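/- Let γ ∈ F(−1,1). Then the truncated bilinear Hilbert transform along the curve (t, γ(t)) is bounded from L²(ℝ)×L²(ℝ) to L¹(ℝ): there exists a constant C > 0 (depending only on γ) such that for all Schwartz functions f, g on ℝ and every 0 < ε < 1, ‖x ↦ ∫_{ε<|t|<1} f(x−t) g(x−γ(t)) t^{−1} dt‖_{L¹(ℝ)} ≤ C ‖f‖_{L²(ℝ)} ‖g‖_{L²(ℝ)}. In particular the principal value H_Γ(f,g)(x) = p.v. ∫_{−1}^{1} f(x−t) g(x−γ(t)) t^{−1} dt defines (by density) a bounded bilinear operator from L²(ℝ)×L²(ℝ) to L¹(ℝ). -/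

import Mathlib

open MeasureTheory Real Set

noncomputable section

/-- `Qc γ ε t = γ(εt)/(ε γ'(ε))`. -/
def Qc (γ : ℝ → ℝ) (ε t : ℝ) : ℝ := γ (ε * t) / (ε * deriv γ ε)

/-- `Δc γ j = |2^{-j} γ'(2^{-j})|⁻¹`. -/
def Δc (γ : ℝ → ℝ) (j : ℤ) : ℝ := |(2:ℝ) ^ (-j) * deriv γ ((2:ℝ) ^ (-j))|⁻¹

/-- Branch (a) of the class F(-1,1). -/
def BranchA (γ : ℝ → ℝ) (c₀ c₁ c₂ K₁ : ℝ) : Prop :=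
  (∀ ε : ℝ, 0 < |ε| → |ε| < c₀ → |deriv γ ε| ≤ K₁ * |ε| ^ c₁) ∧
  ∀ ε t : ℝ, 0 < |ε| → |ε| < c₀ → 1/4 ≤ |t| → |t| ≤ 4 →
    c₂ ≤ |(iteratedDeriv 2 (Qc γ ε) t) ^ 2 -
          iteratedDeriv 1 (Qc γ ε) t * iteratedDeriv 3 (Qc γ ε) t|

/-- Branch (b) of the class F(-1,1). -/
def BranchB (γ : ℝ → ℝ) (c₀ c₁ c₃ K₂ : ℝ) : Prop :=
  (∀ ε : ℝ, 0 < |ε| → |ε| < c₀ → K₂ * |ε| ^ (-c₁) ≤ |deriv γ ε|) ∧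
  ∀ ε t : ℝ, 0 < |ε| → |ε| < c₀ → 1/4 ≤ |t| → |t| ≤ 4 →
    c₃ ≤ |2 * (iteratedDeriv 2 (Qc γ ε) t) ^ 2 -
          iteratedDeriv 1 (Qc γ ε) t * iteratedDeriv 3 (Qc γ ε) t|

/-- The class F(-1,1) of curves, with explicit constants. -/
structure MemF (γ : ℝ → ℝ) (A₁ c₀ c₁ c₂ c₃ C₁ K₁ K₂ : ℝ) (N : ℕ) : Prop where
  hA₁0 : 0 < A₁
  hA₁ : A₁ < 1/2
  hc₀0 : 0 < c₀
  hc₀ : c₀ < A₁ / 4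
  hc₁ : 0 < c₁
  hc₂ : 0 < c₂
  hc₃ : 0 < c₃
  hC₁ : 0 < C₁
  hK₁ : 0 < K₁
  hK₂ : 0 < K₂
  hN : 5 ≤ N
  smooth : ContDiffOn ℝ N γ (Ioo (-A₁) A₁ \ {0})
  deriv_ne : ∀ t ∈ Ioo (-A₁) A₁ \ {0}, deriv γ t ≠ 0
  derivBound : ∀ ε t : ℝ, 0 < |ε| → |ε| < c₀ → 1/4 ≤ |t| → |t| ≤ 4 →
    ∀ k : ℕ, k ≤ N → |iteratedDeriv k (Qc γ ε) t| ≤ C₁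
  secondDeriv : ∀ ε t : ℝ, 0 < |ε| → |ε| < c₀ → 1/4 ≤ |t| → |t| ≤ 4 →
    c₁ ≤ |iteratedDeriv 2 (Qc γ ε) t|
  branch : BranchA γ c₀ c₁ c₂ K₁ ∨ BranchB γ c₀ c₁ c₃ K₂
  dyadic : (∀ ε : ℝ, 0 < ε → ε < c₀ → deriv (deriv γ) ε * deriv γ ε < 0) →
    ∃ (K₃ : ℤ) (K₄ : ℕ), ∀ j : ℤ, (K₄ : ℤ) ≤ j → 2 * Δc γ j ≤ Δc γ (j + K₃)

open scoped ComplexConjugate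
open Finset (sum_congr mul_sum sum_sub_distrib sum_range_succ sum_le_sum sum_add_distrib
  sum_mul sum_nonneg)
open Complex (norm_real normSq_eq_norm_sq real_smul)
open Function (uncurry)
open ENNReal (ofReal ofReal_mul ofReal_le_ofReal ofReal_pow ofReal_ne_top ofReal_add ofReal_lt_top)

theorem contDiffOn_one_of_hasDerivAt {u u' : ℝ → ℝ} {U : Set ℝ} (hU : IsOpen U)
    (hu : ∀ s ∈ U, HasDerivAt u (u' s) s) (hcont : ContinuousOn u' U) : ContDiffOn ℝ 1 u U := by
  rw [show (1 : WithTop ℕ∞) = 0 + 1 from (zero_add 1).symm, contDiffOn_succ_iff_deriv_of_isOpen hU]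
  refine ⟨fun s hs => (hu s hs).differentiableAt.differentiableWithinAt, by simp, ?_⟩
  rw [contDiffOn_zero]
  exact hcont.congr fun s hs => (hu s hs).deriv

/-- `φ` is `C¹` on `Ω`, with `φ` and its derivative bounded by `K` there. -/
structure BddC1 {E : Type*} [NormedAddCommGroup E] [NormedSpace ℝ E]
    (Ω : Set E) (K : ℝ) (φ : E → ℝ) : Prop where
  nonneg : 0 ≤ K
  contDiffOn : ContDiffOn ℝ 1 φ Ω
  bound : ∀ p ∈ Ω, |φ p| ≤ K
  fderiv_bound : ∀ p ∈ Ω, ‖fderiv ℝ φ p‖ ≤ K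

namespace BddC1

variable {E : Type*} [NormedAddCommGroup E] [NormedSpace ℝ E] {Ω : Set E} {K L : ℝ} {φ ψ : E → ℝ}

theorem differentiableAt (h : BddC1 Ω K φ) (hΩ : IsOpen Ω) {p : E} (hp : p ∈ Ω) :
    DifferentiableAt ℝ φ p :=
  (h.contDiffOn.differentiableOn one_ne_zero).differentiableAt (hΩ.mem_nhds hp)

theorem mono (h : BddC1 Ω K φ) (hKL : K ≤ L) : BddC1 Ω L φ :=
  ⟨h.nonneg.trans hKL, h.contDiffOn, fun p hp => (h.bound p hp).trans hKL,
    fun p hp => (h.fderiv_bound p hp).trans hKL⟩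

theorem sub (hΩ : IsOpen Ω) (h : BddC1 Ω K φ) (h' : BddC1 Ω L ψ) :
    BddC1 Ω (K + L) (fun p => φ p - ψ p) := by
  refine ⟨add_nonneg h.nonneg h'.nonneg, h.contDiffOn.sub h'.contDiffOn, fun p hp =>
    (abs_sub _ _).trans (add_le_add (h.bound p hp) (h'.bound p hp)), fun p hp => ?_⟩
  rw [fderiv_fun_sub (h.differentiableAt hΩ hp) (h'.differentiableAt hΩ hp)]
  exact (norm_sub_le _ _).trans (add_le_add (h.fderiv_bound p hp) (h'.fderiv_bound p hp))

theorem mul (hΩ : IsOpen Ω) (h : BddC1 Ω K φ) (h' : BddC1 Ω L ψ) :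
    BddC1 Ω (2 * (K * L)) (fun p => φ p * ψ p) := by
  have hKL := mul_nonneg h.nonneg h'.nonneg
  refine ⟨by positivity, h.contDiffOn.mul h'.contDiffOn, fun p hp => ?_, fun p hp => ?_⟩
  · rw [abs_mul]
    have := mul_le_mul (h.bound p hp) (h'.bound p hp) (abs_nonneg _) h.nonneg
    linarith
  · rw [fderiv_fun_mul (h.differentiableAt hΩ hp) (h'.differentiableAt hΩ hp)]
    refine (norm_add_le _ _).trans ?_
    rw [norm_smul, norm_smul]
    have h1 := mul_le_mul (h.bound p hp) (h'.fderiv_bound p hp) (norm_nonneg _) h.nonneg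
    have h2 := mul_le_mul (h'.bound p hp) (h.fderiv_bound p hp) (norm_nonneg _) h'.nonneg
    rw [norm_eq_abs, norm_eq_abs]
    linarith

theorem const (c : ℝ) : BddC1 Ω |c| (fun _ => c) :=
  ⟨abs_nonneg _, contDiffOn_const, fun _ _ => le_rfl, fun p _ => by simp⟩

/-- Composition with a function of one real variable. -/
theorem comp (hΩ : IsOpen Ω) (hφ : ContDiffOn ℝ 1 φ Ω) (hb : ∀ p ∈ Ω, ‖fderiv ℝ φ p‖ ≤ K)
    {u u' : ℝ → ℝ} {U : Set ℝ} (hU : IsOpen U) (hmaps : MapsTo φ Ω U) (hL : 0 ≤ L)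
    (hu : ∀ s ∈ U, HasDerivAt u (u' s) s) (hcont : ContinuousOn u' U)
    (hu0 : ∀ s ∈ U, |u s| ≤ L) (hu1 : ∀ s ∈ U, |u' s| ≤ L) (hK : 1 ≤ K) :
    BddC1 Ω (L * K) (fun p => u (φ p)) := by
  refine ⟨by positivity, (contDiffOn_one_of_hasDerivAt hU hu hcont).comp hφ hmaps,
    fun p hp => (hu0 _ (hmaps hp)).trans
    (le_mul_of_one_le_right hL hK), fun p hp => ?_⟩
  have hd : DifferentiableAt ℝ φ p :=
    (hφ.differentiableOn one_ne_zero).differentiableAt (hΩ.mem_nhds hp)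
  have := (hu _ (hmaps hp)).comp_hasFDerivAt p hd.hasFDerivAt
  have h2 : fderiv ℝ (fun p => u (φ p)) p = u' (φ p) • fderiv ℝ φ p := this.fderiv
  rw [h2, norm_smul]
  exact mul_le_mul (hu1 _ (hmaps hp)) (hb p hp) (norm_nonneg _) hL

end BddC1

/-- The integral of a directional derivative of a compactly supported `C¹` function vanishes. -/
theorem integral_fderiv_apply_eq_zero {E : Type*} [NormedAddCommGroup E] [NormedSpace ℝ E]
    [FiniteDimensional ℝ E] [MeasurableSpace E] [BorelSpace E] (μ : Measure E)
    [μ.IsAddHaarMeasure] {φ : E → ℂ} (hφ : ContDiff ℝ 1 φ) (hc : HasCompactSupport φ) (v : E) :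
    ∫ p, fderiv ℝ φ p v ∂μ = 0 := by
  have hcont : Continuous fun p => fderiv ℝ φ p v :=
    (hφ.continuous_fderiv one_ne_zero).clm_apply continuous_const
  have hintg : Integrable (fun p => fderiv ℝ φ p v) μ :=
    hcont.integrable_of_hasCompactSupport (hc.fderiv_apply ℝ v)
  have h := integral_bilinear_hasLineDerivAt_right_eq_neg_left_of_integrable (μ := μ)
    (f := fun _ : E => (1:ℂ)) (f' := fun _ => 0) (g := φ) (g' := fun p => fderiv ℝ φ p v) (v := v)
    (B := ContinuousLinearMap.mul ℝ ℂ) (by simp) (by simpa using hintg)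
    (by simpa using hφ.continuous.integrable_of_hasCompactSupport hc)
    (fun p _ => by simpa using (hasFDerivAt_const (1:ℂ) p).hasLineDerivAt v)
    (fun p _ => ((hφ.differentiable one_ne_zero).differentiableAt.hasFDerivAt.hasLineDerivAt v))
  simpa using h

/-- A curve with three derivatives on an interval, satisfying the nondegeneracy conditions needed
for the smoothing estimate. -/
structure SmoothingCurve (K l r : ℝ) (q q₁ q₂ q₃ : ℝ → ℝ) : Prop where
  one_le : 1 ≤ K
  length : r - l ≤ K
  deriv0 : ∀ t ∈ Ioo l r, HasDerivAt q (q₁ t) t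
  deriv1 : ∀ t ∈ Ioo l r, HasDerivAt q₁ (q₂ t) t
  deriv2 : ∀ t ∈ Ioo l r, HasDerivAt q₂ (q₃ t) t
  bound0 : ∀ t ∈ Ioo l r, |q t| ≤ K
  bound1 : ∀ t ∈ Ioo l r, |q₁ t| ≤ K
  bound2 : ∀ t ∈ Ioo l r, |q₂ t| ≤ K
  lower1 : ∀ t ∈ Ioo l r, K⁻¹ ≤ |q₁ t|
  lower2 : ∀ t ∈ Ioo l r, K⁻¹ ≤ |q₂ t ^ 2 - q₁ t * q₃ t|

/-- A `C¹` amplitude supported compactly in an interval. -/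
structure Amplitude (K l r : ℝ) (ζ ζ' : ℝ → ℝ) : Prop where
  hasDeriv : ∀ t, HasDerivAt ζ (ζ' t) t
  cont : Continuous ζ'
  bound0 : ∀ t, |ζ t| ≤ K
  bound1 : ∀ t, |ζ' t| ≤ K
  compact : HasCompactSupport ζ
  supp : tsupport ζ ⊆ Ioo l r

@[fun_prop]
theorem measurable_indicator_Ioo (a b : ℝ) :
    Measurable ((Ioo a b).indicator (1 : ℝ → ENNReal)) :=
  measurable_one.indicator measurableSet_Ioo

@[fun_prop]
theorem measurable_indicator_Icc (a b : ℝ) :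
    Measurable ((Icc a b).indicator (1 : ℝ → ENNReal)) :=
  measurable_one.indicator measurableSet_Icc

theorem contDiff_of_forall_tsupport {E F : Type*} [NormedAddCommGroup E] [NormedSpace ℝ E]
    [NormedAddCommGroup F] [NormedSpace ℝ F] {f : E → F} {n : WithTop ℕ∞}
    (h : ∀ p ∈ tsupport f, ContDiffAt ℝ n f p) : ContDiff ℝ n f := by
  rw [contDiff_iff_contDiffAt]
  intro p
  by_cases hp : p ∈ tsupport f
  · exact h p hp
  · exact contDiffAt_const.congr_of_eventuallyEq (notMem_tsupport_iff_eventuallyEq.1 hp)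

/-- Integration by parts against a compactly supported vector field. -/
theorem enorm_integral_fderiv_le {E : Type*} [NormedAddCommGroup E] [NormedSpace ℝ E]
    [FiniteDimensional ℝ E] [MeasurableSpace E] [BorelSpace E] (μ : Measure E)
    [μ.IsAddHaarMeasure] {ι : Type*} [Fintype ι] (e : ι → E) {V : ι → E → ℝ} {P : E → ℂ}
    {Ω : Set E} (hΩ : IsOpen Ω) (hV : ∀ i, ContDiffOn ℝ 1 (V i) Ω) (hP : ContDiffOn ℝ 1 P Ω)
    (hc : ∀ i, HasCompactSupport (V i)) (hs : ∀ i, tsupport (V i) ⊆ Ω) :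
    ‖∫ p, fderiv ℝ P p (∑ i, V i p • e i) ∂μ‖ₑ ≤
      ∫⁻ p, ‖(∑ i, fderiv ℝ (V i) p (e i)) • P p‖ₑ ∂μ := by
  have hV' : ∀ i, ContDiff ℝ 1 (V i) := fun i => contDiff_of_forall_tsupport fun p hp =>
    (hV i).contDiffAt (hΩ.mem_nhds (hs i hp))
  set Φ : ι → E → ℂ := fun i p => V i p • P p with hΦ
  have hΦs : ∀ i, tsupport (Φ i) ⊆ tsupport (V i) := fun i => closure_mono fun p hp h => hp (by
    simp only [hΦ]; rw [h, zero_smul])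
  have hΦc : ∀ i, HasCompactSupport (Φ i) := fun i =>
      (hc i).of_isClosed_subset isClosed_closure (hΦs i)
  have hΦ1 : ∀ i, ContDiff ℝ 1 (Φ i) := fun i => contDiff_of_forall_tsupport fun p hp =>
    ((hV i).contDiffAt (hΩ.mem_nhds (hs i (hΦs i hp)))).smul
      (hP.contDiffAt (hΩ.mem_nhds (hs i (hΦs i hp))))
  have hintg : ∀ i, Integrable (fun p => fderiv ℝ (Φ i) p (e i)) μ := fun i =>
    (((hΦ1 i).continuous_fderiv one_ne_zero).clm_apply
      continuous_const).integrable_of_hasCompactSupport ((hΦc i).fderiv_apply ℝ (e i))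
  have hint2 : ∀ i, Integrable (fun p => (fderiv ℝ (V i) p (e i)) • P p) μ := fun i => by
    have hsub : tsupport (fun p => (fderiv ℝ (V i) p (e i)) • P p) ⊆ tsupport (V i) :=
      (tsupport_smul_subset_left _ _).trans (tsupport_fderiv_apply_subset ℝ (e i))
    refine Continuous.integrable_of_hasCompactSupport ?_
      ((hc i).of_isClosed_subset isClosed_closure hsub)
    refine continuous_of_tsupport fun p hp => ?_
    exact (((hV' i).continuous_fderiv one_ne_zero).clm_apply continuous_const).continuousAt.smul
      (hP.contDiffAt (hΩ.mem_nhds (hs i (hsub hp)))).continuousAt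
  have key : ∀ p, fderiv ℝ P p (∑ i, V i p • e i) =
      (∑ i, fderiv ℝ (Φ i) p (e i)) - (∑ i, fderiv ℝ (V i) p (e i)) • P p := by
    intro p
    rw [map_sum, Finset.sum_smul, ← sum_sub_distrib]
    refine sum_congr rfl fun i _ => ?_
    by_cases hp : p ∈ tsupport (V i)
    · have hpΩ := hΩ.mem_nhds (hs i hp)
      have hd := ((hP.contDiffAt hpΩ).differentiableAt one_ne_zero)
      have hd' := ((hV' i).differentiable one_ne_zero) p
      have : fderiv ℝ (Φ i) p = V i p • fderiv ℝ P p + (fderiv ℝ (V i) p).smulRight (P p) :=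
        fderiv_fun_smul hd' hd
      rw [this]
      simp
    · have h1 : V i p = 0 := image_eq_zero_of_notMem_tsupport hp
      have h2 : fderiv ℝ (V i) p = 0 :=
        image_eq_zero_of_notMem_tsupport fun h => hp (tsupport_fderiv_subset ℝ h)
      have h3 : fderiv ℝ (Φ i) p = 0 :=
        image_eq_zero_of_notMem_tsupport fun h => hp (hΦs i (tsupport_fderiv_subset ℝ h))
      simp [h1, h2, h3]
  simp_rw [key]
  have hS : ∀ p, (∑ i, fderiv ℝ (V i) p (e i)) • P p = ∑ i, (fderiv ℝ (V i) p (e i)) • P p :=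
    fun p => Finset.sum_smul
  rw [integral_sub (integrable_finsetSum _ fun i _ => hintg i)
    (by simp_rw [hS]; exact integrable_finsetSum _ fun i _ => hint2 i),
    integral_finsetSum _ fun i _ => hintg i,
    Finset.sum_eq_zero fun i _ => integral_fderiv_apply_eq_zero μ (hΦ1 i) (hΦc i) (e i), zero_sub,
    enorm_neg]
  exact enorm_integral_le_lintegral_enorm _

/-- A Cauchy–Schwarz inequality for lower integrals. -/
theorem sq_lintegral_le {α : Type*} [MeasurableSpace α] {μ : Measure α} {b u v : α → ENNReal}
    (hu : AEMeasurable u μ) (hv : AEMeasurable v μ) (h : ∀ᵐ x ∂μ, b x ^ 2 ≤ u x * v x) :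
    (∫⁻ x, b x ∂μ) ^ 2 ≤ (∫⁻ x, u x ∂μ) * ∫⁻ x, v x ∂μ := by
  have hr : ∀ x : ENNReal, (x ^ (1 / 2 : ℝ)) ^ (2 : ℝ) = x := fun x => by
    rw [← ENNReal.rpow_mul]; norm_num
  have h1 : ∫⁻ x, b x ∂μ ≤ ∫⁻ x, (u x) ^ (1 / 2 : ℝ) * (v x) ^ (1 / 2 : ℝ) ∂μ := by
    refine lintegral_mono_ae ?_
    filter_upwards [h] with x hx
    rw [← ENNReal.mul_rpow_of_nonneg _ _ (by norm_num)]
    refine le_trans (le_of_eq ?_) (ENNReal.rpow_le_rpow hx (by norm_num : (0 : ℝ) ≤ 1 / 2))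
    rw [← ENNReal.rpow_natCast, ← ENNReal.rpow_mul]; norm_num
  have h2 := ENNReal.lintegral_mul_le_Lp_mul_Lq μ Real.HolderConjugate.two_two
    (hu.pow_const (1 / 2 : ℝ)) (hv.pow_const (1 / 2 : ℝ))
  simp only [Pi.mul_apply, hr] at h2
  calc _ ≤ ((∫⁻ x, u x ∂μ) ^ (1 / 2 : ℝ) * (∫⁻ x, v x ∂μ) ^ (1 / 2 : ℝ)) ^ 2 := by
        gcongr; exact h1.trans h2
    _ = _ := by
        rw [mul_pow]
        congr 1 <;> rw [← ENNReal.rpow_natCast, ← ENNReal.rpow_mul] <;> norm_num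

theorem sq_lintegral_mul_le {α : Type*} [MeasurableSpace α] {μ : Measure α} {u v : α → ENNReal}
    (hu : AEMeasurable u μ) (hv : AEMeasurable v μ) :
    (∫⁻ x, u x * v x ∂μ) ^ 2 ≤ (∫⁻ x, u x ^ 2 ∂μ) * ∫⁻ x, v x ^ 2 ∂μ :=
  sq_lintegral_le (hu.pow_const 2) (hv.pow_const 2) (.of_forall fun _ => (mul_pow _ _ _).le)

theorem setLIntegral_Icc_eq (φ : ℝ → ENNReal) (L s : ℝ) :
    ∫⁻ y in Icc (s - L) (s + L), φ y =
      ∫⁻ y, (Icc (-L) L).indicator 1 (y - s) * φ y := by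
  rw [← lintegral_indicator measurableSet_Icc]
  refine lintegral_congr fun y => ?_
  by_cases h : y - s ∈ Icc (-L) L
  · have : y ∈ Icc (s - L) (s + L) := ⟨by linarith [h.1], by linarith [h.2]⟩
    simp [h, this]
  · have : y ∉ Icc (s - L) (s + L) := fun h' => h ⟨by linarith [h'.1], by linarith [h'.2]⟩
    simp [h, this]

theorem measurable_setLIntegral_Icc {φ : ℝ → ENNReal} (hφ : Measurable φ) (L : ℝ) :
    Measurable fun s => ∫⁻ y in Icc (s - L) (s + L), φ y := by
  simp_rw [setLIntegral_Icc_eq φ L]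
  exact Measurable.lintegral_prod_right' (f := fun p : ℝ × ℝ =>
    (Icc (-L) L).indicator 1 (p.2 - p.1) * φ p.2) (by fun_prop)

theorem lintegral_setLIntegral_Icc {φ : ℝ → ENNReal} (hφ : Measurable φ) {L : ℝ} :
    ∫⁻ s, ∫⁻ y in Icc (s - L) (s + L), φ y = ofReal (2 * L) * ∫⁻ y, φ y := by
  simp_rw [setLIntegral_Icc_eq φ L]
  rw [lintegral_lintegral_swap (by fun_prop)]
  simp_rw [fun y => lintegral_mul_const (μ := volume) (φ y)
    (f := fun s => (Icc (-L) L).indicator (1 : ℝ → ENNReal) (y - s)) (by fun_prop)]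
  rw [← lintegral_const_mul _ hφ]
  refine lintegral_congr fun y => ?_
  rw [lintegral_sub_left_eq_self (fun s => (Icc (-L) L).indicator (1 : ℝ → ENNReal) s) y,
    lintegral_indicator_one measurableSet_Icc, volume_Icc]
  congr 2; ring

theorem lintegral_translate_mul_le {g h : ℝ → ENNReal} (hg : Measurable g) (hh : Measurable h)
    (a b : ℝ) :
    (∫⁻ x, g (x - a) * h (x - b)) ^ 2 ≤ (∫⁻ x, g x ^ 2) * ∫⁻ x, h x ^ 2 := by
  refine (sq_lintegral_mul_le (u := fun x => g (x - a)) (v := fun x => h (x - b))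
    (by fun_prop) (by fun_prop)).trans (le_of_eq ?_)
  rw [lintegral_sub_right_eq_self (fun x => g x ^ 2),
    lintegral_sub_right_eq_self (fun x => h x ^ 2)]

theorem ENNReal.le_of_sq_le_sq {a b : ENNReal} (h : a ^ 2 ≤ b ^ 2) : a ≤ b :=
  (ENNReal.pow_le_pow_left_iff two_ne_zero).1 h

namespace Smoothing

/-- The four-dimensional space with coordinates `(x, τ, t, t')`. -/
abbrev E4 : Type := ℝ × ℝ × ℝ × ℝ

/-- The region where all the curve parameters lie in the interval. -/
def region (l r : ℝ) : Set E4 :=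
  {p | p.2.2.1 ∈ Ioo l r ∧ p.2.2.2 ∈ Ioo l r ∧ p.2.2.1 + p.2.1 ∈ Ioo l r ∧
    p.2.2.2 + p.2.1 ∈ Ioo l r}

theorem isOpen_region (l r : ℝ) : IsOpen (region l r) := by
  refine (isOpen_Ioo.preimage (f := fun p : E4 => p.2.2.1) (by fun_prop)).inter
    ((isOpen_Ioo.preimage (f := fun p : E4 => p.2.2.2) (by fun_prop)).inter
    ((isOpen_Ioo.preimage (f := fun p : E4 => p.2.2.1 + p.2.1) (by fun_prop)).inter
    (isOpen_Ioo.preimage (f := fun p : E4 => p.2.2.2 + p.2.1) (by fun_prop))))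

/-- The `τ` component of the vector field. -/
def tauComp (A : ℝ) (q₁ : ℝ → ℝ) (p : E4) : ℝ :=
  (q₁ (p.2.2.2 + p.2.1) * (q₁ p.2.2.2)⁻¹ - 1) * (A - q₁ (p.2.2.2 + p.2.1))⁻¹

/-- The derivative along the vector field of the remaining moving point. -/
def speed (A : ℝ) (q₁ : ℝ → ℝ) (p : E4) : ℝ :=
  (q₁ (p.2.2.2 + p.2.1) * (q₁ p.2.2.2)⁻¹ - q₁ (p.2.2.1 + p.2.1) * (q₁ p.2.2.1)⁻¹) -
    tauComp A q₁ p * (q₁ (p.2.2.1 + p.2.1) - q₁ (p.2.2.2 + p.2.1))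

def cutoff (w ζ : ℝ → ℝ) (s : ℝ) (p : E4) : ℝ :=
  w (p.1 - s) * (p.2.1 * p.2.1) * (ζ p.2.2.1 * ζ p.2.2.2) *
    (ζ (p.2.2.1 + p.2.1) * ζ (p.2.2.2 + p.2.1))

def regInv (ε d : ℝ) : ℝ := d / (d ^ 2 + ε ^ 2)

theorem hasDerivAt_regInv {ε : ℝ} (hε : 0 < ε) (d : ℝ) :
    HasDerivAt (regInv ε) ((ε ^ 2 - d ^ 2) / (d ^ 2 + ε ^ 2) ^ 2) d := by
  have h : d ^ 2 + ε ^ 2 ≠ 0 := by positivity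
  have := (hasDerivAt_id d).fun_div (((hasDerivAt_id d).fun_pow 2).add_const (ε ^ 2)) h
  refine this.congr_deriv ?_
  simp only [id, Nat.cast_ofNat]
  ring

theorem abs_regInv_le {ε : ℝ} (hε : 0 < ε) (hε1 : ε ≤ 1) (d : ℝ) : |regInv ε d| ≤ 1 / ε ^ 2 := by
  have h : 0 < d ^ 2 + ε ^ 2 := by positivity
  rw [regInv, abs_div, abs_of_pos h, div_le_div_iff₀ h (by positivity), one_mul]
  have h1 : 2 * (|d| * ε) ≤ d ^ 2 + ε ^ 2 := by
    have := sq_nonneg (|d| - ε)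
    rw [← sq_abs d]; linarith
  have : |d| * ε ^ 2 ≤ |d| * ε := by
    apply mul_le_mul_of_nonneg_left _ (abs_nonneg d); nlinarith
  have : 0 ≤ |d| * ε := by positivity
  linarith

theorem abs_deriv_regInv_le {ε : ℝ} (hε : 0 < ε) (d : ℝ) :
    |(ε ^ 2 - d ^ 2) / (d ^ 2 + ε ^ 2) ^ 2| ≤ 1 / ε ^ 2 := by
  have h : 0 < d ^ 2 + ε ^ 2 := by positivity
  rw [abs_div, abs_of_pos (pow_pos h 2), div_le_div_iff₀ (by positivity) (by positivity), one_mul]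
  have h1 : |ε ^ 2 - d ^ 2| ≤ d ^ 2 + ε ^ 2 := by
    rw [abs_le]; constructor <;> nlinarith [sq_nonneg d, sq_nonneg ε]
  calc _ ≤ (d ^ 2 + ε ^ 2) * (d ^ 2 + ε ^ 2) :=
        mul_le_mul h1 (by nlinarith [sq_nonneg d]) (by positivity) h.le
    _ = _ := by ring

/-- Coordinate functionals have derivative of norm at most two. -/
theorem bddC1_comp_linear {Ω : Set E4} (hΩ : IsOpen Ω) {L : ℝ} (ℓ : E4 →L[ℝ] ℝ) (s : ℝ)
    (hℓ : ∀ p, |ℓ p| ≤ 2 * ‖p‖) {u u' : ℝ → ℝ} {U : Set ℝ} (hU : IsOpen U)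
    (hmaps : ∀ p ∈ Ω, ℓ p - s ∈ U) (hL : 0 ≤ L)
    (hu : ∀ s ∈ U, HasDerivAt u (u' s) s) (hcont : ContinuousOn u' U)
    (hu0 : ∀ s ∈ U, |u s| ≤ L) (hu1 : ∀ s ∈ U, |u' s| ≤ L) :
    BddC1 Ω (L * 2) (fun p => u (ℓ p - s)) := by
  refine BddC1.comp (φ := fun p => ℓ p - s) hΩ (ℓ.contDiff.sub contDiff_const).contDiffOn
    (fun p _ => ?_) hU hmaps hL hu hcont hu0 hu1 one_le_two
  rw [fderiv_sub_const, ℓ.fderiv]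
  exact ℓ.opNorm_le_bound zero_le_two hℓ

def ℓx : E4 →L[ℝ] ℝ := ContinuousLinearMap.fst ℝ ℝ _
def ℓτ : E4 →L[ℝ] ℝ := (ContinuousLinearMap.fst ℝ ℝ _).comp (ContinuousLinearMap.snd ℝ ℝ _)
def ℓt : E4 →L[ℝ] ℝ := (ContinuousLinearMap.fst ℝ ℝ _).comp
  ((ContinuousLinearMap.snd ℝ ℝ _).comp (ContinuousLinearMap.snd ℝ ℝ _))
def ℓt' : E4 →L[ℝ] ℝ := (ContinuousLinearMap.snd ℝ ℝ _).comp
  ((ContinuousLinearMap.snd ℝ ℝ _).comp (ContinuousLinearMap.snd ℝ ℝ _))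

theorem abs_coords_le (p : E4) :
    |p.1| ≤ ‖p‖ ∧ |p.2.1| ≤ ‖p‖ ∧ |p.2.2.1| ≤ ‖p‖ ∧ |p.2.2.2| ≤ ‖p‖ := by
  have h := norm_snd_le p
  have h' := norm_snd_le p.2
  exact ⟨norm_fst_le p, (norm_fst_le p.2).trans h, (norm_fst_le p.2.2).trans (h'.trans h),
    (norm_snd_le p.2.2).trans (h'.trans h)⟩

variable {K l r A s : ℝ} {q q₁ q₂ q₃ w w' ζ ζ' : ℝ → ℝ}

local notation "𝓢q" => SmoothingCurve K l r q q₁ q₂ q₃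

theorem abs_tau_le (hq : 𝓢q) {p : E4} (hp : p ∈ region l r) :
    |p.2.1| ≤ K := by
  obtain ⟨h1, h2, h3, h4⟩ := hp
  have := hq.length
  rw [abs_le]; constructor <;> linarith [h1.1, h1.2, h3.1, h3.2]

theorem le_abs_sub (hq : 𝓢q) (hA : 4 * K ^ 8 ≤ A) {t : ℝ}
    (ht : t ∈ Ioo l r) : A / 2 ≤ A - q₁ t ∧ 1 ≤ A - q₁ t := by
  have h1 := hq.one_le
  have h2 := (abs_le.1 (hq.bound1 t ht)).2
  have h3 : K ≤ K ^ 8 := le_self_pow₀ h1 (by norm_num)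
  constructor <;> linarith

theorem curve_ne_zero (hq : 𝓢q) {t : ℝ} (ht : t ∈ Ioo l r) :
    q₁ t ≠ 0 := fun h0 => by
  have := hq.lower1 t ht
  have hK := hq.one_le
  rw [h0, abs_zero] at this
  have : 0 < K⁻¹ := by positivity
  linarith

theorem abs_inv_curve_le (hq : 𝓢q) {t : ℝ} (ht : t ∈ Ioo l r) :
    |(q₁ t)⁻¹| ≤ K := by
  rw [abs_inv]
  exact inv_le_of_inv_le₀ (by linarith [hq.one_le]) (hq.lower1 t ht)

/-- Uniform bounds for the elementary building blocks. -/
theorem exists_bddC1_blocks (K : ℝ) : ∃ C, 1 ≤ C ∧ ∀ {l r A s : ℝ} {q q₁ q₂ q₃ w w' ζ ζ' : ℝ → ℝ},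
    SmoothingCurve K l r q q₁ q₂ q₃ → Amplitude K l r ζ ζ' → (∀ t, HasDerivAt w (w' t) t) →
    Continuous w' → (∀ t, |w t| ≤ K) → (∀ t, |w' t| ≤ K) → 4 * K ^ 8 ≤ A →
    BddC1 (region l r) C (cutoff w ζ s) ∧ BddC1 (region l r) C (speed A q₁) ∧
    BddC1 (region l r) C (tauComp A q₁) ∧
    BddC1 (region l r) C (fun p => (q₁ p.2.2.1)⁻¹) ∧
    BddC1 (region l r) C (fun p => (q₁ p.2.2.2)⁻¹) := by
  let Z := 2 * (K * 2 * (K * 2))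
  let Q := 2 * (K * 2 * (K ^ 3 * 2))
  let T := 2 * ((Q + |1|) * (K * 2))
  let S := Q + Q + 2 * (T * (K * 2 + K * 2))
  let C := 2 * (2 * (2 * (K * 2 * (2 * (2 * K * 2 * (2 * K * 2)))) * Z) * Z)
  have h1 := abs_nonneg C
  have h2 := abs_nonneg S
  have h3 := abs_nonneg T
  have h4 := abs_nonneg (K ^ 3 * 2)
  refine ⟨1 + |C| + |S| + |T| + |K ^ 3 * 2|, by linarith, fun {l r A s q q₁ q₂ q₃ w w' ζ ζ'}
    hq hζ hw hw' hwb hwb' hA => ?_⟩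
  have hK := hq.one_le
  have hK0 : 0 ≤ K := by linarith
  have hΩ := isOpen_region l r
  have hc2 : ContinuousOn q₂ (Ioo l r) := fun t ht =>
      (hq.deriv2 t ht).continuousAt.continuousWithinAt
  have hc1 : ContinuousOn q₁ (Ioo l r) := fun t ht =>
      (hq.deriv1 t ht).continuousAt.continuousWithinAt
  have hne : ∀ t ∈ Ioo l r, q₁ t ≠ 0 := fun t ht => curve_ne_zero hq ht
  have hinv : ∀ t ∈ Ioo l r, |(q₁ t)⁻¹| ≤ K := fun t ht => abs_inv_curve_le hq ht
  have hKK : K ≤ K ^ 3 := le_self_pow₀ hK (by norm_num)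
  have hℓ (p : E4) : |ℓx p| ≤ 2 * ‖p‖ ∧ |ℓτ p| ≤ 2 * ‖p‖ ∧ |ℓt p| ≤ 2 * ‖p‖ ∧ |ℓt' p| ≤ 2 * ‖p‖ ∧
      |(ℓt + ℓτ) p| ≤ 2 * ‖p‖ ∧ |(ℓt' + ℓτ) p| ≤ 2 * ‖p‖ := by
    change |p.1| ≤ _ ∧ |p.2.1| ≤ _ ∧ |p.2.2.1| ≤ _ ∧ |p.2.2.2| ≤ _ ∧ |p.2.2.1 + p.2.1| ≤ _ ∧
      |p.2.2.2 + p.2.1| ≤ _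
    obtain ⟨h0, h1, h2, h3⟩ := abs_coords_le p
    have := abs_add_le p.2.2.1 p.2.1
    have := abs_add_le p.2.2.2 p.2.1
    have := norm_nonneg p
    refine ⟨?_, ?_, ?_, ?_, ?_, ?_⟩ <;> linarith
  have i1 : ∀ t ∈ Ioo l r, HasDerivAt (fun t => (q₁ t)⁻¹) (-q₂ t / q₁ t ^ 2) t := fun t ht =>
    (hq.deriv1 t ht).fun_inv (hne t ht)
  have i2 : ContinuousOn (fun t => -q₂ t / q₁ t ^ 2) (Ioo l r) :=
    hc2.neg.div (hc1.pow 2) fun t ht => pow_ne_zero 2 (hne t ht)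
  have i3 : ∀ t ∈ Ioo l r, |-q₂ t / q₁ t ^ 2| ≤ K ^ 3 := fun t ht => by
    rw [div_eq_mul_inv, ← inv_pow, abs_mul, abs_neg, abs_pow]
    calc |q₂ t| * |(q₁ t)⁻¹| ^ 2 ≤ K * K ^ 2 := mul_le_mul (hq.bound2 t ht)
          (pow_le_pow_left₀ (abs_nonneg _) (hinv t ht) 2) (by positivity) hK0
      _ = K ^ 3 := by ring
  have bq (ℓ : E4 →L[ℝ] ℝ) (h : ∀ p, |ℓ p| ≤ 2 * ‖p‖) (hm : ∀ p ∈ region l r, ℓ p ∈ Ioo l r) :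
      BddC1 (region l r) (K * 2) (fun p => q₁ (ℓ p)) := by
    simpa using bddC1_comp_linear hΩ ℓ 0 h isOpen_Ioo (by simpa using hm) hK0
      hq.deriv1 hc2 hq.bound1 hq.bound2
  have bi (ℓ : E4 →L[ℝ] ℝ) (h : ∀ p, |ℓ p| ≤ 2 * ‖p‖) (hm : ∀ p ∈ region l r, ℓ p ∈ Ioo l r) :
      BddC1 (region l r) (K ^ 3 * 2) (fun p => (q₁ (ℓ p))⁻¹) := by
    simpa using bddC1_comp_linear hΩ ℓ 0 h isOpen_Ioo (by simpa using hm)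
      (by positivity) i1 i2 (fun t ht => (hinv t ht).trans hKK) i3
  have bs := bq (ℓt + ℓτ) (fun p => (hℓ p).2.2.2.2.1) fun p hp => hp.2.2.1
  have bs' := bq (ℓt' + ℓτ) (fun p => (hℓ p).2.2.2.2.2) fun p hp => hp.2.2.2
  have bit := bi ℓt (fun p => (hℓ p).2.2.1) fun p hp => hp.1
  have bit' := bi ℓt' (fun p => (hℓ p).2.2.2.1) fun p hp => hp.2.1
  have bA : BddC1 (region l r) (K * 2) (fun p => (A - q₁ ((ℓt' + ℓτ) p))⁻¹) := by
    have hpos : ∀ t ∈ Ioo l r, 1 ≤ A - q₁ t := fun t ht => (le_abs_sub hq hA ht).2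
    simpa using bddC1_comp_linear hΩ (ℓt' + ℓτ) 0 (fun p => (hℓ p).2.2.2.2.2) isOpen_Ioo
      (u := fun t => (A - q₁ t)⁻¹) (u' := fun t => - (-q₂ t) / (A - q₁ t) ^ 2)
      (fun p hp => by simpa [ℓt', ℓτ] using hp.2.2.2) hK0
      (fun t ht => ((hq.deriv1 t ht).const_sub A).fun_inv (by linarith [hpos t ht]))
      (hc2.neg.neg.div ((continuousOn_const.sub hc1).pow 2) fun t ht =>
        pow_ne_zero 2 (by linarith [hpos t ht]))
      (fun t ht => by
        rw [abs_inv, abs_of_pos (by linarith [hpos t ht])]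
        exact (inv_le_one_of_one_le₀ (hpos t ht)).trans hK)
      (fun t ht => by
        rw [neg_neg, abs_div, abs_pow, abs_of_pos (a := A - q₁ t) (by linarith [hpos t ht])]
        exact (div_le_self (abs_nonneg _) (one_le_pow₀ (hpos t ht))).trans (hq.bound2 t ht))
  have bτ : BddC1 (region l r) (2 * K * 2) (fun p => ℓτ p) := by
    simpa using bddC1_comp_linear hΩ ℓτ 0 (fun p => (hℓ p).2.1)
      (isOpen_Ioo (a := -(2 * K)) (b := 2 * K)) (u := id) (u' := fun _ => 1) (fun p hp => by
        have h := abs_le.1 (abs_tau_le hq hp)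
        rw [sub_zero]
        exact ⟨(by linarith : -(2 * K) < p.2.1), (by linarith : p.2.1 < 2 * K)⟩)
      (by positivity) (fun t _ => hasDerivAt_id t) continuousOn_const
      (fun t ht => abs_le.2 ⟨ht.1.le, ht.2.le⟩) (fun t ht => by rw [abs_one]; linarith)
  have bw : BddC1 (region l r) (K * 2) (fun p => w (p.1 - s)) :=
    bddC1_comp_linear hΩ ℓx s (fun p => (hℓ p).1) isOpen_univ (fun _ _ => mem_univ _) hK0
      (fun t _ => hw t) hw'.continuousOn (fun t _ => hwb t) (fun t _ => hwb' t)
  have bz : ∀ ℓ : E4 →L[ℝ] ℝ, (∀ p, |ℓ p| ≤ 2 * ‖p‖) →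
      BddC1 (region l r) (K * 2) (fun p => ζ (ℓ p)) := fun ℓ hℓ => by
    simpa using bddC1_comp_linear hΩ ℓ 0 hℓ isOpen_univ (fun _ _ => mem_univ _) hK0
      (fun t _ => hζ.hasDeriv t) hζ.cont.continuousOn (fun t _ => hζ.bound0 t)
        (fun t _ => hζ.bound1 t)
  have bW : BddC1 (region l r) T (tauComp A q₁) := ((bs'.mul hΩ bit').sub hΩ (.const 1)).mul hΩ bA
  have bC : BddC1 (region l r) C (cutoff w ζ s) :=
    ((bw.mul hΩ (bτ.mul hΩ bτ)).mul hΩ ((bz ℓt fun p => (hℓ p).2.2.1).mul hΩ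
      (bz ℓt' fun p => (hℓ p).2.2.2.1))).mul hΩ ((bz (ℓt + ℓτ) fun p => (hℓ p).2.2.2.2.1).mul hΩ
      (bz (ℓt' + ℓτ) fun p => (hℓ p).2.2.2.2.2))
  have bS : BddC1 (region l r) S (speed A q₁) :=
    ((bs'.mul hΩ bit').sub hΩ (bs.mul hΩ bit)).sub hΩ (bW.mul hΩ (bs.sub hΩ bs'))
  exact ⟨bC.mono (by linarith [le_abs_self C]), bS.mono (by linarith [le_abs_self S]),
    bW.mono (by linarith [le_abs_self T]), bit.mono (by linarith [le_abs_self (K ^ 3 * 2)]),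
    bit'.mono (by linarith [le_abs_self (K ^ 3 * 2)])⟩

/-- The mean value theorem in the form of a two-sided identity, on an interval. -/
theorem exists_slope {u u' : ℝ → ℝ} (hu : ∀ t ∈ Ioo l r, HasDerivAt u (u' t) t) {a b : ℝ}
    (ha : a ∈ Ioo l r) (hb : b ∈ Ioo l r) : ∃ c ∈ uIcc a b, u b - u a = u' c * (b - a) := by
  wlog h : a ≤ b
  · obtain ⟨c, hc, e⟩ := this hu hb ha (le_of_not_ge h)
    exact ⟨c, uIcc_comm a b ▸ hc, by linarith⟩
  obtain rfl | h := h.eq_or_lt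
  · exact ⟨a, left_mem_uIcc, by simp⟩
  have hsub : Icc a b ⊆ Ioo l r := Icc_subset_Ioo ha.1 hb.2
  obtain ⟨c, hc, hc'⟩ := exists_hasDerivAt_eq_slope u u' h
    (fun x hx => (hu x (hsub hx)).continuousAt.continuousWithinAt)
    (fun x hx => hu x (hsub (Ioo_subset_Icc_self hx)))
  refine ⟨c, Icc_subset_uIcc (Ioo_subset_Icc_self hc), ?_⟩
  rw [hc', div_mul_cancel₀]; linarith

theorem uIcc_subset_Ioo {a b : ℝ} (ha : a ∈ Ioo l r) (hb : b ∈ Ioo l r) : uIcc a b ⊆ Ioo l r :=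
  ordConnected_Ioo.uIcc_subset ha hb

theorem abs_q1_sub_le (hq : 𝓢q) {a b : ℝ}
    (ha : a ∈ Ioo l r) (hb : b ∈ Ioo l r) : |q₁ b - q₁ a| ≤ K * |b - a| := by
  obtain ⟨c, hc, h⟩ := exists_slope hq.deriv1 ha hb
  rw [h, abs_mul]
  exact mul_le_mul_of_nonneg_right (hq.bound2 c (uIcc_subset_Ioo ha hb hc)) (abs_nonneg _)

/-- The ratio `q₁(t+τ)/q₁(t)` has `t`-derivative of size at least `|τ|`. -/
theorem le_abs_ratio_sub (hq : 𝓢q) {τ t t' : ℝ}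
    (ht : t ∈ Ioo l r) (ht' : t' ∈ Ioo l r) (hs : t + τ ∈ Ioo l r) (hs' : t' + τ ∈ Ioo l r) :
    (K ^ 5)⁻¹ * (|τ| * |t - t'|) ≤ |q₁ (t' + τ) * (q₁ t')⁻¹ - q₁ (t + τ) * (q₁ t)⁻¹| := by
  have hK := hq.one_le
  have hK0 : 0 < K := by linarith
  have hdom : ∀ c ∈ Ioo (max l (l - τ)) (min r (r - τ)), c ∈ Ioo l r ∧ c + τ ∈ Ioo l r := by
    intro c hc
    have h1 := max_lt_iff.1 hc.1
    have h2 := lt_min_iff.1 hc.2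
    exact ⟨⟨h1.1, h2.1⟩, ⟨by linarith, by linarith⟩⟩
  have hmem : ∀ c, c ∈ Ioo l r → c + τ ∈ Ioo l r → c ∈ Ioo (max l (l - τ)) (min r (r - τ)) := by
    intro c h1 h2
    exact ⟨max_lt h1.1 (by linarith [h2.1]), lt_min h1.2 (by linarith [h2.2])⟩
  have hd : ∀ c ∈ Ioo (max l (l - τ)) (min r (r - τ)),
      HasDerivAt (fun c => q₁ (c + τ) * (q₁ c)⁻¹)
        ((q₁ (c + τ) * (q₁ c)⁻¹) * (q₂ (c + τ) * (q₁ (c + τ))⁻¹ - q₂ c * (q₁ c)⁻¹)) c := by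
    intro c hc
    obtain ⟨h1, h2⟩ := hdom c hc
    have e1 := curve_ne_zero hq h1
    have e2 := curve_ne_zero hq h2
    refine (((hq.deriv1 _ h2).comp_add_const c τ).fun_mul
      ((hq.deriv1 c h1).fun_inv e1)).congr_deriv ?_
    field_simp
    ring
  obtain ⟨ξ, hξ, e⟩ := exists_slope hd (hmem t ht hs) (hmem t' ht' hs')
  obtain ⟨hξ1, hξ2⟩ := hdom ξ (uIcc_subset_Ioo (hmem t ht hs) (hmem t' ht' hs') hξ)
  have hd2 : ∀ c ∈ Ioo l r, HasDerivAt (fun c => q₂ c * (q₁ c)⁻¹)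
      (-(q₂ c ^ 2 - q₁ c * q₃ c) * ((q₁ c)⁻¹) ^ 2) c := by
    intro c hc
    have e1 := curve_ne_zero hq hc
    refine ((hq.deriv2 c hc).fun_mul ((hq.deriv1 c hc).fun_inv e1)).congr_deriv ?_
    field_simp
    ring
  obtain ⟨η, hη, e'⟩ := exists_slope hd2 hξ1 hξ2
  have hη' := uIcc_subset_Ioo hξ1 hξ2 hη
  have low : ∀ c ∈ Ioo l r, K⁻¹ ≤ |(q₁ c)⁻¹| := fun c hc => by
    rw [abs_inv]
    exact inv_anti₀ (abs_pos.2 (curve_ne_zero hq hc)) (hq.bound1 c hc)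
  rw [e, e', add_sub_cancel_left, abs_mul, abs_mul, abs_mul, abs_mul, abs_mul, abs_neg, abs_pow,
    abs_sub_comm t]
  have hKi : 0 ≤ K⁻¹ := by positivity
  have f1 : K⁻¹ * K⁻¹ ≤ |q₁ (ξ + τ)| * |(q₁ ξ)⁻¹| :=
    mul_le_mul (hq.lower1 _ hξ2) (low _ hξ1) hKi (abs_nonneg _)
  have f2 : K⁻¹ * K⁻¹ ^ 2 ≤ |q₂ η ^ 2 - q₁ η * q₃ η| * |(q₁ η)⁻¹| ^ 2 :=
    mul_le_mul (hq.lower2 _ hη') (pow_le_pow_left₀ hKi (low _ hη') 2) (by positivity) (abs_nonneg _)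
  calc (K ^ 5)⁻¹ * (|τ| * |t' - t|) = (K⁻¹ * K⁻¹) * ((K⁻¹ * K⁻¹ ^ 2) * |τ|) * |t' - t| := by
        rw [← inv_pow]; ring
    _ ≤ _ := by gcongr

theorem le_abs_speed (hq : 𝓢q) (hA : 4 * K ^ 8 ≤ A) {p : E4}
    (hp : p ∈ region l r) :
    (2 * K ^ 5)⁻¹ * (|p.2.1| * |p.2.2.1 - p.2.2.2|) ≤ |speed A q₁ p| := by
  obtain ⟨ht, ht', hs, hs'⟩ := hp
  have hK := hq.one_le
  have hK0 : 0 < K := by linarith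
  have h1 := le_abs_ratio_sub hq ht ht' hs hs'
  obtain ⟨hA1, hA2⟩ := le_abs_sub hq hA hs'
  have hA0 : 0 < A := by linarith [pow_pos hK0 8]
  have hW : |tauComp A q₁ p| ≤ 2 * K ^ 2 * |p.2.1| / A := by
    have : q₁ (p.2.2.2 + p.2.1) * (q₁ p.2.2.2)⁻¹ - 1 =
        (q₁ (p.2.2.2 + p.2.1) - q₁ p.2.2.2) * (q₁ p.2.2.2)⁻¹ := by
      rw [sub_mul, mul_inv_cancel₀ (curve_ne_zero hq ht')]
    rw [tauComp, this, abs_mul, abs_mul, abs_inv (A - _), abs_of_pos (a := A - _) (by linarith)]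
    have h2 := abs_q1_sub_le hq ht' hs'
    rw [add_sub_cancel_left] at h2
    have h3 : (A - q₁ (p.2.2.2 + p.2.1))⁻¹ ≤ (A / 2)⁻¹ := inv_anti₀ (by linarith) hA1
    calc _ ≤ (K * |p.2.1|) * K * (A / 2)⁻¹ := by
          gcongr
          exact abs_inv_curve_le hq ht'
      _ = _ := by field_simp
  have h4 := abs_q1_sub_le hq hs' hs
  rw [add_sub_add_right_eq_sub] at h4
  have h5 : |tauComp A q₁ p * (q₁ (p.2.2.1 + p.2.1) - q₁ (p.2.2.2 + p.2.1))| ≤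
      (2 * K ^ 5)⁻¹ * (|p.2.1| * |p.2.2.1 - p.2.2.2|) := by
    rw [abs_mul]
    calc _ ≤ (2 * K ^ 2 * |p.2.1| / A) * (K * |p.2.2.1 - p.2.2.2|) := by gcongr
      _ = (2 * K ^ 3 / A) * (|p.2.1| * |p.2.2.1 - p.2.2.2|) := by ring
      _ ≤ _ := by
        gcongr
        rw [div_le_iff₀ hA0, inv_mul_eq_div, le_div_iff₀ (by positivity)]
        calc 2 * K ^ 3 * (2 * K ^ 5) = 4 * K ^ 8 := by ring
          _ ≤ A := hA
  have h6 : (K ^ 5)⁻¹ = (2 * K ^ 5)⁻¹ + (2 * K ^ 5)⁻¹ := by field_simp; ring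
  rw [h6, add_mul] at h1
  rw [speed]
  linarith [abs_sub_abs_le_abs_sub
    (q₁ (p.2.2.2 + p.2.1) * (q₁ p.2.2.2)⁻¹ - q₁ (p.2.2.1 + p.2.1) * (q₁ p.2.2.1)⁻¹)
    (tauComp A q₁ p * (q₁ (p.2.2.1 + p.2.1) - q₁ (p.2.2.2 + p.2.1)))]

theorem remainder_le (hq : 𝓢q) (hA : 4 * K ^ 8 ≤ A) {p : E4}
    (hp : p ∈ region l r) {ε η : ℝ} (hε : 0 < ε) (hη : 0 < η) :
    p.2.1 ^ 2 * (ε ^ 2 / (speed A q₁ p ^ 2 + ε ^ 2)) ≤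
      4 * K ^ 10 * ((if |p.2.2.1 - p.2.2.2| < η then 1 else 0) + ε ^ 2 / η ^ 2) := by
  have hK := hq.one_le
  have hK0 : 0 < K := by linarith
  have hpos : 0 < speed A q₁ p ^ 2 + ε ^ 2 := by positivity
  have hτ := abs_tau_le hq hp
  split_ifs with h
  · have h1 : ε ^ 2 / (speed A q₁ p ^ 2 + ε ^ 2) ≤ 1 :=
      (div_le_one hpos).2 (by linarith [sq_nonneg (speed A q₁ p)])
    have h2 : p.2.1 ^ 2 ≤ K ^ 10 := by
      rw [← sq_abs]
      exact (pow_le_pow_left₀ (abs_nonneg _) hτ 2).trans (pow_le_pow_right₀ hK (by norm_num))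
    have h3 : p.2.1 ^ 2 * (ε ^ 2 / (speed A q₁ p ^ 2 + ε ^ 2)) ≤ K ^ 10 * 1 :=
      mul_le_mul h2 h1 (by positivity) (by positivity)
    have h4 : 0 ≤ K ^ 10 * (ε ^ 2 / η ^ 2) := by positivity
    have h5 : 0 ≤ K ^ 10 := by positivity
    linarith
  · push Not at h
    have h1 := le_abs_speed hq hA hp
    have h2 : (2 * K ^ 5)⁻¹ * (|p.2.1| * η) ≤ |speed A q₁ p| := le_trans (by gcongr) h1
    rw [inv_mul_le_iff₀ (by positivity)] at h2
    have h3 := pow_le_pow_left₀ (by positivity) h2 2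
    rw [mul_pow, mul_pow, sq_abs, sq_abs] at h3
    rw [zero_add, mul_div_assoc', mul_div_assoc', div_le_div_iff₀ hpos (by positivity)]
    calc p.2.1 ^ 2 * ε ^ 2 * η ^ 2 = (p.2.1 ^ 2 * η ^ 2) * ε ^ 2 := by ring
      _ ≤ ((2 * K ^ 5) ^ 2 * speed A q₁ p ^ 2) * ε ^ 2 := by gcongr
      _ = 4 * K ^ 10 * ε ^ 2 * speed A q₁ p ^ 2 := by ring
      _ ≤ _ := by
        gcongr
        linarith [sq_nonneg ε]

def ptY (q : ℝ → ℝ) (p : E4) : ℝ := p.1 - q p.2.2.1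
def ptY' (q : ℝ → ℝ) (p : E4) : ℝ := p.1 - q p.2.2.2
def ptZ (A : ℝ) (q : ℝ → ℝ) (p : E4) : ℝ := p.1 + A * p.2.1 - q (p.2.2.1 + p.2.1)
def ptZ' (A : ℝ) (q : ℝ → ℝ) (p : E4) : ℝ := p.1 + A * p.2.1 - q (p.2.2.2 + p.2.1)

def prod4 (A : ℝ) (q : ℝ → ℝ) (a b c d : ℝ → ℂ) (p : E4) : ℂ :=
  a (ptY q p) * b (ptZ A q p) * (c (ptY' q p) * d (ptZ' A q p))

/-- The vector field killing three of the four points. -/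
def field (A : ℝ) (q₁ : ℝ → ℝ) (p : E4) : E4 := (1, tauComp A q₁ p, (q₁ p.2.2.1)⁻¹, (q₁ p.2.2.2)⁻¹)

theorem hasFDerivAt_points (hq : 𝓢q) {p : E4} (hp : p ∈ region l r) :
    HasFDerivAt (ptY q) (ℓx - q₁ p.2.2.1 • ℓt) p ∧
    HasFDerivAt (ptZ A q) (ℓx + A • ℓτ - q₁ (p.2.2.1 + p.2.1) • (ℓt + ℓτ)) p ∧
    HasFDerivAt (ptY' q) (ℓx - q₁ p.2.2.2 • ℓt') p ∧
    HasFDerivAt (ptZ' A q) (ℓx + A • ℓτ - q₁ (p.2.2.2 + p.2.1) • (ℓt' + ℓτ)) p := by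
  obtain ⟨h1, h2, h3, h4⟩ := hp
  have hx := ℓx.hasFDerivAt (x := p)
  have hz := hx.add (ℓτ.hasFDerivAt.const_mul A)
  exact ⟨hx.sub ((hq.deriv0 _ h1).comp_hasFDerivAt p ℓt.hasFDerivAt),
    hz.sub ((hq.deriv0 _ h3).comp_hasFDerivAt p (ℓt + ℓτ).hasFDerivAt),
    hx.sub ((hq.deriv0 _ h2).comp_hasFDerivAt p ℓt'.hasFDerivAt),
    hz.sub ((hq.deriv0 _ h4).comp_hasFDerivAt p (ℓt' + ℓτ).hasFDerivAt)⟩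

theorem contDiffOn_points (hq : 𝓢q) :
    ContDiffOn ℝ 1 (ptY q) (region l r) ∧ ContDiffOn ℝ 1 (ptZ A q) (region l r) ∧
    ContDiffOn ℝ 1 (ptY' q) (region l r) ∧ ContDiffOn ℝ 1 (ptZ' A q) (region l r) := by
  have hC (L : E4 →L[ℝ] ℝ) (h : MapsTo L (region l r) (Ioo l r)) :
      ContDiffOn ℝ 1 (fun p => q (L p)) (region l r) :=
    (contDiffOn_one_of_hasDerivAt isOpen_Ioo hq.deriv0 fun t ht =>
      (hq.deriv1 t ht).continuousAt.continuousWithinAt).comp L.contDiff.contDiffOn h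
  exact ⟨.sub (by fun_prop) (hC ℓt fun p hp => hp.1),
    .sub (by fun_prop) (hC (ℓt + ℓτ) fun p hp => hp.2.2.1),
    .sub (by fun_prop) (hC ℓt' fun p hp => hp.2.1),
    .sub (by fun_prop) (hC (ℓt' + ℓτ) fun p hp => hp.2.2.2)⟩

theorem contDiffOn_prod4 (hq : 𝓢q) {a b c d : ℝ → ℂ}
    {n : WithTop ℕ∞} (hn : n ≤ 1) (ha : ContDiff ℝ n a) (hb : ContDiff ℝ n b)
    (hc : ContDiff ℝ n c) (hd : ContDiff ℝ n d) :
    ContDiffOn ℝ n (prod4 A q a b c d) (region l r) := by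
  obtain ⟨h1, h2, h3, h4⟩ := contDiffOn_points (A := A) hq
  exact ((ha.comp_contDiffOn (h1.of_le hn)).mul (hb.comp_contDiffOn (h2.of_le hn))).mul
    ((hc.comp_contDiffOn (h3.of_le hn)).mul (hd.comp_contDiffOn (h4.of_le hn)))

theorem fderiv_prod4_field (hq : 𝓢q) (hA : 4 * K ^ 8 ≤ A)
    {a b b' c d : ℝ → ℂ} (ha : Differentiable ℝ a) (hb : ∀ x, HasDerivAt b (b' x) x)
    (hc : Differentiable ℝ c) (hd : Differentiable ℝ d) {p : E4} (hp : p ∈ region l r) :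
    fderiv ℝ (prod4 A q a b c d) p (field A q₁ p) = speed A q₁ p • prod4 A q a b' c d p := by
  obtain ⟨h1, h2, h3, h4⟩ := hasFDerivAt_points (A := A) hq hp
  have e1 : (ℓx - q₁ p.2.2.1 • ℓt) (field A q₁ p) = 0 := by
    simp [ℓx, ℓt, field, mul_inv_cancel₀ (curve_ne_zero hq hp.1)]
  have e3 : (ℓx - q₁ p.2.2.2 • ℓt') (field A q₁ p) = 0 := by
    simp [ℓx, ℓt', field, mul_inv_cancel₀ (curve_ne_zero hq hp.2.1)]
  have hW : tauComp A q₁ p * (A - q₁ (p.2.2.2 + p.2.1)) =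
      q₁ (p.2.2.2 + p.2.1) * (q₁ p.2.2.2)⁻¹ - 1 := by
    have := (le_abs_sub hq hA hp.2.2.2).2
    rw [tauComp, inv_mul_cancel_right₀ (by linarith)]
  have e4 : (ℓx + A • ℓτ - q₁ (p.2.2.2 + p.2.1) • (ℓt' + ℓτ)) (field A q₁ p) = 0 := by
    simp [ℓx, ℓt', ℓτ, field]
    linear_combination hW
  have e2 : (ℓx + A • ℓτ - q₁ (p.2.2.1 + p.2.1) • (ℓt + ℓτ)) (field A q₁ p) = speed A q₁ p := by
    simp [ℓx, ℓt, ℓτ, field, speed]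
    linear_combination hW
  have k1 := (ha (ptY q p)).hasFDerivAt.comp p h1
  have k2 := (hb (ptZ A q p)).hasFDerivAt.comp p h2
  have k3 := (hc (ptY' q p)).hasFDerivAt.comp p h3
  have k4 := (hd (ptZ' A q p)).hasFDerivAt.comp p h4
  have := ((k1.mul k2).mul (k3.mul k4)).fderiv
  have h : prod4 A q a b c d = a ∘ ptY q * b ∘ ptZ A q * (c ∘ ptY' q * d ∘ ptZ' A q) := rfl
  rw [h, this]
  simp only [add_apply, smul_apply,
    ContinuousLinearMap.comp_apply, e1, e2, e3, e4, map_zero, smul_zero, add_zero, zero_add,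
    ContinuousLinearMap.toSpanSingleton_apply, Pi.mul_apply, Function.comp_apply, prod4]
  simp only [smul_eq_mul, real_smul]
  ring

/-- A `C¹` window supported in `[-2,2]`. -/
structure Window (K : ℝ) (w w' : ℝ → ℝ) : Prop where
  hasDeriv : ∀ t, HasDerivAt w (w' t) t
  cont : Continuous w'
  bound0 : ∀ t, |w t| ≤ K
  bound1 : ∀ t, |w' t| ≤ K
  supp : ∀ t, 2 < |t| → w t = 0

/-- The part of the region over a window centred at `s`. -/
def box (l r s : ℝ) : Set E4 := {p | p ∈ region l r ∧ |p.1 - s| ≤ 2}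

theorem measurableSet_box (l r s : ℝ) : MeasurableSet (box l r s) :=
  (isOpen_region l r).measurableSet.inter
    (isClosed_le (f := fun p : E4 => |p.1 - s|) (by fun_prop) continuous_const).measurableSet

theorem cutoff_support (hK : r - l ≤ K) (hζ : Amplitude K l r ζ ζ') (hw : Window K w w') :
    HasCompactSupport (cutoff w ζ s) ∧ tsupport (cutoff w ζ s) ⊆ box l r s := by
  set Z : Set E4 := {p | |p.1 - s| ≤ 2 ∧ p.2.2.1 ∈ tsupport ζ ∧ p.2.2.2 ∈ tsupport ζ ∧
    p.2.2.1 + p.2.1 ∈ tsupport ζ ∧ p.2.2.2 + p.2.1 ∈ tsupport ζ} with hZ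
  have hc := isClosed_tsupport ζ
  have hclosed : IsClosed Z :=
    (isClosed_le (f := fun p : E4 => |p.1 - s|) (by fun_prop) continuous_const).inter
    ((hc.preimage ℓt.continuous).inter
    ((hc.preimage ℓt'.continuous).inter
    ((hc.preimage (ℓt + ℓτ).continuous).inter (hc.preimage (ℓt' + ℓτ).continuous))))
  have hsub : tsupport (cutoff w ζ s) ⊆ Z := by
    refine closure_minimal (fun p hp => ?_) hclosed
    have hp' : cutoff w ζ s p ≠ 0 := hp
    simp only [cutoff, mul_ne_zero_iff] at hp'
    obtain ⟨⟨⟨h1, -⟩, h2, h3⟩, h4, h5⟩ := hp'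
    exact ⟨not_lt.1 fun h => h1 (hw.supp _ h), subset_tsupport _ h2, subset_tsupport _ h3,
      subset_tsupport _ h4, subset_tsupport _ h5⟩
  have hZc : IsCompact Z := by
    refine IsCompact.of_isClosed_subset (isCompact_Icc.prod (isCompact_Icc.prod
      (hζ.compact.isCompact.prod hζ.compact.isCompact)))
      hclosed (s := Icc (s - 2) (s + 2) ×ˢ Icc (-K) K ×ˢ tsupport ζ ×ˢ tsupport ζ) ?_
    rintro p ⟨h1, h2, h3, h4, h5⟩
    have a1 := hζ.supp h2
    have a2 := hζ.supp h4
    rw [abs_le] at h1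
    exact ⟨⟨by linarith, by linarith⟩, ⟨by linarith [a1.1, a1.2, a2.1, a2.2],
      by linarith [a1.1, a1.2, a2.1, a2.2]⟩, h2, h3⟩
  exact ⟨hZc.of_isClosed_subset isClosed_closure hsub, fun p hp =>
    have h := hsub hp
    ⟨⟨hζ.supp h.2.1, hζ.supp h.2.2.1, hζ.supp h.2.2.2.1, hζ.supp h.2.2.2.2⟩, h.1⟩⟩

theorem continuous_cutoff (hζ : Amplitude K l r ζ ζ') (hw : Window K w w') :
    Continuous (cutoff w ζ s) := by
  have h1 : Continuous w := continuous_iff_continuousAt.2 fun t => (hw.hasDeriv t).continuousAt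
  have h2 : Continuous ζ := continuous_iff_continuousAt.2 fun t => (hζ.hasDeriv t).continuousAt
  unfold cutoff
  fun_prop

theorem integrable_cutoff_smul (hK : r - l ≤ K) (hζ : Amplitude K l r ζ ζ') (hw : Window K w w')
    {h : E4 → ℂ} (hh : ContinuousOn h (region l r)) :
    Integrable (fun p => cutoff w ζ s p • h p) := by
  obtain ⟨h1, h2⟩ := cutoff_support (s := s) hK hζ hw
  have hsub : tsupport (fun p => cutoff w ζ s p • h p) ⊆ tsupport (cutoff w ζ s) :=
    tsupport_smul_subset_left _ _
  refine Continuous.integrable_of_hasCompactSupport ?_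
    (h1.of_isClosed_subset isClosed_closure hsub)
  exact continuous_of_tsupport fun p hp => (continuous_cutoff hζ hw).continuousAt.smul
    (hh.continuousAt ((isOpen_region l r).mem_nhds (h2 (hsub hp)).1))

def fieldComp (A : ℝ) (q₁ : ℝ → ℝ) : Fin 4 → E4 → ℝ :=
  ![fun _ => 1, tauComp A q₁, fun p => (q₁ p.2.2.1)⁻¹, fun p => (q₁ p.2.2.2)⁻¹]

def basisVec : Fin 4 → E4 := ![(1, 0, 0, 0), (0, 1, 0, 0), (0, 0, 1, 0), (0, 0, 0, 1)]

theorem norm_basisVec_le (i : Fin 4) : ‖basisVec i‖ ≤ 1 := by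
  fin_cases i <;> simp [basisVec, Prod.norm_def]

theorem sum_fieldComp (A : ℝ) (q₁ : ℝ → ℝ) (m : ℝ) (p : E4) :
    ∑ i, (m * fieldComp A q₁ i p) • basisVec i = m • field A q₁ p := by
  simp [Fin.sum_univ_four, fieldComp, basisVec, field]

/-- The fourfold estimate obtained by splitting according to the size of `speed`. -/
theorem exists_fourfold_bound (K : ℝ) : ∃ C, 0 < C ∧
    ∀ {l r A s ε η : ℝ} {q q₁ q₂ q₃ w w' ζ ζ' : ℝ → ℝ} {a b b' c d : ℝ → ℂ},
    SmoothingCurve K l r q q₁ q₂ q₃ → Amplitude K l r ζ ζ' → Window K w w' → 4 * K ^ 8 ≤ A →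
    0 < ε → ε ≤ 1 → 0 < η → ContDiff ℝ 1 a → (∀ x, HasDerivAt b (b' x) x) → Continuous b' →
    ContDiff ℝ 1 c → ContDiff ℝ 1 d →
    ‖∫ p, cutoff w ζ s p • prod4 A q a b' c d p‖ₑ ≤
      (∫⁻ p in box l r s, ofReal (C / ε ^ 2) * ‖prod4 A q a b c d p‖ₑ) +
      ∫⁻ p in box l r s, ofReal
        (C * ((if |p.2.2.1 - p.2.2.2| < η then 1 else 0) + ε ^ 2 / η ^ 2)) *
        ‖prod4 A q a b' c d p‖ₑ := by
  obtain ⟨C₀, hC₀, hblocks⟩ := exists_bddC1_blocks K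
  set C₁ := 4 * (2 * (2 * (C₀ * (C₀ + 1)) * C₀)) with hC₁
  have hC₁0 : 0 ≤ C₁ := by positivity
  refine ⟨1 + C₁ + |K| ^ 5 * (4 * |K| ^ 10), by positivity, ?_⟩
  intro l r A s ε η q q₁ q₂ q₃ w w' ζ ζ' a b b' c d hq hζ hw hA hε hε1 hη ha hb hb' hc hd
  have hK := hq.one_le
  have hK0 : 0 < K := by linarith
  rw [abs_of_pos hK0]
  have hΩ := isOpen_region l r
  obtain ⟨bχ, bD, bW, bt, bt'⟩ := hblocks (s := s) hq hζ hw.hasDeriv hw.cont hw.bound0 hw.bound1 hA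
  obtain ⟨hχc, hχs⟩ := cutoff_support (s := s) hq.length hζ hw
  have hbC : ContDiff ℝ 1 b := by
    rw [contDiff_one_iff_deriv]
    exact ⟨fun x => (hb x).differentiableAt,
      by rwa [show deriv b = b' from funext fun x => (hb x).deriv]⟩
  have bM : BddC1 (region l r) (1 / ε ^ 2 * (C₀ + 1)) (fun p => regInv ε (speed A q₁ p)) := by
    refine BddC1.comp hΩ bD.contDiffOn (fun p hp => (bD.fderiv_bound p hp).trans (by linarith))
      isOpen_univ (mapsTo_univ _ _) (by positivity) (fun d _ => hasDerivAt_regInv hε d) ?_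
      (fun d _ => abs_regInv_le hε hε1 d) (fun d _ => abs_deriv_regInv_le hε d) (by linarith)
    refine Continuous.continuousOn (Continuous.div (by fun_prop) (by fun_prop) fun d => ?_)
    have : 0 < d ^ 2 + ε ^ 2 := by positivity
    positivity
  set m : E4 → ℝ := fun p => cutoff w ζ s p * regInv ε (speed A q₁ p) with hm
  set V : Fin 4 → E4 → ℝ := fun i p => m p * fieldComp A q₁ i p with hV
  have bV : ∀ i, BddC1 (region l r) (C₁ / 4 / ε ^ 2) (V i) := by
    have bm := BddC1.mul hΩ bχ bM
    have bc : ∀ i, BddC1 (region l r) C₀ (fieldComp A q₁ i) := by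
      intro i
      fin_cases i
      · exact (BddC1.const 1).mono (by simpa using hC₀)
      · exact bW
      · exact bt
      · exact bt'
    intro i
    refine (BddC1.mul hΩ bm (bc i)).mono (le_of_eq ?_)
    rw [hC₁]; ring
  have hVsub : ∀ i, tsupport (V i) ⊆ tsupport (cutoff w ζ s) := fun i =>
    (tsupport_mul_subset_left (f := m) (g := fieldComp A q₁ i)).trans
      (tsupport_mul_subset_left (f := cutoff w ζ s) (g := fun p => regInv ε (speed A q₁ p)))
  have : (volume : Measure (ℝ × ℝ)).IsAddHaarMeasure := by
    rw [Measure.volume_eq_prod]; infer_instance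
  have : (volume : Measure (ℝ × ℝ × ℝ)).IsAddHaarMeasure := by
    rw [Measure.volume_eq_prod]; infer_instance
  have : (volume : Measure E4).IsAddHaarMeasure := by
    rw [Measure.volume_eq_prod]; infer_instance
  have hmain := enorm_integral_fderiv_le volume basisVec hΩ (fun i => (bV i).contDiffOn)
    (contDiffOn_prod4 (A := A) hq le_rfl ha hbC hc hd)
    (fun i => hχc.of_isClosed_subset isClosed_closure (hVsub i))
    (fun i => (hVsub i).trans fun p hp => (hχs hp).1)
  have hχ0 : ∀ p, p ∉ box l r s → cutoff w ζ s p = 0 := fun p hp =>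
    image_eq_zero_of_notMem_tsupport fun h => hp (hχs h)
  have hleft : ∀ p, fderiv ℝ (prod4 A q a b c d) p (∑ i, V i p • basisVec i) =
      cutoff w ζ s p • ((regInv ε (speed A q₁ p) * speed A q₁ p) • prod4 A q a b' c d p) := by
    intro p
    simp only [hV]
    rw [sum_fieldComp, map_smul]
    by_cases hp : p ∈ box l r s
    · rw [fderiv_prod4_field hq hA (ha.differentiable one_ne_zero) hb
        (hc.differentiable one_ne_zero) (hd.differentiable one_ne_zero) hp.1, hm]
      simp only [smul_smul]
      ring_nf
    · simp [hm, hχ0 p hp]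
  simp_rw [hleft] at hmain
  have hsplit : ∀ p, cutoff w ζ s p • prod4 A q a b' c d p =
      cutoff w ζ s p • ((regInv ε (speed A q₁ p) * speed A q₁ p) • prod4 A q a b' c d p) +
      cutoff w ζ s p • ((ε ^ 2 / (speed A q₁ p ^ 2 + ε ^ 2)) • prod4 A q a b' c d p) := by
    intro p
    have : 0 < speed A q₁ p ^ 2 + ε ^ 2 := by positivity
    rw [← smul_add, ← add_smul]
    rw [show regInv ε (speed A q₁ p) * speed A q₁ p + ε ^ 2 / (speed A q₁ p ^ 2 + ε ^ 2) = 1 by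
      rw [regInv]; field_simp, one_smul]
  have hcontP := (contDiffOn_prod4 (A := A) hq zero_le_one (ha.of_le zero_le_one)
    (contDiff_zero.2 hb') (hc.of_le zero_le_one) (hd.of_le zero_le_one)).continuousOn
  have hcD := bD.contDiffOn.continuousOn
  have hi1 : Integrable fun p => cutoff w ζ s p •
      ((regInv ε (speed A q₁ p) * speed A q₁ p) • prod4 A q a b' c d p) :=
    integrable_cutoff_smul hq.length hζ hw ((bM.contDiffOn.continuousOn.mul hcD).smul hcontP)
  have hi2 : Integrable fun p => cutoff w ζ s p •
      ((ε ^ 2 / (speed A q₁ p ^ 2 + ε ^ 2)) • prod4 A q a b' c d p) := by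
    refine integrable_cutoff_smul hq.length hζ hw (ContinuousOn.smul (ContinuousOn.div
      continuousOn_const ((hcD.pow 2).add continuousOn_const) fun p _ => ?_) hcontP)
    exact (by positivity : speed A q₁ p ^ 2 + ε ^ 2 ≠ 0)
  simp_rw [hsplit]
  rw [integral_add hi1 hi2]
  refine (enorm_add_le _ _).trans (add_le_add (hmain.trans ?_)
    ((enorm_integral_le_lintegral_enorm _).trans ?_))
  · rw [← lintegral_indicator (measurableSet_box l r s)]
    refine lintegral_mono fun p => ?_
    by_cases hp : p ∈ box l r s
    · rw [indicator_of_mem hp, enorm_smul]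
      gcongr
      rw [← ofReal_norm]
      refine ofReal_le_ofReal ((norm_sum_le _ _).trans ?_)
      calc ∑ i, ‖fderiv ℝ (V i) p (basisVec i)‖ ≤ ∑ i : Fin 4, C₁ / 4 / ε ^ 2 := by
            refine sum_le_sum fun i _ => ?_
            refine ((fderiv ℝ (V i) p).le_opNorm_of_le (norm_basisVec_le i)).trans ?_
            rw [mul_one]
            exact (bV i).fderiv_bound p hp.1
        _ = C₁ / ε ^ 2 := by simp; ring
        _ ≤ _ := by
          gcongr
          have : 0 ≤ K ^ 5 * (4 * K ^ 10) := by positivity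
          linarith
    · rw [indicator_of_notMem hp]
      have : ∀ i, fderiv ℝ (V i) p = 0 := fun i =>
        image_eq_zero_of_notMem_tsupport fun h => hp (hχs (hVsub i (tsupport_fderiv_subset ℝ h)))
      simp [this]
  · rw [← lintegral_indicator (measurableSet_box l r s)]
    refine lintegral_mono fun p => ?_
    by_cases hp : p ∈ box l r s
    · rw [indicator_of_mem hp, smul_smul, enorm_smul]
      gcongr
      rw [← ofReal_norm]
      refine ofReal_le_ofReal ?_
      have hpos : 0 < speed A q₁ p ^ 2 + ε ^ 2 := by positivity
      have h1 := remainder_le hq hA hp.1 hε hη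
      set R := (if |p.2.2.1 - p.2.2.2| < η then (1:ℝ) else 0) + ε ^ 2 / η ^ 2 with hR
      have hR0 : 0 ≤ R := by rw [hR]; positivity
      rw [norm_eq_abs, abs_mul, abs_of_nonneg (a := ε ^ 2 / _) (by positivity), cutoff, abs_mul,
        abs_mul, abs_mul, abs_mul (ζ _), abs_mul (ζ _), ← sq, abs_of_nonneg (sq_nonneg p.2.1)]
      calc |w (p.1 - s)| * p.2.1 ^ 2 * (|ζ p.2.2.1| * |ζ p.2.2.2|) *
            (|ζ (p.2.2.1 + p.2.1)| * |ζ (p.2.2.2 + p.2.1)|) * (ε ^ 2 / (speed A q₁ p ^ 2 + ε ^ 2))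
          = (|w (p.1 - s)| * ((|ζ p.2.2.1| * |ζ p.2.2.2|) *
            (|ζ (p.2.2.1 + p.2.1)| * |ζ (p.2.2.2 + p.2.1)|))) *
            (p.2.1 ^ 2 * (ε ^ 2 / (speed A q₁ p ^ 2 + ε ^ 2))) := by ring
        _ ≤ (K * ((K * K) * (K * K))) * (4 * K ^ 10 * R) := by
          gcongr <;> first | exact hw.bound0 _ | exact hζ.bound0 _
        _ = K ^ 5 * (4 * K ^ 10) * R := by ring
        _ ≤ _ := by
          gcongr
          linarith
    · rw [indicator_of_notMem hp]
      simp [hχ0 p hp]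

/-- Change of variables along the fast curve. -/
theorem lintegral_fast_le (hq : 𝓢q) (hA : 4 * K ^ 8 ≤ A)
    (φ : ℝ → ENNReal) {c u v : ℝ} (hc : ∀ σ ∈ Ioo l r, c + (A * σ - q σ) ∈ Icc u v) :
    ∫⁻ σ in Ioo l r, φ (c + (A * σ - q σ)) ≤ ofReal (2 / A) * ∫⁻ y in Icc u v, φ y := by
  have hK := hq.one_le
  have hK8 : K ≤ K ^ 8 := le_self_pow₀ hK (by norm_num)
  have hA0 : 0 < A := by linarith
  have hd : ∀ σ ∈ Ioo l r, HasDerivAt (fun σ => c + (A * σ - q σ)) (A - q₁ σ) σ := fun σ hσ => by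
    have := ((hasDerivAt_id σ).const_mul A).fun_sub (hq.deriv0 σ hσ)
    simpa using this.const_add c
  have hlow : ∀ σ ∈ Ioo l r, A / 2 ≤ A - q₁ σ := fun σ hσ => by
    have := (abs_le.1 (hq.bound1 σ hσ)).2
    linarith
  have hmono : StrictMonoOn (fun σ => c + (A * σ - q σ)) (Ioo l r) := by
    refine strictMonoOn_of_deriv_pos (convex_Ioo l r)
      (fun σ hσ => (hd σ hσ).continuousAt.continuousWithinAt) fun σ hσ => ?_
    rw [interior_Ioo] at hσ
    rw [(hd σ hσ).deriv]
    linarith [hlow σ hσ]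
  have h := lintegral_image_eq_lintegral_abs_deriv_mul measurableSet_Ioo
    (fun σ hσ => (hd σ hσ).hasDerivWithinAt) hmono.injOn φ
  calc _ ≤ ∫⁻ σ in Ioo l r, ofReal (2 / A) *
        (ofReal |A - q₁ σ| * φ (c + (A * σ - q σ))) := by
        refine setLIntegral_mono' measurableSet_Ioo fun σ hσ => ?_
        rw [← mul_assoc, ← ofReal_mul (by positivity)]
        refine le_mul_of_one_le_left zero_le ?_
        rw [ENNReal.one_le_ofReal, div_mul_eq_mul_div, le_div_iff₀ hA0]
        have := hlow σ hσ
        rw [abs_of_pos (by linarith)]; linarith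
    _ = ofReal (2 / A) * ∫⁻ y in (fun σ => c + (A * σ - q σ)) '' Ioo l r, φ y := by
        rw [h, lintegral_const_mul' _ _ ofReal_ne_top]
    _ ≤ _ := by
        gcongr
        exact image_subset_iff.2 hc

/-- The indicator of the box in the variables that involve only one curve parameter. -/
def slab (l r s : ℝ) (x τ t : ℝ) : ENNReal :=
  (Icc (s - 2) (s + 2)).indicator 1 x * (Ioo l r).indicator 1 t * (Ioo l r).indicator 1 (t + τ)

theorem measurable_slab : Measurable fun p : ℝ × ℝ × ℝ => slab l r s p.1 p.2.1 p.2.2 := by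
  unfold slab
  fun_prop

theorem lintegral_slab_le (hq : 𝓢q) (hqm : Measurable q)
    (hA : 4 * K ^ 8 ≤ A) {φ ψ : ℝ → ENNReal} (hφ : Measurable φ) (hψ : Measurable ψ) (s : ℝ) :
    ∫⁻ x, ∫⁻ τ, ∫⁻ t, slab l r s x τ t * (φ (x + A * τ - q (t + τ)) * ψ (x - q t)) ≤
      ofReal (2 * K / A) * (∫⁻ y in Icc (s - (K + 1) * A) (s + (K + 1) * A), φ y) *
        ∫⁻ y in Icc (s - (K + 2)) (s + (K + 2)), ψ y := by
  have hK := hq.one_le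
  have hK8 : K ≤ K ^ 8 := le_self_pow₀ hK (by norm_num)
  have hA0 : 0 < A := by linarith
  set P := ∫⁻ y in Icc (s - (K + 1) * A) (s + (K + 1) * A), φ y with hP
  set R := ∫⁻ y in Icc (s - (K + 2)) (s + (K + 2)), ψ y with hR
  have hinner : ∀ x t, ∫⁻ τ, slab l r s x τ t * (φ (x + A * τ - q (t + τ)) * ψ (x - q t)) ≤
      ((Icc (s - 2) (s + 2)).indicator 1 x * (Ioo l r).indicator 1 t * ψ (x - q t)) *
        (ofReal (2 / A) * P) := by
    intro x t
    by_cases hx : x ∈ Icc (s - 2) (s + 2)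
    swap
    · simp [slab, hx]
    by_cases ht : t ∈ Ioo l r
    swap
    · simp [slab, ht]
    simp only [slab, indicator_of_mem hx, indicator_of_mem ht, Pi.one_apply, one_mul]
    have e : ∀ τ, (Ioo l r).indicator 1 (t + τ) * (φ (x + A * τ - q (t + τ)) * ψ (x - q t)) =
        (fun σ => (ψ (x - q t)) * (Ioo l r).indicator (fun σ => φ ((x - A * t) + (A * σ - q σ))) σ)
          (t + τ) := by
      intro τ
      by_cases hσ : t + τ ∈ Ioo l r
      · simp only [indicator_of_mem hσ, Pi.one_apply, one_mul]
        rw [mul_comm]; congr 2; ring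
      · simp [indicator_of_notMem hσ]
    simp_rw [e]
    rw [lintegral_add_left_eq_self (fun σ => (ψ (x - q t)) * (Ioo l r).indicator
      (fun σ => φ ((x - A * t) + (A * σ - q σ))) σ) t, lintegral_const_mul _
      (Measurable.indicator (by fun_prop) measurableSet_Ioo), lintegral_indicator measurableSet_Ioo]
    gcongr
    refine lintegral_fast_le hq hA φ fun σ hσ => ?_
    have h3 := abs_le.1 (hq.bound0 σ hσ)
    have h4 : |A * (σ - t)| ≤ A * K := by
      rw [abs_mul, abs_of_pos hA0]
      gcongr
      rw [abs_le]; constructor <;> linarith [hq.length, ht.1, ht.2, hσ.1, hσ.2]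
    rw [abs_le] at h4
    constructor <;> nlinarith [hx.1, hx.2]
  calc _ = ∫⁻ x, ∫⁻ t, ∫⁻ τ, slab l r s x τ t * (φ (x + A * τ - q (t + τ)) * ψ (x - q t)) := by
        refine lintegral_congr fun x => lintegral_lintegral_swap ?_
        unfold slab
        fun_prop
    _ ≤ ∫⁻ x, ∫⁻ t, ((Icc (s - 2) (s + 2)).indicator 1 x * (Ioo l r).indicator 1 t *
        ψ (x - q t)) * (ofReal (2 / A) * P) :=
        lintegral_mono fun x => lintegral_mono fun t => hinner x t
    _ = ∫⁻ t, ∫⁻ x, ((Icc (s - 2) (s + 2)).indicator 1 x * (Ioo l r).indicator 1 t *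
        ψ (x - q t)) * (ofReal (2 / A) * P) := by
        refine lintegral_lintegral_swap ?_
        fun_prop
    _ ≤ ∫⁻ t, (Ioo l r).indicator 1 t * (R * (ofReal (2 / A) * P)) := by
        refine lintegral_mono fun t => ?_
        by_cases ht : t ∈ Ioo l r
        swap
        · simp [ht]
        simp only [indicator_of_mem ht, Pi.one_apply, mul_one, one_mul]
        rw [lintegral_mul_const _ (by fun_prop)]
        gcongr
        have e : ∀ x, (Icc (s - 2) (s + 2)).indicator 1 x * ψ (x - q t) ≤
            (fun y => (Icc (s - (K + 2)) (s + (K + 2))).indicator ψ y) (x - q t) := by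
          intro x
          by_cases hx : x ∈ Icc (s - 2) (s + 2)
          swap
          · simp [hx]
          have h3 := abs_le.1 (hq.bound0 t ht)
          have : x - q t ∈ Icc (s - (K + 2)) (s + (K + 2)) :=
            ⟨by linarith [hx.1], by linarith [hx.2]⟩
          simp [hx, this]
        refine (lintegral_mono e).trans ?_
        rw [lintegral_sub_right_eq_self (fun y => (Icc (s - (K + 2)) (s + (K + 2))).indicator ψ y),
          lintegral_indicator measurableSet_Icc]
    _ = volume (Ioo l r) * (R * (ofReal (2 / A) * P)) := by
        rw [lintegral_mul_const _ (by fun_prop), lintegral_indicator_one measurableSet_Ioo]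
    _ ≤ ofReal K * (R * (ofReal (2 / A) * P)) := by
        gcongr
        rw [volume_Ioo]
        exact ofReal_le_ofReal hq.length
    _ = _ := by
        rw [show 2 * K / A = K * (2 / A) by ring, ofReal_mul (by linarith)]
        ring

theorem lintegral_E4 {H : E4 → ENNReal} (hH : Measurable H) :
    ∫⁻ p, H p = ∫⁻ x, ∫⁻ τ, ∫⁻ t, ∫⁻ t', H (x, τ, t, t') := by
  rw [Measure.volume_eq_prod, lintegral_prod _ hH.aemeasurable]
  refine lintegral_congr fun x => ?_
  rw [Measure.volume_eq_prod, lintegral_prod _ (by fun_prop)]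
  refine lintegral_congr fun τ => ?_
  rw [Measure.volume_eq_prod, lintegral_prod _ (by fun_prop)]

/-- Integrating a weighted product involving only one of the curve parameters over the box. -/
theorem lintegral_box_le (hq : 𝓢q) (hqm : Measurable q)
    (hA : 4 * K ^ 8 ≤ A) {φ ψ : ℝ → ENNReal} (hφ : Measurable φ) (hψ : Measurable ψ) (s : ℝ)
    {W : ℝ → ℝ → ENNReal} (hW : Measurable (uncurry W)) {M : ENNReal}
    (hM : ∀ t, ∫⁻ t' in Ioo l r, W t t' ≤ M) :
    ∫⁻ p in box l r s, W p.2.2.1 p.2.2.2 * (φ (ptZ A q p) * ψ (ptY q p)) ≤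
      M * (ofReal (2 * K / A) * (∫⁻ y in Icc (s - (K + 1) * A) (s + (K + 1) * A), φ y) *
        ∫⁻ y in Icc (s - (K + 2)) (s + (K + 2)), ψ y) := by
  have hS : Measurable fun p : ℝ × ℝ × ℝ => slab l r s p.1 p.2.1 p.2.2 := measurable_slab
  set G : ℝ × ℝ × ℝ → ENNReal := fun p => slab l r s p.1 p.2.1 p.2.2 *
    (φ (p.1 + A * p.2.1 - q (p.2.2 + p.2.1)) * ψ (p.1 - q p.2.2)) with hG
  have hGm : Measurable G := by fun_prop
  have hcore := lintegral_slab_le hq hqm hA hφ hψ s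
  have hW' : Measurable fun p : ℝ × ℝ => W p.1 p.2 := hW
  calc _ ≤ ∫⁻ p : E4, G (p.1, p.2.1, p.2.2.1) *
        ((Ioo l r).indicator 1 p.2.2.2 * W p.2.2.1 p.2.2.2) := by
        rw [← lintegral_indicator (measurableSet_box l r s)]
        refine lintegral_mono fun p => ?_
        by_cases hp : p ∈ box l r s
        swap
        · simp [hp]
        obtain ⟨⟨a1, a2, a3, -⟩, a5⟩ := id hp
        have a6 : p.1 ∈ Icc (s - 2) (s + 2) := by
          rw [abs_le] at a5; constructor <;> linarith
        rw [indicator_of_mem hp]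
        simp only [hG, slab, indicator_of_mem a1, indicator_of_mem a2, indicator_of_mem a3,
          indicator_of_mem a6, Pi.one_apply, one_mul, ptZ, ptY]
        rw [mul_comm]
    _ = ∫⁻ x, ∫⁻ τ, ∫⁻ t, G (x, τ, t) * ∫⁻ t' in Ioo l r, W t t' := by
        rw [lintegral_E4 (by fun_prop)]
        refine lintegral_congr fun x => lintegral_congr fun τ => lintegral_congr fun t => ?_
        dsimp only
        rw [lintegral_const_mul _ (by fun_prop), ← lintegral_indicator measurableSet_Ioo]
        congr 1
        refine lintegral_congr fun t' => ?_
        by_cases h : t' ∈ Ioo l r <;> simp [h]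
    _ ≤ ∫⁻ x, ∫⁻ τ, ∫⁻ t, M * G (x, τ, t) := by
        refine lintegral_mono fun x => lintegral_mono fun τ => lintegral_mono fun t => ?_
        dsimp only
        rw [mul_comm]
        gcongr
        exact hM t
    _ = M * ∫⁻ x, ∫⁻ τ, ∫⁻ t, G (x, τ, t) := by
        rw [← lintegral_const_mul _ (by fun_prop)]
        refine lintegral_congr fun x => ?_
        rw [← lintegral_const_mul _ (by fun_prop)]
        refine lintegral_congr fun τ => ?_
        rw [← lintegral_const_mul _ (by fun_prop)]
    _ ≤ _ := by gcongr

theorem lintegral_box_swap {F : E4 → ENNReal} (hF : Measurable F) :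
    ∫⁻ p in box l r s, F (p.1, p.2.1, p.2.2.2, p.2.2.1) = ∫⁻ p in box l r s, F p := by
  have h : MeasurePreserving fun p : E4 => ((p.1, p.2.1, p.2.2.2, p.2.2.1) : E4) :=
    (MeasurePreserving.id _).prod ((MeasurePreserving.id _).prod Measure.measurePreserving_swap)
  rw [← h.setLIntegral_comp_preimage (measurableSet_box l r s) hF]
  congr 2
  ext p
  simp only [box, region, mem_ofPred_eq, mem_preimage]
  tauto

theorem mul_mul_le_sq_add_sq (a b c d : ENNReal) :
    a * b * (c * d) ≤ b ^ 2 * a ^ 2 + d ^ 2 * c ^ 2 := by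
  rcases le_total (a * b) (c * d) with h | h
  · calc _ ≤ c * d * (c * d) := by gcongr
      _ = d ^ 2 * c ^ 2 := by ring
      _ ≤ _ := le_add_self
  · calc _ ≤ a * b * (a * b) := by gcongr
      _ = b ^ 2 * a ^ 2 := by ring
      _ ≤ _ := le_self_add

theorem lintegral_box_prod4_le (hq : 𝓢q) (hqm : Measurable q)
    (hA : 4 * K ^ 8 ≤ A) {a b c d : ℝ → ℂ} (ha : Measurable a) (hb : Measurable b)
    (hc : Measurable c) (hd : Measurable d) (s : ℝ) {Φ Ψ : ℝ → ENNReal}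
    (ha' : ∀ x, ‖a x‖ₑ ^ 2 ≤ Ψ x) (hb' : ∀ x, ‖b x‖ₑ ^ 2 ≤ Φ x)
    (hc' : ∀ x, ‖c x‖ₑ ^ 2 ≤ Ψ x) (hd' : ∀ x, ‖d x‖ₑ ^ 2 ≤ Φ x)
    {W : ℝ → ℝ → ENNReal} (hW : Measurable (uncurry W)) {M : ENNReal}
    (h1 : ∀ t, ∫⁻ t' in Ioo l r, W t t' ≤ M) (h2 : ∀ t', ∫⁻ t in Ioo l r, W t t' ≤ M) :
    ∫⁻ p in box l r s, W p.2.2.1 p.2.2.2 * ‖prod4 A q a b c d p‖ₑ ≤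
      2 * M * (ofReal (2 * K / A) *
        (∫⁻ y in Icc (s - (K + 1) * A) (s + (K + 1) * A), Φ y) *
        ∫⁻ y in Icc (s - (K + 2)) (s + (K + 2)), Ψ y) := by
  have hW' : Measurable fun p : ℝ × ℝ => W p.1 p.2 := hW
  have k1 := lintegral_box_le hq hqm hA (φ := fun x => ‖b x‖ₑ ^ 2) (ψ := fun x => ‖a x‖ₑ ^ 2)
    (by fun_prop) (by fun_prop) s hW h1
  have k2 := lintegral_box_le hq hqm hA (φ := fun x => ‖d x‖ₑ ^ 2) (ψ := fun x => ‖c x‖ₑ ^ 2)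
    (by fun_prop) (by fun_prop) s (W := fun t t' => W t' t) (hW.comp measurable_swap) h2
  rw [← lintegral_box_swap (by unfold ptZ ptY; fun_prop)] at k2
  calc _ ≤ ∫⁻ p in box l r s, (W p.2.2.1 p.2.2.2 * (‖b (ptZ A q p)‖ₑ ^ 2 * ‖a (ptY q p)‖ₑ ^ 2) +
        W p.2.2.1 p.2.2.2 * (‖d (ptZ' A q p)‖ₑ ^ 2 * ‖c (ptY' q p)‖ₑ ^ 2)) := by
        refine lintegral_mono fun p => ?_
        dsimp only
        rw [← mul_add]
        gcongr
        rw [prod4, enorm_mul, enorm_mul, enorm_mul]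
        exact mul_mul_le_sq_add_sq _ _ _ _
    _ = _ := by
        rw [lintegral_add_left]
        unfold ptZ ptY
        fun_prop
    _ ≤ _ := by
        rw [two_mul, add_mul]
        refine add_le_add (k1.trans ?_) (k2.trans ?_)
        · gcongr <;> [apply hb'; apply ha']
        · gcongr <;> [apply hd'; apply hc']

/-- The product `prod4` of a function with itself, one factor being replaced. -/
abbrev selfProd (A : ℝ) (q : ℝ → ℝ) (g H : ℝ → ℂ) : E4 → ℂ :=
  prod4 A q g (fun x => conj (H x)) (fun x => conj (g x)) g

theorem exists_window_bound (K : ℝ) : ∃ C, 0 < C ∧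
    ∀ {l r A s μ : ℝ} {q q₁ q₂ q₃ w w' ζ ζ' : ℝ → ℝ} {g H : ℝ → ℂ},
    SmoothingCurve K l r q q₁ q₂ q₃ → Measurable q → Amplitude K l r ζ ζ' → Window K w w' →
    4 * K ^ 8 ≤ A → 0 < μ → μ ≤ 1 → ContDiff ℝ 1 g →
    (∀ x, HasDerivAt (fun x => (μ : ℂ) ^ 8 * H x) (g x) x) →
    ‖∫ p, cutoff w ζ s p • selfProd A q g g p‖ₑ ≤
      ofReal (C * μ / A) *
        (∫⁻ y in Icc (s - (K + 1) * A) (s + (K + 1) * A), (‖g y‖ₑ ^ 2 + ‖H y‖ₑ ^ 2)) *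
        ∫⁻ y in Icc (s - (K + 2)) (s + (K + 2)), ‖g y‖ₑ ^ 2 := by
  obtain ⟨C, hC, hfour⟩ := exists_fourfold_bound K
  refine ⟨4 * |K| * C * (2 * |K| + 2) + 1, by positivity, ?_⟩
  intro l r A s μ q q₁ q₂ q₃ w w' ζ ζ' g H hq hqm hζ hw hA hμ hμ1 hg hH
  have hK := hq.one_le
  have hK8 : K ≤ K ^ 8 := le_self_pow₀ hK (by norm_num)
  have hA0 : 0 < A := by linarith
  rw [abs_of_pos (by linarith)]
  have hgc : ContDiff ℝ 1 fun x => conj (g x) := Complex.conjCLE.contDiff.comp hg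
  have hΓ : ∀ x, HasDerivAt (fun x => conj ((μ : ℂ) ^ 8 * H x)) (conj (g x)) x := fun x =>
    (Complex.conjCLE : ℂ →L[ℝ] ℂ).hasFDerivAt.comp_hasDerivAt x (hH x)
  have hHc : Continuous H := by
    have h : Continuous fun x => (μ : ℂ) ^ 8 * H x :=
      continuous_iff_continuousAt.2 fun x => (hH x).continuousAt
    have h2 : H = fun x => ((μ : ℂ) ^ 8)⁻¹ * ((μ : ℂ) ^ 8 * H x) := by
      ext x
      rw [inv_mul_cancel_left₀]
      exact pow_ne_zero _ (by exact_mod_cast hμ.ne')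
    rw [h2]
    fun_prop
  have hgm : Measurable g := hg.continuous.measurable
  have hgcm : Measurable fun x => conj (g x) := hgc.continuous.measurable
  have key := hfour (s := s) (ε := μ ^ 2) (η := μ) hq hζ hw hA (by positivity)
    (pow_le_one₀ hμ.le hμ1) hμ hg hΓ hgc.continuous hgc hg
  refine key.trans ?_
  set P := ∫⁻ y in Icc (s - (K + 1) * A) (s + (K + 1) * A), (‖g y‖ₑ ^ 2 + ‖H y‖ₑ ^ 2) with hP
  set R := ∫⁻ y in Icc (s - (K + 2)) (s + (K + 2)), ‖g y‖ₑ ^ 2 with hR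
  have hvol : volume (Ioo l r) ≤ ofReal K := by
    rw [volume_Ioo]; exact ofReal_le_ofReal hq.length
  have t1 : ∫⁻ p in box l r s, ofReal (C / (μ ^ 2) ^ 2) *
      ‖selfProd A q g (fun x => (μ : ℂ) ^ 8 * H x) p‖ₑ ≤
      2 * ofReal (C * μ * K) * (ofReal (2 * K / A) * P * R) := by
    have e : ∀ p, ofReal (C / (μ ^ 2) ^ 2) *
        ‖selfProd A q g (fun x => (μ : ℂ) ^ 8 * H x) p‖ₑ =
        (fun _ _ : ℝ => ofReal (C * μ ^ 4)) p.2.2.1 p.2.2.2 *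
        ‖selfProd A q g H p‖ₑ := by
      intro p
      have : selfProd A q g (fun x => (μ : ℂ) ^ 8 * H x) p =
          ((μ ^ 8 : ℝ) : ℂ) * selfProd A q g H p := by
        simp only [selfProd, prod4, map_mul, map_pow, Complex.conj_ofReal, Complex.ofReal_pow]
        ring
      rw [this, enorm_mul, ← mul_assoc, ← ofReal_norm, Complex.norm_of_nonneg (by positivity),
        ← ofReal_mul (by positivity)]
      congr 2
      field_simp
    simp_rw [e]
    refine lintegral_box_prod4_le hq hqm hA hgm ?_ hgcm hgm s (Ψ := fun x => ‖g x‖ₑ ^ 2)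
      (W := fun _ _ => ofReal (C * μ ^ 4)) (fun x => le_rfl) (fun x => ?_) (fun x => ?_)
      (fun x => le_self_add) measurable_const ?_ ?_
    · exact (Complex.continuous_conj.comp hHc).measurable
    · rw [RCLike.enorm_conj]; exact le_add_self
    · rw [RCLike.enorm_conj]
    all_goals
      intro t
      rw [setLIntegral_const]
      calc _ ≤ ofReal (C * μ ^ 4) * ofReal K := by gcongr
        _ = ofReal (C * μ ^ 4 * K) := by rw [← ofReal_mul (by positivity)]
        _ ≤ _ := by
          apply ofReal_le_ofReal
          gcongr
          exact pow_le_of_le_one hμ.le hμ1 (by norm_num)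
  have t2 : ∫⁻ p in box l r s, ofReal
        (C * ((if |p.2.2.1 - p.2.2.2| < μ then 1 else 0) + (μ ^ 2) ^ 2 / μ ^ 2)) *
        ‖selfProd A q g g p‖ₑ ≤
      2 * ofReal (C * μ * (K + 2)) * (ofReal (2 * K / A) * P * R) := by
    set W : ℝ → ℝ → ENNReal := fun t t' =>
      ofReal (C * ((if |t - t'| < μ then 1 else 0) + (μ ^ 2) ^ 2 / μ ^ 2)) with hW
    have hWle : ∀ t t', W t t' ≤
        (Icc (t - μ) (t + μ)).indicator (fun _ => ofReal C) t' +
          ofReal (C * μ) := by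
      intro t t'
      have : (μ ^ 2) ^ 2 / μ ^ 2 ≤ μ := by
        have : (μ ^ 2) ^ 2 / μ ^ 2 = μ * μ := by field_simp
        rw [this]; nlinarith
      simp only [hW]
      split_ifs with h
      · have hm : t' ∈ Icc (t - μ) (t + μ) := by
          rw [abs_lt] at h; constructor <;> linarith
        rw [indicator_of_mem hm, ← ofReal_add hC.le (by positivity)]
        apply ofReal_le_ofReal
        rw [mul_add, mul_one]
        gcongr
      · refine le_trans (ofReal_le_ofReal ?_) le_add_self
        rw [zero_add]
        gcongr
    have hone : ∀ t, ∫⁻ t' in Ioo l r, W t t' ≤ ofReal (C * μ * (K + 2)) := by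
      intro t
      calc _ ≤ ∫⁻ t' in Ioo l r, ((Icc (t - μ) (t + μ)).indicator (fun _ => ofReal C) t' +
          ofReal (C * μ)) := lintegral_mono fun t' => hWle t t'
        _ = (∫⁻ t' in Ioo l r, (Icc (t - μ) (t + μ)).indicator (fun _ => ofReal C) t') +
          ofReal (C * μ) * volume (Ioo l r) := by
          rw [lintegral_add_right _ measurable_const, setLIntegral_const]
        _ ≤ (∫⁻ t', (Icc (t - μ) (t + μ)).indicator (fun _ => ofReal C) t') +
          ofReal (C * μ) * ofReal K := by
          gcongr
          exact Measure.restrict_le_self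
        _ = ofReal (C * μ * (K + 2)) := by
          rw [lintegral_indicator measurableSet_Icc, setLIntegral_const, volume_Icc,
            ← ofReal_mul hC.le, ← ofReal_mul (by positivity),
            ← ofReal_add (by nlinarith) (by positivity)]
          congr 1; ring
    refine lintegral_box_prod4_le hq hqm hA hgm hgcm hgcm hgm s (Ψ := fun x => ‖g x‖ₑ ^ 2)
      (W := W) (fun x => le_rfl) (fun x => ?_) (fun x => ?_) (fun x => le_self_add) ?_ hone ?_
    · rw [RCLike.enorm_conj]; exact le_self_add
    · rw [RCLike.enorm_conj]
    · refine ENNReal.measurable_ofReal.comp (Measurable.const_mul (Measurable.add_const ?_ _) _)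
      refine Measurable.ite ?_ measurable_const measurable_const
      exact measurableSet_lt (f := fun p : ℝ × ℝ => |p.1 - p.2|) (by fun_prop) measurable_const
    · intro t'
      simp_rw [hW, abs_sub_comm _ t']
      exact hone t'
  refine (add_le_add t1 t2).trans ?_
  have h3 : (2 : ENNReal) * ofReal (C * μ * K) * (ofReal (2 * K / A) * P * R) +
      2 * ofReal (C * μ * (K + 2)) * (ofReal (2 * K / A) * P * R) =
      (2 * (ofReal (C * μ * K) + ofReal (C * μ * (K + 2))) *
        ofReal (2 * K / A)) * P * R := by ring
  rw [h3]
  gcongr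
  rw [← ofReal_add (by positivity) (by positivity),
    show (2 : ENNReal) = ofReal 2 by simp, ← ofReal_mul (by norm_num),
    ← ofReal_mul (by positivity)]
  apply ofReal_le_ofReal
  rw [show 2 * (C * μ * K + C * μ * (K + 2)) * (2 * K / A) =
    (4 * K * C * (2 * K + 2)) * μ / A by ring]
  gcongr
  linarith


variable {g : ℝ → ℂ}

/-- The correlation of a function with its translates along the curve. -/
def corr (A : ℝ) (q ζ : ℝ → ℝ) (g : ℝ → ℂ) (x τ : ℝ) : ℂ :=
  ∫ t, ((ζ t * ζ (t + τ) : ℝ) : ℂ) * (g (x - q t) * conj (g (x + A * τ - q (t + τ))))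

theorem integral_cutoff_prod4_fiber (x τ : ℝ) :
    ∫ z : ℝ × ℝ, cutoff w ζ s (x, τ, z) • selfProd A q g g (x, τ, z) =
      ((w (x - s) * τ ^ 2 * ‖corr A q ζ g x τ‖ ^ 2 : ℝ) : ℂ) := by
  set κ : ℝ → ℂ := fun t => ((ζ t * ζ (t + τ) : ℝ) : ℂ) *
    (g (x - q t) * conj (g (x + A * τ - q (t + τ)))) with hκ
  have e : ∀ z : ℝ × ℝ, cutoff w ζ s (x, τ, z) • selfProd A q g g (x, τ, z) =
      ((w (x - s) * τ ^ 2 : ℝ) : ℂ) * (κ z.1 * conj (κ z.2)) := by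
    intro z
    simp only [cutoff, selfProd, prod4, ptY, ptY', ptZ, ptZ', hκ, real_smul, map_mul,
      Complex.conj_ofReal, Complex.conj_conj]
    push_cast
    ring
  simp_rw [e]
  rw [integral_const_mul, Measure.volume_eq_prod, integral_prod_mul κ fun t => conj (κ t),
    integral_conj]
  change _ * (corr A q ζ g x τ * conj (corr A q ζ g x τ)) = _
  rw [Complex.mul_conj, normSq_eq_norm_sq]
  push_cast
  ring

theorem lintegral_corr_sq_le (hq : 𝓢q) (hζ : Amplitude K l r ζ ζ')
    (hw : Window K w w') (hw0 : ∀ t, 0 ≤ w t) (hg : ContDiff ℝ 1 g) :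
    ∫⁻ x, ∫⁻ τ, ofReal (w (x - s) * τ ^ 2) * ‖corr A q ζ g x τ‖ₑ ^ 2 ≤
      ‖∫ p, cutoff w ζ s p • selfProd A q g g p‖ₑ := by
  have hgc : ContDiff ℝ 1 fun x => conj (g x) := Complex.conjCLE.contDiff.comp hg
  have hintg := integrable_cutoff_smul (s := s) hq.length hζ hw
    (contDiffOn_prod4 (A := A) hq le_rfl hg hgc hgc hg).continuousOn
  rw [Measure.volume_eq_prod] at hintg ⊢
  rw [integral_prod _ hintg]
  set F : ℝ → ℝ → ℝ := fun x τ => w (x - s) * τ ^ 2 * ‖corr A q ζ g x τ‖ ^ 2 with hF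
  have hF0 : ∀ x τ, 0 ≤ F x τ := fun x τ => by
    have := hw0 (x - s); positivity
  have hfib : ∀ᵐ x, Integrable (F x) ∧
      ∫ y : ℝ × ℝ × ℝ, cutoff w ζ s (x, y) • selfProd A q g g (x, y) =
      ((∫ τ, F x τ : ℝ) : ℂ) := by
    filter_upwards [hintg.prod_right_ae] with x hx
    rw [Measure.volume_eq_prod] at hx ⊢
    have h1 := hx.integral_prod_left
    rw [integral_prod _ hx]
    simp_rw [integral_cutoff_prod4_fiber] at h1 ⊢
    refine ⟨h1.re, ?_⟩
    exact integral_ofReal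
  have hI := hintg.integral_prod_left
  have e : (fun x => ∫ y : ℝ × ℝ × ℝ, cutoff w ζ s (x, y) • selfProd A q g g (x, y)) =ᵐ[volume]
      fun x => ((∫ τ, F x τ : ℝ) : ℂ) := hfib.mono fun x hx => hx.2
  rw [integral_congr_ae e]
  have hI' := (integrable_congr e).1 hI
  have hI2 : Integrable fun x => ∫ τ, F x τ := hI'.re
  rw [show ∫ x, ((∫ τ, F x τ : ℝ) : ℂ) = ((∫ x, ∫ τ, F x τ : ℝ) : ℂ) from integral_ofReal,
    ← ofReal_norm, Complex.norm_of_nonneg (integral_nonneg fun x => integral_nonneg (hF0 x)),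
    ofReal_integral_eq_lintegral_ofReal hI2 (.of_forall fun x => integral_nonneg (hF0 x))]
  refine lintegral_mono_ae ?_
  filter_upwards [hfib] with x hx
  rw [ofReal_integral_eq_lintegral_ofReal hx.1 (.of_forall (hF0 x))]
  refine lintegral_mono fun τ => ?_
  simp only [hF]
  have := hw0 (x - s)
  rw [ofReal_mul (q := ‖corr A q ζ g x τ‖ ^ 2) (by positivity), ← ofReal_norm,
    ofReal_pow (norm_nonneg _)]

/-- A fixed smooth window. -/
def stdBump : ContDiffBump (0 : ℝ) := ⟨1, 2, one_pos, one_lt_two⟩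

theorem exists_window : ∃ K₀ : ℝ, ∀ K, K₀ ≤ K → Window K stdBump (deriv stdBump) := by
  have hc : ContDiff ℝ 1 (stdBump : ℝ → ℝ) := stdBump.contDiff
  have hcd : Continuous (deriv stdBump) := hc.continuous_deriv le_rfl
  obtain ⟨M, hM⟩ := hcd.bounded_above_of_compact_support stdBump.hasCompactSupport.deriv
  refine ⟨max 1 M, fun K hK => ⟨fun t => (hc.differentiable (by norm_num) t).hasDerivAt, hcd,
    fun t => ?_, fun t => (hM t).trans ((le_max_right _ _).trans hK), fun t ht => ?_⟩⟩
  · rw [abs_of_nonneg stdBump.nonneg]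
    exact stdBump.le_one.trans ((le_max_left _ _).trans hK)
  · exact stdBump.zero_of_le_dist (by simpa [stdBump] using ht.le)


theorem measurable_corr (hqm : Measurable q) (hζ : Measurable ζ) (hg : Measurable g) :
    Measurable fun z : ℝ × ℝ => corr A q ζ g z.1 z.2 := by
  have hc : Measurable (starRingEnd ℂ) := Complex.continuous_conj.measurable
  have h : Measurable fun p : (ℝ × ℝ) × ℝ => ((ζ p.2 * ζ (p.2 + p.1.2) : ℝ) : ℂ) *
      (g (p.1.1 - q p.2) * conj (g (p.1.1 + A * p.1.2 - q (p.2 + p.1.2)))) := by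
    fun_prop
  exact h.stronglyMeasurable.integral_prod_right.measurable

theorem Amplitude_continuous (hζ : Amplitude K l r ζ ζ') : Continuous ζ :=
  continuous_iff_continuousAt.2 fun t => (hζ.hasDeriv t).continuousAt

theorem Amplitude_eq_zero (hζ : Amplitude K l r ζ ζ') {t : ℝ} (ht : t ∉ Ioo l r) : ζ t = 0 :=
  image_eq_zero_of_notMem_tsupport fun h => ht (hζ.supp h)

theorem corr_eq_zero (hK : r - l ≤ K) (hζ : Amplitude K l r ζ ζ') {x τ : ℝ} (hτ : K < |τ|) :
    corr A q ζ g x τ = 0 := by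
  rw [corr, ← integral_zero ℝ ℂ]
  congr 1
  ext t
  by_cases h1 : t ∈ Ioo l r
  · by_cases h2 : t + τ ∈ Ioo l r
    · exfalso
      have : |τ| ≤ K := by
        rw [abs_le]; constructor <;> linarith [h1.1, h1.2, h2.1, h2.2]
      linarith
    · simp [Amplitude_eq_zero hζ h2]
  · simp [Amplitude_eq_zero hζ h1]

theorem lintegral_corr_le (hK0 : 0 ≤ K) (hK : r - l ≤ K) (hqm : Measurable q)
    (hζ : Amplitude K l r ζ ζ') (hg : Measurable g) (τ : ℝ) :
    ∫⁻ x, ‖corr A q ζ g x τ‖ₑ ≤ ofReal (K ^ 3) * ∫⁻ x, ‖g x‖ₑ ^ 2 := by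
  have hζm := (Amplitude_continuous hζ).measurable
  set N := ∫⁻ x, ‖g x‖ₑ ^ 2 with hN
  calc _ ≤ ∫⁻ x, ∫⁻ t, (Ioo l r).indicator (fun _ => ofReal (K ^ 2)) t *
        (‖g (x - q t)‖ₑ * ‖g (x - (q (t + τ) - A * τ))‖ₑ) := by
        refine lintegral_mono fun x => (enorm_integral_le_lintegral_enorm _).trans
          (lintegral_mono fun t => ?_)
        rw [enorm_mul, enorm_mul, show ‖conj (g (x + A * τ - q (t + τ)))‖ₑ =
          ‖g (x - (q (t + τ) - A * τ))‖ₑ by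
            rw [RCLike.enorm_conj]; congr 2; ring]
        gcongr
        by_cases h1 : t ∈ Ioo l r
        · rw [indicator_of_mem h1, ← ofReal_norm, norm_real, norm_eq_abs, abs_mul,
            sq]
          gcongr <;> apply hζ.bound0
        · simp [Amplitude_eq_zero hζ h1]
    _ = ∫⁻ t, ∫⁻ x, (Ioo l r).indicator (fun _ => ofReal (K ^ 2)) t *
        (‖g (x - q t)‖ₑ * ‖g (x - (q (t + τ) - A * τ))‖ₑ) := by
        refine lintegral_lintegral_swap ?_
        have : Measurable ((Ioo l r).indicator fun _ : ℝ => ofReal (K ^ 2)) :=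
          measurable_const.indicator measurableSet_Ioo
        fun_prop
    _ ≤ ∫⁻ t, (Ioo l r).indicator (fun _ => ofReal (K ^ 2)) t * N := by
        refine lintegral_mono fun t => ?_
        rw [lintegral_const_mul _ (by fun_prop)]
        gcongr
        refine ENNReal.le_of_sq_le_sq ?_
        rw [sq N]
        exact lintegral_translate_mul_le (g := fun x => ‖g x‖ₑ) (h := fun x => ‖g x‖ₑ)
          (by fun_prop) (by fun_prop) _ _
    _ ≤ _ := by
        rw [lintegral_mul_const _ (measurable_const.indicator measurableSet_Ioo),
          lintegral_indicator measurableSet_Ioo, setLIntegral_const, volume_Ioo,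
          ← ofReal_mul (by positivity)]
        gcongr
        rw [pow_succ K 2]
        gcongr

/-- The correlation estimate with the weight `|τ|`. -/
theorem exists_weighted_corr_bound : ∃ K₀ : ℝ, ∀ K, K₀ ≤ K → ∃ C, 0 < C ∧
    ∀ {l r A μ : ℝ} {q q₁ q₂ q₃ ζ ζ' : ℝ → ℝ} {g H : ℝ → ℂ},
    SmoothingCurve K l r q q₁ q₂ q₃ → Measurable q → Amplitude K l r ζ ζ' →
    4 * K ^ 8 ≤ A → 0 < μ → μ ≤ 1 → ContDiff ℝ 1 g →
    (∀ x, HasDerivAt (fun x => (μ : ℂ) ^ 8 * H x) (g x) x) → Measurable H →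
    (∫⁻ z : ℝ × ℝ, ofReal |z.2| * ‖corr A q ζ g z.1 z.2‖ₑ) ^ 2 ≤
      ofReal (C * μ) * (∫⁻ y, (‖g y‖ₑ ^ 2 + ‖H y‖ₑ ^ 2)) * ∫⁻ y, ‖g y‖ₑ ^ 2 := by
  obtain ⟨K₀, hK₀⟩ := exists_window
  refine ⟨K₀, fun K hKK => ?_⟩
  have hw := hK₀ K hKK
  obtain ⟨C, hC, hwin⟩ := exists_window_bound K
  refine ⟨1 + 4 * (2 * |K|) * C * (2 * (|K| + 1)) * (2 * (|K| + 2)), by positivity, ?_⟩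
  intro l r A μ q q₁ q₂ q₃ ζ ζ' g H hq hqm hζ hA hμ hμ1 hg hH hHm
  have hK := hq.one_le
  have hK8 : K ≤ K ^ 8 := le_self_pow₀ hK (by norm_num)
  have hA0 : 0 < A := by linarith
  rw [abs_of_pos (by linarith)]
  have hζm := (Amplitude_continuous hζ).measurable
  have hgm := hg.continuous.measurable
  have hcm := measurable_corr (A := A) hqm hζm hgm
  set w : ℝ → ENNReal := fun t => ofReal (stdBump t) with hwdef
  have hwm : Measurable w := stdBump.continuous.measurable.ennreal_ofReal
  set cw := ∫⁻ t, w t with hcw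
  have hcw1 : 1 ≤ cw := by
    calc (1 : ENNReal) ≤ volume (Icc (-1 : ℝ) 1) := by
          rw [volume_Icc]; simp
      _ = ∫⁻ t, (Icc (-1 : ℝ) 1).indicator 1 t := (lintegral_indicator_one measurableSet_Icc).symm
      _ ≤ _ := by
          refine lintegral_mono fun t => ?_
          by_cases h : t ∈ Icc (-1 : ℝ) 1
          · rw [indicator_of_mem h, hwdef]
            dsimp only
            rw [stdBump.one_of_mem_closedBall (by simpa [stdBump, abs_le] using h)]
            simp
          · simp [h]
  have hcw4 : cw ≤ 4 := by
    calc _ ≤ ∫⁻ t, (Icc (-2 : ℝ) 2).indicator 1 t := by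
          refine lintegral_mono fun t => ?_
          by_cases h : t ∈ Icc (-2 : ℝ) 2
          · rw [indicator_of_mem h]
            exact ENNReal.ofReal_le_one.2 stdBump.le_one
          · have : 2 < |t| := by
              by_contra h'
              exact h (abs_le.1 (not_lt.1 h'))
            simp [hwdef, hw.supp t this]
      _ = 4 := by
          rw [lintegral_indicator_one measurableSet_Icc, volume_Icc]
          norm_num
  have hcwt : cw ≠ ⊤ := ne_top_of_le_ne_top (by simp) hcw4
  set Y : ℝ × ℝ → ENNReal := fun z => ofReal |z.2| * ‖corr A q ζ g z.1 z.2‖ₑ with hY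
  have hYm : Measurable Y := by fun_prop
  set φ : ℝ → ENNReal := fun y => ‖g y‖ₑ ^ 2 + ‖H y‖ₑ ^ 2 with hφ
  have hφm : Measurable φ := by fun_prop
  set b : ℝ → ENNReal := fun s => ∫⁻ z, w (z.1 - s) * Y z with hb
  have hbint : ∫⁻ s, b s = cw * ∫⁻ z, Y z := by
    simp only [hb]
    rw [lintegral_lintegral_swap (by fun_prop), ← lintegral_const_mul _ hYm]
    refine lintegral_congr fun z => ?_
    rw [lintegral_mul_const _ (by fun_prop), lintegral_sub_left_eq_self (fun s => w s) z.1]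
  have hbs : ∀ s, b s ^ 2 ≤ (cw * ofReal (2 * K) * ofReal (C * μ / A) *
      ∫⁻ y in Icc (s - (K + 1) * A) (s + (K + 1) * A), φ y) *
      ∫⁻ y in Icc (s - (K + 2)) (s + (K + 2)), ‖g y‖ₑ ^ 2 := by
    intro s
    have h1 := sq_lintegral_le (μ := (volume : Measure (ℝ × ℝ))) (b := fun z => w (z.1 - s) * Y z)
      (u := fun z => w (z.1 - s) * (Icc (-K) K).indicator 1 z.2)
      (v := fun z => w (z.1 - s) * Y z ^ 2) (by fun_prop) (by fun_prop) (.of_forall fun z => by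
        by_cases h : z.2 ∈ Icc (-K) K
        · rw [indicator_of_mem h, Pi.one_apply]
          exact le_of_eq (by ring)
        · have : K < |z.2| := by
            by_contra h'
            exact h (abs_le.1 (not_lt.1 h'))
          simp [hY, corr_eq_zero hq.length hζ this])
    have h2 : ∫⁻ z : ℝ × ℝ, w (z.1 - s) * (Icc (-K) K).indicator 1 z.2 =
        cw * ofReal (2 * K) := by
      rw [Measure.volume_eq_prod, lintegral_prod_mul (f := fun x => w (x - s)) (by fun_prop)
        (by fun_prop), lintegral_sub_right_eq_self (fun x => w x),
        lintegral_indicator_one measurableSet_Icc, volume_Icc]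
      congr 2; ring
    have h3 : ∫⁻ z : ℝ × ℝ, w (z.1 - s) * Y z ^ 2 ≤ ofReal (C * μ / A) *
        (∫⁻ y in Icc (s - (K + 1) * A) (s + (K + 1) * A), φ y) *
        ∫⁻ y in Icc (s - (K + 2)) (s + (K + 2)), ‖g y‖ₑ ^ 2 := by
      refine le_trans (le_of_eq ?_) ((lintegral_corr_sq_le (s := s) hq hζ hw
        (fun _ => stdBump.nonneg) hg).trans (hwin hq hqm hζ hw hA hμ hμ1 hg hH))
      rw [Measure.volume_eq_prod, lintegral_prod _ (by fun_prop)]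
      refine lintegral_congr fun x => lintegral_congr fun τ => ?_
      simp only [hY, hwdef]
      rw [mul_pow, ← ofReal_pow (abs_nonneg _), sq_abs, ← mul_assoc,
        ← ofReal_mul stdBump.nonneg]
    exact h1.trans ((mul_le_mul' h2.le h3).trans (le_of_eq (by ring)))
  have h1 := sq_lintegral_le (μ := (volume : Measure ℝ)) (b := b)
    (((measurable_setLIntegral_Icc hφm ((K + 1) * A)).const_mul _).aemeasurable)
    ((measurable_setLIntegral_Icc (φ := fun y => ‖g y‖ₑ ^ 2) (by fun_prop) (K + 2)).aemeasurable)
    (.of_forall hbs)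
  rw [hbint, lintegral_const_mul _ (measurable_setLIntegral_Icc hφm _),
    lintegral_setLIntegral_Icc hφm, lintegral_setLIntegral_Icc (by fun_prop)] at h1
  calc _ ≤ (cw * ∫⁻ z, Y z) ^ 2 := by
        gcongr
        exact le_mul_of_one_le_left zero_le hcw1
    _ ≤ _ := h1
    _ = (cw * (ofReal (2 * K) * ofReal (C * μ / A) *
        ofReal (2 * ((K + 1) * A)) * ofReal (2 * (K + 2)))) * (∫⁻ y, φ y) *
        ∫⁻ y, ‖g y‖ₑ ^ 2 := by ring
    _ ≤ _ := by
        gcongr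
        calc _ ≤ ofReal 4 * (ofReal (2 * K) * ofReal (C * μ / A) *
            ofReal (2 * ((K + 1) * A)) * ofReal (2 * (K + 2))) := by
              gcongr
              simpa using hcw4
          _ = ofReal (4 * (2 * K) * C * (2 * (K + 1)) * (2 * (K + 2)) * μ) := by
              rw [← ofReal_mul (by positivity), ← ofReal_mul (by positivity),
                ← ofReal_mul (by positivity), ← ofReal_mul (by positivity)]
              congr 1
              field_simp
          _ ≤ _ := by
              apply ofReal_le_ofReal
              gcongr
              linarith

theorem exists_corr_bound : ∃ K₀ : ℝ, ∀ K, K₀ ≤ K → ∃ C, 0 < C ∧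
    ∀ {l r A ρ : ℝ} {q q₁ q₂ q₃ ζ ζ' : ℝ → ℝ} {g H : ℝ → ℂ},
    SmoothingCurve K l r q q₁ q₂ q₃ → Measurable q → Amplitude K l r ζ ζ' →
    4 * K ^ 8 ≤ A → 0 < ρ → ρ ≤ 1 → ContDiff ℝ 1 g →
    (∀ x, HasDerivAt (fun x => (ρ : ℂ) ^ 32 * H x) (g x) x) → Measurable H →
    ∫⁻ y, ‖H y‖ₑ ^ 2 ≤ ofReal (K ^ 2) * ∫⁻ y, ‖g y‖ₑ ^ 2 →
    ∫⁻ z : ℝ × ℝ, ‖corr A q ζ g z.1 z.2‖ₑ ≤ ofReal (C * ρ) * ∫⁻ y, ‖g y‖ₑ ^ 2 := by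
  obtain ⟨K₀, hK₀⟩ := exists_weighted_corr_bound
  refine ⟨K₀, fun K hKK => ?_⟩
  obtain ⟨C, hC, hwt⟩ := hK₀ K hKK
  set D := C * (1 + K ^ 2) with hD
  refine ⟨2 * |K| ^ 3 + √D, by positivity, ?_⟩
  intro l r A ρ q q₁ q₂ q₃ ζ ζ' g H hq hqm hζ hA hρ hρ1 hg hH hHm hHg
  have hK := hq.one_le
  have hK0 : 0 < K := by linarith
  rw [abs_of_pos hK0]
  have hζm := (Amplitude_continuous hζ).measurable
  have hgm := hg.continuous.measurable
  have hcm := measurable_corr (A := A) hqm hζm hgm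
  set N := ∫⁻ y, ‖g y‖ₑ ^ 2 with hN
  have h1 := hwt (μ := ρ ^ 4) hq hqm hζ hA (by positivity) (pow_le_one₀ hρ.le hρ1) hg
    (by simpa [← pow_mul] using hH) hHm
  have h2 : ∫⁻ z : ℝ × ℝ, ofReal |z.2| * ‖corr A q ζ g z.1 z.2‖ₑ ≤
      ofReal (√D * ρ ^ 2) * N := by
    refine ENNReal.le_of_sq_le_sq (h1.trans ?_)
    rw [lintegral_add_left (by fun_prop)]
    calc _ ≤ ofReal (C * ρ ^ 4) * (N + ofReal (K ^ 2) * N) * N := by gcongr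
      _ = ofReal (C * ρ ^ 4) * (ofReal 1 + ofReal (K ^ 2)) * (N * N) := by
          simp; ring
      _ = _ := by
          rw [← ofReal_add (by norm_num) (by positivity),
            ← ofReal_mul (by positivity), mul_pow, ← sq,
            ← ofReal_pow (by positivity), mul_pow, sq_sqrt (by positivity)]
          congr 2
          rw [hD]; ring
  have hpt : ∀ z : ℝ × ℝ, ‖corr A q ζ g z.1 z.2‖ₑ ≤
      (Icc (-ρ) ρ).indicator 1 z.2 * ‖corr A q ζ g z.1 z.2‖ₑ +
        ofReal ρ⁻¹ * (ofReal |z.2| * ‖corr A q ζ g z.1 z.2‖ₑ) := by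
    intro z
    by_cases h : z.2 ∈ Icc (-ρ) ρ
    · simp [h]
    · have h' : ρ < |z.2| := by
        by_contra h'
        exact h (abs_le.1 (not_lt.1 h'))
      rw [← mul_assoc, ← ofReal_mul (by positivity)]
      refine le_add_left (le_mul_of_one_le_left zero_le ?_)
      rw [ENNReal.one_le_ofReal, inv_mul_eq_div, le_div_iff₀ hρ]
      linarith
  have h3 : ∫⁻ z : ℝ × ℝ, (Icc (-ρ) ρ).indicator 1 z.2 * ‖corr A q ζ g z.1 z.2‖ₑ ≤
      ofReal (2 * K ^ 3 * ρ) * N := by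
    rw [Measure.volume_eq_prod, lintegral_prod_symm' _ (by fun_prop)]
    calc _ = ∫⁻ τ, (Icc (-ρ) ρ).indicator 1 τ * ∫⁻ x, ‖corr A q ζ g x τ‖ₑ := by
          refine lintegral_congr fun τ => ?_
          dsimp only
          rw [lintegral_const_mul _ (by fun_prop)]
      _ ≤ ∫⁻ τ, (Icc (-ρ) ρ).indicator 1 τ * (ofReal (K ^ 3) * N) := by
          gcongr with τ
          exact lintegral_corr_le hK0.le hq.length hqm hζ hgm τ
      _ = _ := by
          rw [lintegral_mul_const _ (by fun_prop), lintegral_indicator_one measurableSet_Icc,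
            volume_Icc, ← mul_assoc, ← ofReal_mul (by linarith)]
          congr 2; ring
  calc _ ≤ _ := lintegral_mono hpt
    _ = (∫⁻ z : ℝ × ℝ, (Icc (-ρ) ρ).indicator 1 z.2 * ‖corr A q ζ g z.1 z.2‖ₑ) +
        ofReal ρ⁻¹ * ∫⁻ z : ℝ × ℝ, ofReal |z.2| * ‖corr A q ζ g z.1 z.2‖ₑ := by
        rw [lintegral_add_left (by fun_prop), lintegral_const_mul _ (by fun_prop)]
    _ ≤ ofReal (2 * K ^ 3 * ρ) * N +
        ofReal ρ⁻¹ * (ofReal (√D * ρ ^ 2) * N) := by gcongr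
    _ = _ := by
        rw [← mul_assoc, ← ofReal_mul (by positivity), ← add_mul,
          ← ofReal_add (by positivity) (by positivity)]
        congr 2
        field_simp

/-- The integrand of the dual operator. -/
def dualInt (A : ℝ) (q ζ : ℝ → ℝ) (h g : ℝ → ℂ) (y s : ℝ) : ℂ :=
  (ζ s : ℂ) * (h (y + A * s) * g (y + A * s - q s))

theorem measurable_dualInt {h : ℝ → ℂ} (hqm : Measurable q) (hζ : Measurable ζ) (hh : Measurable h)
    (hg : Measurable g) : Measurable fun p : ℝ × ℝ => dualInt A q ζ h g p.1 p.2 := by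
  unfold dualInt
  fun_prop

theorem lintegral_dualInt_sq_le {h : ℝ → ℂ} (hK0 : 0 ≤ K) (hK : r - l ≤ K) (hqm : Measurable q)
    (hζ : Amplitude K l r ζ ζ') (hh : ∀ x, ‖h x‖ₑ ≤ 1) (hg : Measurable g) :
    ∫⁻ y, (∫⁻ s, ‖dualInt A q ζ h g y s‖ₑ) ^ 2 ≤ ofReal (K ^ 4) * ∫⁻ x, ‖g x‖ₑ ^ 2 := by
  set u : ℝ → ENNReal := (Ioo l r).indicator 1 with hu
  have hv : ∫⁻ s, u s ≤ ofReal K := by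
    rw [lintegral_indicator_one measurableSet_Ioo, volume_Ioo]
    exact ofReal_le_ofReal hK
  have hpt : ∀ y, (∫⁻ s, ‖dualInt A q ζ h g y s‖ₑ) ^ 2 ≤
      ofReal (K ^ 3) * ∫⁻ s, u s * ‖g (y + A * s - q s)‖ₑ ^ 2 := by
    intro y
    have := sq_lintegral_le (μ := volume) (b := fun s => ‖dualInt A q ζ h g y s‖ₑ)
      (u := fun s => ofReal (K ^ 2) * u s) (v := fun s => u s * ‖g (y + A * s - q s)‖ₑ ^ 2)
      (by fun_prop) (by fun_prop) (.of_forall fun s => ?_)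
    · refine this.trans ?_
      gcongr
      rw [lintegral_const_mul _ (by fun_prop), pow_succ K 2, ofReal_mul (by positivity)]
      gcongr
    · by_cases hs : s ∈ Ioo l r
      · simp only [hu, indicator_of_mem hs, Pi.one_apply, one_mul, mul_one]
        rw [dualInt, enorm_mul, enorm_mul, mul_pow, ofReal_pow hK0]
        gcongr
        · rw [← ofReal_norm, norm_real]
          exact ofReal_le_ofReal (hζ.bound0 s)
        · exact mul_le_of_le_one_left zero_le (hh _)
      · simp [dualInt, Amplitude_eq_zero hζ hs]
  calc _ ≤ ∫⁻ y, ofReal (K ^ 3) * ∫⁻ s, u s * ‖g (y + A * s - q s)‖ₑ ^ 2 :=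
        lintegral_mono hpt
    _ = ofReal (K ^ 3) * ∫⁻ s, ∫⁻ y, u s * ‖g (y + A * s - q s)‖ₑ ^ 2 := by
        rw [lintegral_const_mul' _ _ ofReal_ne_top, lintegral_lintegral_swap (by fun_prop)]
    _ = ofReal (K ^ 3) * ∫⁻ s, u s * ∫⁻ x, ‖g x‖ₑ ^ 2 := by
        congr 1
        refine lintegral_congr fun s => ?_
        rw [lintegral_const_mul _ (by fun_prop)]
        simp_rw [add_sub_assoc]
        rw [lintegral_add_right_eq_self (fun y => ‖g y‖ₑ ^ 2)]
    _ ≤ _ := by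
        rw [lintegral_mul_const _ (by fun_prop), ← mul_assoc, pow_succ K 3,
          ofReal_mul (by positivity)]
        gcongr

/-- The shear used to reduce the dual operator to the correlation. -/
theorem measurePreserving_shear (A : ℝ) :
    MeasurePreserving (fun p : (ℝ × ℝ) × ℝ => ((p.1.2, p.1.2 + p.1.1), p.2 - A * p.1.2))
      (((volume : Measure ℝ).prod volume).prod volume)
      (((volume : Measure ℝ).prod volume).prod volume) := by
  refine MeasurePreserving.skew_product (f := fun p : ℝ × ℝ => (p.2, p.2 + p.1))
    (g := fun p x => x - A * p.2) ?_ (by fun_prop) (.of_forall fun p => ?_)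
  · exact (measurePreserving_prod_add (volume : Measure ℝ) volume).comp
      (Measure.measurePreserving_swap (μ := (volume : Measure ℝ)) (ν := volume))
  · exact (measurePreserving_sub_right volume (A * p.2)).map_eq

theorem lintegral_dual_sq_le {h : ℝ → ℂ} (hK0 : 0 ≤ K) (hK : r - l ≤ K) (hqm : Measurable q)
    (hζ : Amplitude K l r ζ ζ') (hhm : Measurable h) (hh : ∀ x, ‖h x‖ₑ ≤ 1) (hg : Measurable g)
    (hg2 : ∫⁻ x, ‖g x‖ₑ ^ 2 < ⊤) :
    ∫⁻ y, ‖∫ s, dualInt A q ζ h g y s‖ₑ ^ 2 ≤ ∫⁻ z : ℝ × ℝ, ‖corr A q ζ g z.1 z.2‖ₑ := by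
  have hc : Measurable (starRingEnd ℂ) := Complex.continuous_conj.measurable
  have hζm := (Amplitude_continuous hζ).measurable
  have ham := measurable_dualInt (A := A) hqm hζm hhm hg
  set a := dualInt A q ζ h g with ha
  set G : ℝ → ℂ := fun y => ∫ s, a y s with hG
  set Φ : (ℝ × ℝ) × ℝ → ℂ := fun p => a p.2 p.1.1 * conj (a p.2 p.1.2) with hΦ
  have hΦm : Measurable Φ := by fun_prop
  have hfin := lintegral_dualInt_sq_le (A := A) hK0 hK hqm hζ hh hg
  have hΦi : Integrable Φ (((volume : Measure ℝ).prod volume).prod volume) := by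
    refine ⟨hΦm.aestronglyMeasurable, ?_⟩
    rw [HasFiniteIntegral, lintegral_prod_symm' _ (by fun_prop)]
    refine lt_of_eq_of_lt ?_ (hfin.trans_lt (ENNReal.mul_lt_top ofReal_lt_top hg2))
    refine lintegral_congr fun y => ?_
    have hay : AEMeasurable (fun s => ‖dualInt A q ζ h g y s‖ₑ) :=
      (ham.comp (measurable_prodMk_left (x := y))).enorm.aemeasurable
    rw [sq, ← lintegral_prod_mul hay hay]
    refine lintegral_congr fun z => ?_
    rw [hΦ]
    dsimp only
    rw [enorm_mul, RCLike.enorm_conj]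
  have hslice : ∀ y, ∫ z : ℝ × ℝ, Φ (z, y) ∂((volume : Measure ℝ).prod volume) =
      ((‖G y‖ ^ 2 : ℝ) : ℂ) := by
    intro y
    simp only [hΦ]
    rw [integral_prod_mul (fun s => a y s) (fun s => conj (a y s)), integral_conj, Complex.mul_conj,
      normSq_eq_norm_sq]
  have e1 : ∫ p, Φ p ∂(((volume : Measure ℝ).prod volume).prod volume) =
      ((∫ y, ‖G y‖ ^ 2 : ℝ) : ℂ) := by
    rw [integral_prod_symm _ hΦi]
    simp_rw [hslice]
    exact integral_ofReal
  have hGi : Integrable fun y => ‖G y‖ ^ 2 := by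
    have := hΦi.integral_prod_right
    simp_rw [hslice] at this
    exact this.re
  have hmp := measurePreserving_shear A
  have hΨi : Integrable (fun p : (ℝ × ℝ) × ℝ => Φ ((p.1.2, p.1.2 + p.1.1), p.2 - A * p.1.2))
      (((volume : Measure ℝ).prod volume).prod volume) := hmp.integrable_comp_of_integrable hΦi
  have e2 : ∫ p, Φ p ∂(((volume : Measure ℝ).prod volume).prod volume) =
      ∫ p : (ℝ × ℝ) × ℝ, Φ ((p.1.2, p.1.2 + p.1.1), p.2 - A * p.1.2)
        ∂(((volume : Measure ℝ).prod volume).prod volume) := by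
    conv_lhs => rw [← hmp.map_eq]
    exact integral_map hmp.measurable.aemeasurable hΦm.aestronglyMeasurable
  have e3 : ∀ x τ, ∫ s, Φ ((s, s + τ), x - A * s) =
      h x * conj (h (x + A * τ)) * corr A q ζ g x τ := by
    intro x τ
    rw [corr, ← integral_const_mul]
    congr 1
    ext s
    simp only [hΦ, ha, dualInt, map_mul, Complex.conj_ofReal, sub_add_cancel,
      show x - A * s + A * (s + τ) = x + A * τ by ring]
    push_cast
    ring
  calc ∫⁻ y, ‖G y‖ₑ ^ 2 = ofReal (∫ y, ‖G y‖ ^ 2) := by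
        rw [ofReal_integral_eq_lintegral_ofReal hGi (.of_forall fun y => by positivity)]
        refine lintegral_congr fun y => ?_
        rw [ofReal_pow (norm_nonneg _), ofReal_norm]
    _ = ‖∫ p, Φ p ∂(((volume : Measure ℝ).prod volume).prod volume)‖ₑ := by
        rw [e1, ← ofReal_norm, Complex.norm_of_nonneg (integral_nonneg fun y => by positivity)]
    _ ≤ ∫⁻ x, ‖∫ z : ℝ × ℝ, Φ ((z.2, z.2 + z.1), x - A * z.2)
          ∂((volume : Measure ℝ).prod volume)‖ₑ := by
        rw [e2, integral_prod_symm _ hΨi]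
        exact enorm_integral_le_lintegral_enorm _
    _ ≤ ∫⁻ x, ∫⁻ τ, ‖corr A q ζ g x τ‖ₑ := by
        refine lintegral_mono_ae ?_
        filter_upwards [hΨi.prod_left_ae] with x hx
        rw [integral_prod _ hx]
        refine (enorm_integral_le_lintegral_enorm _).trans (lintegral_mono fun τ => ?_)
        rw [e3, enorm_mul, enorm_mul, RCLike.enorm_conj]
        refine mul_le_of_le_one_left zero_le (mul_le_one' (hh _) (hh _))
    _ = _ := by
        rw [Measure.volume_eq_prod, lintegral_prod]
        exact (measurable_corr hqm hζm hg).enorm.aemeasurable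

variable {f : ℝ → ℂ}

/-- The unimodular multiplier realizing the absolute value. -/
def csign (z : ℂ) : ℂ := conj z * ((‖z‖⁻¹ : ℝ) : ℂ)

theorem csign_mul (z : ℂ) : csign z * z = ((‖z‖ : ℝ) : ℂ) := by
  by_cases h : ‖z‖ = 0
  · rw [norm_eq_zero] at h; simp [csign, h]
  · rw [csign, mul_right_comm, mul_comm (conj z), Complex.mul_conj, normSq_eq_norm_sq,
      ← Complex.ofReal_mul]
    congr 1
    field_simp

theorem enorm_csign_le (z : ℂ) : ‖csign z‖ₑ ≤ 1 := by
  rw [← ofReal_norm, ENNReal.ofReal_le_one, csign, norm_mul, RCLike.norm_conj, norm_real,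
    norm_inv, norm_norm]
  exact mul_inv_le_one

theorem measurable_csign : Measurable csign := by
  have hc : Measurable (starRingEnd ℂ) := Complex.continuous_conj.measurable
  unfold csign
  fun_prop

/-- The normalized one-scale operator. -/
def oneScale (A : ℝ) (q ζ : ℝ → ℝ) (f g : ℝ → ℂ) (x : ℝ) : ℂ :=
  ∫ s, (ζ s : ℂ) * (f (x - A * s) * g (x - q s))

theorem sq_lintegral_oneScale_le (hK0 : 0 ≤ K) (hK : r - l ≤ K) (hqm : Measurable q)
    (hζ : Amplitude K l r ζ ζ') (hfm : Measurable f) (hg : Measurable g)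
    (hf2 : ∫⁻ x, ‖f x‖ₑ ^ 2 < ⊤) (hg2 : ∫⁻ x, ‖g x‖ₑ ^ 2 < ⊤) :
    (∫⁻ x, ‖oneScale A q ζ f g x‖ₑ) ^ 2 ≤
      (∫⁻ x, ‖f x‖ₑ ^ 2) * ∫⁻ z : ℝ × ℝ, ‖corr A q ζ g z.1 z.2‖ₑ := by
  have hζm := (Amplitude_continuous hζ).measurable
  have hΘm : Measurable fun p : ℝ × ℝ => (ζ p.2 : ℂ) * (f (p.1 - A * p.2) * g (p.1 - q p.2)) := by
    fun_prop
  have hTm : Measurable (oneScale A q ζ f g) :=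
    hΘm.stronglyMeasurable.integral_prod_right.measurable
  set T := oneScale A q ζ f g with hT
  set h : ℝ → ℂ := fun x => csign (T x) with hh
  have hhm : Measurable h := measurable_csign.comp hTm
  have hh1 : ∀ x, ‖h x‖ₑ ≤ 1 := fun x => enorm_csign_le _
  set G : ℝ → ℂ := fun y => ∫ s, dualInt A q ζ h g y s with hG
  have hGm : Measurable G :=
    (measurable_dualInt hqm hζm hhm hg).stronglyMeasurable.integral_prod_right.measurable
  set Ψ : ℝ × ℝ → ℂ := fun p => (ζ p.1 : ℂ) * (f (p.2 - A * p.1) * g (p.2 - q p.1)) * h p.2 with hΨ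
  have hΨm : Measurable Ψ := by fun_prop
  have hΨi : Integrable Ψ ((volume : Measure ℝ).prod volume) := by
    refine ⟨hΨm.aestronglyMeasurable, ?_⟩
    rw [HasFiniteIntegral, lintegral_prod _ (by fun_prop)]
    have hB : ((∫⁻ x, ‖f x‖ₑ ^ 2) * ∫⁻ x, ‖g x‖ₑ ^ 2) < ⊤ := ENNReal.mul_lt_top hf2 hg2
    set B := (∫⁻ x, ‖f x‖ₑ ^ 2) * ∫⁻ x, ‖g x‖ₑ ^ 2
    calc _ ≤ ∫⁻ s, (Ioo l r).indicator (fun _ => ofReal K) s * (B + 1) := by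
          refine lintegral_mono fun s => ?_
          by_cases hs : s ∈ Ioo l r
          · rw [indicator_of_mem hs]
            calc _ ≤ ∫⁻ x, ofReal K * (‖f (x - A * s)‖ₑ * ‖g (x - q s)‖ₑ) := by
                  refine lintegral_mono fun x => ?_
                  simp only [hΨ]
                  rw [enorm_mul, enorm_mul, enorm_mul]
                  refine (mul_le_of_le_one_right zero_le (hh1 x)).trans ?_
                  gcongr
                  rw [← ofReal_norm, norm_real]
                  exact ofReal_le_ofReal (hζ.bound0 s)
              _ = ofReal K * ∫⁻ x, ‖f (x - A * s)‖ₑ * ‖g (x - q s)‖ₑ :=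
                  lintegral_const_mul' _ _ ofReal_ne_top
              _ ≤ _ := by
                  gcongr
                  refine ENNReal.le_of_sq_le_sq ((lintegral_translate_mul_le
                    (g := fun x => ‖f x‖ₑ) (h := fun x => ‖g x‖ₑ) (by fun_prop) (by fun_prop)
                    (A * s) (q s)).trans ?_)
                  change B ≤ (B + 1) ^ 2
                  calc B ≤ (B + 1) * 1 := by rw [mul_one]; exact le_self_add
                    _ ≤ (B + 1) * (B + 1) := by gcongr; exact le_add_self
                    _ = _ := by ring
          · simp [hΨ, Amplitude_eq_zero hζ hs]
      _ = ofReal K * volume (Ioo l r) * (B + 1) := by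
          rw [lintegral_mul_const _ (measurable_const.indicator measurableSet_Ioo),
            lintegral_indicator measurableSet_Ioo, setLIntegral_const]
      _ < ⊤ := by
          rw [volume_Ioo]
          exact ENNReal.mul_lt_top (ENNReal.mul_lt_top ofReal_lt_top ofReal_lt_top)
            (by simpa using hB)
  have hslice : ∀ x, ∫ s, Ψ (s, x) = ((‖T x‖ : ℝ) : ℂ) := by
    intro x
    simp only [hΨ]
    rw [integral_mul_const, ← csign_mul, mul_comm]
    rfl
  have e1 : ∫ p, Ψ p ∂((volume : Measure ℝ).prod volume) = ((∫ x, ‖T x‖ : ℝ) : ℂ) := by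
    rw [integral_prod_symm _ hΨi]
    simp_rw [hslice]
    exact integral_ofReal
  have hTi : Integrable fun x => ‖T x‖ := by
    have := hΨi.integral_prod_right
    simp_rw [hslice] at this
    exact this.re
  have hmp : MeasurePreserving (fun p : ℝ × ℝ => (p.1, p.2 + A * p.1))
      ((volume : Measure ℝ).prod volume) ((volume : Measure ℝ).prod volume) :=
    MeasurePreserving.skew_product (f := fun s : ℝ => s) (g := fun s y => y + A * s)
      (MeasurePreserving.id _) (by fun_prop)
      (.of_forall fun s => (measurePreserving_add_right volume (A * s)).map_eq)
  have e2 : ∫ p, Ψ p ∂((volume : Measure ℝ).prod volume) = ∫ y, f y * G y := by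
    conv_lhs => rw [← hmp.map_eq]
    rw [integral_map hmp.measurable.aemeasurable hΨm.aestronglyMeasurable, integral_prod_symm]
    · congr 1
      ext y
      rw [hG, ← integral_const_mul]
      congr 1
      ext s
      simp only [hΨ, dualInt, add_sub_cancel_right]
      ring
    · exact hmp.integrable_comp_of_integrable hΨi
  have e3 : ∫⁻ x, ‖T x‖ₑ ≤ ∫⁻ y, ‖f y‖ₑ * ‖G y‖ₑ := by
    calc ∫⁻ x, ‖T x‖ₑ = ofReal (∫ x, ‖T x‖) := by
          rw [ofReal_integral_eq_lintegral_ofReal hTi (.of_forall fun y => norm_nonneg _)]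
          simp_rw [ofReal_norm]
      _ = ‖∫ y, f y * G y‖ₑ := by
          rw [← e2, e1, ← ofReal_norm,
            Complex.norm_of_nonneg (integral_nonneg fun y => norm_nonneg _)]
      _ ≤ _ := (enorm_integral_le_lintegral_enorm _).trans
          (lintegral_mono fun y => (enorm_mul _ _).le)
  calc _ ≤ (∫⁻ y, ‖f y‖ₑ * ‖G y‖ₑ) ^ 2 := by gcongr
    _ ≤ (∫⁻ y, ‖f y‖ₑ ^ 2) * ∫⁻ y, ‖G y‖ₑ ^ 2 :=
        sq_lintegral_mul_le (by fun_prop) (by fun_prop)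
    _ ≤ _ := by
        gcongr
        exact lintegral_dual_sq_le hK0 hK hqm hζ hhm hh1 hg hg2

theorem lintegral_comp_mul_left {φ : ℝ → ENNReal} {β : ℝ} (hβ : 0 < β) :
    ∫⁻ x, φ (β * x) = ofReal β⁻¹ * ∫⁻ x, φ x := by
  have h := Real.map_volume_mul_left hβ.ne'
  have e := (Homeomorph.mulLeft₀ β hβ.ne').measurableEmbedding.lintegral_map φ (μ := volume)
  simp only [Homeomorph.coe_mulLeft₀] at e
  rw [← e, h, lintegral_smul_measure, abs_of_pos (inv_pos.2 hβ), smul_eq_mul]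

/-- The one-scale smoothing estimate. -/
theorem exists_smoothing_bound : ∃ K₀ : ℝ, ∀ K, K₀ ≤ K → ∃ C, 0 < C ∧
    ∀ {l r α β ν : ℝ} {q q₁ q₂ q₃ ζ ζ' : ℝ → ℝ} {f g Γ : ℝ → ℂ},
    SmoothingCurve K l r q q₁ q₂ q₃ → Measurable q → Amplitude K l r ζ ζ' →
    0 < β → 4 * K ^ 8 * β ≤ α → 1 ≤ ν * β →
    Measurable f → ∫⁻ x, ‖f x‖ₑ ^ 2 < ⊤ → ∫⁻ x, ‖g x‖ₑ ^ 2 < ⊤ → ContDiff ℝ 1 g →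
    (∀ x, HasDerivAt Γ (g x) x) →
    ofReal (ν ^ 2) * ∫⁻ y, ‖Γ y‖ₑ ^ 2 ≤ ofReal (K ^ 2) * ∫⁻ y, ‖g y‖ₑ ^ 2 →
    (∫⁻ x, ‖∫ s, (ζ s : ℂ) * (f (x - α * s) * g (x - β * q s))‖ₑ) ^ 2 ≤
      ofReal (C * (ν * β) ^ (-(1 / 32) : ℝ)) * (∫⁻ x, ‖f x‖ₑ ^ 2) * ∫⁻ x, ‖g x‖ₑ ^ 2 := by
  obtain ⟨K₀, hK₀⟩ := exists_corr_bound
  refine ⟨K₀, fun K hKK => ?_⟩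
  obtain ⟨C, hC, hcorr⟩ := hK₀ K hKK
  refine ⟨C, hC, ?_⟩
  intro l r α β ν q q₁ q₂ q₃ ζ ζ' f g Γ hq hqm hζ hβ hA hν hfm hf2 hg2 hg hΓ hΓ2
  have hK := hq.one_le
  have hβc : (β : ℂ) ≠ 0 := by exact_mod_cast hβ.ne'
  have hν0 : 0 < ν := by
    by_contra h
    nlinarith
  set ρ : ℝ := (ν * β) ^ (-(1 / 32) : ℝ) with hρ
  have hρ0 : 0 < ρ := by positivity
  have hρ1 : ρ ≤ 1 := rpow_le_one_of_one_le_of_nonpos hν (by norm_num)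
  have hρ32 : ρ ^ 32 = (ν * β)⁻¹ := by
    rw [hρ, ← rpow_natCast, ← rpow_mul (by positivity)]
    norm_num
    rw [Real.rpow_neg_one, mul_inv, mul_comm]
  have hΓm : Measurable Γ :=
    (continuous_iff_continuousAt.2 fun x => (hΓ x).continuousAt).measurable
  set gt : ℝ → ℂ := fun x => g (β * x) with hgt
  set ft : ℝ → ℂ := fun x => f (β * x) with hft
  set H : ℝ → ℂ := fun x => (ν : ℂ) * Γ (β * x) with hH
  have hgm : Measurable g := hg.continuous.measurable
  have sc : ∀ φ : ℝ → ℂ, ∫⁻ x, ‖φ (β * x)‖ₑ ^ 2 = ofReal β⁻¹ * ∫⁻ x, ‖φ x‖ₑ ^ 2 :=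
    fun φ => lintegral_comp_mul_left (φ := fun x => ‖φ x‖ₑ ^ 2) hβ
  have h1 := hcorr (A := α / β) (ρ := ρ) (g := gt) (H := H) hq hqm hζ
    (by rw [le_div_iff₀ hβ]; exact hA) hρ0 hρ1 (hg.comp (contDiff_const.mul contDiff_id))
    (fun x => by
      have hd : HasDerivAt (fun x : ℝ => β * x) β x := by
        simpa using (hasDerivAt_id x).const_mul β
      have h2 := ((hΓ (β * x)).scomp x hd).const_mul ((β : ℂ)⁻¹)
      have e : (fun x => (ρ : ℂ) ^ 32 * H x) = fun x => (β : ℂ)⁻¹ * Γ (β * x) := by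
        ext x
        rw [hH, ← Complex.ofReal_pow, hρ32]
        have : (ν : ℂ) ≠ 0 := by exact_mod_cast hν0.ne'
        push_cast
        field_simp
      rw [e]
      refine h2.congr_deriv ?_
      rw [real_smul, ← mul_assoc, inv_mul_cancel₀ hβc, one_mul])
    (by fun_prop) (by
      rw [sc]
      simp only [hH, enorm_mul, mul_pow]
      rw [lintegral_const_mul _ (by fun_prop), sc, ← ofReal_norm, Complex.norm_of_nonneg hν0.le,
        ← ofReal_pow hν0.le]
      calc _ = ofReal β⁻¹ * (ofReal (ν ^ 2) * ∫⁻ y, ‖Γ y‖ₑ ^ 2) := by ring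
        _ ≤ ofReal β⁻¹ * (ofReal (K ^ 2) * ∫⁻ y, ‖g y‖ₑ ^ 2) := by gcongr
        _ = _ := by ring)
  have h2 := sq_lintegral_oneScale_le (A := α / β) (f := ft) (g := gt) (by linarith) hq.length
    hqm hζ (by fun_prop) (by fun_prop)
    (by rw [sc]; exact ENNReal.mul_lt_top ofReal_lt_top hf2)
    (by rw [sc]; exact ENNReal.mul_lt_top ofReal_lt_top hg2)
  have e : ∀ x, oneScale (α / β) q ζ ft gt x =
      (fun x => ∫ s, (ζ s : ℂ) * (f (x - α * s) * g (x - β * q s))) (β * x) := by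
    intro x
    simp only [oneScale, hft, hgt]
    congr 1
    ext s
    congr 3 <;> field_simp
  simp_rw [e] at h2
  rw [lintegral_comp_mul_left (φ := fun x => ‖(fun x => ∫ s, (ζ s : ℂ) *
    (f (x - α * s) * g (x - β * q s))) x‖ₑ) hβ] at h2
  set X := ∫⁻ x, ‖∫ s, (ζ s : ℂ) * (f (x - α * s) * g (x - β * q s))‖ₑ with hX
  have hX' : X = ofReal β * (ofReal β⁻¹ * X) := by
    rw [← mul_assoc, ← ofReal_mul hβ.le, mul_inv_cancel₀ hβ.ne', ENNReal.ofReal_one,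
      one_mul]
  have hβ1 : ofReal β * ofReal β⁻¹ = 1 := by
    rw [← ofReal_mul hβ.le, mul_inv_cancel₀ hβ.ne', ENNReal.ofReal_one]
  rw [hX', mul_pow]
  calc _ ≤ ofReal β ^ 2 * ((∫⁻ x, ‖ft x‖ₑ ^ 2) *
        (ofReal (C * ρ) * ∫⁻ y, ‖gt y‖ₑ ^ 2)) := by
        gcongr
        exact h2.trans (by gcongr)
    _ = (ofReal β * ofReal β⁻¹) ^ 2 *
        (ofReal (C * ρ) * (∫⁻ x, ‖f x‖ₑ ^ 2) * ∫⁻ x, ‖g x‖ₑ ^ 2) := by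
        rw [sc, sc]; ring
    _ = _ := by rw [hβ1, one_pow, one_mul]

end Smoothing

open Smoothing (stdBump)

namespace DyadicAvg

/-- The dyadic interval of length `2 ^ (-m)` containing `x`. -/
def atom (m : ℤ) (x : ℝ) : Set ℝ := {y | ⌊(2:ℝ) ^ m * y⌋ = ⌊(2:ℝ) ^ m * x⌋}

/-- Functions constant on the dyadic intervals of length `2 ^ (-m)`. -/
def AtomConst {β : Type*} (m : ℤ) (Φ : ℝ → β) : Prop := ∀ x y, y ∈ atom m x → Φ y = Φ x

/-- Dyadic averages of nonnegative functions. -/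
def lavg (m : ℤ) (ψ : ℝ → ENNReal) (x : ℝ) : ENNReal :=
  ofReal ((2:ℝ) ^ m) * ∫⁻ y in atom m x, ψ y

/-- Dyadic averages of complex functions. -/
def avg (m : ℤ) (f : ℝ → ℂ) (x : ℝ) : ℂ := (((2:ℝ) ^ m : ℝ) : ℂ) * ∫ y in atom m x, f y

lemma mem_atom_self (m : ℤ) (x : ℝ) : x ∈ atom m x := rfl

lemma mem_atom_comm {m : ℤ} {x y : ℝ} : y ∈ atom m x ↔ x ∈ atom m y := eq_comm

lemma atom_eq {m : ℤ} {x y : ℝ} (h : y ∈ atom m x) : atom m y = atom m x := by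
  ext z
  have h' : ⌊(2:ℝ) ^ m * y⌋ = ⌊(2:ℝ) ^ m * x⌋ := h
  simp [atom, h']

lemma atom_eq_Ico (m : ℤ) (x : ℝ) :
    atom m x = Ico (⌊(2:ℝ) ^ m * x⌋ / (2:ℝ) ^ m) ((⌊(2:ℝ) ^ m * x⌋ + 1) / (2:ℝ) ^ m) := by
  have h : (0:ℝ) < 2 ^ m := by positivity
  ext y
  simp only [atom, mem_ofPred_eq, mem_Ico]
  rw [Int.floor_eq_iff, div_le_iff₀ h, lt_div_iff₀ h, mul_comm y]

lemma measurableSet_atom (m : ℤ) (x : ℝ) : MeasurableSet (atom m x) := by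
  rw [atom_eq_Ico]; exact measurableSet_Ico

lemma volume_atom (m : ℤ) (x : ℝ) : volume (atom m x) = ofReal ((2:ℝ) ^ m)⁻¹ := by
  rw [atom_eq_Ico, volume_Ico]
  congr 1
  field_simp
  ring

lemma volume_atom_ne_top (m : ℤ) (x : ℝ) : volume (atom m x) ≠ ⊤ := by
  rw [volume_atom]; exact ofReal_ne_top

lemma mul_volume_atom (m : ℤ) (x : ℝ) :
    ofReal ((2:ℝ) ^ m) * volume (atom m x) = 1 := by
  have h : (0:ℝ) < 2 ^ m := by positivity
  rw [volume_atom, ← ofReal_mul h.le, mul_inv_cancel₀ h.ne', ENNReal.ofReal_one]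

lemma abs_sub_le_of_mem_atom {m : ℤ} {x y : ℝ} (h : y ∈ atom m x) : |y - x| ≤ (2:ℝ) ^ (-m) := by
  have hx := mem_atom_self m x
  have h0 : (0:ℝ) < 2 ^ m := by positivity
  rw [atom_eq_Ico] at h hx
  have e : ((⌊(2:ℝ) ^ m * x⌋ + 1) / (2:ℝ) ^ m) = ⌊(2:ℝ) ^ m * x⌋ / (2:ℝ) ^ m + 2 ^ (-m) := by
    rw [zpow_neg]; field_simp
  rw [e] at h hx
  rw [abs_le]
  constructor <;> linarith [h.1, h.2, hx.1, hx.2]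

lemma mem_atom_of_le {m n : ℤ} (hmn : m ≤ n) {x y : ℝ} (h : y ∈ atom n x) : y ∈ atom m x := by
  obtain ⟨k, rfl⟩ := Int.le.dest hmn
  have e : ∀ z : ℝ, ⌊(2:ℝ) ^ m * z⌋ = ⌊(2:ℝ) ^ (m + (k:ℤ)) * z⌋ / ((2 ^ k : ℕ) : ℤ) := by
    intro z
    rw [← Int.floor_div_natCast]
    congr 1
    rw [zpow_add₀ two_ne_zero]
    push_cast
    field_simp
    rw [zpow_natCast]
  have h' : ⌊(2:ℝ) ^ (m + (k:ℤ)) * y⌋ = ⌊(2:ℝ) ^ (m + (k:ℤ)) * x⌋ := h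
  change ⌊(2:ℝ) ^ m * y⌋ = ⌊(2:ℝ) ^ m * x⌋
  rw [e y, e x, h']

lemma AtomConst.of_le {β : Type*} {m n : ℤ} (hmn : m ≤ n) {Φ : ℝ → β} (h : AtomConst m Φ) :
    AtomConst n Φ := fun x y hy => h x y (mem_atom_of_le hmn hy)

lemma AtomConst.comp₂ {β β' β'' : Type*} {m : ℤ} {Φ : ℝ → β} {Ψ : ℝ → β'} (h : AtomConst m Φ)
    (h' : AtomConst m Ψ) (u : β → β' → β'') : AtomConst m fun x => u (Φ x) (Ψ x) :=
  fun x y hy => by simp only [h x y hy, h' x y hy]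

lemma AtomConst.comp {β β' : Type*} {m : ℤ} {Φ : ℝ → β} (h : AtomConst m Φ)
    (u : β → β') : AtomConst m fun x => u (Φ x) :=
  fun x y hy => by simp only [h x y hy]

lemma atomConst_avg (m : ℤ) (f : ℝ → ℂ) : AtomConst m (avg m f) := fun x y hy => by
  simp only [avg, atom_eq hy]

lemma atomConst_lavg (m : ℤ) (f : ℝ → ENNReal) : AtomConst m (lavg m f) := fun x y hy => by
  simp only [lavg, atom_eq hy]

lemma AtomConst.factor {β : Type*} {m : ℤ} {Φ : ℝ → β} (h : AtomConst m Φ) :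
    Φ = (fun j : ℤ => Φ ((2:ℝ) ^ (-m) * j)) ∘ fun x => ⌊(2:ℝ) ^ m * x⌋ := by
  ext x
  refine (h x _ ?_).symm
  change ⌊(2:ℝ) ^ m * ((2:ℝ) ^ (-m) * (⌊(2:ℝ) ^ m * x⌋ : ℝ))⌋ = ⌊(2:ℝ) ^ m * x⌋
  rw [← mul_assoc, zpow_neg, mul_inv_cancel₀ (by positivity), one_mul, Int.floor_intCast]

lemma AtomConst.measurable {β : Type*} [MeasurableSpace β] {m : ℤ} {Φ : ℝ → β}
    (h : AtomConst m Φ) : Measurable Φ := by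
  rw [h.factor]
  exact measurable_from_top.comp (Int.measurable_floor.comp (measurable_const_mul _))

lemma measurable_avg (m : ℤ) (f : ℝ → ℂ) : Measurable (avg m f) := (atomConst_avg m f).measurable

lemma measurable_lavg (m : ℤ) (f : ℝ → ENNReal) : Measurable (lavg m f) :=
  (atomConst_lavg m f).measurable

lemma lavg_mul {m : ℤ} {Φ : ℝ → ENNReal} (hΦ : AtomConst m Φ) {ψ : ℝ → ENNReal}
    (hψ : Measurable ψ) (x : ℝ) : lavg m (fun y => Φ y * ψ y) x = Φ x * lavg m ψ x := by
  rw [lavg, lavg, setLIntegral_congr_fun (measurableSet_atom m x)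
    (g := fun y => Φ x * ψ y) (fun y hy => by simp only [hΦ x y hy]), lintegral_const_mul _ hψ]
  ring

lemma measurableSet_rel (m : ℤ) : MeasurableSet {p : ℝ × ℝ | p.2 ∈ atom m p.1} := by
  have h1 : Measurable fun p : ℝ × ℝ => ⌊(2:ℝ) ^ m * p.2⌋ :=
    Int.measurable_floor.comp (measurable_snd.const_mul _)
  have h2 : Measurable fun p : ℝ × ℝ => ⌊(2:ℝ) ^ m * p.1⌋ :=
    Int.measurable_floor.comp (measurable_fst.const_mul _)
  exact measurableSet_eq_fun h1 h2

lemma lintegral_lavg (m : ℤ) {ψ : ℝ → ENNReal} (hψ : Measurable ψ) :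
    ∫⁻ x, lavg m ψ x = ∫⁻ x, ψ x := by
  simp only [lavg]
  rw [lintegral_const_mul' _ _ ofReal_ne_top]
  simp_rw [← lintegral_indicator (measurableSet_atom m _)]
  rw [lintegral_lintegral_swap]
  · rw [← lintegral_const_mul' _ _ ofReal_ne_top]
    refine lintegral_congr fun y => ?_
    have : ∀ x, (atom m x).indicator ψ y = (atom m y).indicator (fun _ => ψ y) x := by
      intro x
      by_cases h : y ∈ atom m x
      · rw [indicator_of_mem h, indicator_of_mem (mem_atom_comm.1 h)]
      · rw [indicator_of_notMem h, indicator_of_notMem (mt mem_atom_comm.1 h)]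
    simp_rw [this]
    rw [lintegral_indicator_const (measurableSet_atom m y)]
    calc _ = (ofReal ((2:ℝ) ^ m) * volume (atom m y)) * ψ y := by ring
      _ = _ := by rw [mul_volume_atom, one_mul]
  · refine Measurable.aemeasurable ?_
    have : (uncurry fun x a => (atom m x).indicator ψ a) =
        {p : ℝ × ℝ | p.2 ∈ atom m p.1}.indicator fun p => ψ p.2 := by
      ext ⟨x, a⟩
      simp [indicator]
    rw [this]
    exact (hψ.comp measurable_snd).indicator (measurableSet_rel m)

lemma lintegral_mul_lavg {m : ℤ} {Φ : ℝ → ENNReal} (hΦ : AtomConst m Φ) {ψ : ℝ → ENNReal}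
    (hψ : Measurable ψ) : ∫⁻ x, Φ x * lavg m ψ x = ∫⁻ x, Φ x * ψ x := by
  rw [← lintegral_lavg m (ψ := fun x => Φ x * ψ x) (hΦ.measurable.mul hψ)]
  exact lintegral_congr fun x => (lavg_mul hΦ hψ x).symm

lemma lavg_of_atomConst {m : ℤ} {Φ : ℝ → ENNReal} (hΦ : AtomConst m Φ) (x : ℝ) :
    lavg m Φ x = Φ x := by
  have := lavg_mul hΦ (measurable_const (a := (1:ENNReal))) x
  simp only [mul_one] at this
  rw [this, lavg, setLIntegral_const, one_mul, mul_volume_atom, mul_one]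

lemma enorm_avg_le (m : ℤ) (f : ℝ → ℂ) (x : ℝ) : ‖avg m f x‖ₑ ≤ lavg m (fun y => ‖f y‖ₑ) x := by
  rw [avg, lavg, enorm_mul]
  gcongr
  · rw [← ofReal_norm, norm_real, Real.norm_of_nonneg (by positivity)]
  · exact enorm_integral_le_lintegral_enorm _

lemma sq_lavg_le (m : ℤ) {ψ : ℝ → ENNReal} (hψ : Measurable ψ) (x : ℝ) :
    lavg m ψ x ^ 2 ≤ lavg m (fun y => ψ y ^ 2) x := by
  have h := sq_lintegral_mul_le (μ := volume.restrict (atom m x)) (u := fun _ => 1) (v := ψ)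
    (by fun_prop) hψ.aemeasurable
  simp only [one_mul, one_pow, setLIntegral_const] at h
  rw [lavg, lavg, mul_pow]
  calc _ ≤ ofReal ((2:ℝ) ^ m) ^ 2 * (volume (atom m x) * ∫⁻ y in atom m x, ψ y ^ 2) := by
        gcongr
    _ = (ofReal ((2:ℝ) ^ m) * volume (atom m x)) *
        (ofReal ((2:ℝ) ^ m) * ∫⁻ y in atom m x, ψ y ^ 2) := by ring
    _ = _ := by rw [mul_volume_atom, one_mul]

lemma lintegral_sq_lavg_le (m : ℤ) {ψ : ℝ → ENNReal} (hψ : Measurable ψ) :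
    ∫⁻ x, lavg m ψ x ^ 2 ≤ ∫⁻ x, ψ x ^ 2 :=
  (lintegral_mono fun x => sq_lavg_le m hψ x).trans (lintegral_lavg m (by fun_prop)).le

lemma lintegral_sq_avg_le (m : ℤ) {f : ℝ → ℂ} (hf : Measurable f) :
    ∫⁻ x, ‖avg m f x‖ₑ ^ 2 ≤ ∫⁻ x, ‖f x‖ₑ ^ 2 :=
  (lintegral_mono fun x => by gcongr; exact enorm_avg_le m f x).trans
    (lintegral_sq_lavg_le m (by fun_prop))

/-- Doob's maximal function over the levels `lo, …, lo + N`. -/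
def maxAvg (lo : ℤ) (ψ : ℝ → ENNReal) : ℕ → ℝ → ENNReal
  | 0 => lavg lo ψ
  | N + 1 => fun x => max (maxAvg lo ψ N x) (lavg (lo + (N + 1 : ℕ)) ψ x)

lemma atomConst_maxAvg (lo : ℤ) (ψ : ℝ → ENNReal) (N : ℕ) :
    AtomConst (lo + N) (maxAvg lo ψ N) := by
  induction N with
  | zero => simpa [maxAvg] using atomConst_lavg lo ψ
  | succ N ih =>
    exact (ih.of_le (by push_cast; linarith)).comp₂ (atomConst_lavg _ ψ) max

lemma maxAvg_mono (lo : ℤ) (ψ : ℝ → ENNReal) (x : ℝ) : Monotone fun N => maxAvg lo ψ N x :=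
  monotone_nat_of_le_succ fun _ => le_max_left _ _

lemma lavg_le_maxAvg (lo : ℤ) (ψ : ℝ → ENNReal) (N : ℕ) (x : ℝ) :
    lavg (lo + N) ψ x ≤ maxAvg lo ψ N x := by
  cases N with
  | zero => simp [maxAvg]
  | succ N => exact le_max_right _ _

lemma lintegral_sq_maxAvg_le_mul (lo : ℤ) {ψ : ℝ → ENNReal} (hψ : Measurable ψ) (N : ℕ) :
    ∫⁻ x, maxAvg lo ψ N x ^ 2 ≤ 2 * ∫⁻ x, maxAvg lo ψ N x * ψ x := by
  induction N with
  | zero =>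
    simp only [maxAvg]
    rw [← lintegral_mul_lavg (atomConst_lavg lo ψ) hψ]
    simp_rw [← sq]
    exact le_mul_of_one_le_left' one_le_two
  | succ N ih =>
    set A := lavg (lo + (N + 1 : ℕ)) ψ with hA
    set M := maxAvg lo ψ N with hM
    have hMm : Measurable M := (atomConst_maxAvg lo ψ N).measurable
    have hd : AtomConst (lo + (N + 1 : ℕ)) fun x => A x - M x :=
      (atomConst_lavg _ ψ).comp₂ ((atomConst_maxAvg lo ψ N).of_le (by push_cast; linarith))
        fun a b => a - b
    have e : ∀ x, maxAvg lo ψ (N + 1) x = M x + (A x - M x) := fun x => add_tsub_eq_max.symm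
    have hpt : ∀ x, maxAvg lo ψ (N + 1) x ^ 2 ≤ M x ^ 2 + 2 * ((A x - M x) * A x) := by
      intro x
      rw [e x]
      rcases le_total (A x) (M x) with h | h
      · simp [tsub_eq_zero_of_le h]
      · obtain ⟨d, hd⟩ := exists_add_of_le h
        have h1 : A x - M x ≤ d := by rw [hd]; exact add_tsub_le_left
        rw [add_tsub_cancel_of_le h]
        by_cases hM' : M x = ⊤
        · simp [hM']
        rw [show A x - M x = d by rw [hd]; exact ENNReal.add_sub_cancel_left hM', hd]
        calc (M x + d) ^ 2 ≤ (M x + d) ^ 2 + d * d := le_self_add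
          _ = _ := by ring
    calc _ ≤ ∫⁻ x, M x ^ 2 + 2 * ((A x - M x) * A x) := lintegral_mono hpt
      _ = ∫⁻ x, M x ^ 2 + 2 * ((A x - M x) * ψ x) := by
          rw [lintegral_add_left (by fun_prop), lintegral_add_left (by fun_prop),
            lintegral_const_mul' _ _ (by simp), lintegral_const_mul' _ _ (by simp),
            lintegral_mul_lavg hd hψ]
      _ ≤ 2 * (∫⁻ x, M x * ψ x) + 2 * ∫⁻ x, (A x - M x) * ψ x := by
          rw [lintegral_add_left (by fun_prop), lintegral_const_mul' _ _ (by simp)]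
          gcongr
      _ = _ := by
          rw [← mul_add, ← lintegral_add_left (by fun_prop)]
          simp_rw [e, add_mul]

lemma lintegral_sq_maxAvg_ne_top (lo : ℤ) {ψ : ℝ → ENNReal} (hψ : Measurable ψ)
    (h2 : ∫⁻ x, ψ x ^ 2 ≠ ⊤) (N : ℕ) : ∫⁻ x, maxAvg lo ψ N x ^ 2 ≠ ⊤ := by
  induction N with
  | zero => exact ne_top_of_le_ne_top h2 (lintegral_sq_lavg_le lo hψ)
  | succ N ih =>
    refine ne_top_of_le_ne_top (ENNReal.add_ne_top.2 ⟨ih, ne_top_of_le_ne_top h2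
      (lintegral_sq_lavg_le (lo + (N + 1 : ℕ)) hψ)⟩) ?_
    have := (atomConst_maxAvg lo ψ N).measurable
    rw [← lintegral_add_left (by fun_prop)]
    refine lintegral_mono fun x => ?_
    simp only [maxAvg]
    rcases max_choice (maxAvg lo ψ N x) (lavg (lo + (N + 1 : ℕ)) ψ x) with h | h <;> rw [h]
    · exact le_self_add
    · exact le_add_self

/-- Doob's maximal inequality in `L²` for dyadic averages. -/
lemma lintegral_sq_maxAvg_le (lo : ℤ) {ψ : ℝ → ENNReal} (hψ : Measurable ψ)
    (h2 : ∫⁻ x, ψ x ^ 2 ≠ ⊤) (N : ℕ) :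
    ∫⁻ x, maxAvg lo ψ N x ^ 2 ≤ 4 * ∫⁻ x, ψ x ^ 2 := by
  have h1 := lintegral_sq_maxAvg_le_mul lo hψ N
  have hm := (atomConst_maxAvg lo ψ N).measurable
  have h3 := sq_lintegral_mul_le (μ := volume) hm.aemeasurable hψ.aemeasurable
  have h4 := lintegral_sq_maxAvg_ne_top lo hψ h2 N
  set X := ∫⁻ x, maxAvg lo ψ N x ^ 2
  set Y := ∫⁻ x, ψ x ^ 2
  by_cases hX : X = 0
  · simp [hX]
  have h5 : X * X ≤ X * (4 * Y) := by
    calc X * X = X ^ 2 := (sq X).symm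
      _ ≤ (2 * ∫⁻ x, maxAvg lo ψ N x * ψ x) ^ 2 := by gcongr
      _ = 4 * (∫⁻ x, maxAvg lo ψ N x * ψ x) ^ 2 := by ring
      _ ≤ 4 * (X * Y) := by gcongr
      _ = _ := by ring
  exact (ENNReal.mul_le_mul_iff_right hX h4).1 h5

end DyadicAvg

/-- `f` is a measurable function with `L²` norm at most `c`. -/
structure L2B (f : ℝ → ℂ) (c : ℝ) : Prop where
  meas : Measurable f
  nonneg : 0 ≤ c
  le : eLpNorm f 2 volume ≤ ofReal c

/-- `f` is a measurable function with `L¹` norm at most `c`. -/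
structure L1B (f : ℝ → ℂ) (c : ℝ) : Prop where
  meas : Measurable f
  nonneg : 0 ≤ c
  le : ∫⁻ x, ‖f x‖ₑ ≤ ofReal c

def nrm (f : ℝ → ℂ) : ℝ := (eLpNorm f 2 volume).toReal

lemma sq_eLpNorm_two (f : ℝ → ℂ) : eLpNorm f 2 volume ^ 2 = ∫⁻ x, ‖f x‖ₑ ^ 2 := by
  have := eLpNorm_nnreal_pow_eq_lintegral (f := f) (μ := volume) (p := 2) two_ne_zero
  simpa using this

lemma nrm_nonneg (f : ℝ → ℂ) : 0 ≤ nrm f := ENNReal.toReal_nonneg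

namespace L2B

variable {f g : ℝ → ℂ} {a b : ℝ}

lemma of_lintegral (hf : Measurable f) (ha : 0 ≤ a)
    (h : ∫⁻ x, ‖f x‖ₑ ^ 2 ≤ ofReal (a ^ 2)) : L2B f a := by
  refine ⟨hf, ha, ENNReal.le_of_sq_le_sq ?_⟩
  rwa [sq_eLpNorm_two, ← ofReal_pow ha]

lemma lintegral_le (h : L2B f a) : ∫⁻ x, ‖f x‖ₑ ^ 2 ≤ ofReal (a ^ 2) := by
  rw [← sq_eLpNorm_two, ofReal_pow h.nonneg]
  gcongr
  exact h.le

lemma memLp (h : L2B f a) : MemLp f 2 volume :=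
  ⟨h.meas.aestronglyMeasurable, h.le.trans_lt ofReal_lt_top⟩

lemma of_memLp (hf : Measurable f) (h : MemLp f 2 volume) : L2B f (nrm f) :=
  ⟨hf, nrm_nonneg f, by rw [nrm, ENNReal.ofReal_toReal h.2.ne]⟩

lemma nrm_le (h : L2B f a) : nrm f ≤ a := ENNReal.toReal_le_of_le_ofReal h.nonneg h.le

lemma self (h : L2B f a) : L2B f (nrm f) := of_memLp h.meas h.memLp

lemma mono (h : L2B f a) (hab : a ≤ b) : L2B f b :=
  ⟨h.meas, h.nonneg.trans hab, h.le.trans (ofReal_le_ofReal hab)⟩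

lemma add (hf : L2B f a) (hg : L2B g b) : L2B (fun x => f x + g x) (a + b) :=
  ⟨hf.meas.add hg.meas, add_nonneg hf.nonneg hg.nonneg, by
    rw [ofReal_add hf.nonneg hg.nonneg]
    exact (eLpNorm_add_le hf.memLp.1 hg.memLp.1 (by norm_num)).trans (add_le_add hf.le hg.le)⟩

lemma sub (hf : L2B f a) (hg : L2B g b) : L2B (fun x => f x - g x) (a + b) :=
  ⟨hf.meas.sub hg.meas, add_nonneg hf.nonneg hg.nonneg, by
    rw [ofReal_add hf.nonneg hg.nonneg]
    exact (eLpNorm_sub_le hf.memLp.1 hg.memLp.1 (by norm_num)).trans (add_le_add hf.le hg.le)⟩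

lemma zero : L2B (fun _ => 0) 0 := ⟨measurable_const, le_rfl, by simp⟩

lemma sum {ι : Type*} (s : Finset ι) {f : ι → ℝ → ℂ} {a : ι → ℝ} (h : ∀ i ∈ s, L2B (f i) (a i)) :
    L2B (fun x => ∑ i ∈ s, f i x) (∑ i ∈ s, a i) := by
  classical
  induction s using Finset.induction_on with
  | empty => simpa using zero
  | insert i s hi ih =>
    simp only [Finset.sum_insert hi]
    exact (h i (by simp)).add (ih fun j hj => h j (by simp [hj]))

lemma translate (hf : L2B f a) (c : ℝ) : L2B (fun x => f (x - c)) a :=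
  of_lintegral (hf.meas.comp (measurable_id.sub_const c)) hf.nonneg (by
    rw [lintegral_sub_right_eq_self (fun x => ‖f x‖ₑ ^ 2) c]
    exact hf.lintegral_le)

lemma const_mul (hf : L2B f a) (c : ℂ) : L2B (fun x => c * f x) (‖c‖ * a) :=
  ⟨hf.meas.const_mul c, mul_nonneg (norm_nonneg _) hf.nonneg, by
    rw [ofReal_mul (norm_nonneg _), ofReal_norm]
    refine (eLpNorm_const_smul c f 2 volume).le.trans ?_
    gcongr
    exact hf.le⟩

lemma mul (hf : L2B f a) (hg : L2B g b) : L1B (fun x => f x * g x) (a * b) :=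
  ⟨hf.meas.mul hg.meas, mul_nonneg hf.nonneg hg.nonneg, by
    refine ENNReal.le_of_sq_le_sq ?_
    have := hf.meas
    have := hg.meas
    simp only [enorm_mul]
    refine (sq_lintegral_mul_le (by fun_prop) (by fun_prop)).trans ?_
    rw [ofReal_mul hf.nonneg, mul_pow, ← sq_eLpNorm_two, ← sq_eLpNorm_two]
    gcongr
    exacts [hf.le, hg.le]⟩

lemma mono_fun (hf : L2B f a) (hg : Measurable g) (h : ∀ x, ‖g x‖ ≤ ‖f x‖) : L2B g a :=
  ⟨hg, hf.nonneg, (eLpNorm_mono h).trans hf.le⟩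

lemma avg (hf : L2B f a) (m : ℤ) : L2B (DyadicAvg.avg m f) a :=
  of_lintegral (DyadicAvg.measurable_avg m f) hf.nonneg
    ((DyadicAvg.lintegral_sq_avg_le m hf.meas).trans hf.lintegral_le)

lemma integrableOn (hf : L2B f a) {s : Set ℝ} (hs : volume s ≠ ⊤) : IntegrableOn f s volume := by
  have : IsFiniteMeasure (volume.restrict s) := ⟨by
    rw [Measure.restrict_apply_univ]; exact hs.lt_top⟩
  exact (hf.memLp.restrict s).integrable (by norm_num)

/-- Minkowski's inequality for averages of `L²` functions. -/
lemma integral {Φ : ℝ → ℝ → ℂ} {σ : ℝ → ℂ} {M c : ℝ} (hΦ : Measurable (uncurry Φ))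
    (hσ : Measurable σ) (hM : 0 ≤ M) (hc : 0 ≤ c) (hσM : ∫⁻ t, ‖σ t‖ₑ ≤ ofReal M)
    (h : ∀ t, σ t ≠ 0 → L2B (fun x => Φ x t) c) :
    L2B (fun x => ∫ t, Φ x t * σ t) (M * c) := by
  have hm : Measurable (uncurry fun x t => Φ x t * σ t) :=
    hΦ.mul (hσ.comp measurable_snd)
  refine of_lintegral (hm.stronglyMeasurable.integral_prod_right).measurable (by positivity) ?_
  have hpt : ∀ x, ‖∫ t, Φ x t * σ t‖ₑ ^ 2 ≤
      ofReal M * ∫⁻ t, ‖Φ x t‖ₑ ^ 2 * ‖σ t‖ₑ := by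
    intro x
    have hx : Measurable (Φ x) := hΦ.comp measurable_prodMk_left
    calc _ ≤ (∫⁻ t, ‖Φ x t‖ₑ * ‖σ t‖ₑ) ^ 2 := by
          gcongr
          refine (enorm_integral_le_lintegral_enorm _).trans_eq ?_
          simp only [enorm_mul]
      _ ≤ (∫⁻ t, ‖σ t‖ₑ) * ∫⁻ t, ‖Φ x t‖ₑ ^ 2 * ‖σ t‖ₑ :=
          sq_lintegral_le (by fun_prop) (by fun_prop) (.of_forall fun t => le_of_eq (by ring))
      _ ≤ _ := by gcongr
  calc _ ≤ ∫⁻ x, ofReal M * ∫⁻ t, ‖Φ x t‖ₑ ^ 2 * ‖σ t‖ₑ := lintegral_mono hpt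
    _ = ofReal M * ∫⁻ t, (∫⁻ x, ‖Φ x t‖ₑ ^ 2) * ‖σ t‖ₑ := by
        rw [lintegral_const_mul' _ _ ofReal_ne_top, lintegral_lintegral_swap]
        · congr 1
          refine lintegral_congr fun t => ?_
          have : Measurable fun x => Φ x t := hΦ.comp measurable_prodMk_right
          rw [lintegral_mul_const _ (by fun_prop)]
        · exact ((hΦ.enorm.pow_const 2).mul (hσ.comp measurable_snd).enorm).aemeasurable
    _ ≤ ofReal M * ∫⁻ t, ofReal (c ^ 2) * ‖σ t‖ₑ := by
        refine mul_le_mul' le_rfl (lintegral_mono fun t => ?_)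
        dsimp only
        by_cases ht : σ t = 0
        · simp [ht]
        · gcongr
          exact (h t ht).lintegral_le
    _ ≤ ofReal M * (ofReal (c ^ 2) * ofReal M) := by
        rw [lintegral_const_mul' _ _ ofReal_ne_top]
        gcongr
    _ = _ := by
        rw [← ofReal_mul (by positivity), ← ofReal_mul hM]
        ring_nf

end L2B

namespace L1B

variable {f g : ℝ → ℂ} {a b : ℝ}

lemma mono (h : L1B f a) (hab : a ≤ b) : L1B f b :=
  ⟨h.meas, h.nonneg.trans hab, h.le.trans (ofReal_le_ofReal hab)⟩

lemma integrable (h : L1B f a) : Integrable f :=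
  ⟨h.meas.aestronglyMeasurable, h.le.trans_lt ofReal_lt_top⟩

lemma add (hf : L1B f a) (hg : L1B g b) : L1B (fun x => f x + g x) (a + b) :=
  ⟨hf.meas.add hg.meas, add_nonneg hf.nonneg hg.nonneg, by
    rw [ofReal_add hf.nonneg hg.nonneg]
    have := hf.meas
    refine (lintegral_mono fun x => enorm_add_le _ _).trans ?_
    rw [lintegral_add_left (by fun_prop)]
    exact add_le_add hf.le hg.le⟩

lemma neg (hf : L1B f a) : L1B (fun x => -f x) a :=
  ⟨hf.meas.neg, hf.nonneg, by simpa using hf.le⟩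

lemma sub (hf : L1B f a) (hg : L1B g b) : L1B (fun x => f x - g x) (a + b) := by
  simpa only [sub_eq_add_neg] using hf.add hg.neg

lemma zero : L1B (fun _ => 0) 0 := ⟨measurable_const, le_rfl, by simp⟩

lemma sum {ι : Type*} (s : Finset ι) {f : ι → ℝ → ℂ} {a : ι → ℝ} (h : ∀ i ∈ s, L1B (f i) (a i)) :
    L1B (fun x => ∑ i ∈ s, f i x) (∑ i ∈ s, a i) := by
  classical
  induction s using Finset.induction_on with
  | empty => simpa using zero
  | insert i s hi ih =>
    simp only [Finset.sum_insert hi]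
    exact (h i (by simp)).add (ih fun j hj => h j (by simp [hj]))

/-- Minkowski's inequality for averages of `L¹` functions. -/
lemma integral {Φ : ℝ → ℝ → ℂ} {σ : ℝ → ℂ} {M c : ℝ} (hΦ : Measurable (uncurry Φ))
    (hσ : Measurable σ) (hM : 0 ≤ M) (hc : 0 ≤ c) (hσM : ∫⁻ t, ‖σ t‖ₑ ≤ ofReal M)
    (h : ∀ t, σ t ≠ 0 → L1B (fun x => Φ x t) c) :
    L1B (fun x => ∫ t, Φ x t * σ t) (M * c) := by
  have hm : Measurable (uncurry fun x t => Φ x t * σ t) :=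
    hΦ.mul (hσ.comp measurable_snd)
  refine ⟨(hm.stronglyMeasurable.integral_prod_right).measurable, by positivity, ?_⟩
  calc _ ≤ ∫⁻ x, ∫⁻ t, ‖Φ x t‖ₑ * ‖σ t‖ₑ := by
        refine lintegral_mono fun x => (enorm_integral_le_lintegral_enorm _).trans_eq ?_
        simp only [enorm_mul]
    _ = ∫⁻ t, (∫⁻ x, ‖Φ x t‖ₑ) * ‖σ t‖ₑ := by
        rw [lintegral_lintegral_swap]
        · refine lintegral_congr fun t => ?_
          have : Measurable fun x => Φ x t := hΦ.comp measurable_prodMk_right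
          rw [lintegral_mul_const _ (by fun_prop)]
        · exact (hΦ.enorm.mul (hσ.comp measurable_snd).enorm).aemeasurable
    _ ≤ ∫⁻ t, ofReal c * ‖σ t‖ₑ := by
        refine lintegral_mono fun t => ?_
        dsimp only
        by_cases ht : σ t = 0
        · simp [ht]
        · gcongr
          exact (h t ht).le
    _ ≤ ofReal c * ofReal M := by
        rw [lintegral_const_mul' _ _ ofReal_ne_top]
        gcongr
    _ = _ := by rw [← ofReal_mul hc, mul_comm]

end L1B

namespace DyadicAvg

/-- Measurable functions integrable on every dyadic interval. -/
structure LocInt (f : ℝ → ℂ) : Prop where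
  meas : Measurable f
  int : ∀ m x, IntegrableOn f (atom m x)

lemma _root_.L2B.locInt {f : ℝ → ℂ} {a : ℝ} (h : L2B f a) : LocInt f :=
  ⟨h.meas, fun m x => h.integrableOn (volume_atom_ne_top m x)⟩

lemma LocInt.of_bounded {f : ℝ → ℂ} (h : Measurable f) {c : ℝ} (hc : ∀ x, ‖f x‖ ≤ c) :
    LocInt f :=
  ⟨h, fun m x => Measure.integrableOn_of_bounded (volume_atom_ne_top m x)
    h.aestronglyMeasurable (M := c) (.of_forall hc)⟩

lemma avg_sub {f g : ℝ → ℂ} (hf : LocInt f) (hg : LocInt g) (m : ℤ) (x : ℝ) :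
    avg m (fun y => f y - g y) x = avg m f x - avg m g x := by
  simp only [avg]
  rw [integral_sub (hf.int m x) (hg.int m x), mul_sub]

lemma avg_sum {ι : Type*} (s : Finset ι) {f : ι → ℝ → ℂ} (hf : ∀ i ∈ s, LocInt (f i)) (m : ℤ)
    (x : ℝ) : avg m (fun y => ∑ i ∈ s, f i y) x = ∑ i ∈ s, avg m (f i) x := by
  simp only [avg]
  rw [integral_finsetSum _ fun i hi => (hf i hi).int m x, mul_sum]

lemma avg_mul {m : ℤ} {Φ : ℝ → ℂ} (hΦ : AtomConst m Φ) (f : ℝ → ℂ) (x : ℝ) :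
    avg m (fun y => Φ y * f y) x = Φ x * avg m f x := by
  rw [avg, avg, setIntegral_congr_fun (measurableSet_atom m x)
    (g := fun y => Φ x * f y) (fun y hy => by simp only [hΦ x y hy]), integral_const_mul]
  ring

lemma avg_of_atomConst {m : ℤ} {Φ : ℝ → ℂ} (hΦ : AtomConst m Φ) (x : ℝ) : avg m Φ x = Φ x := by
  have h0 : (0:ℝ) < 2 ^ m := by positivity
  have := avg_mul hΦ (fun _ => 1) x
  simp only [mul_one] at this
  rw [this, avg, setIntegral_const, measureReal_def, volume_atom, ENNReal.toReal_ofReal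
    (by positivity), real_smul, mul_one, ← Complex.ofReal_mul, mul_inv_cancel₀ h0.ne']
  simp

lemma integrable_avg (m : ℤ) {f : ℝ → ℂ} (hf : Measurable f) (hi : Integrable f) :
    Integrable (avg m f) := by
  refine ⟨(measurable_avg m f).aestronglyMeasurable, ?_⟩
  refine lt_of_le_of_lt ?_ hi.2
  exact (lintegral_mono fun x => enorm_avg_le m f x).trans (lintegral_lavg m (by fun_prop)).le

lemma integral_avg (m : ℤ) {f : ℝ → ℂ} (hf : Measurable f) (hi : Integrable f) :
    ∫ x, avg m f x = ∫ x, f x := by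
  have h0 : (0:ℝ) < 2 ^ m := by positivity
  simp only [avg]
  rw [integral_const_mul]
  simp_rw [← integral_indicator (measurableSet_atom m _)]
  have hsym : ∀ x y, (atom m x).indicator f y = (atom m y).indicator (fun _ => f y) x := by
    intro x y
    by_cases h : y ∈ atom m x
    · rw [indicator_of_mem h, indicator_of_mem (mem_atom_comm.1 h)]
    · rw [indicator_of_notMem h, indicator_of_notMem (mt mem_atom_comm.1 h)]
  have hmeas : Measurable (uncurry fun x a => (atom m x).indicator f a) := by
    have : (uncurry fun x a => (atom m x).indicator f a) =
        {p : ℝ × ℝ | p.2 ∈ atom m p.1}.indicator fun p => f p.2 := by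
      ext ⟨x, a⟩
      simp [indicator]
    rw [this]
    exact (hf.comp measurable_snd).indicator (measurableSet_rel m)
  rw [integral_integral_swap]
  · rw [← integral_const_mul]
    congr 1
    ext y
    simp_rw [hsym]
    rw [integral_indicator_const _ (measurableSet_atom m y), measureReal_def, volume_atom,
      ENNReal.toReal_ofReal (by positivity), real_smul, ← mul_assoc,
      ← Complex.ofReal_mul, mul_inv_cancel₀ h0.ne']
    simp
  · refine ⟨hmeas.aestronglyMeasurable, ?_⟩
    rw [hasFiniteIntegral_iff_enorm, lintegral_prod _ hmeas.enorm.aemeasurable]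
    have e : ∀ x, ∫⁻ y, ‖(uncurry fun x a => (atom m x).indicator f a) (x, y)‖ₑ =
        ofReal ((2:ℝ) ^ m)⁻¹ * lavg m (fun y => ‖f y‖ₑ) x := by
      intro x
      simp only [uncurry, enorm_indicator_eq_indicator_enorm]
      rw [lintegral_indicator (measurableSet_atom m x), lavg, ← mul_assoc,
        ← ofReal_mul (by positivity), inv_mul_cancel₀ h0.ne', ENNReal.ofReal_one, one_mul]
    simp_rw [e]
    rw [lintegral_const_mul' _ _ ofReal_ne_top, lintegral_lavg m (by fun_prop)]
    exact ENNReal.mul_lt_top ofReal_lt_top hi.2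

lemma integral_mul_avg {m : ℤ} {Φ : ℝ → ℂ} (hΦ : AtomConst m Φ) {f : ℝ → ℂ} (hf : Measurable f)
    (hi : Integrable fun x => Φ x * f x) : ∫ x, Φ x * avg m f x = ∫ x, Φ x * f x := by
  rw [← integral_avg m (f := fun x => Φ x * f x) (hΦ.measurable.mul hf) hi]
  simp_rw [avg_mul hΦ]

lemma atomConst_indicator (m : ℤ) (x : ℝ) : AtomConst m ((atom m x).indicator fun _ => (1:ℂ)) := by
  intro y z hz
  by_cases h : y ∈ atom m x
  · rw [indicator_of_mem h, indicator_of_mem (by rwa [← atom_eq h])]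
  · rw [indicator_of_notMem h, indicator_of_notMem]
    intro h'
    exact h (by rw [← atom_eq h']; exact mem_atom_comm.1 hz)

lemma avg_avg {m n : ℤ} (hmn : m ≤ n) {f : ℝ → ℂ} (hf : LocInt f) (x : ℝ) :
    avg m (avg n f) x = avg m f x := by
  have hc := (atomConst_indicator m x).of_le hmn
  have e : ∀ g : ℝ → ℂ, (fun y => (atom m x).indicator (fun _ => (1:ℂ)) y * g y) =
      (atom m x).indicator g := by
    intro g
    ext y
    by_cases h : y ∈ atom m x <;> simp [h]
  have h := integral_mul_avg hc hf.meas (by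
    rw [e, integrable_indicator_iff (measurableSet_atom m x)]
    exact hf.int m x)
  simp_rw [e] at h
  rw [integral_indicator (measurableSet_atom m x), integral_indicator (measurableSet_atom m x)] at h
  rw [avg, avg, h]

lemma locInt_avg {f : ℝ → ℂ} (hf : LocInt f) (n : ℤ) : LocInt (avg n f) := by
  refine ⟨measurable_avg n f, fun m x => ?_⟩
  have e : ∀ k, avg n ((atom k x).indicator f) =
      avg n (fun y => (atom k x).indicator 1 y * f y) := by
    intro k
    congr 1
    ext y
    by_cases h : y ∈ atom k x <;> simp [h]
  have h1 : IntegrableOn (avg n f) (atom (min m n) x) := by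
    have h2 := integrable_avg n (hf.meas.indicator (measurableSet_atom (min m n) x))
      ((integrable_indicator_iff (measurableSet_atom _ x)).2 (hf.int (min m n) x))
    rw [e] at h2
    have h3 : avg n (fun y => (atom (min m n) x).indicator 1 y * f y) =
        (atom (min m n) x).indicator (avg n f) := by
      ext y
      have := avg_mul ((atomConst_indicator (min m n) x).of_le (min_le_right m n)) f y
      refine this.trans ?_
      by_cases h : y ∈ atom (min m n) x <;> simp [h]
    rw [h3] at h2
    exact (integrable_indicator_iff (measurableSet_atom _ x)).1 h2
  exact h1.mono_set fun y hy => mem_atom_of_le (min_le_left m n) hy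

lemma pythagoras_le (m : ℤ) {u : ℝ → ℂ} (hu : Measurable u) (x : ℝ) :
    ‖avg m u x‖ₑ ^ 2 + lavg m (fun y => ‖u y - avg m u y‖ₑ ^ 2) x ≤
      lavg m (fun y => ‖u y‖ₑ ^ 2) x := by
  by_cases htop : ∫⁻ y in atom m x, ‖u y‖ₑ ^ 2 = ⊤
  · have : ofReal ((2:ℝ) ^ m) ≠ 0 := by
      rw [Ne, ENNReal.ofReal_eq_zero, not_le]; positivity
    rw [lavg, lavg, htop, ENNReal.mul_top this]
    exact le_top
  have hfin : IsFiniteMeasure (volume.restrict (atom m x)) := ⟨by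
    rw [Measure.restrict_apply_univ]; exact (volume_atom_ne_top m x).lt_top⟩
  have h0 : (0:ℝ) < 2 ^ m := by positivity
  set μ := volume.restrict (atom m x) with hμ
  set c := avg m u x with hc
  have hmem : MemLp u 2 μ := by
    refine ⟨hu.aestronglyMeasurable, ?_⟩
    have := eLpNorm_nnreal_pow_eq_lintegral (f := u) (μ := μ) (p := 2) two_ne_zero
    by_contra h
    rw [not_lt, top_le_iff] at h
    refine htop ?_
    simpa [h] using this.symm
  have hui : Integrable u μ := hmem.integrable (by norm_num)
  have hmem' : MemLp (fun y => u y - c) 2 μ := hmem.sub (memLp_const c)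
  have e1 : ∫ y, ‖u y‖ ^ 2 ∂μ = ∫ y, ‖u y - c‖ ^ 2 ∂μ + ((2:ℝ) ^ m)⁻¹ * ‖c‖ ^ 2 := by
    have hpt : ∀ y, ‖u y‖ ^ 2 = ‖u y - c‖ ^ 2 + (2 * (conj c * u y).re - ‖c‖ ^ 2) := by
      intro y
      rw [← normSq_eq_norm_sq, ← normSq_eq_norm_sq, ← normSq_eq_norm_sq,
        Complex.normSq_apply, Complex.normSq_apply, Complex.normSq_apply]
      simp
      ring
    have hcu : Integrable (fun y => conj c * u y) μ := hui.const_mul _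
    have h1 : Integrable (fun y => (conj c * u y).re) μ := hcu.re
    have h5 : Integrable (fun y => 2 * (conj c * u y).re - ‖c‖ ^ 2) μ :=
      (h1.const_mul 2).sub (integrable_const _)
    simp_rw [hpt]
    rw [integral_add (hmem'.integrable_norm_pow two_ne_zero) h5,
      integral_sub (h1.const_mul 2) (integrable_const _), integral_const_mul]
    have h2 : ∫ y, (conj c * u y).re ∂μ = ((2:ℝ) ^ m)⁻¹ * ‖c‖ ^ 2 := by
      have h3 : ∫ y, (conj c * u y).re ∂μ = (∫ y, conj c * u y ∂μ).re := integral_re hcu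
      have h4 : ∫ y, u y ∂μ = ((((2:ℝ) ^ m)⁻¹ : ℝ) : ℂ) * c := by
        rw [hc, avg, ← mul_assoc, ← Complex.ofReal_mul, inv_mul_cancel₀ h0.ne']
        simp [hμ]
      have h6 : conj c * (((((2:ℝ) ^ m)⁻¹ : ℝ) : ℂ) * c) =
          ((((2:ℝ) ^ m)⁻¹ * Complex.normSq c : ℝ) : ℂ) := by
        rw [Complex.ofReal_mul, Complex.normSq_eq_conj_mul_self]
        ring
      rw [h3, integral_const_mul, h4, ← normSq_eq_norm_sq, h6, Complex.ofReal_re]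
    rw [h2, integral_const, measureReal_def, hμ, Measure.restrict_apply_univ, volume_atom,
      ENNReal.toReal_ofReal (by positivity), smul_eq_mul]
    ring
  have key : ∀ v : ℝ → ℂ, Measurable v → MemLp v 2 μ →
      ∫⁻ y, ‖v y‖ₑ ^ 2 ∂μ = ofReal (∫ y, ‖v y‖ ^ 2 ∂μ) := by
    intro v hv hv2
    rw [ofReal_integral_eq_lintegral_ofReal (hv2.integrable_norm_pow two_ne_zero)
      (.of_forall fun y => by positivity)]
    refine lintegral_congr fun y => ?_
    rw [ofReal_pow (norm_nonneg _), ofReal_norm]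
  have e2 : lavg m (fun y => ‖u y - avg m u y‖ₑ ^ 2) x =
      ofReal ((2:ℝ) ^ m) * ∫⁻ y, ‖u y - c‖ₑ ^ 2 ∂μ := by
    rw [lavg]
    congr 1
    refine setLIntegral_congr_fun (measurableSet_atom m x) fun y hy => ?_
    simp only [atomConst_avg m u x y hy, hc]
  rw [e2, lavg, key _ (hu.sub_const c) hmem', key _ hu hmem, e1, ← ofReal_mul h0.le,
    ← ofReal_mul h0.le, ← ofReal_norm, ← ofReal_pow (norm_nonneg _),
    ← ofReal_add (by positivity)
      (mul_nonneg h0.le (integral_nonneg fun y => by positivity))]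
  refine ofReal_le_ofReal (le_of_eq ?_)
  field_simp
  ring

end DyadicAvg

lemma ENNReal.sq_sum_mul_le {ι : Type*} (s : Finset ι) (u v : ι → ENNReal) :
    (∑ i ∈ s, u i * v i) ^ 2 ≤ (∑ i ∈ s, u i ^ 2) * ∑ i ∈ s, v i ^ 2 := by
  have h := ENNReal.inner_le_Lp_mul_Lq s u v Real.HolderConjugate.two_two
  calc _ ≤ ((∑ i ∈ s, u i ^ (2:ℝ)) ^ (1 / 2 : ℝ) * (∑ i ∈ s, v i ^ (2:ℝ)) ^ (1 / 2 : ℝ)) ^ 2 := by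
        gcongr
    _ = _ := by
        rw [mul_pow, ← ENNReal.rpow_natCast, ← ENNReal.rpow_natCast, ← ENNReal.rpow_mul,
          ← ENNReal.rpow_mul]
        norm_num

namespace DyadicAvg

/-- Differences of dyadic averages along a sequence of levels. -/
def mdiff (n : ℕ → ℤ) (i : ℕ) (f : ℝ → ℂ) (x : ℝ) : ℂ := avg (n (i + 1)) f x - avg (n i) f x

lemma measurable_mdiff (n : ℕ → ℤ) (i : ℕ) (f : ℝ → ℂ) : Measurable (mdiff n i f) :=
  (measurable_avg _ f).sub (measurable_avg _ f)

lemma sum_weighted_mdiff_le {n : ℕ → ℤ} (hn : Monotone n) {W : ℕ → ℝ → ENNReal}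
    (hW : ∀ i, AtomConst (n i) (W i)) (hmono : ∀ i x, W i x ≤ W (i + 1) x) {u : ℝ → ℂ}
    (hu : LocInt u) (N : ℕ) :
    ∑ i ∈ Finset.range N, ∫⁻ x, W i x * ‖mdiff n i u x‖ₑ ^ 2 ≤
      ∫⁻ x, W N x * ‖avg (n N) u x‖ₑ ^ 2 := by
  induction N with
  | zero => simp
  | succ N ih =>
    rw [sum_range_succ]
    have hm1 := measurable_avg (n N) u
    have hm2 := measurable_avg (n (N + 1)) u
    have hm3 := (hW N).measurable
    have hm4 := measurable_mdiff n N u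
    calc _ ≤ (∫⁻ x, W N x * ‖avg (n N) u x‖ₑ ^ 2) + ∫⁻ x, W N x * ‖mdiff n N u x‖ₑ ^ 2 := by
          gcongr
      _ = (∫⁻ x, W N x * ‖avg (n N) u x‖ₑ ^ 2) +
          ∫⁻ x, W N x * lavg (n N) (fun y => ‖mdiff n N u y‖ₑ ^ 2) x := by
          rw [lintegral_mul_lavg (hW N) (by fun_prop)]
      _ = ∫⁻ x, W N x * (‖avg (n N) u x‖ₑ ^ 2 +
          lavg (n N) (fun y => ‖mdiff n N u y‖ₑ ^ 2) x) := by
          rw [← lintegral_add_left (by fun_prop)]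
          simp_rw [mul_add]
      _ ≤ ∫⁻ x, W N x * lavg (n N) (fun y => ‖avg (n (N + 1)) u y‖ₑ ^ 2) x := by
          refine lintegral_mono fun x => mul_le_mul' le_rfl ?_
          have h := pythagoras_le (n N) hm2 x
          have e : ∀ y, avg (n N) (avg (n (N + 1)) u) y = avg (n N) u y :=
            fun y => avg_avg (hn N.le_succ) hu y
          simp_rw [e] at h
          exact h
      _ = ∫⁻ x, W N x * ‖avg (n (N + 1)) u x‖ₑ ^ 2 := lintegral_mul_lavg (hW N) (by fun_prop)
      _ ≤ _ := lintegral_mono fun x => mul_le_mul' (hmono N x) le_rfl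

lemma sum_mdiff_le {n : ℕ → ℤ} (hn : Monotone n) {f : ℝ → ℂ} {a : ℝ} (hf : L2B f a) (N : ℕ) :
    ∑ i ∈ Finset.range N, ∫⁻ x, ‖mdiff n i f x‖ₑ ^ 2 ≤ ofReal (a ^ 2) := by
  have h := sum_weighted_mdiff_le hn (W := fun _ _ => 1) (fun _ _ _ _ => rfl) (fun _ _ => le_rfl)
    hf.locInt N
  simp only [one_mul] at h
  exact h.trans (hf.avg _).lintegral_le

lemma avg_mdiff {n : ℕ → ℤ} (hn : Monotone n) (i : ℕ) {f : ℝ → ℂ} (hf : LocInt f) (x : ℝ) :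
    avg (n i) (mdiff n i f) x = 0 := by
  have h := avg_sub (locInt_avg hf (n (i + 1))) (locInt_avg hf (n i)) (n i) x
  refine h.trans ?_
  rw [avg_avg (hn i.le_succ) hf, avg_of_atomConst (atomConst_avg _ f), sub_self]

lemma norm_avg_le_one {h : ℝ → ℂ} (hb : ∀ x, ‖h x‖ₑ ≤ 1) (m : ℤ) (x : ℝ) :
    ‖avg m h x‖ₑ ≤ 1 :=
  (enorm_avg_le m h x).trans ((by
    unfold lavg
    gcongr
    exact hb _ : _ ≤ lavg m (fun _ => 1) x).trans
      (lavg_of_atomConst (m := m) (Φ := fun _ => 1) (fun _ _ _ => rfl) x).le)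

lemma atomConst_mdiff {n : ℕ → ℤ} (hn : Monotone n) (i : ℕ) (f : ℝ → ℂ) :
    AtomConst (n (i + 1)) (mdiff n i f) :=
  (atomConst_avg _ f).comp₂ ((atomConst_avg _ f).of_le (hn i.le_succ)) fun a b => a - b

lemma L1B_mul_bounded {f h : ℝ → ℂ} {a : ℝ} (hf : L1B f a) (hh : Measurable h)
    (hb : ∀ x, ‖h x‖ₑ ≤ 1) : L1B (fun x => f x * h x) a :=
  ⟨hf.meas.mul hh, hf.nonneg, (lintegral_mono fun x => by
    rw [enorm_mul]; exact mul_le_of_le_one_right zero_le (hb x)).trans hf.le⟩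

/-- Replacing `h` by its martingale difference in the pairing with a paraproduct summand. -/
lemma integral_paraproduct_eq {n : ℕ → ℤ} (hn : Monotone n) (i : ℕ) {m : ℤ} (hm : m ≤ n i)
    {F g h : ℝ → ℂ} {a b : ℝ} (hF : L2B F a) (hg : L2B g b) (hh : Measurable h)
    (hb : ∀ x, ‖h x‖ₑ ≤ 1) :
    ∫ x, avg m F x * mdiff n i g x * h x =
      ∫ x, avg m F x * mdiff n i g x * mdiff n i h x := by
  have hD : L2B (mdiff n i g) (b + b) := (hg.avg _).sub (hg.avg _)
  have hP := (hF.avg m).mul hD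
  have hc : AtomConst (n (i + 1)) fun x => avg m F x * mdiff n i g x :=
    ((atomConst_avg m F).of_le (hm.trans (hn i.le_succ))).comp₂ (atomConst_mdiff hn i g)
      fun a b => a * b
  have hb1 : ∀ k x, ‖avg k h x‖ₑ ≤ 1 := fun k x => norm_avg_le_one hb k x
  have h1 := (L1B_mul_bounded hP (measurable_avg (n (i + 1)) h) (hb1 _)).integrable
  have h2 := (L1B_mul_bounded hP (measurable_avg (n i) h) (hb1 _)).integrable
  rw [← integral_mul_avg hc hh (L1B_mul_bounded hP hh hb).integrable]
  simp only [mdiff, mul_sub] at h1 h2 ⊢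
  have h3 : ∫ x, avg m F x * mdiff n i g x * avg (n i) h x = 0 := by
    have hc' : AtomConst (n i) fun x => avg m F x * avg (n i) h x :=
      ((atomConst_avg m F).of_le hm).comp₂ (atomConst_avg _ h) fun a b => a * b
    have e : (fun x => avg m F x * mdiff n i g x * avg (n i) h x) =
        fun x => avg m F x * avg (n i) h x * mdiff n i g x := by ext x; ring
    rw [e, ← integral_mul_avg hc' hD.meas (by
      rw [← e]; exact (L1B_mul_bounded hP (measurable_avg (n i) h) (hb1 _)).integrable)]
    simp_rw [avg_mdiff hn i hg.locInt]
    simp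
  simp only [mdiff, mul_sub] at h3
  rw [integral_sub h1 h2, h3, sub_zero]

lemma avg_le_maxAvg {lo m n : ℤ} (hlo : lo ≤ m) (hmn : m ≤ n) (F : ℝ → ℂ) (x : ℝ) :
    ‖avg m F x‖ₑ ≤ maxAvg lo (fun y => ‖F y‖ₑ) (n - lo).toNat x := by
  refine (enorm_avg_le m F x).trans ?_
  have e : lo + ((m - lo).toNat : ℤ) = m := by omega
  calc _ = lavg (lo + ((m - lo).toNat : ℤ)) (fun y => ‖F y‖ₑ) x := by rw [e]
    _ ≤ maxAvg lo (fun y => ‖F y‖ₑ) (m - lo).toNat x := lavg_le_maxAvg _ _ _ _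
    _ ≤ _ := maxAvg_mono lo _ x (by omega)

/-- Dyadic paraproducts are bounded from `L² × L²` to `L¹`. -/
theorem paraproduct_bound {n m : ℕ → ℤ} (hn : Monotone n) {N : ℕ} (hm : ∀ i < N, m i ≤ n i)
    {F g : ℝ → ℂ} {a b : ℝ} (hF : L2B F a) (hg : L2B g b) :
    L1B (fun x => ∑ i ∈ Finset.range N, avg (m i) F x * mdiff n i g x) (2 * a * b) := by
  obtain ⟨lo, hlo, hlo0⟩ : ∃ lo : ℤ, (∀ i < N, lo ≤ m i) ∧ lo ≤ n 0 := by
    refine ⟨-(∑ i ∈ Finset.range N, |m i|) - |n 0|, fun i hi => ?_, ?_⟩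
    · have := Finset.single_le_sum (f := fun i => |m i|) (fun i _ => abs_nonneg _)
        (Finset.mem_range.2 hi)
      have h2 := neg_abs_le (m i)
      have h3 := abs_nonneg (n 0)
      linarith
    · have := sum_nonneg (s := Finset.range N) (f := fun i => |m i|)
        (fun i _ => abs_nonneg _)
      linarith [neg_abs_le (n 0)]
  have hD : ∀ i, L2B (mdiff n i g) (b + b) := fun i => (hg.avg _).sub (hg.avg _)
  set G := fun x => ∑ i ∈ Finset.range N, avg (m i) F x * mdiff n i g x with hG
  have hG1 : L1B G (∑ i ∈ Finset.range N, a * (b + b)) :=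
    L1B.sum _ fun i _ => (hF.avg (m i)).mul (hD i)
  refine ⟨hG1.meas, by have := hF.nonneg; have := hg.nonneg; positivity, ?_⟩
  set h : ℝ → ℂ := fun x => Smoothing.csign (G x) with hh
  have hhm : Measurable h := Smoothing.measurable_csign.comp hG1.meas
  have hb : ∀ x, ‖h x‖ₑ ≤ 1 := fun x => Smoothing.enorm_csign_le _
  have hhl : LocInt h := LocInt.of_bounded hhm (c := 1) fun x => by
    have := hb x
    rwa [← ofReal_norm, ENNReal.ofReal_le_one] at this
  set Φ : ℕ → ℝ → ENNReal := fun i => maxAvg lo (fun y => ‖F y‖ₑ) (n i - lo).toNat with hΦ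
  have hΦc : ∀ i, AtomConst (n i) (Φ i) := by
    intro i
    have := hn (Nat.zero_le i)
    have e : lo + ((n i - lo).toNat : ℤ) = n i := by omega
    have h1 := atomConst_maxAvg lo (fun y => ‖F y‖ₑ) (n i - lo).toNat
    rwa [e] at h1
  have hΦm : ∀ i x, Φ i x ≤ Φ (i + 1) x := by
    intro i x
    have := hn (Nat.le_succ i)
    exact maxAvg_mono lo _ x (by simp only [Nat.succ_eq_add_one] at this; omega)
  have hFm := hF.meas
  have e1 : ∫⁻ x, ‖G x‖ₑ = ‖∫ x, G x * h x‖ₑ := by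
    have : ∀ x, G x * h x = ((‖G x‖ : ℝ) : ℂ) := fun x =>
        by rw [mul_comm]; exact Smoothing.csign_mul _
    simp_rw [this]
    rw [integral_complex_ofReal, ← ofReal_norm, Complex.norm_of_nonneg
      (integral_nonneg fun x => norm_nonneg _), ofReal_integral_norm_eq_lintegral_enorm
      hG1.integrable]
  have e2 : ∫ x, G x * h x =
      ∑ i ∈ Finset.range N, ∫ x, avg (m i) F x * mdiff n i g x * mdiff n i h x := by
    simp only [hG, sum_mul]
    rw [integral_finsetSum _ fun i _ =>
      (L1B_mul_bounded ((hF.avg (m i)).mul (hD i)) hhm hb).integrable]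
    exact sum_congr rfl fun i hi =>
      integral_paraproduct_eq hn i (hm i (Finset.mem_range.1 hi)) hF hg hhm hb
  have e3 : ‖∫ x, G x * h x‖ₑ ≤
      ∫⁻ x, ∑ i ∈ Finset.range N, ‖mdiff n i g x‖ₑ * (Φ i x * ‖mdiff n i h x‖ₑ) := by
    rw [e2, lintegral_finsetSum' _ fun i _ => by
      have := (hΦc i).measurable
      have := measurable_mdiff n i g
      have := measurable_mdiff n i h
      fun_prop]
    refine (enorm_sum_le _ _).trans (sum_le_sum fun i hi => ?_)
    refine (enorm_integral_le_lintegral_enorm _).trans (lintegral_mono fun x => ?_)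
    rw [enorm_mul, enorm_mul, mul_comm ‖avg (m i) F x‖ₑ, mul_assoc]
    have hi' := Finset.mem_range.1 hi
    gcongr
    exact avg_le_maxAvg (hlo i hi') (hm i hi') F x
  refine ENNReal.le_of_sq_le_sq ?_
  rw [e1]
  calc _ ≤ (∫⁻ x, ∑ i ∈ Finset.range N, ‖mdiff n i g x‖ₑ * (Φ i x * ‖mdiff n i h x‖ₑ)) ^ 2 := by
        gcongr
    _ ≤ (∫⁻ x, ∑ i ∈ Finset.range N, ‖mdiff n i g x‖ₑ ^ 2) *
        ∫⁻ x, ∑ i ∈ Finset.range N, (Φ i x * ‖mdiff n i h x‖ₑ) ^ 2 := by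
        refine sq_lintegral_le ?_ ?_ (.of_forall fun x => ENNReal.sq_sum_mul_le _ _ _)
        · refine Finset.aemeasurable_fun_sum _ fun i _ => ?_
          have := measurable_mdiff n i g
          fun_prop
        · refine Finset.aemeasurable_fun_sum _ fun i _ => ?_
          have := (hΦc i).measurable
          have := measurable_mdiff n i h
          fun_prop
    _ = (∑ i ∈ Finset.range N, ∫⁻ x, ‖mdiff n i g x‖ₑ ^ 2) *
        ∑ i ∈ Finset.range N, ∫⁻ x, Φ i x ^ 2 * ‖mdiff n i h x‖ₑ ^ 2 := by
        rw [lintegral_finsetSum' _ fun i _ => by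
          have := measurable_mdiff n i g
          fun_prop, lintegral_finsetSum' _ fun i _ => by
          have := (hΦc i).measurable
          have := measurable_mdiff n i h
          fun_prop]
        simp_rw [mul_pow]
    _ ≤ ofReal (b ^ 2) * ∫⁻ x, Φ N x ^ 2 * ‖avg (n N) h x‖ₑ ^ 2 := by
        gcongr
        · exact sum_mdiff_le hn hg N
        · exact sum_weighted_mdiff_le hn (W := fun i x => Φ i x ^ 2)
            (fun i => (hΦc i).comp fun z => z ^ 2) (fun i x => by gcongr; exact hΦm i x) hhl N
    _ ≤ ofReal (b ^ 2) * ∫⁻ x, Φ N x ^ 2 := by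
        gcongr with x
        exact mul_le_of_le_one_right zero_le (pow_le_one' (norm_avg_le_one hb _ x) 2)
    _ ≤ ofReal (b ^ 2) * (4 * ofReal (a ^ 2)) := by
        gcongr
        refine (lintegral_sq_maxAvg_le lo (by fun_prop) ?_ _).trans ?_
        · exact ne_top_of_le_ne_top ofReal_ne_top hF.lintegral_le
        · gcongr
          exact hF.lintegral_le
    _ = _ := by
        rw [show (4:ENNReal) = ofReal 4 by simp, ← ofReal_mul (by positivity),
          ← ofReal_mul (by positivity), ← ofReal_pow (by
            have := hF.nonneg; have := hg.nonneg; positivity)]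
        ring_nf

lemma mem_atom_or {n : ℤ} {x c : ℝ} (hc : 0 ≤ c) (hcn : (2:ℝ) ^ n * c ≤ 1) :
    x - c ∈ atom n x ∨ (x - c ∈ atom n (x - 2 ^ (-n)) ∧
      x ∈ Ico (⌊(2:ℝ) ^ n * x⌋ / (2:ℝ) ^ n) (⌊(2:ℝ) ^ n * x⌋ / (2:ℝ) ^ n + c)) := by
  have h0 : (0:ℝ) < 2 ^ n := by positivity
  have hf1 := Int.floor_le ((2:ℝ) ^ n * x)
  have hf2 := Int.lt_floor_add_one ((2:ℝ) ^ n * x)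
  set j := ⌊(2:ℝ) ^ n * x⌋ with hj
  have hnc : 0 ≤ (2:ℝ) ^ n * c := by positivity
  by_cases h : (j:ℝ) ≤ 2 ^ n * (x - c)
  · left
    change ⌊(2:ℝ) ^ n * (x - c)⌋ = ⌊(2:ℝ) ^ n * x⌋
    rw [← hj, Int.floor_eq_iff]
    refine ⟨h, ?_⟩
    rw [mul_sub]; linarith
  · right
    push Not at h
    rw [mul_sub] at h
    refine ⟨?_, ?_, ?_⟩
    · change ⌊(2:ℝ) ^ n * (x - c)⌋ = ⌊(2:ℝ) ^ n * (x - 2 ^ (-n))⌋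
      have e : (2:ℝ) ^ n * (x - 2 ^ (-n)) = 2 ^ n * x - 1 := by
        rw [mul_sub, zpow_neg, mul_inv_cancel₀ h0.ne']
      rw [e, Int.floor_sub_one, ← hj, Int.floor_eq_iff]
      push_cast
      rw [mul_sub]
      constructor <;> linarith
    · rw [div_le_iff₀ h0]; linarith
    · rw [div_add' _ _ _ h0.ne', lt_div_iff₀ h0]; linarith

lemma translate_sub_bound_of_nonneg {n : ℤ} {w : ℝ → ℂ} {a : ℝ} (hc : AtomConst n w)
    (hw : L2B w a) {c : ℝ} (h0 : 0 ≤ c) (hcn : (2:ℝ) ^ n * c ≤ 1) :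
    L2B (fun x => w (x - c) - w x) (2 * a * √((2:ℝ) ^ n * c)) := by
  have ha := hw.nonneg
  have hn0 : (0:ℝ) < 2 ^ n := by positivity
  refine L2B.of_lintegral ((hw.translate c).sub hw).meas (by positivity) ?_
  set B : Set ℝ := {x | x ∈ Ico (⌊(2:ℝ) ^ n * x⌋ / (2:ℝ) ^ n) (⌊(2:ℝ) ^ n * x⌋ / (2:ℝ) ^ n + c)}
    with hB
  have hfm : Measurable fun x : ℝ => (⌊(2:ℝ) ^ n * x⌋ : ℝ) / (2:ℝ) ^ n :=
    ((measurable_from_top (f := fun j : ℤ => (j : ℝ))).comp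
      (Int.measurable_floor.comp (measurable_const_mul _))).div_const _
  have hBm : MeasurableSet B :=
    (measurableSet_le hfm measurable_id).inter (measurableSet_lt measurable_id (hfm.add_const c))
  set Ψ : ℝ → ENNReal := fun x => ‖w (x - 2 ^ (-n)) - w x‖ₑ ^ 2 with hΨ
  have hsh : AtomConst n fun x => w (x - 2 ^ (-n)) := by
    intro x y hy
    refine hc _ _ ?_
    have h' : ⌊(2:ℝ) ^ n * y⌋ = ⌊(2:ℝ) ^ n * x⌋ := hy
    change ⌊(2:ℝ) ^ n * (y - 2 ^ (-n))⌋ = ⌊(2:ℝ) ^ n * (x - 2 ^ (-n))⌋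
    have e : ∀ z : ℝ, (2:ℝ) ^ n * (z - 2 ^ (-n)) = 2 ^ n * z - 1 := fun z => by
      rw [mul_sub, zpow_neg, mul_inv_cancel₀ hn0.ne']
    rw [e, e, Int.floor_sub_one, Int.floor_sub_one, h']
  have hΨc : AtomConst n Ψ := hsh.comp₂ hc fun u v => ‖u - v‖ₑ ^ 2
  have hlav : ∀ x, lavg n (B.indicator fun _ => 1) x ≤ ofReal ((2:ℝ) ^ n * c) := by
    intro x
    rw [lavg, lintegral_indicator_const hBm, one_mul, Measure.restrict_apply hBm, ofReal_mul hn0.le]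
    gcongr
    calc volume (B ∩ atom n x) ≤ volume (Ico (⌊(2:ℝ) ^ n * x⌋ / (2:ℝ) ^ n)
          (⌊(2:ℝ) ^ n * x⌋ / (2:ℝ) ^ n + c)) := by
          refine measure_mono ?_
          rintro y ⟨hy1, hy2⟩
          have h' : ⌊(2:ℝ) ^ n * y⌋ = ⌊(2:ℝ) ^ n * x⌋ := hy2
          rw [← h']
          exact hy1
      _ = _ := by rw [volume_Ico]; congr 1; ring
  have hpt : ∀ x, ‖w (x - c) - w x‖ₑ ^ 2 ≤ Ψ x * B.indicator (fun _ => 1) x := by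
    intro x
    rcases mem_atom_or (n := n) (x := x) h0 hcn with h | ⟨h, h'⟩
    · rw [hc _ _ h]; simp
    · rw [indicator_of_mem (show x ∈ B from h'), mul_one, hc _ _ h]
  calc _ ≤ ∫⁻ x, Ψ x * B.indicator (fun _ => 1) x := lintegral_mono hpt
    _ = ∫⁻ x, Ψ x * lavg n (B.indicator fun _ => 1) x :=
        (lintegral_mul_lavg hΨc (measurable_const.indicator hBm)).symm
    _ ≤ ∫⁻ x, Ψ x * ofReal ((2:ℝ) ^ n * c) :=
        lintegral_mono fun x => mul_le_mul' le_rfl (hlav x)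
    _ ≤ ofReal ((a + a) ^ 2) * ofReal ((2:ℝ) ^ n * c) := by
        rw [lintegral_mul_const' _ _ ofReal_ne_top]
        gcongr
        exact ((hw.translate (2 ^ (-n))).sub hw).lintegral_le
    _ = _ := by
        rw [← ofReal_mul (by positivity), mul_pow, sq_sqrt (by positivity)]
        ring_nf

/-- The `L²` modulus of continuity of step functions. -/
lemma translate_sub_bound {n : ℤ} {w : ℝ → ℂ} {a : ℝ} (hc : AtomConst n w)
    (hw : L2B w a) (c : ℝ) :
    L2B (fun x => w (x - c) - w x) (2 * a * √((2:ℝ) ^ n * |c|)) := by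
  have ha := hw.nonneg
  have hn0 : (0:ℝ) < 2 ^ n := by positivity
  rcases le_total ((2:ℝ) ^ n * |c|) 1 with h | h
  · rcases le_total 0 c with h0 | h0
    · rw [abs_of_nonneg h0] at h ⊢
      exact translate_sub_bound_of_nonneg hc hw h0 h
    · rw [abs_of_nonpos h0] at h ⊢
      have h1 := ((translate_sub_bound_of_nonneg hc hw (neg_nonneg.2 h0) h).translate c).const_mul
        (-1)
      simp only [norm_neg, norm_one, one_mul] at h1
      refine h1.mono_fun ((hw.translate c).sub hw).meas fun x => le_of_eq ?_
      congr 1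
      rw [show x - c - -c = x by ring]
      ring
  · refine ((hw.translate c).sub hw).mono ?_
    have := Real.one_le_sqrt.2 h
    nlinarith

lemma sub_avg_bound {φ : ℝ → ℂ} {a A : ℝ} (hφ : L2B φ a) (m : ℤ) (hA : 0 ≤ A)
    (h : ∀ c, |c| ≤ (2:ℝ) ^ (-m) → L2B (fun x => φ (x - c) - φ x) A) :
    L2B (fun x => φ x - avg m φ x) (2 * A) := by
  have hn0 : (0:ℝ) < 2 ^ m := by positivity
  have hφm := hφ.meas
  refine L2B.of_lintegral (hφ.sub (hφ.avg m)).meas (by positivity) ?_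
  have hpt : ∀ x, ‖φ x - avg m φ x‖ₑ ^ 2 ≤ ofReal ((2:ℝ) ^ m) *
      ∫⁻ c in Icc (-(2:ℝ) ^ (-m)) (2 ^ (-m)), ‖φ (x - c) - φ x‖ₑ ^ 2 := by
    intro x
    have e : avg m φ x - φ x = avg m (fun y => φ y - φ x) x := by
      have := avg_sub (m := m) (x := x) hφ.locInt (LocInt.of_bounded (f := fun _ => φ x)
        measurable_const (c := ‖φ x‖) fun _ => le_rfl)
      rw [this, avg_of_atomConst (Φ := fun _ => φ x) (fun _ _ _ => rfl)]
    rw [← neg_sub, enorm_neg, e]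
    calc _ ≤ lavg m (fun y => ‖φ y - φ x‖ₑ) x ^ 2 := by gcongr; exact enorm_avg_le _ _ _
      _ ≤ lavg m (fun y => ‖φ y - φ x‖ₑ ^ 2) x := sq_lavg_le m (by fun_prop) x
      _ ≤ ofReal ((2:ℝ) ^ m) *
          ∫⁻ y in Icc (x - (2:ℝ) ^ (-m)) (x + 2 ^ (-m)), ‖φ y - φ x‖ₑ ^ 2 := by
          unfold lavg
          gcongr
          intro y hy
          have := abs_le.1 (abs_sub_le_of_mem_atom hy)
          constructor <;> linarith [this.1, this.2]
      _ = _ := by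
          congr 1
          rw [← lintegral_indicator measurableSet_Icc, ← lintegral_indicator measurableSet_Icc,
            ← lintegral_sub_left_eq_self _ x]
          refine lintegral_congr fun c => ?_
          by_cases hc : c ∈ Icc (-(2:ℝ) ^ (-m)) (2 ^ (-m))
          · rw [indicator_of_mem hc, indicator_of_mem (by
              constructor <;> linarith [hc.1, hc.2])]
          · rw [indicator_of_notMem hc, indicator_of_notMem fun h' => hc (by
              constructor <;> linarith [h'.1, h'.2])]
  calc _ ≤ ∫⁻ x, ofReal ((2:ℝ) ^ m) *
        ∫⁻ c in Icc (-(2:ℝ) ^ (-m)) (2 ^ (-m)), ‖φ (x - c) - φ x‖ₑ ^ 2 := lintegral_mono hpt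
    _ = ofReal ((2:ℝ) ^ m) *
        ∫⁻ c in Icc (-(2:ℝ) ^ (-m)) (2 ^ (-m)), ∫⁻ x, ‖φ (x - c) - φ x‖ₑ ^ 2 := by
        rw [lintegral_const_mul' _ _ ofReal_ne_top, lintegral_lintegral_swap]
        refine Measurable.aemeasurable ?_
        simp only [Function.uncurry_def]
        fun_prop
    _ ≤ ofReal ((2:ℝ) ^ m) *
        ∫⁻ _ in Icc (-(2:ℝ) ^ (-m)) (2 ^ (-m)), ofReal (A ^ 2) := by
        gcongr ofReal ((2:ℝ) ^ m) * ?_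
        refine setLIntegral_mono measurable_const fun c hc => (h c ?_).lintegral_le
        exact abs_le.2 hc
    _ ≤ _ := by
        rw [setLIntegral_const, volume_Icc, ← ofReal_mul (by positivity),
          ← ofReal_mul (by positivity)]
        refine ofReal_le_ofReal ?_
        rw [zpow_neg]
        have : (2:ℝ) ^ m * (A ^ 2 * (((2:ℝ) ^ m)⁻¹ - -((2:ℝ) ^ m)⁻¹)) = 2 * A ^ 2 := by
          field_simp; ring
        rw [this]
        nlinarith [sq_nonneg A]

/-- Averages at coarse scale of translates of functions with vanishing averages at fine scale. -/
lemma avg_translate_bound {φ : ℝ → ℂ} {a : ℝ} (hφ : L2B φ a) {k : ℤ}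
    (hk : ∀ x, avg k φ x = 0) (m : ℤ) (c : ℝ) :
    L2B (avg m fun x => φ (x - c)) (4 * √((2:ℝ) ^ (m - k)) * a) := by
  set τ : ℝ → ℂ := fun x => φ (x - c) with hτ
  have hτ2 : L2B τ a := hφ.translate c
  set v := avg m τ with hv
  have hv2 : L2B v (nrm v) := (hτ2.avg m).self
  set b := nrm v with hb
  have ha := hφ.nonneg
  have hb0 : 0 ≤ b := nrm_nonneg v
  set v' : ℝ → ℂ := fun x => conj (v x) with hv'
  have hv'c : AtomConst m v' := (atomConst_avg m τ).comp conj
  have hv'2 : L2B v' b := hv2.mono_fun hv'c.measurable fun x => by simp [hv']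
  have hvs : L2B (fun x => v' (x + c)) b := by
    simpa using hv'2.translate (-c)
  have hmod : L2B (fun x => v' (x + c) - avg k (fun x => v' (x + c)) x)
      (2 * (2 * b * √((2:ℝ) ^ m * 2 ^ (-k)))) := by
    refine sub_avg_bound hvs k (by positivity) fun d hd => ?_
    have h1 := (translate_sub_bound hv'c hv'2 d).translate (-c)
    have e : (fun x => v' (x - -c - d) - v' (x - -c)) = fun x => v' (x - d + c) - v' (x + c) := by
      ext x
      rw [sub_neg_eq_add, show x + c - d = x - d + c by ring]
    rw [e] at h1
    refine h1.mono ?_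
    gcongr
  have e1 : ∫ x, v' x * v x = ∫ x, v' x * τ x :=
    integral_mul_avg hv'c hτ2.meas (hv'2.mul hτ2).integrable
  have e2 : ∫ x, v' x * τ x = ∫ x, v' (x + c) * φ x := by
    rw [← integral_add_right_eq_self _ c]
    simp [hτ]
  have e3 : ∫ x, avg k (fun x => v' (x + c)) x * φ x = 0 := by
    rw [← integral_mul_avg (atomConst_avg k _) hφ.meas ((hvs.avg k).mul hφ).integrable]
    simp [hk]
  have e4 : ∫ x, v' (x + c) * φ x =
      ∫ x, (v' (x + c) - avg k (fun x => v' (x + c)) x) * φ x := by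
    simp_rw [sub_mul]
    rw [integral_sub (hvs.mul hφ).integrable ((hvs.avg k).mul hφ).integrable, e3, sub_zero]
  have h5 : ∫⁻ x, ‖v x‖ₑ ^ 2 ≤
      ofReal (2 * (2 * b * √((2:ℝ) ^ m * 2 ^ (-k))) * a) := by
    have e5 : ∫⁻ x, ‖v x‖ₑ ^ 2 = ‖∫ x, v' x * v x‖ₑ := by
      have : ∀ x, v' x * v x = ((‖v x‖ ^ 2 : ℝ) : ℂ) := fun x => by
        rw [← normSq_eq_norm_sq, Complex.normSq_eq_conj_mul_self]
      simp_rw [this]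
      rw [integral_complex_ofReal, ← ofReal_norm, Complex.norm_of_nonneg
        (integral_nonneg fun x => by positivity), ofReal_integral_eq_lintegral_ofReal
        (hv2.memLp.integrable_norm_pow two_ne_zero) (.of_forall fun y => by positivity)]
      refine lintegral_congr fun y => ?_
      rw [ofReal_pow (norm_nonneg _), ofReal_norm]
    rw [e5, e1, e2, e4]
    exact (enorm_integral_le_lintegral_enorm _).trans (hmod.mul hφ).le
  have h6 : b ^ 2 ≤ 2 * (2 * b * √((2:ℝ) ^ m * 2 ^ (-k))) * a := by
    have : b ^ 2 = (∫⁻ x, ‖v x‖ₑ ^ 2).toReal := by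
      rw [← sq_eLpNorm_two, ENNReal.toReal_pow]; rfl
    rw [this]
    exact ENNReal.toReal_le_of_le_ofReal (by positivity) h5
  refine hv2.mono ?_
  rw [zpow_sub₀ two_ne_zero]
  rw [zpow_neg, ← div_eq_mul_inv] at h6
  by_contra hlt
  push Not at hlt
  have hs := Real.sqrt_nonneg ((2:ℝ) ^ m / 2 ^ k)
  have : 0 < b := lt_of_le_of_lt (by positivity) hlt
  nlinarith

/-- A function oscillating at the dyadic scale `2 ^ (-k)`, with `L²` norm at most `a`. -/
structure Piece (k : ℤ) (φ : ℝ → ℂ) (a : ℝ) : Prop where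
  const : AtomConst (k + 1) φ
  mean : ∀ x, avg k φ x = 0
  l2 : L2B φ a

/-- The average of `w` over `[x, x + η]`. -/
def smear (η : ℝ) (w : ℝ → ℂ) (x : ℝ) : ℂ :=
  ∫ u, w (x + u) * (Ioc 0 η).indicator (fun _ => ((η⁻¹ : ℝ) : ℂ)) u

lemma smear_eq {η : ℝ} (hη : 0 < η) (w : ℝ → ℂ) (x : ℝ) :
    smear η w x = ((η⁻¹ : ℝ) : ℂ) * ∫ u in x..(x + η), w u := by
  have h : ∀ u, w (x + u) * (Ioc 0 η).indicator (fun _ => ((η⁻¹ : ℝ) : ℂ)) u =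
      (Ioc 0 η).indicator (fun u => ((η⁻¹ : ℝ) : ℂ) * w (x + u)) u := fun u => by
    by_cases hu : u ∈ Ioc 0 η
    · rw [indicator_of_mem hu, indicator_of_mem hu, mul_comm]
    · rw [indicator_of_notMem hu, indicator_of_notMem hu, mul_zero]
  simp_rw [smear, h]
  rw [integral_indicator measurableSet_Ioc, ← intervalIntegral.integral_of_le hη.le,
    intervalIntegral.integral_const_mul, intervalIntegral.integral_comp_add_left, add_zero]

lemma lintegral_smear_kernel {η : ℝ} (hη : 0 < η) :
    ∫⁻ u, ‖(Ioc 0 η).indicator (fun _ => ((η⁻¹ : ℝ) : ℂ)) u‖ₑ ≤ ofReal 1 := by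
  simp_rw [enorm_indicator_eq_indicator_enorm]
  rw [lintegral_indicator_const measurableSet_Ioc, volume_Ioc, ← ofReal_norm,
    Complex.norm_of_nonneg (by positivity), ← ofReal_mul (by positivity), sub_zero,
    inv_mul_cancel₀ hη.ne']

lemma _root_.L2B.smear {w : ℝ → ℂ} {a : ℝ} (hw : L2B w a) {η : ℝ} (hη : 0 < η) :
    L2B (smear η w) a := by
  have := L2B.integral (Φ := fun x u => w (x + u))
    (hw.meas.comp (measurable_fst.add measurable_snd))
    (measurable_const.indicator measurableSet_Ioc) zero_le_one hw.nonneg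
    (lintegral_smear_kernel hη)
    (fun u _ => by simpa only [sub_neg_eq_add] using hw.translate (-u))
  rwa [one_mul] at this

lemma smear_sub_bound {w : ℝ → ℂ} {a A : ℝ} (hw : L2B w a) {η : ℝ} (hη : 0 < η) (hA : 0 ≤ A)
    (h : ∀ c, |c| ≤ η → L2B (fun x => w (x - c) - w x) A) :
    L2B (fun x => DyadicAvg.smear η w x - w x) A := by
  have hi : ∀ x y, IntervalIntegrable w volume x y := fun x y =>
    intervalIntegrable_iff.2 (hw.integrableOn measure_Ioc_lt_top.ne)
  have key : ∀ x, DyadicAvg.smear η w x - w x =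
      ∫ u, (w (x + u) - w x) * (Ioc 0 η).indicator (fun _ => ((η⁻¹ : ℝ) : ℂ)) u := by
    intro x
    change _ = DyadicAvg.smear η (fun y => w y - w x) x
    rw [smear_eq hη, smear_eq hη, intervalIntegral.integral_sub (hi _ _) (by simp),
      intervalIntegral.integral_const, add_sub_cancel_left, mul_sub, real_smul,
      ← mul_assoc, ← Complex.ofReal_mul, inv_mul_cancel₀ hη.ne', Complex.ofReal_one, one_mul]
  have hm := hw.meas
  have := L2B.integral (Φ := fun x u => w (x + u) - w x) (by fun_prop)
    (measurable_const.indicator measurableSet_Ioc) zero_le_one hA (lintegral_smear_kernel hη)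
    (fun u hu => by
      have hu' : u ∈ Ioc 0 η := by
        by_contra hc; exact hu (indicator_of_notMem hc _)
      simpa only [sub_neg_eq_add] using
        h (-u) (by rw [abs_neg, abs_of_pos hu'.1]; exact hu'.2))
  simpa only [one_mul, ← key] using this

lemma hasDerivAt_smear {η : ℝ} (hη : 0 < η) {w : ℝ → ℂ} (hw : Continuous w) (x : ℝ) :
    HasDerivAt (smear η w) (((η⁻¹ : ℝ) : ℂ) * (w (x + η) - w x)) x := by
  have hi : ∀ x y, IntervalIntegrable w volume x y := fun x y => hw.intervalIntegrable _ _
  have hW : ∀ x, HasDerivAt (fun x => ∫ u in (0:ℝ)..x, w u) (w x) x := fun x =>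
    (hw.integral_hasStrictDerivAt 0 x).hasDerivAt
  have e : smear η w = fun x => ((η⁻¹ : ℝ) : ℂ) *
      ((∫ u in (0:ℝ)..(x + η), w u) - ∫ u in (0:ℝ)..x, w u) := by
    funext x
    rw [smear_eq hη, intervalIntegral.integral_interval_sub_left (hi _ _) (hi _ _)]
  rw [e]
  exact (((hW (x + η)).comp_add_const x η).sub (hW x)).const_mul _

namespace Piece

variable {k : ℤ} {φ : ℝ → ℂ} {a : ℝ}

lemma intervalIntegrable (h : Piece k φ a) (x y : ℝ) : IntervalIntegrable φ volume x y :=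
  intervalIntegrable_iff.2 (h.l2.integrableOn measure_Ioc_lt_top.ne)

lemma integral_lattice (h : Piece k φ a) (j : ℤ) : ∫ u in (0:ℝ)..(j / (2:ℝ) ^ k), φ u = 0 := by
  have hk0 : (0:ℝ) < 2 ^ k := by positivity
  have step : ∀ j : ℤ, ∫ u in (j / (2:ℝ) ^ k)..((j + 1) / (2:ℝ) ^ k), φ u = 0 := by
    intro j
    have h1 := h.mean (j / (2:ℝ) ^ k)
    have e : ⌊(2:ℝ) ^ k * (j / (2:ℝ) ^ k)⌋ = j := by
      rw [mul_div_cancel₀ _ hk0.ne', Int.floor_intCast]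
    rw [avg, atom_eq_Ico, e, integral_Ico_eq_integral_Ioc,
      ← intervalIntegral.integral_of_le (by gcongr; linarith)] at h1
    refine (mul_eq_zero.1 h1).resolve_left ?_
    exact_mod_cast hk0.ne'
  induction j using Int.induction_on with
  | zero => simp
  | succ i ih =>
    rw [← intervalIntegral.integral_add_adjacent_intervals (h.intervalIntegrable _ _)
      (h.intervalIntegrable _ _), ih, zero_add]
    simpa using step i
  | pred i ih =>
    have h2 := step (-i - 1)
    rw [← intervalIntegral.integral_add_adjacent_intervals
      (h.intervalIntegrable _ (((-i - 1 : ℤ) : ℝ) / 2 ^ k))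
      (h.intervalIntegrable _ _)] at ih
    push_cast at h2 ih ⊢
    rw [sub_add_cancel] at h2
    rwa [h2, add_zero] at ih

/-- The primitive of a piece. -/
lemma primitive (h : Piece k φ a) : L2B (fun x => ∫ u in (0:ℝ)..x, φ u) ((2:ℝ) ^ (-k) * a) := by
  have hk0 : (0:ℝ) < 2 ^ k := by positivity
  have hc : Continuous fun x => ∫ u in (0:ℝ)..x, φ u :=
    intervalIntegral.continuous_primitive (fun x y => h.intervalIntegrable x y) 0
  refine L2B.of_lintegral hc.measurable (mul_nonneg (by positivity) h.l2.nonneg) ?_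
  have pt : ∀ x, ‖∫ u in (0:ℝ)..x, φ u‖ₑ ≤
      ofReal ((2:ℝ) ^ (-k)) * lavg k (fun y => ‖φ y‖ₑ) x := by
    intro x
    set p : ℝ := ⌊(2:ℝ) ^ k * x⌋ / (2:ℝ) ^ k with hp
    have hpx : p ≤ x := by
      rw [hp, div_le_iff₀ hk0, mul_comm]; exact Int.floor_le _
    rw [← intervalIntegral.integral_add_adjacent_intervals (h.intervalIntegrable 0 p)
      (h.intervalIntegrable p x), h.integral_lattice, zero_add,
      intervalIntegral.integral_of_le hpx, lavg, ← mul_assoc,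
      ← ofReal_mul (by positivity), zpow_neg, inv_mul_cancel₀ hk0.ne',
      ENNReal.ofReal_one, one_mul, ← integral_Ico_eq_integral_Ioc]
    refine (enorm_integral_le_lintegral_enorm _).trans (lintegral_mono_set ?_)
    rw [atom_eq_Ico]
    refine Ico_subset_Ico_right ?_
    rw [le_div_iff₀ hk0, mul_comm]
    exact (Int.lt_floor_add_one _).le
  calc _ ≤ ∫⁻ x, (ofReal ((2:ℝ) ^ (-k)) * lavg k (fun y => ‖φ y‖ₑ) x) ^ 2 :=
        lintegral_mono fun x => pow_le_pow_left' (pt x) 2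
    _ = ofReal ((2:ℝ) ^ (-k)) ^ 2 * ∫⁻ x, lavg k (fun y => ‖φ y‖ₑ) x ^ 2 := by
        simp_rw [mul_pow]
        rw [lintegral_const_mul _ ((measurable_lavg _ _).pow_const 2)]
    _ ≤ ofReal ((2:ℝ) ^ (-k)) ^ 2 * ofReal (a ^ 2) := by
        gcongr
        exact (lintegral_sq_lavg_le k h.l2.meas.enorm).trans h.l2.lintegral_le
    _ = _ := by
        rw [← ofReal_pow (by positivity), ← ofReal_mul (by positivity), mul_pow]

/-- Pieces can be approximated by smooth functions with controlled primitive. -/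
lemma exists_smooth (h : Piece k φ a) {η : ℝ} (hη : 0 < η) :
    ∃ w W : ℝ → ℂ, ContDiff ℝ 1 w ∧ (∀ x, HasDerivAt W (w x) x) ∧ L2B w a ∧
      L2B (fun x => w x - φ x) (4 * a * √((2:ℝ) ^ (k + 1) * η)) ∧
      L2B (deriv w) (2 * a / η) ∧ L2B W ((2:ℝ) ^ (-k) * a) := by
  set Γ : ℝ → ℂ := fun x => ∫ u in (0:ℝ)..x, φ u with hΓ
  have hc : Continuous Γ :=
    intervalIntegral.continuous_primitive (fun x y => h.intervalIntegrable x y) 0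
  have hΓs : ∀ x, smear η φ x = ((η⁻¹ : ℝ) : ℂ) * (Γ (x + η) - Γ x) := by
    intro x
    rw [smear_eq hη, hΓ, intervalIntegral.integral_interval_sub_left (h.intervalIntegrable _ _)
      (h.intervalIntegrable _ _)]
  have hsc : Continuous (smear η φ) := by
    rw [funext hΓs]; fun_prop
  have hd1 := hasDerivAt_smear hη hc
  have hs1 : Continuous (smear η Γ) :=
    continuous_iff_continuousAt.2 fun x => (hd1 x).continuousAt
  have hd2 := hasDerivAt_smear hη hs1
  have hdw := hasDerivAt_smear hη hsc
  have hww : ∀ x, smear η (smear η φ) x =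
      ((η⁻¹ : ℝ) : ℂ) * (smear η Γ (x + η) - smear η Γ x) := by
    intro x
    rw [smear_eq hη]
    congr 1
    refine intervalIntegral.integral_eq_sub_of_hasDerivAt (fun y _ => ?_)
      (hsc.intervalIntegrable _ _)
    rw [hΓs]; exact hd1 y
  have hder : deriv (smear η (smear η φ)) =
      fun x => ((η⁻¹ : ℝ) : ℂ) * (smear η φ (x + η) - smear η φ x) := funext fun x => (hdw x).deriv
  have hs := h.l2.smear hη
  have hmod : L2B (fun x => smear η φ x - φ x) (2 * a * √((2:ℝ) ^ (k + 1) * η)) :=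
    smear_sub_bound h.l2 hη (mul_nonneg (mul_nonneg (by norm_num) h.l2.nonneg) (by positivity))
      fun c hc => (translate_sub_bound h.const h.l2 c).mono (by
        have := h.l2.nonneg
        gcongr)
  refine ⟨smear η (smear η φ), smear η (smear η Γ), ?_, fun x => ?_, hs.smear hη, ?_, ?_,
    (h.primitive.smear hη).smear hη⟩
  · rw [contDiff_one_iff_deriv]
    refine ⟨fun x => (hdw x).differentiableAt, ?_⟩
    rw [hder]; fun_prop
  · rw [hww]; exact hd2 x
  · have h2 := (hmod.smear hη).add hmod
    have e : (fun x => smear η (smear η φ) x - φ x) = fun x =>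
        smear η (fun x => smear η φ x - φ x) x + (smear η φ x - φ x) := by
      funext x
      have : smear η (fun x => smear η φ x - φ x) x = smear η (smear η φ) x - smear η φ x := by
        rw [smear_eq hη, smear_eq hη, smear_eq hη (w := φ), intervalIntegral.integral_sub
          (hsc.intervalIntegrable _ _) (h.intervalIntegrable _ _), mul_sub]
      rw [this]; ring
    rw [e]
    exact h2.mono (by apply le_of_eq; ring)
  · rw [hder]
    have h3 := ((hs.translate (-η)).sub hs).const_mul ((η⁻¹ : ℝ) : ℂ)
    simp only [sub_neg_eq_add] at h3
    refine h3.mono (le_of_eq ?_)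
    rw [Complex.norm_of_nonneg (by positivity)]
    field_simp; ring

end Piece
end DyadicAvg

/-- A cancelling bump at unit scale. -/
structure Weight (K : ℝ) (ρ : ℝ → ℝ) : Prop where
  one_le : 1 ≤ K
  smooth : ContDiff ℝ 1 ρ
  supp : ∀ t, ρ t ≠ 0 → 1/2 ≤ |t| ∧ |t| ≤ 2
  bound : ∀ t, |ρ t| ≤ K
  bound' : ∀ t, |deriv ρ t| ≤ K
  mean : ∫ t, ρ t = 0

/-- A family of translations of size `2 ^ (-m)`. -/
structure Shift (K : ℝ) (m : ℤ) (p : ℝ → ℝ) : Prop where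
  meas : Measurable p
  diff : ∀ t, 1/4 < |t| → |t| < 4 → DifferentiableAt ℝ p t
  diff' : ∀ t, 1/4 < |t| → |t| < 4 → DifferentiableAt ℝ (deriv p) t
  bound : ∀ t, 1/4 < |t| → |t| < 4 → |p t| ≤ K * 2 ^ (-m)
  bound' : ∀ t, 1/4 < |t| → |t| < 4 → |deriv p t| ≤ K * 2 ^ (-m)
  bound'' : ∀ t, 1/4 < |t| → |t| < 4 → |deriv (deriv p) t| ≤ K * 2 ^ (-m)
  lower : ∀ t, 1/4 < |t| → |t| < 4 → 2 ^ (-m) ≤ K * |deriv p t|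

/-- Measurable functions bounded on bounded sets. -/
structure LocBdd (f : ℝ → ℂ) : Prop where
  meas : Measurable f
  bdd : ∀ R, ∃ c, 0 ≤ c ∧ ∀ x, |x| ≤ R → ‖f x‖ ≤ c

namespace LocBdd

variable {f g : ℝ → ℂ}

lemma of_continuous (hf : Continuous f) : LocBdd f :=
  ⟨hf.measurable, fun R => by
    obtain ⟨c, hc⟩ := (isCompact_Icc (a := -R) (b := R)).exists_bound_of_continuousOn
      hf.continuousOn
    exact ⟨max c 0, le_max_right _ _, fun x hx => (hc x (abs_le.1 hx)).trans (le_max_left _ _)⟩⟩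

lemma sub (hf : LocBdd f) (hg : LocBdd g) : LocBdd fun x => f x - g x :=
  ⟨hf.meas.sub hg.meas, fun R => by
    obtain ⟨c, hc0, hc⟩ := hf.bdd R
    obtain ⟨d, hd0, hd⟩ := hg.bdd R
    exact ⟨c + d, by positivity, fun x hx =>
      (norm_sub_le _ _).trans (add_le_add (hc x hx) (hd x hx))⟩⟩

lemma of_atomConst {m : ℤ} {a : ℝ} (hc : DyadicAvg.AtomConst m f) (hf : L2B f a) : LocBdd f :=
  ⟨hf.meas, fun R => ⟨√(2 ^ m * a ^ 2), by positivity, fun x _ => by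
    refine Real.le_sqrt_of_sq_le ?_
    have h1 : DyadicAvg.lavg m (fun y => ‖f y‖ₑ ^ 2) x = ‖f x‖ₑ ^ 2 :=
      DyadicAvg.lavg_of_atomConst (hc.comp fun z => ‖z‖ₑ ^ 2) x
    have h2 : ‖f x‖ₑ ^ 2 ≤ ofReal (2 ^ m * a ^ 2) := by
      rw [← h1, DyadicAvg.lavg, ofReal_mul (by positivity)]
      gcongr
      exact (setLIntegral_le_lintegral _ _).trans hf.lintegral_le
    rw [← ofReal_norm, ← ofReal_pow (norm_nonneg _)] at h2
    exact (ENNReal.ofReal_le_ofReal_iff (by positivity)).1 h2⟩⟩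

end LocBdd

/-- The single scale bilinear average. -/
def bil (p q ρ : ℝ → ℝ) (f g : ℝ → ℂ) (x : ℝ) : ℂ :=
  ∫ t, (f (x - p t) * g (x - q t)) * (ρ t : ℂ)

/-- The single scale linear average. -/
def lin (p ρ : ℝ → ℝ) (f : ℝ → ℂ) (x : ℝ) : ℂ := ∫ t, f (x - p t) * (ρ t : ℂ)

lemma bil_comm (p q ρ : ℝ → ℝ) (f g : ℝ → ℂ) : bil p q ρ f g = bil q p ρ g f := by
  funext x
  simp only [bil, mul_comm (f _)]

namespace Weight

variable {K : ℝ} {ρ : ℝ → ℝ}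

lemma meas (hρ : Weight K ρ) : Measurable fun t => (ρ t : ℂ) :=
  (Complex.continuous_ofReal.comp hρ.smooth.continuous).measurable

/-- Kernels supported in the support of a weight and bounded by `M` have mass at most `4 * M`. -/
lemma lintegral_kernel_le {σ : ℝ → ℂ} {M : ℝ} (hM : 0 ≤ M) (hσ : ∀ t, ‖σ t‖ ≤ M)
    (hs : ∀ t, σ t ≠ 0 → |t| ≤ 2) : ∫⁻ t, ‖σ t‖ₑ ≤ ofReal (4 * M) := by
  calc ∫⁻ t, ‖σ t‖ₑ ≤ ∫⁻ t, (Icc (-2:ℝ) 2).indicator (fun _ => ofReal M) t := by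
        refine lintegral_mono fun t => ?_
        by_cases h : t ∈ Icc (-2:ℝ) 2
        · rw [indicator_of_mem h, ← ofReal_norm]
          exact ofReal_le_ofReal (hσ t)
        · have : σ t = 0 := by
            by_contra h'
            exact h (abs_le.1 (hs t h'))
          simp [this]
    _ = _ := by
        rw [lintegral_indicator_const measurableSet_Icc, volume_Icc,
          ← ofReal_mul hM]
        congr 1; ring

lemma integrable_kernel {σ : ℝ → ℂ} {M : ℝ} (hm : Measurable σ) (hM : 0 ≤ M)
    (hσ : ∀ t, ‖σ t‖ ≤ M) (hs : ∀ t, σ t ≠ 0 → |t| ≤ 2) : Integrable σ :=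
  ⟨hm.aestronglyMeasurable, (lintegral_kernel_le hM hσ hs).trans_lt ofReal_lt_top⟩

lemma norm_le (hρ : Weight K ρ) (t : ℝ) : ‖(ρ t : ℂ)‖ ≤ K := by
  rw [norm_real]; exact hρ.bound t

lemma range (hρ : Weight K ρ) {t : ℝ} (h : (ρ t : ℂ) ≠ 0) : 1/4 < |t| ∧ |t| < 4 ∧ |t| ≤ 2 := by
  have := hρ.supp t (by exact_mod_cast h)
  exact ⟨by linarith [this.1], by linarith [this.2], this.2⟩

lemma lintegral_le (hρ : Weight K ρ) : ∫⁻ t, ‖(ρ t : ℂ)‖ₑ ≤ ofReal (4 * K) :=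
  lintegral_kernel_le (by linarith [hρ.one_le]) hρ.norm_le fun _ h => (hρ.range h).2.2

lemma integral_ofReal (hρ : Weight K ρ) : ∫ t, (ρ t : ℂ) = 0 := by
  rw [integral_complex_ofReal, hρ.mean, Complex.ofReal_zero]

end Weight

section OneScale

variable {K : ℝ} {ρ p q : ℝ → ℝ} {m n : ℤ} {f g : ℝ → ℂ} {a b A B : ℝ}

lemma Shift.nonneg (hp : Shift K m p) : 0 ≤ K := by
  have := (abs_nonneg _).trans (hp.bound 1 (by norm_num) (by norm_num))
  exact nonneg_of_mul_nonneg_left this (by positivity)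

lemma LocBdd.along (hf : LocBdd f) (hp : Shift K m p) (x : ℝ) :
    ∃ c, 0 ≤ c ∧ ∀ t, 1/4 < |t| → |t| < 4 → ‖f (x - p t)‖ ≤ c := by
  obtain ⟨c, hc0, hc⟩ := hf.bdd (|x| + K * 2 ^ (-m))
  exact ⟨c, hc0, fun t h1 h2 => hc _ ((abs_sub _ _).trans (by linarith [hp.bound t h1 h2]))⟩

lemma integrable_bil (hρ : Weight K ρ) (hp : Shift K m p) (hq : Shift K n q) (hf : LocBdd f)
    (hg : LocBdd g) (x : ℝ) :
    Integrable fun t => (f (x - p t) * g (x - q t)) * (ρ t : ℂ) := by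
  obtain ⟨c, hc0, hc⟩ := hf.along hp x
  obtain ⟨d, hd0, hd⟩ := hg.along hq x
  have := hf.meas
  have := hg.meas
  have := hp.meas
  have := hq.meas
  have := hρ.meas
  have hK := hp.nonneg
  refine Weight.integrable_kernel (M := c * d * K) (by fun_prop) (by positivity) (fun t => ?_)
    (fun t ht => (hρ.range (right_ne_zero_of_mul ht)).2.2)
  by_cases h : (ρ t : ℂ) = 0
  · rw [h, mul_zero, norm_zero]; positivity
  · obtain ⟨h1, h2, -⟩ := hρ.range h
    rw [norm_mul, norm_mul]
    gcongr
    exacts [hc t h1 h2, hd t h1 h2, hρ.norm_le t]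

lemma integrable_lin (hρ : Weight K ρ) (hp : Shift K m p) (hf : LocBdd f) (x : ℝ) :
    Integrable fun t => f (x - p t) * (ρ t : ℂ) := by
  simpa using integrable_bil hρ hp hp hf (LocBdd.of_continuous (f := fun _ => 1) continuous_const) x

lemma integrable_weight (hρ : Weight K ρ) : Integrable fun t => (ρ t : ℂ) :=
  Weight.integrable_kernel hρ.meas (by linarith [hρ.one_le]) hρ.norm_le
    fun _ h => (hρ.range h).2.2

lemma bil_sub_left (hρ : Weight K ρ) (hp : Shift K m p) (hq : Shift K n q) {f' : ℝ → ℂ}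
    (hf : LocBdd f) (hf' : LocBdd f') (hg : LocBdd g) (x : ℝ) :
    bil p q ρ (fun y => f y - f' y) g x = bil p q ρ f g x - bil p q ρ f' g x := by
  rw [bil, bil, bil, ← integral_sub (integrable_bil hρ hp hq hf hg x)
    (integrable_bil hρ hp hq hf' hg x)]
  exact integral_congr_ae (.of_forall fun t => by ring)

lemma bil_sub_right (hρ : Weight K ρ) (hp : Shift K m p) (hq : Shift K n q) {g' : ℝ → ℂ}
    (hf : LocBdd f) (hg : LocBdd g) (hg' : LocBdd g') (x : ℝ) :
    bil p q ρ f (fun y => g y - g' y) x = bil p q ρ f g x - bil p q ρ f g' x := by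
  rw [bil, bil, bil, ← integral_sub (integrable_bil hρ hp hq hf hg x)
    (integrable_bil hρ hp hq hf hg' x)]
  exact integral_congr_ae (.of_forall fun t => by ring)

lemma lin_sub (hρ : Weight K ρ) (hp : Shift K m p) {f' : ℝ → ℂ} (hf : LocBdd f)
    (hf' : LocBdd f') (x : ℝ) :
    lin p ρ (fun y => f y - f' y) x = lin p ρ f x - lin p ρ f' x := by
  rw [lin, lin, lin, ← integral_sub (integrable_lin hρ hp hf x) (integrable_lin hρ hp hf' x)]
  exact integral_congr_ae (.of_forall fun t => by ring)

lemma lin_sum (hρ : Weight K ρ) (hp : Shift K m p) {ι : Type*} (s : Finset ι) {f : ι → ℝ → ℂ}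
    (hf : ∀ i ∈ s, LocBdd (f i)) (x : ℝ) :
    lin p ρ (fun y => ∑ i ∈ s, f i y) x = ∑ i ∈ s, lin p ρ (f i) x := by
  simp only [lin, sum_mul]
  exact integral_finsetSum s fun i hi => integrable_lin hρ hp (hf i hi) x

lemma bil_sum (hρ : Weight K ρ) (hp : Shift K m p) (hq : Shift K n q) {ι κ : Type*}
    (s : Finset ι) (s' : Finset κ) {f : ι → ℝ → ℂ} {g : κ → ℝ → ℂ}
    (hf : ∀ i ∈ s, LocBdd (f i)) (hg : ∀ j ∈ s', LocBdd (g j)) (x : ℝ) :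
    bil p q ρ (fun y => ∑ i ∈ s, f i y) (fun y => ∑ j ∈ s', g j y) x =
      ∑ i ∈ s, ∑ j ∈ s', bil p q ρ (f i) (g j) x := by
  simp only [bil, sum_mul, mul_sum]
  simp_rw [Finset.sum_comm (s := s')]
  rw [integral_finsetSum s fun i hi => integrable_finsetSum s' fun j hj =>
    integrable_bil hρ hp hq (hf i hi) (hg j hj) x]
  exact sum_congr rfl fun i hi => integral_finsetSum s' fun j hj =>
    integrable_bil hρ hp hq (hf i hi) (hg j hj) x

lemma bil_bound (hρ : Weight K ρ) (hp : Measurable p) (hq : Measurable q) (hf : L2B f a)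
    (hg : L2B g b) : L1B (bil p q ρ f g) (4 * K * (a * b)) := by
  have := hf.meas
  have := hg.meas
  have hK := hρ.one_le
  exact L1B.integral (Φ := fun x t => f (x - p t) * g (x - q t)) (by fun_prop) hρ.meas
    (by linarith) (mul_nonneg hf.nonneg hg.nonneg) hρ.lintegral_le
    fun t _ => (hf.translate _).mul (hg.translate _)

lemma lin_bound (hρ : Weight K ρ) (hp : Measurable p) (hf : L2B f a) :
    L2B (lin p ρ f) (4 * K * a) := by
  have := hf.meas
  have hK := hρ.one_le
  exact L2B.integral (Φ := fun x t => f (x - p t)) (by fun_prop) hρ.meas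
    (by linarith) hf.nonneg hρ.lintegral_le fun t _ => hf.translate _

/-- Replacing the second factor by its value at the base point. -/
lemma bil_sub_lin_mul_bound (hρ : Weight K ρ) (hp : Shift K m p) (hq : Shift K n q) (hf : L2B f a)
    (hf' : LocBdd f) (hg' : LocBdd g) (hB0 : 0 ≤ B)
    (hB : ∀ c, |c| ≤ K * 2 ^ (-n) → L2B (fun x => g (x - c) - g x) B) :
    L1B (fun x => bil p q ρ f g x - lin p ρ f x * g x) (4 * K * (a * B)) := by
  have := hf'.meas
  have := hg'.meas
  have := hp.meas
  have := hq.meas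
  have hK := hρ.one_le
  have h := L1B.integral (Φ := fun x t => f (x - p t) * (g (x - q t) - g x)) (by fun_prop)
    hρ.meas (by linarith) (mul_nonneg hf.nonneg hB0) hρ.lintegral_le
    fun t ht => (hf.translate _).mul (hB _ (hq.bound t (hρ.range ht).1 (hρ.range ht).2.1))
  convert h using 2 with x
  rw [bil, lin, ← integral_mul_const, ← integral_sub (integrable_bil hρ hp hq hf' hg' x)
    ((integrable_lin hρ hp hf' x).mul_const _)]
  exact integral_congr_ae (.of_forall fun t => by ring)

/-- Replacing each factor by its value at the base point. -/
lemma bil_sub_lin_sub_lin_bound (hρ : Weight K ρ) (hp : Shift K m p) (hq : Shift K n q)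
    (hf' : LocBdd f) (hg' : LocBdd g) (hA0 : 0 ≤ A) (hB0 : 0 ≤ B)
    (hA : ∀ c, |c| ≤ K * 2 ^ (-m) → L2B (fun x => f (x - c) - f x) A)
    (hB : ∀ c, |c| ≤ K * 2 ^ (-n) → L2B (fun x => g (x - c) - g x) B) :
    L1B (fun x => bil p q ρ f g x - lin p ρ f x * g x - f x * lin q ρ g x)
      (4 * K * (A * B)) := by
  have := hf'.meas
  have := hg'.meas
  have := hp.meas
  have := hq.meas
  have hK := hρ.one_le
  have h := L1B.integral (Φ := fun x t => (f (x - p t) - f x) * (g (x - q t) - g x))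
    (by fun_prop) hρ.meas (by linarith) (mul_nonneg hA0 hB0) hρ.lintegral_le
    fun t ht => (hA _ (hp.bound t (hρ.range ht).1 (hρ.range ht).2.1)).mul
      (hB _ (hq.bound t (hρ.range ht).1 (hρ.range ht).2.1))
  convert h using 2 with x
  have e : ∫ t, f x * g x * (ρ t : ℂ) = 0 := by
    rw [integral_const_mul, hρ.integral_ofReal, mul_zero]
  have h1 := integrable_bil hρ hp hq hf' hg' x
  have h2 : Integrable fun t => f (x - p t) * (ρ t : ℂ) * g x :=
    (integrable_lin hρ hp hf' x).mul_const _
  have h3 : Integrable fun t => f x * (g (x - q t) * (ρ t : ℂ)) :=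
    (integrable_lin hρ hq hg' x).const_mul _
  have h4 : Integrable fun t => f x * g x * (ρ t : ℂ) := (integrable_weight hρ).const_mul _
  have h12 : Integrable fun t => f (x - p t) * g (x - q t) * (ρ t : ℂ) -
    f (x - p t) * (ρ t : ℂ) * g x := h1.sub h2
  have h123 : Integrable fun t => f (x - p t) * g (x - q t) * (ρ t : ℂ) -
    f (x - p t) * (ρ t : ℂ) * g x - f x * (g (x - q t) * (ρ t : ℂ)) := h12.sub h3
  rw [bil, lin, lin, ← integral_mul_const, ← integral_const_mul, ← integral_sub h1 h2,
    ← integral_sub h12 h3, ← add_zero (∫ t, _), ← e, ← integral_add h123 h4]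
  exact integral_congr_ae (.of_forall fun t => by ring)

/-- Linear averages gain from the regularity of the function. -/
lemma lin_bound_of_modulus (hρ : Weight K ρ) (hp : Shift K m p) (hf' : LocBdd f) (hA0 : 0 ≤ A)
    (hA : ∀ c, |c| ≤ K * 2 ^ (-m) → L2B (fun x => f (x - c) - f x) A) :
    L2B (lin p ρ f) (4 * K * A) := by
  have := hf'.meas
  have := hp.meas
  have hK := hρ.one_le
  have h := L2B.integral (Φ := fun x t => f (x - p t) - f x)
    (by fun_prop) hρ.meas (by linarith) hA0 hρ.lintegral_le
    fun t ht => hA _ (hp.bound t (hρ.range ht).1 (hρ.range ht).2.1)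
  convert h using 2 with x
  have e : ∫ t, f x * (ρ t : ℂ) = 0 := by
    rw [integral_const_mul, hρ.integral_ofReal, mul_zero]
  rw [lin, ← sub_zero (∫ t, _), ← e, ← integral_sub (integrable_lin hρ hp hf' x)
    ((integrable_weight hρ).const_mul _)]
  exact integral_congr_ae (.of_forall fun t => by ring)

lemma Weight.eventually_zero (hρ : Weight K ρ) {t : ℝ} (h : ¬ (1/4 < |t| ∧ |t| < 4)) :
    ∀ᶠ s in nhds t, ρ s = 0 := by
  have : ∀ᶠ s in nhds t, ¬ (1/2 ≤ |s| ∧ |s| ≤ 2) := by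
    rw [not_and_or, not_lt, not_lt] at h
    rcases h with h | h
    · have : ∀ᶠ s in nhds t, |s| < 1/2 :=
        continuous_abs.continuousAt.eventually_lt continuousAt_const (by linarith)
      exact this.mono fun s hs => by rintro ⟨h1, -⟩; linarith
    · have : ∀ᶠ s in nhds t, 2 < |s| :=
        continuousAt_const.eventually_lt continuous_abs.continuousAt (by linarith)
      exact this.mono fun s hs => by rintro ⟨-, h1⟩; linarith
  exact this.mono fun s hs => by by_contra h'; exact hs (hρ.supp s h')

lemma Weight.deriv_supp (hρ : Weight K ρ) {t : ℝ} (h : deriv ρ t ≠ 0) :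
    1/2 ≤ |t| ∧ |t| ≤ 2 := by
  by_contra hc
  refine h ?_
  have : ∀ᶠ s in nhds t, ¬ (1/2 ≤ |s| ∧ |s| ≤ 2) := by
    rw [not_and_or, not_le, not_le] at hc
    rcases hc with h | h
    · have : ∀ᶠ s in nhds t, |s| < 1/2 :=
        continuous_abs.continuousAt.eventually_lt continuousAt_const h
      exact this.mono fun s hs => by rintro ⟨h1, -⟩; linarith
    · have : ∀ᶠ s in nhds t, 2 < |s| :=
        continuousAt_const.eventually_lt continuous_abs.continuousAt h
      exact this.mono fun s hs => by rintro ⟨-, h1⟩; linarith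
  have h0 : ρ =ᶠ[nhds t] fun _ => 0 := this.mono fun s hs => by
    by_contra h'; exact hs (hρ.supp s h')
  rw [h0.deriv_eq, deriv_const]

lemma Shift.deriv_ne_zero (hp : Shift K m p) {t : ℝ} (h1 : 1/4 < |t|) (h2 : |t| < 4) :
    deriv p t ≠ 0 := fun h => by
  have := hp.lower t h1 h2
  rw [h, abs_zero, mul_zero] at this
  exact absurd this (not_le.2 (by positivity))

lemma Shift.inv_deriv_le (hp : Shift K m p) {t : ℝ} (h1 : 1/4 < |t|) (h2 : |t| < 4) :
    |deriv p t|⁻¹ ≤ K * 2 ^ m := by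
  have h0 := abs_pos.2 (hp.deriv_ne_zero h1 h2)
  have := hp.lower t h1 h2
  rw [zpow_neg] at this
  rw [inv_le_iff_one_le_mul₀ h0]
  have hm : (0:ℝ) < 2 ^ m := by positivity
  calc (1:ℝ) = (2 ^ m)⁻¹ * 2 ^ m := (inv_mul_cancel₀ hm.ne').symm
    _ ≤ (K * |deriv p t|) * 2 ^ m := by gcongr
    _ = _ := by ring

/-- The kernel arising after one integration by parts. -/
def ibpKernel (p ρ : ℝ → ℝ) (t : ℝ) : ℝ := (deriv ρ t * deriv p t - ρ t * deriv (deriv p) t) /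
  deriv p t ^ 2

lemma hasDerivAt_div_deriv (hρ : Weight K ρ) (hp : Shift K m p) (t : ℝ) :
    HasDerivAt (fun t => ρ t / deriv p t) (ibpKernel p ρ t) t := by
  by_cases h : 1/4 < |t| ∧ |t| < 4
  · exact ((hρ.smooth.differentiable one_ne_zero t).hasDerivAt).fun_div
      (hp.diff' t h.1 h.2).hasDerivAt (hp.deriv_ne_zero h.1 h.2)
  · have h0 := hρ.eventually_zero h
    have e : (fun t => ρ t / deriv p t) =ᶠ[nhds t] fun _ => 0 := h0.mono fun s hs => by
      simp only [hs, zero_div]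
    have h1 : ρ =ᶠ[nhds t] fun _ => 0 := h0
    have : ibpKernel p ρ t = 0 := by
      rw [ibpKernel, h0.self_of_nhds, h1.deriv_eq, deriv_const]; simp
    rw [this]
    exact (hasDerivAt_const t (0:ℝ)).congr_of_eventuallyEq e

lemma abs_ibpKernel_le (hρ : Weight K ρ) (hp : Shift K m p) (t : ℝ) :
    |ibpKernel p ρ t| ≤ 2 * K ^ 4 * 2 ^ m := by
  have hK := hρ.one_le
  have hm : (0:ℝ) < 2 ^ m := by positivity
  by_cases h : 1/4 < |t| ∧ |t| < 4
  · have h1 := hp.inv_deriv_le h.1 h.2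
    have h0 := abs_pos.2 (hp.deriv_ne_zero h.1 h.2)
    have e : ibpKernel p ρ t = deriv ρ t * (deriv p t)⁻¹ -
        ρ t * deriv (deriv p) t * ((deriv p t)⁻¹ * (deriv p t)⁻¹) := by
      have := hp.deriv_ne_zero h.1 h.2
      rw [ibpKernel]; field_simp
    rw [e]
    refine (abs_sub _ _).trans ?_
    rw [abs_mul, abs_mul, abs_mul, abs_mul, abs_inv]
    calc _ ≤ K * (K * 2 ^ m) + K * (K * 2 ^ (-m)) * ((K * 2 ^ m) * (K * 2 ^ m)) := by
          gcongr
          exacts [hρ.bound' t, hρ.bound t, hp.bound'' t h.1 h.2]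
      _ = (K ^ 2 + K ^ 4) * 2 ^ m := by
          rw [zpow_neg]; field_simp
      _ ≤ _ := by
          gcongr
          nlinarith [pow_le_pow_right₀ hK (show 2 ≤ 4 by norm_num)]
  · have h0 := hρ.eventually_zero h
    have h1 : ρ =ᶠ[nhds t] fun _ => 0 := h0
    have : ibpKernel p ρ t = 0 := by
      rw [ibpKernel, h0.self_of_nhds, h1.deriv_eq, deriv_const]; simp
    rw [this, abs_zero]; positivity

lemma ibpKernel_supp (hρ : Weight K ρ) {t : ℝ} (h : ibpKernel p ρ t ≠ 0) : 1/2 ≤ |t| ∧ |t| ≤ 2 := by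
  by_cases h1 : deriv ρ t = 0
  · refine hρ.supp t fun h2 => h ?_
    rw [ibpKernel, h1, h2]; simp
  · exact hρ.deriv_supp h1

lemma measurable_ibpKernel (hρ : Weight K ρ) : Measurable (ibpKernel p ρ) := by
  have := hρ.smooth.continuous.measurable
  have := measurable_deriv ρ
  have := measurable_deriv p
  have := measurable_deriv (deriv p)
  unfold ibpKernel
  fun_prop

/-- The second kernel arising after one integration by parts. -/
lemma abs_ratioKernel_le (hρ : Weight K ρ) (hp : Shift K m p) (hq : Shift K n q) (t : ℝ) :
    |deriv q t * (ρ t / deriv p t)| ≤ K ^ 3 * 2 ^ m * 2 ^ (-n) := by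
  have hK := hρ.one_le
  by_cases h : ρ t = 0
  · rw [h, zero_div, mul_zero, abs_zero]; positivity
  · obtain ⟨h1, h2, -⟩ := hρ.range (t := t) (by exact_mod_cast h)
    rw [abs_mul, div_eq_mul_inv, abs_mul, abs_inv]
    calc _ ≤ K * 2 ^ (-n) * (K * (K * 2 ^ m)) := by
          gcongr
          exacts [hq.bound' t h1 h2, hρ.bound t, hp.inv_deriv_le h1 h2]
      _ = _ := by ring

lemma bil_eq_ibp (hρ : Weight K ρ) (hp : Shift K m p) (hq : Shift K n q) {w W G : ℝ → ℂ}
    (hw : Continuous w) (hW : ∀ x, HasDerivAt W (w x) x) (hG : ContDiff ℝ 1 G) (x : ℝ) :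
    bil p q ρ w G x = (∫ t, (W (x - p t) * G (x - q t)) * (ibpKernel p ρ t : ℂ)) -
      ∫ t, (W (x - p t) * deriv G (x - q t)) * ((deriv q t * (ρ t / deriv p t) : ℝ) : ℂ) := by
  have hWc : Continuous W := continuous_iff_continuousAt.2 fun y => (hW y).continuousAt
  have hGc := hG.continuous
  have hG'c : Continuous (deriv G) := hG.continuous_deriv le_rfl
  obtain ⟨c, hc0, hc⟩ := (LocBdd.of_continuous hWc).along hp x
  obtain ⟨d, hd0, hd⟩ := (LocBdd.of_continuous hGc).along hq x
  obtain ⟨d', hd'0, hd'⟩ := (LocBdd.of_continuous hG'c).along hq x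
  have hK := hρ.one_le
  have hpm := hp.meas
  have hqm := hq.meas
  have hWm := hWc.measurable
  have hGm := hGc.measurable
  have hG'm := hG'c.measurable
  have hkm := measurable_ibpKernel (p := p) hρ
  have hρm := hρ.smooth.continuous.measurable
  have hdp := measurable_deriv p
  have hdq := measurable_deriv q
  have h1 := integrable_bil hρ hp hq (LocBdd.of_continuous hw) (LocBdd.of_continuous hGc) x
  have h2 : Integrable fun t => (W (x - p t) * G (x - q t)) * (ibpKernel p ρ t : ℂ) := by
    refine Weight.integrable_kernel (M := c * d * (2 * K ^ 4 * 2 ^ m)) (by fun_prop)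
      (by positivity) (fun t => ?_) fun t ht => ?_
    · by_cases h : ibpKernel p ρ t = 0
      · rw [h, Complex.ofReal_zero, mul_zero, norm_zero]; positivity
      · obtain ⟨h1, h2⟩ := ibpKernel_supp hρ h
        rw [norm_mul, norm_mul, norm_real]
        gcongr
        exacts [hc t (by linarith) (by linarith), hd t (by linarith) (by linarith),
          abs_ibpKernel_le hρ hp t]
    · exact (ibpKernel_supp (p := p) hρ (by exact_mod_cast right_ne_zero_of_mul ht)).2
  have h3 : Integrable fun t => (W (x - p t) * deriv G (x - q t)) *
      ((deriv q t * (ρ t / deriv p t) : ℝ) : ℂ) := by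
    refine Weight.integrable_kernel (M := c * d' * (K ^ 3 * 2 ^ m * 2 ^ (-n))) (by fun_prop)
      (by positivity) (fun t => ?_) fun t ht => ?_
    · by_cases h : ρ t = 0
      · rw [h, zero_div, mul_zero, Complex.ofReal_zero, mul_zero, norm_zero]; positivity
      · obtain ⟨h1, h2⟩ := hρ.supp t h
        rw [norm_mul, norm_mul, norm_real]
        gcongr
        exacts [hc t (by linarith) (by linarith), hd' t (by linarith) (by linarith),
          abs_ratioKernel_le hρ hp hq t]
    · refine (hρ.supp t fun h => right_ne_zero_of_mul ht ?_).2
      rw [h, zero_div, mul_zero, Complex.ofReal_zero]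
  have h0 : Integrable fun t => (W (x - p t) * G (x - q t)) * ((ρ t / deriv p t : ℝ) : ℂ) := by
    refine Weight.integrable_kernel (M := c * d * (K * (K * 2 ^ m))) (by fun_prop)
      (by positivity) (fun t => ?_) fun t ht => ?_
    · by_cases h : ρ t = 0
      · rw [h, zero_div, Complex.ofReal_zero, mul_zero, norm_zero]; positivity
      · obtain ⟨h1, h2⟩ := hρ.supp t h
        rw [norm_mul, norm_mul, norm_real, norm_eq_abs, div_eq_mul_inv, abs_mul,
          abs_inv]
        gcongr
        exacts [hc t (by linarith) (by linarith), hd t (by linarith) (by linarith),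
          hρ.bound t, hp.inv_deriv_le (by linarith) (by linarith)]
    · refine (hρ.supp t fun h => right_ne_zero_of_mul ht ?_).2
      rw [h, zero_div, Complex.ofReal_zero]
  have h12 : Integrable fun t => (W (x - p t) * G (x - q t)) * (ibpKernel p ρ t : ℂ) -
      (W (x - p t) * deriv G (x - q t)) * ((deriv q t * (ρ t / deriv p t) : ℝ) : ℂ) := h2.sub h3
  have key := integral_eq_zero_of_hasDerivAt_of_integrable (fun t => ?_) (h12.sub h1) h0
  · rw [← sub_eq_zero, ← integral_sub h2 h3, bil, ← neg_eq_zero, neg_sub,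
      ← integral_sub h12 h1]
    exact key
  · simp only [Pi.sub_apply]
    have hh := (hasDerivAt_div_deriv hρ hp t).ofReal_comp
    by_cases h : 1/4 < |t| ∧ |t| < 4
    · have hp1 := (hp.diff t h.1 h.2).hasDerivAt
      have hq1 := (hq.diff t h.1 h.2).hasDerivAt
      have e1 := (hW (x - p t)).scomp t (hp1.const_sub x)
      have e2 := ((hG.differentiable one_ne_zero (x - q t)).hasDerivAt).scomp t (hq1.const_sub x)
      have e := (e1.fun_mul e2).fun_mul hh
      refine e.congr_deriv ?_
      have hne : ((deriv p t : ℝ) : ℂ) ≠ 0 := by exact_mod_cast hp.deriv_ne_zero h.1 h.2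
      simp only [real_smul, Function.comp_apply]
      push_cast
      field_simp
      ring
    · have h0 := hρ.eventually_zero h
      have h1 : ρ =ᶠ[nhds t] fun _ => 0 := h0
      have hk : ibpKernel p ρ t = 0 := by
        rw [ibpKernel, h0.self_of_nhds, h1.deriv_eq, deriv_const]; simp
      rw [hk, h0.self_of_nhds]
      simp only [zero_div, mul_zero, Complex.ofReal_zero, sub_zero]
      refine (hasDerivAt_const t (0:ℂ)).congr_of_eventuallyEq (h0.mono fun s hs => ?_)
      simp only [hs, zero_div, Complex.ofReal_zero, mul_zero]

lemma bil_ibp_bound (hρ : Weight K ρ) (hp : Shift K m p) (hq : Shift K n q) {w W G : ℝ → ℂ}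
    {c b b' : ℝ} (hw : Continuous w) (hW : ∀ x, HasDerivAt W (w x) x) (hG : ContDiff ℝ 1 G)
    (hWc : L2B W c) (hGb : L2B G b) (hGb' : L2B (deriv G) b') :
    L1B (bil p q ρ w G) (8 * K ^ 4 * 2 ^ m * c * (b + 2 ^ (-n) * b')) := by
  have hK := hρ.one_le
  have := hp.meas
  have := hq.meas
  have := hWc.meas
  have := hGb.meas
  have := hGb'.meas
  have hkm := measurable_ibpKernel (p := p) hρ
  have hρm := hρ.smooth.continuous.measurable
  have hdp := measurable_deriv p
  have hdq := measurable_deriv q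
  have := hWc.nonneg
  have := hGb.nonneg
  have := hGb'.nonneg
  have h1 := L1B.integral (Φ := fun x t => W (x - p t) * G (x - q t)) (by fun_prop)
    (σ := fun t => (ibpKernel p ρ t : ℂ)) (M := 4 * (2 * K ^ 4 * 2 ^ m)) (by fun_prop)
    (by positivity) (mul_nonneg hWc.nonneg hGb.nonneg)
    (Weight.lintegral_kernel_le (by positivity)
      (fun t => by rw [norm_real]; exact abs_ibpKernel_le hρ hp t)
      fun t ht => (ibpKernel_supp (p := p) hρ (by exact_mod_cast ht)).2)
    fun t _ => (hWc.translate _).mul (hGb.translate _)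
  have h2 := L1B.integral (Φ := fun x t => W (x - p t) * deriv G (x - q t)) (by fun_prop)
    (σ := fun t => ((deriv q t * (ρ t / deriv p t) : ℝ) : ℂ))
    (M := 4 * (K ^ 3 * 2 ^ m * 2 ^ (-n))) (by fun_prop)
    (by positivity) (mul_nonneg hWc.nonneg hGb'.nonneg)
    (Weight.lintegral_kernel_le (by positivity)
      (fun t => by rw [norm_real]; exact abs_ratioKernel_le hρ hp hq t)
      fun t ht => (hρ.supp t fun h => ht (by rw [h, zero_div, mul_zero, Complex.ofReal_zero])).2)
    fun t _ => (hWc.translate _).mul (hGb'.translate _)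
  have h := h1.sub h2
  simp only [← bil_eq_ibp hρ hp hq hw hW hG] at h
  refine h.mono ?_
  have h3 : K ^ 3 ≤ 2 * K ^ 4 := by nlinarith [pow_pos (zero_lt_one.trans_le hK) 3]
  have h4 : 4 * (K ^ 3 * 2 ^ m * 2 ^ (-n)) * (c * b') ≤
      4 * (2 * K ^ 4 * 2 ^ m * 2 ^ (-n)) * (c * b') := by gcongr
  linarith

lemma lin_ibp_bound (hρ : Weight K ρ) (hp : Shift K m p) {w W : ℝ → ℂ}
    {c : ℝ} (hw : Continuous w) (hW : ∀ x, HasDerivAt W (w x) x) (hWc : L2B W c) :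
    L2B (lin p ρ w) (8 * K ^ 4 * 2 ^ m * c) := by
  have hK := hρ.one_le
  have := hp.meas
  have := hWc.meas
  have hkm := measurable_ibpKernel (p := p) hρ
  have := hWc.nonneg
  have h1 := L2B.integral (Φ := fun x t => W (x - p t)) (by fun_prop)
    (σ := fun t => (ibpKernel p ρ t : ℂ)) (M := 4 * (2 * K ^ 4 * 2 ^ m)) (by fun_prop)
    (by positivity) hWc.nonneg
    (Weight.lintegral_kernel_le (by positivity)
      (fun t => by rw [norm_real]; exact abs_ibpKernel_le hρ hp t)
      fun t ht => (ibpKernel_supp (p := p) hρ (by exact_mod_cast ht)).2)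
    fun t _ => hWc.translate _
  have e : lin p ρ w = fun x => ∫ t, W (x - p t) * (ibpKernel p ρ t : ℂ) := by
    funext x
    have := bil_eq_ibp hρ hp hp hw hW (G := fun _ => 1) contDiff_const x
    simpa [bil, lin] using this
  rw [e]
  exact h1.mono (by apply le_of_eq; ring)

namespace DyadicAvg.Piece

variable {k l : ℤ} {φ ψ : ℝ → ℂ} {a b : ℝ}

lemma locBdd (h : Piece k φ a) : LocBdd φ := LocBdd.of_atomConst h.const h.l2

lemma modulus (h : Piece k φ a) (hK : 1 ≤ K) {c : ℝ} (hc : |c| ≤ K * 2 ^ (-m)) :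
    L2B (fun x => φ (x - c) - φ x) (4 * K * (2 ^ (((k:ℝ) - m) / 2) * a)) := by
  have ha := h.l2.nonneg
  refine (translate_sub_bound h.const h.l2 c).mono ?_
  have e1 : (2:ℝ) ^ (((k:ℝ) - m) / 2) = √((2:ℝ) ^ (k - m)) := by
    rw [sqrt_eq_rpow, ← rpow_intCast, ← rpow_mul (by norm_num)]
    push_cast; congr 1; ring
  have e2 : √((2:ℝ) ^ (k + 1) * |c|) ≤ 2 * K * √((2:ℝ) ^ (k - m)) := by
    rw [sqrt_le_left (by positivity), mul_pow, sq_sqrt (by positivity)]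
    calc (2:ℝ) ^ (k + 1) * |c| ≤ 2 ^ (k + 1) * (K * 2 ^ (-m)) := by gcongr
      _ = 2 * K * 2 ^ (k - m) := by
          rw [zpow_add₀ two_ne_zero, zpow_sub₀ two_ne_zero, zpow_neg, zpow_one]; ring
      _ ≤ (2 * K) ^ 2 * 2 ^ (k - m) := by
          gcongr; nlinarith
  rw [e1]
  calc 2 * a * √((2:ℝ) ^ (k + 1) * |c|) ≤ 2 * a * (2 * K * √((2:ℝ) ^ (k - m))) := by gcongr
    _ = _ := by ring

lemma lin_bound_small (h : Piece k φ a) (hρ : Weight K ρ) (hp : Shift K m p) :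
    L2B (lin p ρ φ) (16 * K ^ 2 * (2 ^ (((k:ℝ) - m) / 2) * a)) := by
  have ha := h.l2.nonneg
  have hK := hρ.one_le
  exact (lin_bound_of_modulus hρ hp h.locBdd (by positivity)
    fun c hc => h.modulus hK hc).mono (by apply le_of_eq; ring)

lemma lin_bound_large (h : Piece k φ a) (hρ : Weight K ρ) (hp : Shift K m p) :
    L2B (lin p ρ φ) (24 * K ^ 4 * (2 ^ (-((k:ℝ) - m)) * a)) := by
  have ha := h.l2.nonneg
  have hK := hρ.one_le
  set X : ℝ := 2 ^ (m - k) with hX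
  have hX0 : 0 < X := by positivity
  have eX : (2:ℝ) ^ (-((k:ℝ) - m)) = X := by
    rw [hX, ← rpow_intCast]; push_cast; congr 1; ring
  obtain ⟨w, W, hw, hW, hwa, hwφ, -, hWa⟩ := h.exists_smooth (η := X ^ 2 / 2 ^ (k + 1))
      (by positivity)
  rw [mul_div_cancel₀ _ (by positivity), sqrt_sq hX0.le] at hwφ
  have h1 := lin_ibp_bound hρ hp hw.continuous hW hWa
  have h2 := lin_bound hρ hp.meas hwφ
  have h3 := h1.sub h2
  simp only [lin_sub hρ hp (LocBdd.of_continuous hw.continuous) h.locBdd, sub_sub_cancel] at h3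
  refine h3.mono ?_
  have e : (2:ℝ) ^ m * (2 ^ (-k) * a) = X * a := by
    rw [hX, zpow_sub₀ two_ne_zero, zpow_neg]; ring
  rw [eX, mul_assoc (8 * K ^ 4), e]
  have hXa : 0 ≤ X * a := by positivity
  have : K ≤ K ^ 4 := le_self_pow₀ hK (by norm_num)
  nlinarith [mul_le_mul_of_nonneg_right this hXa]

/-- Integration by parts in the first factor. -/
lemma bil_bound_ibp (h : Piece k φ a) (h' : Piece l ψ b) (hρ : Weight K ρ) (hp : Shift K m p)
    (hq : Shift K n q) {τ : ℝ} (hτ : 0 < τ) :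
    L1B (bil p q ρ φ ψ) (32 * K ^ 4 * ((√τ + 2 ^ (-((k:ℝ) - m)) +
      2 ^ (((l:ℝ) - n) - ((k:ℝ) - m)) / τ) * (a * b))) := by
  have ha := h.l2.nonneg
  have hb := h'.l2.nonneg
  have hK := hρ.one_le
  set X : ℝ := 2 ^ (m - k) with hX
  set Y : ℝ := 2 ^ (l - n) with hY
  have hX0 : 0 < X := by positivity
  have hY0 : 0 < Y := by positivity
  have eX : (2:ℝ) ^ (-((k:ℝ) - m)) = X := by
    rw [hX, ← rpow_intCast]; push_cast; congr 1; ring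
  have eY : (2:ℝ) ^ (((l:ℝ) - n) - ((k:ℝ) - m)) = X * Y := by
    rw [← eX, hY, ← rpow_intCast, ← rpow_add two_pos]; push_cast; congr 1; ring
  obtain ⟨w, W, hw, hW, hwa, hwφ, -, hWa⟩ := h.exists_smooth (η := τ / 2 ^ (k + 1)) (by positivity)
  obtain ⟨G, -, hG, -, hGb, hGψ, hG', -⟩ := h'.exists_smooth (η := τ / 2 ^ (l + 1)) (by positivity)
  rw [mul_div_cancel₀ _ (by positivity)] at hwφ hGψ
  have hwl := LocBdd.of_continuous hw.continuous
  have hGl := LocBdd.of_continuous hG.continuous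
  have h1 := bil_ibp_bound hρ hp hq hw.continuous hW hG hWa hGb hG'
  have h2 := bil_bound hρ hp.meas hq.meas hwφ h'.l2
  have h3 := bil_bound hρ hp.meas hq.meas hwa hGψ
  have h4 := (h1.sub h3).sub h2
  simp only [bil_sub_left hρ hp hq hwl h.locBdd h'.locBdd,
    bil_sub_right hρ hp hq hwl hGl h'.locBdd] at h4
  have e : (fun x => bil p q ρ w G x - (bil p q ρ w G x - bil p q ρ w ψ x) -
      (bil p q ρ w ψ x - bil p q ρ φ ψ x)) = bil p q ρ φ ψ := by funext x; ring
  rw [e] at h4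
  refine h4.mono ?_
  have e1 : (8:ℝ) * K ^ 4 * 2 ^ m * (2 ^ (-k) * a) = 8 * K ^ 4 * (X * a) := by
    rw [hX, zpow_sub₀ two_ne_zero, zpow_neg]; ring
  have e2 : (2:ℝ) ^ (-n) * (2 * b / (τ / 2 ^ (l + 1))) = 4 * Y / τ * b := by
    rw [hY, zpow_sub₀ two_ne_zero, zpow_neg, zpow_add₀ two_ne_zero, zpow_one]; field_simp; ring
  rw [e1, e2, eX, eY]
  have hs : 0 ≤ √τ * (a * b) := by positivity
  have h5 : K ≤ K ^ 4 := le_self_pow₀ hK (by norm_num)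
  have h6 := mul_le_mul_of_nonneg_right h5 hs
  have h7 : 0 ≤ K ^ 4 * (X * (a * b)) := by positivity
  have e3 : 8 * K ^ 4 * (X * a) * (b + 4 * Y / τ * b) =
    8 * (K ^ 4 * (X * (a * b))) + 32 * (K ^ 4 * (X * Y / τ * (a * b))) := by ring
  rw [e3]
  nlinarith

end DyadicAvg.Piece
end OneScale

/-- The data of the bilinear average at one scale: translations of size `2 ^ (-m)` and `2 ^ (-n)`,
with decay for a second factor oscillating at scale finer than `2 ^ (-n)`. -/
structure ScaleData (K : ℝ) (ρ : ℝ → ℝ) (m n : ℤ) (p q : ℝ → ℝ) : Prop where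
  left : Shift K m p
  right : Shift K n q
  osc : ∀ {f ψ : ℝ → ℂ} {a b : ℝ} {l : ℤ}, n ≤ l → L2B f a → DyadicAvg.Piece l ψ b →
    L1B (bil p q ρ f ψ) (K * (2 ^ (-(((l:ℝ) - n) / 64)) * (a * b)))

section OneScale

variable {K : ℝ} {ρ p q : ℝ → ℝ} {m n k l : ℤ} {φ ψ : ℝ → ℂ} {a b : ℝ}

lemma L1B.of_max {f : ℝ → ℂ} {C c u v w : ℝ} (hC : 0 ≤ C) (hc : 0 ≤ c)
    (hu : L1B f (C * (2 ^ (-u) * c))) (hv : L1B f (C * (2 ^ (-v) * c))) (hw : w ≤ max u v) :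
    L1B f (C * (2 ^ (-w) * c)) := by
  rcases le_max_iff.1 hw with h | h
  · refine hu.mono ?_
    gcongr
    norm_num
  · refine hv.mono ?_
    gcongr
    norm_num

namespace DyadicAvg.Piece

lemma avg_of_lt (h : Piece k φ a) (hkm : k < m) (x : ℝ) : avg m φ x = φ x :=
  avg_of_atomConst (h.const.of_le (by omega)) x

lemma avg_of_le (h : Piece k φ a) (hkm : m ≤ k) (x : ℝ) : avg m φ x = 0 := by
  rw [← avg_avg hkm h.l2.locInt, show avg k φ = fun _ => 0 from funext h.mean]
  simp [avg]

lemma bil_bound_large (h : Piece k φ a) (h' : Piece l ψ b) (hρ : Weight K ρ) (hp : Shift K m p)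
    (hq : Shift K n q) (hk : 0 ≤ (k:ℝ) - m) (hl : (l:ℝ) - n ≤ ((k:ℝ) - m) / 2) :
    L1B (bil p q ρ φ ψ) (96 * K ^ 4 * (2 ^ (-(((k:ℝ) - m) / 8)) * (a * b))) := by
  have ha := h.l2.nonneg
  have hb := h'.l2.nonneg
  have hK := hρ.one_le
  refine (h.bil_bound_ibp h' hρ hp hq (τ := 2 ^ (-(((k:ℝ) - m) / 4))) (by positivity)).mono ?_
  set x : ℝ := (k:ℝ) - m
  have e1 : √((2:ℝ) ^ (-(x / 4))) = 2 ^ (-(x / 8)) := by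
    rw [sqrt_eq_rpow, ← rpow_mul (by norm_num)]; congr 1; ring
  have e2 : (2:ℝ) ^ (-x) ≤ 2 ^ (-(x / 8)) :=
    rpow_le_rpow_of_exponent_le (by norm_num) (by linarith)
  have e3 : (2:ℝ) ^ (((l:ℝ) - n) - x) / 2 ^ (-(x / 4)) ≤ 2 ^ (-(x / 8)) := by
    rw [← rpow_sub two_pos]
    exact rpow_le_rpow_of_exponent_le (by norm_num) (by linarith)
  calc _ ≤ 32 * K ^ 4 * ((2 ^ (-(x / 8)) + 2 ^ (-(x / 8)) + 2 ^ (-(x / 8))) * (a * b)) := by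
        gcongr
        exact e1.le
    _ = _ := by ring

lemma mixed_bound (h : Piece k φ a) (h' : Piece l ψ b) (hρ : Weight K ρ) (hp : Shift K m p)
    (hq : Shift K n q) (hk : m ≤ k) (hl : l < n) :
    L1B (fun x => bil p q ρ φ ψ x - lin p ρ φ x * ψ x)
      (128 * K ^ 4 * (2 ^ (-((|(k:ℝ) - m| + |(l:ℝ) - n|) / 192)) * (a * b))) := by
  have ha := h.l2.nonneg
  have hb := h'.l2.nonneg
  have hK := hρ.one_le
  have hk' : 0 ≤ (k:ℝ) - m := sub_nonneg.2 (by exact_mod_cast hk)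
  have hl' : (l:ℝ) - n < 0 := sub_neg.2 (by exact_mod_cast hl)
  have hab : 0 ≤ a * b := by positivity
  have h1 := bil_sub_lin_mul_bound hρ hp hq h.l2 h.locBdd h'.locBdd (by positivity)
    fun c hc => h'.modulus hK hc
  have h2 := (h.bil_bound_large h' hρ hp hq hk' (by linarith)).sub
    ((h.lin_bound_large hρ hp).mul h'.l2)
  rw [abs_of_nonneg hk', abs_of_neg hl']
  have h24 : K ^ 2 ≤ K ^ 4 := pow_le_pow_right₀ hK (by norm_num)
  refine L1B.of_max (u := ((k:ℝ) - m) / 8) (v := -(((l:ℝ) - n) / 2)) (by positivity) hab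
    (h2.mono ?_) (h1.mono ?_) ?_
  · have e2 : (2:ℝ) ^ (-((k:ℝ) - m)) ≤ 2 ^ (-(((k:ℝ) - m) / 8)) :=
      rpow_le_rpow_of_exponent_le (by norm_num) (by linarith)
    set Z := (2:ℝ) ^ (-(((k:ℝ) - m) / 8))
    have : 24 * K ^ 4 * (2 ^ (-((k:ℝ) - m)) * a) * b ≤ 24 * K ^ 4 * (Z * a) * b := by gcongr
    have h0 : 0 ≤ K ^ 4 * (Z * (a * b)) := by positivity
    nlinarith
  · rw [neg_neg]
    set Z := (2:ℝ) ^ (((l:ℝ) - n) / 2)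
    have h0 : 0 ≤ Z * (a * b) := by positivity
    have := mul_le_mul_of_nonneg_right h24 h0
    have : 0 ≤ K ^ 4 * (Z * (a * b)) := by positivity
    nlinarith
  · rcases le_total (((k:ℝ) - m) / 8) (-(((l:ℝ) - n) / 2)) with hle | hle
    · exact le_max_of_le_right (by linarith)
    · exact le_max_of_le_left (by linarith)

end DyadicAvg.Piece

open DyadicAvg

/-- The one scale bilinear average with its paraproduct parts removed. -/
def remainder (m n : ℤ) (p q ρ : ℝ → ℝ) (f g : ℝ → ℂ) (x : ℝ) : ℂ :=
  bil p q ρ f g x - lin p ρ f x * avg n g x - avg m f x * lin q ρ g x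

lemma remainder_bound (hρ : Weight K ρ) (hS : ScaleData K ρ m n p q) (h : Piece k φ a)
    (h' : Piece l ψ b) : L1B (remainder m n p q ρ φ ψ)
      (128 * K ^ 4 * (2 ^ (-((|(k:ℝ) - m| + |(l:ℝ) - n|) / 192)) * (a * b))) := by
  have ha := h.l2.nonneg
  have hb := h'.l2.nonneg
  have hab : 0 ≤ a * b := by positivity
  have hK := hρ.one_le
  have hp := hS.left
  have hq := hS.right
  unfold remainder
  rcases le_or_gt m k with hk | hk <;> rcases le_or_gt n l with hl | hl
  · have hk' : 0 ≤ (k:ℝ) - m := sub_nonneg.2 (by exact_mod_cast hk)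
    have hl' : 0 ≤ (l:ℝ) - n := sub_nonneg.2 (by exact_mod_cast hl)
    simp only [h.avg_of_le hk, h'.avg_of_le hl, mul_zero, zero_mul, sub_zero]
    rw [abs_of_nonneg hk', abs_of_nonneg hl']
    rcases le_total (((k:ℝ) - m) / 2) ((l:ℝ) - n) with hc | hc
    · refine (hS.osc hl h.l2 h').mono ?_
      have hK4 : K ≤ 128 * K ^ 4 := by
        have := le_self_pow₀ hK (show 4 ≠ 0 by norm_num)
        linarith [pow_pos (zero_lt_one.trans_le hK) 4]
      have e : (2:ℝ) ^ (-(((l:ℝ) - n) / 64)) ≤ 2 ^ (-(((k:ℝ) - m + ((l:ℝ) - n)) / 192)) :=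
        rpow_le_rpow_of_exponent_le (by norm_num) (by linarith)
      gcongr
    · refine (h.bil_bound_large h' hρ hp hq hk' hc).mono ?_
      have e : (2:ℝ) ^ (-(((k:ℝ) - m) / 8)) ≤ 2 ^ (-(((k:ℝ) - m + ((l:ℝ) - n)) / 192)) :=
        rpow_le_rpow_of_exponent_le (by norm_num) (by linarith)
      gcongr
      norm_num
  · simp only [h.avg_of_le hk, h'.avg_of_lt hl, zero_mul, sub_zero]
    exact h.mixed_bound h' hρ hp hq hk hl
  · simp only [h.avg_of_lt hk, h'.avg_of_le hl, mul_zero, sub_zero]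
    have := h'.mixed_bound h hρ hq hp hl hk
    simp only [bil_comm q p, mul_comm (lin q ρ ψ _)] at this
    rwa [add_comm, mul_comm b a] at this
  · have hk' : (k:ℝ) - m < 0 := sub_neg.2 (by exact_mod_cast hk)
    have hl' : (l:ℝ) - n < 0 := sub_neg.2 (by exact_mod_cast hl)
    simp only [h.avg_of_lt hk, h'.avg_of_lt hl]
    refine (bil_sub_lin_sub_lin_bound hρ hp hq h.locBdd h'.locBdd (by positivity) (by positivity)
      (fun c hc => h.modulus hK hc) (fun c hc => h'.modulus hK hc)).mono ?_
    rw [abs_of_neg hk', abs_of_neg hl']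
    have e : (2:ℝ) ^ (((k:ℝ) - m) / 2) * 2 ^ (((l:ℝ) - n) / 2) ≤
        2 ^ (-((-((k:ℝ) - m) + -((l:ℝ) - n)) / 192)) := by
      rw [← rpow_add two_pos]
      exact rpow_le_rpow_of_exponent_le (by norm_num) (by linarith)
    have h34 : K ^ 3 ≤ K ^ 4 := pow_le_pow_right₀ hK (by norm_num)
    calc _ = 64 * K ^ 3 * ((2:ℝ) ^ (((k:ℝ) - m) / 2) * 2 ^ (((l:ℝ) - n) / 2) * (a * b)) := by ring
      _ ≤ _ := by
          gcongr
          norm_num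

end OneScale

/-- Exponential decay away from the origin. -/
def decay (e : ℝ) (z : ℤ) : ℝ := 2 ^ (-(e * |(z:ℝ)|))

lemma decay_pos (e : ℝ) (z : ℤ) : 0 < decay e z := by unfold decay; positivity

lemma decay_nonneg (e : ℝ) (z : ℤ) : 0 ≤ decay e z := (decay_pos e z).le

lemma summable_decay {e : ℝ} (he : 0 < e) : Summable (decay e) := by
  have hr : (2:ℝ) ^ (-e) < 1 := Real.rpow_lt_one_of_one_lt_of_neg one_lt_two (by linarith)
  have key : Summable fun n : ℕ => decay e n := by
    refine (summable_geometric_of_lt_one (by positivity) hr).congr fun n => ?_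
    rw [decay, ← rpow_natCast, ← rpow_mul (by norm_num)]
    simp
  refine Summable.of_nat_of_neg key (key.congr fun n => ?_)
  simp [decay]

/-- The total mass of `decay e`. -/
def decaySum (e : ℝ) : ℝ := ∑' z, decay e z

lemma decaySum_nonneg (e : ℝ) : 0 ≤ decaySum e := tsum_nonneg (decay_nonneg e)

lemma sum_decay_le {e : ℝ} (he : 0 < e) {ι : Type*} (s : Finset ι) {c : ι → ℤ}
    (hc : InjOn c s) : ∑ i ∈ s, decay e (c i) ≤ decaySum e := by
  rw [← Finset.sum_image (f := decay e) hc]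
  exact (summable_decay he).sum_le_tsum _ fun z _ => decay_nonneg e z

/-- Schur's test for an exponentially decaying kernel. -/
lemma schur_decay {e : ℝ} (he : 0 < e) {ι : Type*} (s : Finset ι) {m : ι → ℤ} (hm : InjOn m s)
    (I : Finset ℤ) {α : ℤ → ℝ} {a : ℝ} (hα : ∑ k ∈ I, α k ^ 2 ≤ a ^ 2) :
    ∑ i ∈ s, (∑ k ∈ I, decay e (k - m i) * α k) ^ 2 ≤ (decaySum e * a) ^ 2 := by
  have h1 : ∀ i, (∑ k ∈ I, decay e (k - m i) * α k) ^ 2 ≤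
      decaySum e * ∑ k ∈ I, decay e (k - m i) * α k ^ 2 := by
    intro i
    have := Finset.sum_mul_sq_le_sq_mul_sq I (fun k => √(decay e (k - m i)))
      fun k => √(decay e (k - m i)) * α k
    simp only [mul_pow, sq_sqrt (decay_nonneg _ _), ← mul_assoc,
      Real.mul_self_sqrt (decay_nonneg _ _)] at this
    refine this.trans ?_
    refine mul_le_mul_of_nonneg_right (sum_decay_le he I fun x _ y _ h => by simpa using h) ?_
    exact sum_nonneg fun k _ => mul_nonneg (decay_nonneg _ _) (sq_nonneg _)
  calc _ ≤ ∑ i ∈ s, decaySum e * ∑ k ∈ I, decay e (k - m i) * α k ^ 2 :=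
        sum_le_sum fun i _ => h1 i
    _ = decaySum e * ∑ k ∈ I, (∑ i ∈ s, decay e (k - m i)) * α k ^ 2 := by
        rw [← mul_sum, Finset.sum_comm]
        simp only [sum_mul]
    _ ≤ decaySum e * ∑ k ∈ I, decaySum e * α k ^ 2 := by
        refine mul_le_mul_of_nonneg_left (sum_le_sum fun k _ =>
          mul_le_mul_of_nonneg_right (sum_decay_le he s fun i hi j hj h => hm hi hj ?_)
            (sq_nonneg _)) (decaySum_nonneg e)
        have : k - m i = k - m j := h
        omega
    _ ≤ decaySum e * (decaySum e * a ^ 2) := by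
        rw [← mul_sum]
        have := decaySum_nonneg e
        gcongr
    _ = _ := by ring

/-- A finite sequence of functions whose `L²` norms are square summable, with sum `A ^ 2`. -/
structure SqB (N : ℕ) (u : ℕ → ℝ → ℂ) (A : ℝ) : Prop where
  nonneg : 0 ≤ A
  bound : ∃ d : ℕ → ℝ, (∀ i < N, L2B (u i) (d i)) ∧ ∑ i ∈ Finset.range N, d i ^ 2 ≤ A ^ 2

lemma SqB.mul {N : ℕ} {u v : ℕ → ℝ → ℂ} {A B : ℝ} (hu : SqB N u A) (hv : SqB N v B) :
    L1B (fun x => ∑ i ∈ Finset.range N, u i x * v i x) (A * B) := by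
  obtain ⟨c, hc, hcA⟩ := hu.bound
  obtain ⟨d, hd, hdB⟩ := hv.bound
  refine (L1B.sum (Finset.range N) (f := fun i x => u i x * v i x) fun i hi =>
    (hc i (Finset.mem_range.1 hi)).mul (hd i (Finset.mem_range.1 hi))).mono ?_
  refine abs_le_of_sq_le_sq' ?_ (mul_nonneg hu.nonneg hv.nonneg) |>.2
  refine (Finset.sum_mul_sq_le_sq_mul_sq _ _ _).trans ?_
  rw [mul_pow]
  gcongr

lemma SqB.of_lintegral {N : ℕ} {u : ℕ → ℝ → ℂ} {A : ℝ} (hA : 0 ≤ A) (hu : ∀ i, Measurable (u i))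
    (h : ∑ i ∈ Finset.range N, ∫⁻ x, ‖u i x‖ₑ ^ 2 ≤ ofReal (A ^ 2)) : SqB N u A := by
  have hfin : ∀ i < N, ∫⁻ x, ‖u i x‖ₑ ^ 2 ≠ ⊤ := fun i hi =>
    ((Finset.single_le_sum (f := fun i => ∫⁻ x, ‖u i x‖ₑ ^ 2) (fun _ _ => zero_le)
      (Finset.mem_range.2 hi)).trans h).trans_lt ofReal_lt_top |>.ne
  have hsq : ∀ i < N, nrm (u i) ^ 2 = (∫⁻ x, ‖u i x‖ₑ ^ 2).toReal := fun i _ => by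
    rw [nrm, ← ENNReal.toReal_pow, sq_eLpNorm_two]
  refine ⟨hA, fun i => nrm (u i), fun i hi => L2B.of_lintegral (hu i) (nrm_nonneg _) ?_, ?_⟩
  · rw [hsq i hi, ENNReal.ofReal_toReal (hfin i hi)]
  · rw [sum_congr rfl fun i hi => hsq i (Finset.mem_range.1 hi),
      ← ENNReal.toReal_sum fun i hi => hfin i (Finset.mem_range.1 hi)]
    exact ENNReal.toReal_le_of_le_ofReal (sq_nonneg _) h

lemma SqB.of_schur {e : ℝ} (he : 0 < e) {N : ℕ} {m : ℕ → ℤ} (hm : InjOn m (Finset.range N))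
    (I : Finset ℤ) {α : ℤ → ℝ} {a C : ℝ} (ha : 0 ≤ a) (hC : 0 ≤ C) (hα : ∑ k ∈ I, α k ^ 2 ≤ a ^ 2)
    {u : ℕ → ℝ → ℂ} (hu : ∀ i < N, L2B (u i) (C * ∑ k ∈ I, decay e (k - m i) * α k)) :
    SqB N u (C * (decaySum e * a)) := by
  refine ⟨mul_nonneg hC (mul_nonneg (decaySum_nonneg e) ha), _, hu, ?_⟩
  simp_rw [mul_pow C]
  rw [← mul_sum]
  gcongr
  exact schur_decay he _ hm I hα

namespace DyadicAvg

lemma sqB_mdiff {n : ℕ → ℤ} (hn : Monotone n) {f : ℝ → ℂ} {a : ℝ} (hf : L2B f a) (N : ℕ) :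
    SqB N (fun i => mdiff n i f) a :=
  SqB.of_lintegral hf.nonneg (fun i => measurable_mdiff n i f) (sum_mdiff_le hn hf N)

lemma sqB_mdiff_of_antitone {n : ℕ → ℤ} (hn : Antitone n) {f : ℝ → ℂ} {a : ℝ} (hf : L2B f a)
    (N : ℕ) : SqB N (fun i => mdiff n i f) a := by
  refine SqB.of_lintegral hf.nonneg (fun i => measurable_mdiff n i f) ?_
  have hmono : Monotone fun i => n (N - i) := fun i j hij => hn (by omega)
  refine le_trans (le_of_eq ?_) (sum_mdiff_le hmono hf N)
  rw [← Finset.sum_range_reflect]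
  refine sum_congr rfl fun i hi => lintegral_congr fun x => ?_
  have hi' := Finset.mem_range.1 hi
  simp only [mdiff]
  rw [show N - 1 - i + 1 = N - i by omega, show N - 1 - i = N - (i + 1) by omega, enorm_sub_rev]

/-- Pythagoras' theorem for a function and an increment with vanishing dyadic averages. -/
lemma L2B_add_of_orthogonal {m : ℤ} {u v : ℝ → ℂ} {a b : ℝ} (hu : L2B u a) (hv : L2B v b)
    (hc : AtomConst m u) (hv0 : ∀ x, avg m v x = 0) :
    L2B (fun x => u x + v x) √(a ^ 2 + b ^ 2) := by
  have hsq : ∀ {w : ℝ → ℂ} {c : ℝ}, L2B w c → Integrable (fun x => ‖w x‖ ^ 2) ∧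
      ∫ x, ‖w x‖ ^ 2 ≤ c ^ 2 := by
    intro w c hw
    have hi : Integrable (fun x => ‖w x‖ ^ 2) := hw.memLp.integrable_norm_pow two_ne_zero
    refine ⟨hi, ?_⟩
    have h := hw.lintegral_le
    have e : ofReal (∫ x, ‖w x‖ ^ 2) = ∫⁻ x, ‖w x‖ₑ ^ 2 := by
      rw [ofReal_integral_eq_lintegral_ofReal hi (.of_forall fun y => by positivity)]
      refine lintegral_congr fun y => ?_
      rw [ofReal_pow (norm_nonneg _), ofReal_norm]
    rw [← e] at h
    exact (ENNReal.ofReal_le_ofReal_iff (sq_nonneg c)).1 h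
  have huc : L2B (fun x => conj (u x)) a :=
    hu.mono_fun (Complex.continuous_conj.measurable.comp hu.meas) fun x => by simp
  have hintg : Integrable fun x => conj (u x) * v x := (huc.mul hv).integrable
  have horth : ∫ x, conj (u x) * v x = 0 := by
    rw [← integral_mul_avg (hc.comp conj) hv.meas hintg]
    simp [hv0]
  have huv := hu.add hv
  refine L2B.of_lintegral huv.meas (by positivity) ?_
  obtain ⟨hi, -⟩ := hsq huv
  rw [sq_sqrt (by positivity)]
  have e : ofReal (∫ x, ‖u x + v x‖ ^ 2) = ∫⁻ x, ‖u x + v x‖ₑ ^ 2 := by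
    rw [ofReal_integral_eq_lintegral_ofReal hi (.of_forall fun y => by positivity)]
    refine lintegral_congr fun y => ?_
    rw [ofReal_pow (norm_nonneg _), ofReal_norm]
  rw [← e]
  refine ofReal_le_ofReal ?_
  have hre : Integrable fun x => 2 * (conj (u x) * v x).re := hintg.re.const_mul 2
  have hre0 : ∫ x, 2 * (conj (u x) * v x).re = 0 := by
    have h1 : ∫ x, (conj (u x) * v x).re = (∫ x, conj (u x) * v x).re := integral_re hintg
    rw [integral_const_mul, h1, horth]; simp
  have hpt : ∀ x, ‖u x + v x‖ ^ 2 = ‖u x‖ ^ 2 + ‖v x‖ ^ 2 + 2 * (conj (u x) * v x).re := by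
    intro x
    rw [← normSq_eq_norm_sq, ← normSq_eq_norm_sq, ← normSq_eq_norm_sq,
      Complex.normSq_add]
    simp only [Complex.mul_re, Complex.conj_re, Complex.conj_im]
    ring
  have h12 : Integrable fun x => ‖u x‖ ^ 2 + ‖v x‖ ^ 2 := (hsq hu).1.add (hsq hv).1
  simp_rw [hpt]
  rw [integral_add h12 hre, hre0, add_zero, integral_add (hsq hu).1 (hsq hv).1]
  exact add_le_add (hsq hu).2 (hsq hv).2

/-- The square function of the martingale differences controls the function. -/
lemma avg_sub_avg_bound {F : ℝ → ℂ} {a : ℝ} (hF : L2B F a) (μ : ℤ) (N : ℕ) {d : ℕ → ℝ}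
    (hd : ∀ i < N, L2B (mdiff (fun i => μ + i) i F) (d i)) :
    L2B (fun x => avg (μ + N) F x - avg μ F x) √(∑ i ∈ Finset.range N, d i ^ 2) := by
  have hmono : Monotone fun i : ℕ => μ + i := fun i j hij => by
    simp only [add_le_add_iff_left]; exact_mod_cast hij
  induction N with
  | zero => simpa using L2B.zero
  | succ N ih =>
    have h1 := ih fun i hi => hd i (by omega)
    have h2 := L2B_add_of_orthogonal (m := μ + N) h1 (hd N (by omega))
      (((atomConst_avg _ F).comp₂ ((atomConst_avg μ F).of_le (by omega))) fun a b => a - b)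
      fun x => avg_mdiff hmono N hF.locInt x
    rw [sq_sqrt (by positivity), ← sum_range_succ fun i => d i ^ 2] at h2
    convert h2 using 2 with x
    simp only [mdiff]
    push_cast
    ring

end DyadicAvg

open DyadicAvg

lemma L2B.of_max {f : ℝ → ℂ} {C c u v w : ℝ} (hC : 0 ≤ C) (hc : 0 ≤ c)
    (hu : L2B f (C * (2 ^ (-u) * c))) (hv : L2B f (C * (2 ^ (-v) * c))) (hw : w ≤ max u v) :
    L2B f (C * (2 ^ (-w) * c)) := by
  rcases le_max_iff.1 hw with h | h
  · refine hu.mono ?_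
    gcongr
    norm_num
  · refine hv.mono ?_
    gcongr
    norm_num

section AverageOfShift

variable {K : ℝ} {ρ p : ℝ → ℝ} {m k μ : ℤ} {f φ : ℝ → ℂ} {a : ℝ}

lemma measurable_uncurry_avg_translate (hf : Measurable f) (hp : Measurable p) (μ : ℤ) :
    Measurable (uncurry fun x t => avg μ (fun y => f (y - p t)) x) := by
  have hset : MeasurableSet {z : (ℝ × ℝ) × ℝ | z.2 ∈ atom μ z.1.1} := by
    simp only [atom, mem_ofPred_eq]
    exact measurableSet_eq_fun (by fun_prop) (by fun_prop)
  have h : StronglyMeasurable ({z : (ℝ × ℝ) × ℝ | z.2 ∈ atom μ z.1.1}.indicator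
      fun z => f (z.2 - p z.1.2)) :=
    (Measurable.indicator (by fun_prop) hset).stronglyMeasurable
  have h2 := (StronglyMeasurable.integral_prod_right' (ν := volume) h).measurable.const_mul
    (((2:ℝ) ^ μ : ℝ) : ℂ)
  convert h2 using 2 with z
  simp only [uncurry, avg]
  rw [← integral_indicator (measurableSet_atom _ _)]
  rfl

lemma avg_lin (hρ : Weight K ρ) (hp : Shift K m p) (hf : LocBdd f) (μ : ℤ) (x : ℝ) :
    avg μ (lin p ρ f) x = ∫ t, avg μ (fun y => f (y - p t)) x * (ρ t : ℂ) := by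
  have hm := hf.meas
  have hpm := hp.meas
  have hρm := hρ.smooth.continuous.measurable
  obtain ⟨c, hc0, hc⟩ := hf.bdd (|x| + 2 ^ (-μ) + K * 2 ^ (-m))
  have hintg : Integrable (uncurry fun y t => f (y - p t) * (ρ t : ℂ))
      ((volume.restrict (atom μ x)).prod volume) := by
    have hone : Integrable (fun _ : ℝ => (c : ℂ)) (volume.restrict (atom μ x)) :=
      integrableOn_const (volume_atom_ne_top μ x)
    refine (hone.mul_prod (integrable_weight hρ)).mono
      (Measurable.aestronglyMeasurable (by fun_prop)) ?_
    have : ∀ᵐ z ∂(volume.restrict (atom μ x)).prod (volume : Measure ℝ), z.1 ∈ atom μ x :=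
      Measure.quasiMeasurePreserving_fst.ae (ae_restrict_mem (measurableSet_atom μ x))
    filter_upwards [this] with z hz
    simp only [uncurry, norm_mul]
    by_cases h : (ρ z.2 : ℂ) = 0
    · simp [h]
    · refine mul_le_mul_of_nonneg_right ?_ (norm_nonneg _)
      rw [norm_real, norm_of_nonneg hc0]
      refine hc _ ?_
      have h1 := hp.bound z.2 (hρ.range h).1 (hρ.range h).2.1
      have h2 := abs_sub_le_of_mem_atom hz
      calc |z.1 - p z.2| = |x + (z.1 - x) - p z.2| := by ring_nf
        _ ≤ |x| + |z.1 - x| + |p z.2| := (abs_sub _ _).trans (by gcongr; exact abs_add_le _ _)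
        _ ≤ _ := by linarith
  simp only [avg, lin, mul_assoc]
  rw [integral_const_mul]
  congr 1
  rw [integral_integral_swap hintg]
  exact integral_congr_ae (.of_forall fun t => integral_mul_const _ _)

namespace DyadicAvg.Piece

lemma lin_bound (h : Piece k φ a) (hρ : Weight K ρ) (hp : Shift K m p) :
    L2B (lin p ρ φ) (24 * K ^ 4 * (2 ^ (-(|(k:ℝ) - m| / 2)) * a)) := by
  have ha := h.l2.nonneg
  have hK := hρ.one_le
  have hs : L2B (lin p ρ φ) (24 * K ^ 4 * (2 ^ (-(-(((k:ℝ) - m) / 2))) * a)) := by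
    refine (h.lin_bound_small hρ hp).mono ?_
    rw [neg_neg]
    gcongr
    · norm_num
    · norm_num
  refine hs.of_max (by positivity) ha (h.lin_bound_large hρ hp) ?_
  rcases abs_cases ((k:ℝ) - m) with h | h <;> rw [h.1]
  · exact le_max_of_le_right (by linarith)
  · exact le_max_of_le_left (by linarith)

lemma lin_sub_avg_bound (h : Piece k φ a) (hρ : Weight K ρ) (hp : Shift K m p) (μ : ℤ) :
    L2B (fun x => lin p ρ φ x - avg μ (lin p ρ φ) x)
      (32 * K * (2 ^ (((k:ℝ) - μ) / 2) * a)) := by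
  have ha := h.l2.nonneg
  have hK := hρ.one_le
  have hm := h.l2.meas
  have key : ∀ c, |c| ≤ 2 ^ (-μ) → L2B (fun x => lin p ρ φ (x - c) - lin p ρ φ x)
      (4 * K * (4 * 1 * (2 ^ (((k:ℝ) - μ) / 2) * a))) := by
    intro c hc
    have hb := _root_.lin_bound hρ hp.meas (h.modulus le_rfl (m := μ) (c := c) (by simpa using hc))
    convert hb using 2 with x
    have hl : LocBdd fun x => φ (x - c) := by
      refine ⟨by fun_prop, fun R => ?_⟩
      obtain ⟨b, hb0, hb⟩ := h.locBdd.bdd (R + |c|)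
      exact ⟨b, hb0, fun x hx => hb _ ((abs_sub _ _).trans (by linarith))⟩
    rw [lin_sub hρ hp hl h.locBdd, lin, lin, lin]
    congr 1
    exact integral_congr_ae (.of_forall fun t => by simp only [sub_right_comm])
  refine (sub_avg_bound (h.lin_bound hρ hp) μ (by positivity) key).mono (le_of_eq ?_)
  ring

lemma avg_lin_bound (h : Piece k φ a) (hρ : Weight K ρ) (hp : Shift K m p) (μ : ℤ) :
    L2B (avg μ (lin p ρ φ)) (16 * K * (2 ^ (((μ:ℝ) - k) / 2) * a)) := by
  have ha := h.l2.nonneg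
  have hK := hρ.one_le
  have hb := L2B.integral (measurable_uncurry_avg_translate h.l2.meas hp.meas μ) hρ.meas
    (by linarith) (by positivity) hρ.lintegral_le
    fun t _ => avg_translate_bound h.l2 h.mean μ (p t)
  rw [show avg μ (lin p ρ φ) = _ from funext fun x => avg_lin hρ hp h.locBdd μ x]
  refine hb.mono (le_of_eq ?_)
  have e : √((2:ℝ) ^ (μ - k)) = 2 ^ (((μ:ℝ) - k) / 2) := by
    rw [sqrt_eq_rpow, ← rpow_intCast, ← rpow_mul (by norm_num)]
    push_cast; congr 1; ring
  rw [e]; ring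

end DyadicAvg.Piece

end AverageOfShift

/-- A finite decomposition of a function into pieces, with square summable norms. -/
structure Decomp (I : Finset ℤ) (φ : ℤ → ℝ → ℂ) (α : ℤ → ℝ) (f : ℝ → ℂ) (a : ℝ) : Prop where
  eq : f = fun x => ∑ k ∈ I, φ k x
  piece : ∀ k, Piece k (φ k) (α k)
  sq : ∑ k ∈ I, α k ^ 2 ≤ a ^ 2
  l2 : L2B f a

/-- The sum of the linear operators at the scales `i < N`. -/
def total (ρ : ℝ → ℝ) (p : ℕ → ℝ → ℝ) (N : ℕ) (f : ℝ → ℂ) (x : ℝ) : ℂ :=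
  ∑ i ∈ Finset.range N, lin (p i) ρ f x

/-- The sum of the linear operators at those scales `i < N` with frequency at most `2 ^ μ`. -/
def lowPart (ρ : ℝ → ℝ) (m : ℕ → ℤ) (p : ℕ → ℝ → ℝ) (N : ℕ) (μ : ℤ) (f : ℝ → ℂ) (x : ℝ) : ℂ :=
  ∑ i ∈ Finset.range N, if m i ≤ μ then lin (p i) ρ f x else 0

/-- The error made when `lowPart` is replaced by the dyadic average of `total`. -/
def lowErr (ρ : ℝ → ℝ) (m : ℕ → ℤ) (p : ℕ → ℝ → ℝ) (N : ℕ) (μ : ℤ) (f : ℝ → ℂ) (x : ℝ) : ℂ :=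
  lowPart ρ m p N μ f x - avg μ (total ρ p N f) x

lemma decay_mul (e : ℝ) (y z : ℤ) :
    decay e y * decay e z = 2 ^ (-(e * |(y:ℝ)| + e * |(z:ℝ)|)) := by
  rw [decay, decay, ← rpow_add (by norm_num)]; congr 1; ring

section Family

variable {K : ℝ} {ρ : ℝ → ℝ} {m n : ℕ → ℤ} {p q : ℕ → ℝ → ℝ} {N : ℕ} {I J : Finset ℤ}
  {φ ψ : ℤ → ℝ → ℂ} {α β : ℤ → ℝ} {f g : ℝ → ℂ} {a b : ℝ}

lemma Decomp.lin_eq (hf : Decomp I φ α f a) (hρ : Weight K ρ) (hp : ∀ i, Shift K (m i) (p i))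
    (i : ℕ) (x : ℝ) : lin (p i) ρ f x = ∑ k ∈ I, lin (p i) ρ (φ k) x := by
  rw [hf.eq, lin_sum hρ (hp i) I fun k _ => (hf.piece k).locBdd]

lemma Decomp.lin_bound (hf : Decomp I φ α f a) (hρ : Weight K ρ)
    (hp : ∀ i, Shift K (m i) (p i)) (i : ℕ) :
    L2B (lin (p i) ρ f) (24 * K ^ 4 * ∑ k ∈ I, decay (1/2) (k - m i) * α k) := by
  rw [show lin (p i) ρ f = _ from funext fun x => hf.lin_eq hρ hp i x, mul_sum]
  refine L2B.sum I fun k _ => ((hf.piece k).lin_bound hρ (hp i)).mono (le_of_eq ?_)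
  rw [decay]; push_cast; ring_nf

lemma Decomp.sqB_lin (hf : Decomp I φ α f a) (hρ : Weight K ρ)
    (hp : ∀ i, Shift K (m i) (p i)) (hm : InjOn m (Finset.range N)) :
    SqB N (fun i => lin (p i) ρ f) (24 * K ^ 4 * (decaySum (1/2) * a)) :=
  SqB.of_schur (by norm_num) hm I hf.l2.nonneg (by have := hρ.one_le; positivity) hf.sq
    fun i _ => hf.lin_bound hρ hp i

lemma Decomp.l2_lin (hf : Decomp I φ α f a) (hρ : Weight K ρ)
    (hp : ∀ i, Shift K (m i) (p i)) (i : ℕ) : L2B (lin (p i) ρ f) (4 * K * a) :=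
  _root_.lin_bound hρ (hp i).meas hf.l2

lemma Decomp.l2_total (hf : Decomp I φ α f a) (hρ : Weight K ρ)
    (hp : ∀ i, Shift K (m i) (p i)) : L2B (total ρ p N f) (∑ _i ∈ Finset.range N, 4 * K * a) :=
  L2B.sum _ fun i _ => hf.l2_lin hρ hp i

lemma lowErr_piece_bound {k : ℤ} {φ : ℝ → ℂ} {a : ℝ} (h : Piece k φ a) (hρ : Weight K ρ)
    {p : ℝ → ℝ} {m : ℤ} (hp : Shift K m p) (μ : ℤ) :
    L2B (fun x => (if m ≤ μ then lin p ρ φ x else 0) - avg μ (lin p ρ φ) x)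
      (48 * K ^ 4 * (decay (1/4) (k - μ) * decay (1/4) (k - m) * a)) := by
  have ha := h.l2.nonneg
  have hK := hρ.one_le
  have hK4 : K ≤ K ^ 4 := le_self_pow₀ hK (by norm_num)
  have hl := h.lin_bound hρ hp
  rw [decay_mul]
  push_cast
  split_ifs with hm
  · have hm' : (m:ℝ) ≤ μ := by exact_mod_cast hm
    have h1 : L2B (fun x => lin p ρ φ x - avg μ (lin p ρ φ) x)
        (48 * K ^ 4 * (2 ^ (-(((μ:ℝ) - k) / 2)) * a)) := by
      refine (h.lin_sub_avg_bound hρ hp μ).mono ?_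
      rw [show -(((μ:ℝ) - k) / 2) = ((k:ℝ) - μ) / 2 by ring]
      gcongr
      norm_num
    have h2 : L2B (fun x => lin p ρ φ x - avg μ (lin p ρ φ) x)
        (48 * K ^ 4 * (2 ^ (-(|(k:ℝ) - m| / 2)) * a)) :=
      (hl.sub (hl.avg μ)).mono (le_of_eq (by ring))
    refine h1.of_max (by positivity) ha h2 ?_
    rcases le_total (k:ℝ) μ with hk | hk
    · rw [abs_of_nonpos (sub_nonpos.2 hk)]
      rcases le_total (((μ:ℝ) - k) / 2) (|(k:ℝ) - m| / 2) with h | h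
      · exact le_max_of_le_right (by linarith)
      · exact le_max_of_le_left (by linarith)
    · rw [abs_of_nonneg (sub_nonneg.2 hk)]
      have := le_abs_self ((k:ℝ) - m)
      exact le_max_of_le_right (by linarith)
  · have hm' : (μ:ℝ) ≤ m := by exact_mod_cast (not_le.1 hm).le
    have hneg : ∀ {c : ℝ}, L2B (avg μ (lin p ρ φ)) c →
        L2B (fun x => 0 - avg μ (lin p ρ φ) x) c := fun hc =>
      (L2B.zero.sub hc).mono (by simp)
    have h1 : L2B (fun x => 0 - avg μ (lin p ρ φ) x)
        (48 * K ^ 4 * (2 ^ (-(((k:ℝ) - μ) / 2)) * a)) := by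
      refine hneg ((h.avg_lin_bound hρ hp μ).mono ?_)
      rw [show -(((k:ℝ) - μ) / 2) = ((μ:ℝ) - k) / 2 by ring]
      gcongr
      norm_num
    have h2 : L2B (fun x => 0 - avg μ (lin p ρ φ) x)
        (48 * K ^ 4 * (2 ^ (-(|(k:ℝ) - m| / 2)) * a)) := by
      refine hneg ((hl.avg μ).mono ?_)
      gcongr
      norm_num
    refine h1.of_max (by positivity) ha h2 ?_
    rcases le_total (k:ℝ) μ with hk | hk
    · rw [abs_of_nonpos (sub_nonpos.2 hk)]
      have := neg_abs_le ((k:ℝ) - m)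
      exact le_max_of_le_right (by linarith)
    · rw [abs_of_nonneg (sub_nonneg.2 hk)]
      rcases le_total (((k:ℝ) - μ) / 2) (|(k:ℝ) - m| / 2) with h | h
      · exact le_max_of_le_right (by linarith)
      · exact le_max_of_le_left (by linarith)

lemma Decomp.lowErr_eq (hf : Decomp I φ α f a) (hρ : Weight K ρ)
    (hp : ∀ i, Shift K (m i) (p i)) (μ : ℤ) (x : ℝ) :
    lowErr ρ m p N μ f x = ∑ k ∈ I, ∑ i ∈ Finset.range N,
      ((if m i ≤ μ then lin (p i) ρ (φ k) x else 0) - avg μ (lin (p i) ρ (φ k)) x) := by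
  have hl : ∀ k i, LocInt (lin (p i) ρ (φ k)) := fun k i =>
    ((hf.piece k).lin_bound hρ (hp i)).locInt
  have h1 : avg μ (total ρ p N f) x =
      ∑ i ∈ Finset.range N, ∑ k ∈ I, avg μ (lin (p i) ρ (φ k)) x := by
    unfold total
    rw [avg_sum _ fun i _ => (hf.l2_lin hρ hp i).locInt]
    refine sum_congr rfl fun i _ => ?_
    rw [show lin (p i) ρ f = _ from funext fun x => hf.lin_eq hρ hp i x,
      avg_sum _ fun k _ => hl k i]
  rw [lowErr, h1, lowPart, ← sum_sub_distrib]
  conv_rhs => rw [Finset.sum_comm]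
  refine sum_congr rfl fun i _ => ?_
  rw [sum_sub_distrib]
  congr 1
  split_ifs
  · exact hf.lin_eq hρ hp i x
  · simp

lemma Decomp.lowErr_bound (hf : Decomp I φ α f a) (hρ : Weight K ρ)
    (hp : ∀ i, Shift K (m i) (p i)) (hm : InjOn m (Finset.range N)) (μ : ℤ) :
    L2B (lowErr ρ m p N μ f)
      (48 * K ^ 4 * decaySum (1/4) * ∑ k ∈ I, decay (1/4) (k - μ) * α k) := by
  have hK := hρ.one_le
  rw [show lowErr ρ m p N μ f = _ from funext fun x => hf.lowErr_eq hρ hp μ x, mul_sum]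
  refine L2B.sum I fun k _ => ?_
  have hα := (hf.piece k).l2.nonneg
  refine (L2B.sum (Finset.range N) fun i _ =>
    lowErr_piece_bound (hf.piece k) hρ (hp i) μ).mono ?_
  have hs := sum_decay_le (e := 1/4) (by norm_num) (Finset.range N) (c := fun i => k - m i)
    fun i hi j hj h => hm hi hj (by have : k - m i = k - m j := h; omega)
  calc _ = 48 * K ^ 4 * (decay (1/4) (k - μ) * α k) *
        ∑ i ∈ Finset.range N, decay (1/4) (k - m i) := by
        rw [mul_sum]; exact sum_congr rfl fun i _ => by ring
    _ ≤ 48 * K ^ 4 * (decay (1/4) (k - μ) * α k) * decaySum (1/4) := by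
        have := decay_nonneg (1/4) (k - μ)
        gcongr
    _ = _ := by ring

lemma Decomp.sqB_lowErr (hf : Decomp I φ α f a) (hρ : Weight K ρ)
    (hp : ∀ i, Shift K (m i) (p i)) (hm : InjOn m (Finset.range N)) {N' : ℕ} {μ : ℕ → ℤ}
    (hμ : InjOn μ (Finset.range N')) :
    SqB N' (fun i => lowErr ρ m p N (μ i) f)
      (48 * K ^ 4 * decaySum (1/4) * (decaySum (1/4) * a)) :=
  SqB.of_schur (by norm_num) hμ I hf.l2.nonneg
    (by have := hρ.one_le; have := decaySum_nonneg (1/4); positivity) hf.sq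
    fun i _ => hf.lowErr_bound hρ hp hm (μ i)

lemma Decomp.remainder_bound (hf : Decomp I φ α f a) (hg : Decomp J ψ β g b) (hρ : Weight K ρ)
    (hS : ∀ i, ScaleData K ρ (m i) (n i) (p i) (q i)) (hm : InjOn m (Finset.range N))
    (hn : InjOn n (Finset.range N)) :
    L1B (fun x => ∑ i ∈ Finset.range N, remainder (m i) (n i) (p i) (q i) ρ f g x)
      (128 * K ^ 4 * (decaySum (1/192) ^ 2 * (a * b))) := by
  have hK := hρ.one_le
  have hb := hg.l2.nonneg
  have ha := hf.l2.nonneg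
  have hp := fun i => (hS i).left
  have hq := fun i => (hS i).right
  have heq : ∀ i x, remainder (m i) (n i) (p i) (q i) ρ f g x =
      ∑ k ∈ I, ∑ l ∈ J, remainder (m i) (n i) (p i) (q i) ρ (φ k) (ψ l) x := by
    intro i x
    simp only [remainder, sum_sub_distrib]
    rw [hf.lin_eq hρ hp, hg.lin_eq hρ hq]
    simp_rw [← mul_sum, ← sum_mul]
    have e1 : avg (m i) f x = ∑ k ∈ I, avg (m i) (φ k) x := by
      rw [hf.eq, avg_sum I fun k _ => (hf.piece k).l2.locInt]
    have e2 : avg (n i) g x = ∑ k ∈ J, avg (n i) (ψ k) x := by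
      rw [hg.eq, avg_sum J fun k _ => (hg.piece k).l2.locInt]
    rw [e1, e2]
    congr 2
    rw [hf.eq, hg.eq]
    exact bil_sum hρ (hp i) (hq i) I J (fun k _ => (hf.piece k).locBdd)
      (fun k _ => (hg.piece k).locBdd) x
  simp_rw [heq]
  refine (L1B.sum _ fun i _ => L1B.sum I fun k _ => L1B.sum J fun l _ =>
    _root_.remainder_bound hρ (hS i) (hf.piece k) (hg.piece l)).mono ?_
  have e : ∀ i, (∑ k ∈ I, ∑ l ∈ J, 128 * K ^ 4 *
      (2 ^ (-((|(k:ℝ) - m i| + |(l:ℝ) - n i|) / 192)) * (α k * β l))) =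
      128 * K ^ 4 * ((∑ k ∈ I, decay (1/192) (k - m i) * α k) *
        ∑ l ∈ J, decay (1/192) (l - n i) * β l) := by
    intro i
    rw [Finset.sum_mul_sum, mul_sum]
    refine sum_congr rfl fun k _ => ?_
    rw [mul_sum]
    refine sum_congr rfl fun l _ => ?_
    rw [mul_mul_mul_comm (decay _ _), decay_mul]
    push_cast
    ring_nf
  simp_rw [e]
  rw [← mul_sum]
  refine mul_le_mul_of_nonneg_left ?_ (by positivity)
  have hd := decaySum_nonneg (1/192)
  refine abs_le_of_sq_le_sq' ?_ (by positivity) |>.2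
  refine (Finset.sum_mul_sq_le_sq_mul_sq _ _ _).trans ?_
  rw [show (decaySum (1/192) ^ 2 * (a * b)) ^ 2 =
    (decaySum (1/192) * a) ^ 2 * (decaySum (1/192) * b) ^ 2 by ring]
  exact mul_le_mul (schur_decay (by norm_num) _ hm I hf.sq) (schur_decay (by norm_num) _ hn J hg.sq)
    (sum_nonneg fun _ _ => sq_nonneg _) (sq_nonneg _)

end Family

section Family

variable {K : ℝ} {ρ : ℝ → ℝ} {m n : ℕ → ℤ} {p q : ℕ → ℝ → ℝ} {N : ℕ} {I J : Finset ℤ}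
  {φ ψ : ℤ → ℝ → ℂ} {α β : ℤ → ℝ} {f g : ℝ → ℂ} {a b : ℝ}

/-- The constant in the estimate for `lowErr`. -/
def errConst (K : ℝ) : ℝ := 48 * K ^ 4 * decaySum (1/4) * decaySum (1/4)

/-- The constant in the estimate for `total`. -/
def totalConst (K : ℝ) : ℝ := 48 * K ^ 4 * decaySum (1/4) + 5 * errConst K

lemma errConst_nonneg (K : ℝ) : 0 ≤ errConst K := by
  have := decaySum_nonneg (1/4)
  unfold errConst; positivity

lemma totalConst_nonneg (K : ℝ) : 0 ≤ totalConst K := by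
  have := decaySum_nonneg (1/4)
  have := errConst_nonneg K
  unfold totalConst; positivity

lemma Decomp.lowErr_bound_const (hf : Decomp I φ α f a) (hρ : Weight K ρ)
    (hp : ∀ i, Shift K (m i) (p i)) (hm : InjOn m (Finset.range N)) (μ : ℤ) :
    L2B (lowErr ρ m p N μ f) (errConst K * a) := by
  have ha := hf.l2.nonneg
  have hK := hρ.one_le
  have hd := decaySum_nonneg (1/4)
  have h := schur_decay (e := 1/4) (by norm_num) ({0} : Finset ℕ) (m := fun _ => μ)
    (by simp) I hf.sq
  rw [Finset.sum_singleton] at h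
  refine (hf.lowErr_bound hρ hp hm μ).mono ?_
  rw [errConst, mul_assoc (48 * K ^ 4 * _)]
  exact mul_le_mul_of_nonneg_left (abs_le_of_sq_le_sq' h (by positivity)).2 (by positivity)

lemma decay_half_le (z : ℤ) : decay (1/2) z ≤ decay (1/4) z :=
  rpow_le_rpow_of_exponent_le (by norm_num) (by linarith [abs_nonneg (z:ℝ)])

lemma decay_sub_one_le (z : ℤ) : decay (1/4) (z - 1) ≤ 2 * decay (1/4) z := by
  unfold decay
  nth_rewrite 2 [← rpow_one (2:ℝ)]
  rw [← rpow_add (by norm_num)]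
  refine rpow_le_rpow_of_exponent_le (by norm_num) ?_
  push_cast
  have := abs_sub_abs_le_abs_sub (z:ℝ) (z - 1)
  rw [sub_sub_cancel, abs_one] at this
  linarith

lemma Decomp.lowPart_step_bound (hf : Decomp I φ α f a) (hρ : Weight K ρ)
    (hp : ∀ i, Shift K (m i) (p i)) (hm : InjOn m (Finset.range N)) (μ : ℤ) :
    L2B (fun x => lowPart ρ m p N (μ + 1) f x - lowPart ρ m p N μ f x)
      (24 * K ^ 4 * ∑ k ∈ I, decay (1/2) (k - (μ + 1)) * α k) := by
  have hα : ∀ k, 0 ≤ α k := fun k => (hf.piece k).l2.nonneg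
  have hK := hρ.one_le
  have e : ∀ x, lowPart ρ m p N (μ + 1) f x - lowPart ρ m p N μ f x =
      ∑ i ∈ Finset.range N, if m i = μ + 1 then lin (p i) ρ f x else 0 := by
    intro x
    rw [lowPart, lowPart, ← sum_sub_distrib]
    refine sum_congr rfl fun i _ => ?_
    by_cases h1 : m i ≤ μ
    · simp [h1, show m i ≤ μ + 1 by omega, show m i ≠ μ + 1 by omega]
    · by_cases h2 : m i = μ + 1
      · simp [h2]
      · simp [h1, h2, show ¬ m i ≤ μ + 1 by omega]
  simp_rw [e]
  by_cases h : ∃ j ∈ Finset.range N, m j = μ + 1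
  · obtain ⟨j, hj, hjμ⟩ := h
    have hb := hf.lin_bound hρ hp j
    rw [hjμ] at hb
    convert hb using 2 with x
    rw [Finset.sum_eq_single_of_mem j hj, if_pos hjμ]
    intro i hi hij
    rw [if_neg fun h => hij (hm hi hj (h.trans hjμ.symm))]
  · push Not at h
    have : ∀ x, (∑ i ∈ Finset.range N, if m i = μ + 1 then lin (p i) ρ f x else 0) = 0 :=
      fun x => Finset.sum_eq_zero fun i hi => if_neg (h i hi)
    simp_rw [this]
    refine L2B.zero.mono (mul_nonneg (by positivity) (sum_nonneg fun k _ =>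
      mul_nonneg (decay_nonneg _ _) (hα k)))

lemma Decomp.mdiff_total_bound (hf : Decomp I φ α f a) (hρ : Weight K ρ)
    (hp : ∀ i, Shift K (m i) (p i)) (hm : InjOn m (Finset.range N)) (μ : ℤ) :
    L2B (fun x => avg (μ + 1) (total ρ p N f) x - avg μ (total ρ p N f) x)
      ((48 * K ^ 4 + 3 * (48 * K ^ 4 * decaySum (1/4))) *
        ∑ k ∈ I, decay (1/4) (k - μ) * α k) := by
  have hα : ∀ k, 0 ≤ α k := fun k => (hf.piece k).l2.nonneg
  have hK := hρ.one_le
  have hd := decaySum_nonneg (1/4)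
  have h := (hf.lowPart_step_bound hρ hp hm μ).sub
    ((hf.lowErr_bound hρ hp hm (μ + 1)).sub (hf.lowErr_bound hρ hp hm μ))
  have hY : ∑ k ∈ I, decay (1/4) (k - (μ + 1)) * α k ≤
      2 * ∑ k ∈ I, decay (1/4) (k - μ) * α k := by
    rw [mul_sum]
    refine sum_le_sum fun k _ => ?_
    rw [← mul_assoc, ← sub_sub]
    exact mul_le_mul_of_nonneg_right (decay_sub_one_le _) (hα k)
  have hX : ∑ k ∈ I, decay (1/2) (k - (μ + 1)) * α k ≤
      ∑ k ∈ I, decay (1/4) (k - (μ + 1)) * α k :=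
    sum_le_sum fun k _ => mul_le_mul_of_nonneg_right (decay_half_le _) (hα k)
  convert h.mono ?_ using 2 with x
  · simp only [lowErr]; ring
  · set Y := ∑ k ∈ I, decay (1/4) (k - μ) * α k
    calc _ ≤ 24 * K ^ 4 * (2 * Y) + (48 * K ^ 4 * decaySum (1/4) * (2 * Y) +
          48 * K ^ 4 * decaySum (1/4) * Y) := by
          gcongr; exact hX.trans hY
      _ = _ := by ring

lemma Decomp.total_bound (hf : Decomp I φ α f a) (hρ : Weight K ρ)
    (hp : ∀ i, Shift K (m i) (p i)) (hm : InjOn m (Finset.range N)) :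
    L2B (total ρ p N f) (totalConst K * a) := by
  have ha := hf.l2.nonneg
  have hK := hρ.one_le
  have hd := decaySum_nonneg (1/4)
  obtain ⟨M, hM⟩ : ∃ M : ℕ, ∀ i ∈ Finset.range N, |m i| < M := by
    refine ⟨∑ i ∈ Finset.range N, (m i).natAbs + 1, fun i hi => ?_⟩
    have := Finset.single_le_sum (f := fun i => (m i).natAbs) (fun _ _ => Nat.zero_le _) hi
    rw [Int.abs_eq_natAbs]
    exact_mod_cast Nat.lt_succ_of_le this
  have hdiff := avg_sub_avg_bound (hf.l2_total (N := N) hρ hp) (-M) (2 * M)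
    fun i _ => by
      have := hf.mdiff_total_bound (N := N) hρ hp hm (-M + i)
      convert this using 2
      simp only [mdiff]; push_cast; rw [add_assoc]
  have hdiff' : L2B (fun x => avg M (total ρ p N f) x - avg (-M) (total ρ p N f) x)
      ((48 * K ^ 4 + 3 * (48 * K ^ 4 * decaySum (1/4))) * (decaySum (1/4) * a)) := by
    convert hdiff.mono ?_ using 2
    · push_cast; ring_nf
    · refine (sqrt_le_left (by positivity)).2 ?_
      simp_rw [mul_pow (48 * K ^ 4 + _)]
      rw [← mul_sum]
      refine mul_le_mul_of_nonneg_left ?_ (by positivity)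
      exact schur_decay (by norm_num) _ (m := fun i : ℕ => -(M:ℤ) + i)
        (fun i _ j _ h => by simpa using h) I hf.sq
  have h := hdiff'.add ((hf.lowErr_bound_const (N := N) hρ hp hm M).sub
    (hf.lowErr_bound_const (N := N) hρ hp hm (-M)))
  convert h.mono ?_ using 2 with x
  · have h1 : lowPart ρ m p N M f x = total ρ p N f x :=
      sum_congr rfl fun i hi => if_pos ((le_abs_self _).trans (hM i hi).le)
    have h2 : lowPart ρ m p N (-M) f x = 0 :=
      Finset.sum_eq_zero fun i hi => if_neg (not_le.2 (abs_lt.1 (hM i hi)).1)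
    rw [lowErr, lowErr, h1, h2]; ring
  · rw [totalConst, errConst]
    exact le_of_eq (by ring)

end Family

lemma sum_mul_by_parts (u v : ℕ → ℂ) (N : ℕ) :
    ∑ i ∈ Finset.range N, u i * v i = (∑ i ∈ Finset.range N, u i) * v N -
      ∑ i ∈ Finset.range N, (∑ j ∈ Finset.range (i + 1), u j) * (v (i + 1) - v i) := by
  induction N with
  | zero => simp
  | succ N ih =>
    rw [sum_range_succ, ih]
    conv_rhs => rw [sum_range_succ (fun i => (∑ j ∈ Finset.range (i + 1), u j) * _)]
    rw [sum_range_succ u]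
    ring

/-- The constant in the estimate for sums over scales. -/
def scalesConst (K : ℝ) : ℝ :=
  128 * K ^ 4 * decaySum (1/192) ^ 2 + 9 * totalConst K + 2 * errConst K +
    24 * K ^ 4 * decaySum (1/2)

lemma scalesConst_nonneg (K : ℝ) : 0 ≤ scalesConst K := by
  have := decaySum_nonneg (1/2)
  have := totalConst_nonneg K
  have := errConst_nonneg K
  unfold scalesConst; positivity

section Family

variable {K : ℝ} {ρ : ℝ → ℝ} {m n : ℕ → ℤ} {p q : ℕ → ℝ → ℝ} {N : ℕ} {I J : Finset ℤ}
  {φ ψ : ℤ → ℝ → ℂ} {α β : ℤ → ℝ} {f g : ℝ → ℂ} {a b : ℝ}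

lemma lowPart_of_strictMono (hm : StrictMono m) {i : ℕ} (hi : i < N) (x : ℝ) :
    lowPart ρ m p N (m i) f x = ∑ j ∈ Finset.range (i + 1), lin (p j) ρ f x := by
  rw [lowPart, ← Finset.sum_filter]
  refine sum_congr ?_ fun _ _ => rfl
  ext j
  simp only [Finset.mem_filter, Finset.mem_range, hm.le_iff_le]
  omega

lemma lowPart_of_strictAnti (hm : StrictAnti m) {i : ℕ} (hi : i < N) (x : ℝ) :
    lowPart ρ m p N (m i) f x = total ρ p N f x + lin (p i) ρ f x -
      ∑ j ∈ Finset.range (i + 1), lin (p j) ρ f x := by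
  have h : ∑ j ∈ Finset.range i, lin (p j) ρ f x =
      ∑ j ∈ Finset.range N, if ¬ m j ≤ m i then lin (p j) ρ f x else 0 := by
    rw [← Finset.sum_filter]
    refine sum_congr ?_ fun _ _ => rfl
    ext j
    simp only [Finset.mem_filter, Finset.mem_range, hm.le_iff_ge]
    omega
  rw [sum_range_succ, h, lowPart, total, add_sub_add_right_eq_sub, ← sum_sub_distrib]
  refine sum_congr rfl fun j _ => ?_
  by_cases h : m j ≤ m i <;> simp [h]

lemma L1B.congr {F G : ℝ → ℂ} {c c' : ℝ} (h : L1B F c) (hFG : ∀ x, G x = F x) (hc : c ≤ c') :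
    L1B G c' := by
  rw [show G = F from funext hFG]; exact h.mono hc

lemma Decomp.lin_mul_avg_bound (hf : Decomp I φ α f a) (hg : L2B g b) (hρ : Weight K ρ)
    (hp : ∀ i, Shift K (m i) (p i)) (hm : StrictMono m ∨ StrictAnti m) (hn : Monotone n)
    (hmn : ∀ i, m i ≤ n i) :
    L1B (fun x => ∑ i ∈ Finset.range N, lin (p i) ρ f x * avg (n i) g x)
      ((3 * totalConst K + errConst K + 24 * K ^ 4 * decaySum (1/2)) * (a * b)) := by
  have ha := hf.l2.nonneg
  have hb := hg.nonneg
  have hK := hρ.one_le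
  have hS := decaySum_nonneg (1/2)
  have hinj : InjOn m (Finset.range N) := hm.elim (fun h => h.injective.injOn)
    fun h => h.injective.injOn
  have hF := hf.total_bound (N := N) hρ hp hinj
  have hpar := paraproduct_bound hn (N := N) (fun i _ => hmn i) hF hg
  have herr := (hf.sqB_lowErr (N := N) hρ hp hinj hinj).mul (sqB_mdiff hn hg N)
  have hab := mul_nonneg ha hb
  rcases hm with hm | hm
  · refine (((hF.mul (hg.avg (n N))).sub hpar).sub herr).congr (fun x => ?_) ?_
    · rw [sum_mul_by_parts, sub_sub, ← sum_add_distrib]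
      refine congr_arg₂ _ rfl (sum_congr rfl fun i hi => ?_)
      rw [← lowPart_of_strictMono hm (Finset.mem_range.1 hi), lowErr, mdiff]
      ring
    · have : 0 ≤ 24 * K ^ 4 * decaySum (1/2) * (a * b) := by positivity
      rw [errConst] at *
      nlinarith
  · have hU := (hf.sqB_lin (N := N) hρ hp hinj).mul (sqB_mdiff hn hg N)
    refine (((hF.mul (hg.avg (n 0))).sub hU).add (hpar.add herr)).congr (fun x => ?_) ?_
    · have e : ∑ i ∈ Finset.range N, (∑ j ∈ Finset.range (i + 1), lin (p j) ρ f x) *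
          (avg (n (i + 1)) g x - avg (n i) g x) =
          total ρ p N f x * (avg (n N) g x - avg (n 0) g x) +
          ∑ i ∈ Finset.range N, (lin (p i) ρ f x * mdiff n i g x -
            avg (m i) (total ρ p N f) x * mdiff n i g x -
            lowErr ρ m p N (m i) f x * mdiff n i g x) := by
        rw [← Finset.sum_range_sub (fun i => avg (n i) g x), mul_sum,
          ← sum_add_distrib]
        refine sum_congr rfl fun i hi => ?_
        rw [lowErr, mdiff, lowPart_of_strictAnti hm (Finset.mem_range.1 hi)]
        ring
      rw [sum_mul_by_parts, e, sum_sub_distrib, sum_sub_distrib]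
      simp only [total]
      ring
    · rw [errConst] at *
      nlinarith

lemma Decomp.avg_mul_lin_bound (hg : Decomp J ψ β g b) (hf : L2B f a) (hρ : Weight K ρ)
    (hq : ∀ i, Shift K (n i) (q i)) (hm : StrictMono m ∨ StrictAnti m) (hn : StrictMono n)
    (hmn : ∀ i, m i ≤ n i) :
    L1B (fun x => ∑ i ∈ Finset.range N, avg (m i) f x * lin (q i) ρ g x)
      ((6 * totalConst K + errConst K) * (a * b)) := by
  have ha := hf.nonneg
  have hb := hg.l2.nonneg
  have hinj : InjOn n (Finset.range N) := hn.injective.injOn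
  have hG := hg.total_bound (N := N) hρ hq hinj
  have hpar := paraproduct_bound hn.monotone (N := N) (fun i _ => hmn i) hf hG
  have hDf : SqB N (fun i => mdiff m i f) a := hm.elim (fun h => sqB_mdiff h.monotone hf N)
    fun h => sqB_mdiff_of_antitone h.antitone hf N
  have herr := (hg.sqB_lowErr (N := N) hρ hq hinj hinj).mul hDf
  have hDD := (sqB_mdiff hn.monotone hG N).mul hDf
  refine (((((hG.mul (hf.avg (m N))).sub ((hG.avg (n N)).mul (hf.avg (m N)))).add
    ((hG.avg (n 0)).mul (hf.avg (m 0)))).add hpar).add (hDD.sub herr)).congr (fun x => ?_) ?_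
  · have e1 := sum_mul_by_parts (fun i => lin (q i) ρ g x) (fun i => avg (m i) f x) N
    have e2 : ∑ i ∈ Finset.range N, (∑ j ∈ Finset.range (i + 1), lin (q j) ρ g x) *
        (avg (m (i + 1)) f x - avg (m i) f x) =
        (avg (n N) (total ρ q N g) x * avg (m N) f x - avg (n 0) (total ρ q N g) x *
          avg (m 0) f x) +
        ∑ i ∈ Finset.range N, (lowErr ρ n q N (n i) g x * mdiff m i f x -
          avg (m i) f x * mdiff n i (total ρ q N g) x -
          mdiff n i (total ρ q N g) x * mdiff m i f x) := by
      rw [← Finset.sum_range_sub (fun i => avg (n i) (total ρ q N g) x * avg (m i) f x),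
        ← sum_add_distrib]
      refine sum_congr rfl fun i hi => ?_
      rw [lowErr, mdiff, mdiff, lowPart_of_strictMono hn (Finset.mem_range.1 hi)]
      ring
    rw [sum_congr rfl fun i _ => mul_comm _ _, e1, e2, sum_sub_distrib,
      sum_sub_distrib]
    simp only [total]
    ring
  · rw [errConst] at *
    exact le_of_eq (by ring)

lemma Decomp.sum_bil_bound (hf : Decomp I φ α f a) (hg : Decomp J ψ β g b) (hρ : Weight K ρ)
    (hS : ∀ i, ScaleData K ρ (m i) (n i) (p i) (q i)) (hm : StrictMono m ∨ StrictAnti m)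
    (hn : StrictMono n) (hmn : ∀ i, m i ≤ n i) :
    L1B (fun x => ∑ i ∈ Finset.range N, bil (p i) (q i) ρ f g x) (scalesConst K * (a * b)) := by
  have hinj : InjOn m (Finset.range N) := hm.elim (fun h => h.injective.injOn)
    fun h => h.injective.injOn
  refine (((hf.remainder_bound (N := N) hg hρ hS hinj hn.injective.injOn).add
    (hf.lin_mul_avg_bound (N := N) hg.l2 hρ (fun i => (hS i).left) hm hn.monotone hmn)).add
    (hg.avg_mul_lin_bound (N := N) hf.l2 hρ (fun i => (hS i).right) hm hn hmn)).congr
    (fun x => ?_) (le_of_eq ?_)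
  · rw [← sum_add_distrib, ← sum_add_distrib]
    exact sum_congr rfl fun i _ => by rw [remainder]; ring
  · rw [scalesConst]; ring

end Family

/-- The `k`-th term of the dyadic martingale decomposition. -/
def mpiece (f : ℝ → ℂ) (k : ℤ) (x : ℝ) : ℂ := avg (k + 1) f x - avg k f x

section Density

variable {f f' g : ℝ → ℂ} {a b d : ℝ}

lemma L2B.piece (hf : L2B f a) (k : ℤ) : Piece k (mpiece f k) (nrm (mpiece f k)) where
  const := (atomConst_avg _ f).comp₂ ((atomConst_avg _ f).of_le (by omega)) fun a b => a - b
  mean x := by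
    have h := avg_sub (locInt_avg hf.locInt (k + 1)) (locInt_avg hf.locInt k) k x
    refine h.trans ?_
    rw [avg_avg (by omega) hf.locInt, avg_of_atomConst (atomConst_avg _ f), sub_self]
  l2 := ((hf.avg (k + 1)).sub (hf.avg k)).self

lemma L2B.decomp (hf : L2B f a) (M : ℕ) :
    Decomp (Finset.Ico (-(M:ℤ)) M) (mpiece f) (fun k => nrm (mpiece f k))
      (fun x => DyadicAvg.avg M f x - DyadicAvg.avg (-M) f x) (2 * a) := by
  have ha := hf.nonneg
  have himg : Finset.Ico (-(M:ℤ)) M = (Finset.range (2 * M)).image fun i : ℕ => -(M:ℤ) + i := by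
    ext k
    simp only [Finset.mem_Ico, Finset.mem_image, Finset.mem_range]
    constructor
    · exact fun h => ⟨(k + M).toNat, by omega, by omega⟩
    · rintro ⟨i, hi, rfl⟩; omega
  have hsum : ∀ {E : Type} [AddCommMonoid E] (F : ℤ → E), ∑ k ∈ Finset.Ico (-(M:ℤ)) M, F k =
      ∑ i ∈ Finset.range (2 * M), F (-(M:ℤ) + i) := by
    intro E _ F
    rw [himg, Finset.sum_image fun i _ j _ h => by simpa using h]
  refine ⟨funext fun x => ?_, hf.piece, ?_, ((hf.avg _).sub (hf.avg _)).mono (by linarith)⟩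
  · rw [hsum fun k => mpiece f k x]
    have := Finset.sum_range_sub (fun i : ℕ => DyadicAvg.avg (-(M:ℤ) + i) f x) (2 * M)
    simp only [mpiece, add_assoc]
    push_cast at this
    rw [this]
    ring_nf
  · have hmono : Monotone fun i : ℕ => -(M:ℤ) + i := fun i j hij => by
      simp only [add_le_add_iff_left]; exact_mod_cast hij
    obtain ⟨c, hc, hca⟩ := (sqB_mdiff hmono hf (2 * M)).bound
    rw [hsum fun k => nrm (mpiece f k) ^ 2]
    refine (sum_le_sum fun i hi => ?_).trans (hca.trans (by nlinarith))
    have := (hc i (Finset.mem_range.1 hi)).nrm_le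
    have e : mdiff (fun i : ℕ => -(M:ℤ) + i) i f = mpiece f (-(M:ℤ) + i) := by
      funext x; simp only [mdiff, mpiece]; push_cast; rw [add_assoc]
    rw [e] at this
    have := nrm_nonneg (mpiece f (-(M:ℤ) + i))
    gcongr

lemma L2B.translate_sub (hf : ∀ x, HasDerivAt f (f' x) x) (hf' : Continuous f') (hd : L2B f' d)
    (c : ℝ) : L2B (fun x => f (x - c) - f x) (|c| * d) := by
  have h := L2B.integral (Φ := fun x s => f' (x - c * s))
    (σ := (Ioc (0:ℝ) 1).indicator fun _ => (-c : ℂ)) (by fun_prop)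
    (measurable_const.indicator measurableSet_Ioc) (abs_nonneg c) hd.nonneg ?_
    fun t _ => hd.translate (c * t)
  · convert h using 2 with x
    have hder : ∀ s ∈ uIcc (0:ℝ) 1, HasDerivAt (fun s => f (x - c * s))
        (f' (x - c * s) * (-c : ℂ)) s := by
      intro s _
      have h1 : HasDerivAt (fun s : ℝ => x - c * s) (-c) s := by
        simpa using ((hasDerivAt_id s).const_mul c).const_sub x
      have h2 := (hf (x - c * s)).scomp s h1
      refine h2.congr_deriv ?_
      simp [mul_comm]
    have e := intervalIntegral.integral_eq_sub_of_hasDerivAt hder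
      (Continuous.intervalIntegrable (by fun_prop) _ _)
    rw [intervalIntegral.integral_of_le zero_le_one, ← integral_indicator measurableSet_Ioc] at e
    simp only [mul_one, mul_zero, sub_zero] at e
    rw [← e]
    refine integral_congr_ae (.of_forall fun s => ?_)
    by_cases hs : s ∈ Ioc (0:ℝ) 1
    · simp only [indicator_of_mem hs]
    · simp only [indicator_of_notMem hs, mul_zero]
  · have e : ∀ t : ℝ, ‖(Ioc (0:ℝ) 1).indicator (fun _ => (-c : ℂ)) t‖ₑ =
        (Ioc (0:ℝ) 1).indicator (fun _ => ofReal |c|) t := by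
      intro t
      by_cases ht : t ∈ Ioc (0:ℝ) 1
      · rw [indicator_of_mem ht, indicator_of_mem ht, ← ofReal_norm]; simp
      · rw [indicator_of_notMem ht, indicator_of_notMem ht, enorm_zero]
    simp_rw [e]
    rw [lintegral_indicator_const measurableSet_Ioc]
    simp

lemma L1B.avg_neg_bound (hf : L1B f d) (M : ℕ) : L2B (avg (-M) f) (√(2 ^ (-(M:ℤ))) * d) := by
  have hd := hf.nonneg
  refine L2B.of_lintegral (measurable_avg _ _) (by positivity) ?_
  have hm : Measurable fun y => ‖f y‖ₑ := hf.meas.enorm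
  have h1 : ∀ x, lavg (-M) (fun y => ‖f y‖ₑ) x ≤ ofReal (2 ^ (-(M:ℤ)) * d) := by
    intro x
    rw [lavg, ofReal_mul (by positivity)]
    gcongr
    exact (setLIntegral_le_lintegral _ _).trans hf.le
  calc ∫⁻ x, ‖avg (-M) f x‖ₑ ^ 2
      ≤ ∫⁻ x, ofReal (2 ^ (-(M:ℤ)) * d) * lavg (-M) (fun y => ‖f y‖ₑ) x := by
        refine lintegral_mono fun x => ?_
        rw [sq]
        gcongr
        · exact (enorm_avg_le _ _ _).trans (h1 x)
        · exact enorm_avg_le _ _ _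
    _ = ofReal (2 ^ (-(M:ℤ)) * d) * ∫⁻ x, ‖f x‖ₑ := by
        rw [lintegral_const_mul _ (measurable_lavg _ _), lintegral_lavg _ hm]
    _ ≤ ofReal (2 ^ (-(M:ℤ)) * d) * ofReal d := by gcongr; exact hf.le
    _ = _ := by
        rw [← ofReal_mul (by positivity), mul_pow, sq_sqrt (by positivity)]
        congr 1; ring

lemma SchwartzMap.l2B (f : SchwartzMap ℝ ℂ) : L2B f (nrm f) :=
  L2B.of_memLp f.continuous.measurable (f.memLp 2 volume)

lemma SchwartzMap.exists_approx (f : SchwartzMap ℝ ℂ) {δ : ℝ} (hδ : 0 < δ) :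
    ∃ M : ℕ, L2B (fun x => f x - (avg M f x - avg (-M) f x)) δ := by
  have hf1 : L1B f (∫⁻ x, ‖f x‖ₑ).toReal :=
    ⟨f.continuous.measurable, ENNReal.toReal_nonneg, by
      rw [ENNReal.ofReal_toReal]; exact (f.integrable (μ := volume)).2.ne⟩
  set d₁ := (∫⁻ x, ‖f x‖ₑ).toReal
  have hd := SchwartzMap.l2B (SchwartzMap.derivCLM ℝ ℂ f)
  set d := nrm (SchwartzMap.derivCLM ℝ ℂ f)
  have hd0 := hd.nonneg
  have hd1 := hf1.nonneg
  have hder : ∀ x, HasDerivAt f (SchwartzMap.derivCLM ℝ ℂ f x) x := fun x => by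
    simpa using (f.differentiable x).hasDerivAt
  have hlim : Filter.Tendsto (fun M : ℕ => 2 * ((2⁻¹:ℝ) ^ M * d) + √((2⁻¹:ℝ) ^ M) * d₁)
      Filter.atTop (nhds 0) := by
    have h0 : Filter.Tendsto (fun M : ℕ => (2⁻¹:ℝ) ^ M) Filter.atTop (nhds 0) :=
      tendsto_pow_atTop_nhds_zero_of_lt_one (by norm_num) (by norm_num)
    have h1 := ((h0.mul_const d).const_mul 2).add (h0.sqrt.mul_const d₁)
    simpa using h1
  obtain ⟨M, hM⟩ := (hlim.eventually (gt_mem_nhds hδ)).exists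
  refine ⟨M, ?_⟩
  have e : (2:ℝ) ^ (-(M:ℤ)) = 2⁻¹ ^ M := by rw [zpow_neg, zpow_natCast, inv_pow]
  have h1 := sub_avg_bound f.l2B M (A := 2⁻¹ ^ M * d) (by positivity) fun c hc =>
    (L2B.translate_sub hder (SchwartzMap.derivCLM ℝ ℂ f).continuous hd c).mono (by
      rw [e] at hc; gcongr)
  have h2 := hf1.avg_neg_bound M
  rw [e] at h2
  convert (h1.add h2).mono hM.le using 2 with x
  ring

lemma L1B.of_forall_add {F : ℝ → ℂ} {c : ℝ} (hc : 0 ≤ c) (h : ∀ δ > 0, L1B F (c + δ)) :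
    L1B F c := by
  refine ⟨(h 1 one_pos).meas, hc, ?_⟩
  refine ENNReal.le_of_forall_pos_le_add fun δ hδ _ => ?_
  refine (h δ (by exact_mod_cast hδ)).le.trans ?_
  rw [ofReal_add hc (by positivity), ENNReal.ofReal_coe_nnreal]

/-- The bilinear operators at finitely many scales sum up to an operator which is bounded
uniformly in the number of scales. -/
theorem sum_bil_bound {K : ℝ} {ρ : ℝ → ℝ} {m n : ℕ → ℤ} {p q : ℕ → ℝ → ℝ} (hρ : Weight K ρ)
    (hS : ∀ i, ScaleData K ρ (m i) (n i) (p i) (q i)) (hm : StrictMono m ∨ StrictAnti m)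
    (hn : StrictMono n) (hmn : ∀ i, m i ≤ n i) (N : ℕ) (f g : SchwartzMap ℝ ℂ) :
    L1B (fun x => ∑ i ∈ Finset.range N, bil (p i) (q i) ρ f g x)
      (4 * scalesConst K * (nrm f * nrm g)) := by
  have hC := scalesConst_nonneg K
  have hK := hρ.one_le
  have hf := f.l2B
  have hg := g.l2B
  have ha := hf.nonneg
  have hb := hg.nonneg
  set a := nrm f
  set b := nrm g
  refine L1B.of_forall_add (by positivity) fun δ hδ => ?_
  set δ' := δ / (N * (4 * K * (b + 2 * a)) + 1) with hδ'
  have hden : 0 < N * (4 * K * (b + 2 * a)) + 1 := by positivity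
  have hδ0 : 0 < δ' := by positivity
  obtain ⟨M, hM⟩ := f.exists_approx hδ0
  obtain ⟨L, hL⟩ := g.exists_approx hδ0
  set F : ℝ → ℂ := fun x => avg M f x - avg (-M) f x
  set G : ℝ → ℂ := fun x => avg L g x - avg (-L) g x
  have hlb : ∀ {h : ℝ → ℂ} {c : ℝ} (k : ℤ), L2B h c → LocBdd (avg k h) := fun k hh =>
    LocBdd.of_atomConst (atomConst_avg k _) (hh.avg k)
  have hFl : LocBdd F := (hlb _ hf).sub (hlb _ hf)
  have hGl : LocBdd G := (hlb _ hg).sub (hlb _ hg)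
  have hfl := LocBdd.of_continuous f.continuous
  have hgl := LocBdd.of_continuous g.continuous
  have hM' : L2B (fun x => f x - F x) δ' := hM
  have hL' : L2B (fun x => g x - G x) δ' := hL
  have hF2 : L2B F (2 * a) := (hf.decomp M).l2
  have hmain := (hf.decomp M).sum_bil_bound (N := N) (hg.decomp L) hρ hS hm hn hmn
  have hrest := L1B.sum (Finset.range N) fun i _ =>
    (bil_bound hρ (hS i).left.meas (hS i).right.meas hM' hg).add
      (bil_bound hρ (hS i).left.meas (hS i).right.meas hF2 hL')
  refine (hmain.add hrest).congr (fun x => ?_) ?_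
  · rw [← sum_add_distrib]
    refine sum_congr rfl fun i _ => ?_
    rw [bil_sub_left hρ (hS i).left (hS i).right hfl hFl hgl,
      bil_sub_right hρ (hS i).left (hS i).right hFl hgl hGl]
    ring
  · rw [Finset.sum_const, Finset.card_range, nsmul_eq_mul]
    have h1 : δ' * (N * (4 * K * (b + 2 * a)) + 1) = δ := div_mul_cancel₀ _ hden.ne'
    nlinarith

end Density

/-- The cancelling bump generating a dyadic decomposition of `1 / t`. -/
def kernelBump (t : ℝ) : ℝ := (stdBump t - stdBump (2 * t)) / t

namespace kernelBump

lemma one_of_le {t : ℝ} (h : |t| ≤ 1) : stdBump t = 1 :=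
  stdBump.one_of_mem_closedBall (by simpa [stdBump] using h)

lemma zero_of_le {t : ℝ} (h : 2 ≤ |t|) : stdBump t = 0 :=
  stdBump.zero_of_le_dist (by simpa [stdBump] using h)

lemma supp {t : ℝ} (h : kernelBump t ≠ 0) : 1/2 ≤ |t| ∧ |t| ≤ 2 := by
  contrapose! h
  rw [kernelBump]
  rcases lt_or_ge |t| (1/2) with h1 | h1
  · rw [one_of_le (by linarith), one_of_le (by rw [abs_mul, abs_two]; linarith)]; simp
  · have := h h1
    rw [zero_of_le this.le, zero_of_le (by rw [abs_mul, abs_two]; linarith)]; simp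

lemma contDiff : ContDiff ℝ 1 kernelBump := by
  have hb : ContDiff ℝ 1 stdBump := stdBump.contDiff
  refine contDiff_iff_contDiffAt.2 fun t => ?_
  by_cases ht : t = 0
  · subst ht
    have : kernelBump =ᶠ[nhds 0] fun _ => 0 := by
      filter_upwards [Metric.ball_mem_nhds (0:ℝ) (by norm_num : (0:ℝ) < 1/2)] with t h
      by_contra h'
      have := (supp h').1
      simp at h
      linarith
    exact contDiffAt_const.congr_of_eventuallyEq this
  · exact ((hb.sub (hb.comp (contDiff_const.mul contDiff_id))).contDiffAt).div contDiffAt_id ht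

lemma hasCompactSupport : HasCompactSupport kernelBump :=
  HasCompactSupport.of_support_subset_isCompact (isCompact_Icc (a := -2) (b := 2)) fun _ h =>
    abs_le.1 (supp h).2

lemma neg (t : ℝ) : kernelBump (-t) = -kernelBump t := by
  simp only [kernelBump, mul_neg, stdBump.neg, div_neg]

lemma exists_weight : ∃ K, Weight K kernelBump := by
  obtain ⟨a, ha⟩ := contDiff.continuous.bounded_above_of_compact_support hasCompactSupport
  obtain ⟨b, hb⟩ := (contDiff.continuous_deriv le_rfl).bounded_above_of_compact_support
    hasCompactSupport.deriv
  refine ⟨max 1 (max a b), le_max_left _ _, contDiff, fun t => supp, fun t => (ha t).trans ?_,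
    fun t => (hb t).trans ?_, ?_⟩
  · simp
  · simp
  · have h := integral_neg_eq_self kernelBump volume
    simp only [neg, integral_neg] at h
    linarith

lemma telescope (j₀ : ℤ) (n : ℕ) (t : ℝ) :
    ∑ i ∈ Finset.range n, 2 ^ (j₀ + i) * kernelBump (2 ^ (j₀ + i) * t) =
      (stdBump (2 ^ j₀ * t) - stdBump (2 ^ (j₀ + n) * t)) / t := by
  induction n with
  | zero => simp
  | succ n ih =>
    rw [sum_range_succ, ih, kernelBump, ← mul_assoc 2, ← zpow_one_add₀ two_ne_zero,
      Nat.cast_succ, show (1:ℤ) + (j₀ + n) = j₀ + (n + 1) by ring]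
    rw [← mul_div_assoc, mul_div_mul_left _ _ (by positivity), ← add_div, sub_add_sub_cancel]

end kernelBump

lemma Weight.mono {K K' : ℝ} {ρ : ℝ → ℝ} (h : Weight K ρ) (hK : K ≤ K') : Weight K' ρ :=
  ⟨h.one_le.trans hK, h.smooth, h.supp, fun t => (h.bound t).trans hK,
    fun t => (h.bound' t).trans hK, h.mean⟩

section Oscillation

variable {K l₀ r₀ α β a b : ℝ} {q q₁ q₂ q₃ ζ ζ' : ℝ → ℝ} {f g : ℝ → ℂ}

lemma measurable_bil {p q ρ : ℝ → ℝ} (hp : Measurable p) (hq : Measurable q) (hρ : Measurable ρ)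
    (hf : Measurable f) (hg : Measurable g) : Measurable (bil p q ρ f g) := by
  have hm : Measurable (uncurry fun x t => (f (x - p t) * g (x - q t)) * (ρ t : ℂ)) := by
    unfold uncurry
    fun_prop
  exact (hm.stronglyMeasurable.integral_prod_right).measurable

lemma Amplitude.measurable (hζ : Amplitude K l₀ r₀ ζ ζ') : Measurable ζ :=
  (continuous_iff_continuousAt.2 fun t => (hζ.hasDeriv t).continuousAt).measurable

lemma Amplitude.mem (hζ : Amplitude K l₀ r₀ ζ ζ') {s : ℝ} (h : ζ s ≠ 0) : s ∈ Ioo l₀ r₀ :=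
  hζ.supp (subset_tsupport _ h)

lemma Amplitude.lintegral_le (hζ : Amplitude K l₀ r₀ ζ ζ') (hK : 0 ≤ K) (hl : r₀ - l₀ ≤ K) :
    ∫⁻ s, ‖(ζ s : ℂ)‖ₑ ≤ ofReal (K * K) := by
  calc ∫⁻ s, ‖(ζ s : ℂ)‖ₑ ≤ ∫⁻ s, (Ioo l₀ r₀).indicator (fun _ => ofReal K) s := by
        refine lintegral_mono fun s => ?_
        by_cases h : s ∈ Ioo l₀ r₀
        · rw [indicator_of_mem h, ← ofReal_norm, norm_real]
          exact ofReal_le_ofReal (hζ.bound0 s)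
        · have : ζ s = 0 := by
            by_contra h'
            exact h (hζ.mem h')
          simp [this]
    _ ≤ _ := by
        rw [lintegral_indicator_const measurableSet_Ioo, volume_Ioo, ofReal_mul hK]
        gcongr

lemma integrable_linear_mul (hα : 0 < α) {G : ℝ → ℂ} (hG : Measurable G) {R c : ℝ}
    (hGs : ∀ s, G s ≠ 0 → |s| ≤ R) (hGc : ∀ s, ‖G s‖ ≤ c) (hf : L2B f a) (x : ℝ) :
    Integrable fun s => f (x - α * s) * G s := by
  set I := Icc (x - α * R) (x + α * R)
  have h1 : Integrable (I.indicator f) :=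
    (hf.integrableOn (by simp [I])).integrable_indicator measurableSet_Icc
  have h2 : Integrable fun s => I.indicator f (x - α * s) :=
    ((h1.comp_sub_left x).comp_mul_left' hα.ne')
  refine (h2.mul_bdd hG.aestronglyMeasurable (Filter.Eventually.of_forall hGc)).congr
    (Filter.Eventually.of_forall fun s => ?_)
  by_cases h : G s = 0
  · simp [h]
  · have := abs_le.1 (hGs s h)
    have hm : x - α * s ∈ I := ⟨by nlinarith, by nlinarith⟩
    simp only [indicator_of_mem hm]

lemma SmoothingCurve.integrable (hq : SmoothingCurve K l₀ r₀ q q₁ q₂ q₃) (hqm : Measurable q)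
    (hζ : Amplitude K l₀ r₀ ζ ζ') (hα : 0 < α) (hf : L2B f a) (hg : LocBdd g) (x : ℝ) :
    Integrable fun s => (f (x - α * s) * g (x - β * q s)) * (ζ s : ℂ) := by
  obtain ⟨c, hc0, hc⟩ := hg.bdd (|x| + |β| * K)
  have := hg.meas
  have := hζ.measurable
  have hc' : ∀ s, ζ s ≠ 0 → ‖g (x - β * q s)‖ ≤ c := fun s hs => hc _ <| by
    refine (abs_sub _ _).trans ?_
    rw [abs_mul]
    gcongr
    exact hq.bound0 s (hζ.mem hs)
  simp only [mul_assoc]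
  refine integrable_linear_mul (G := fun s => g (x - β * q s) * (ζ s : ℂ)) (c := c * K)
    (R := max |l₀| |r₀|) hα (by fun_prop) (fun s hs => ?_) (fun s => ?_) hf x
  · have := hζ.mem (s := s) (by rintro h; simp [h] at hs)
    exact abs_le_max_abs_abs this.1.le this.2.le
  · by_cases hs : ζ s = 0
    · simpa [hs] using mul_nonneg hc0 (by linarith [hq.one_le])
    · rw [norm_mul, norm_real]
      exact mul_le_mul (hc' s hs) (hζ.bound0 s) (norm_nonneg _) hc0

lemma Amplitude.bil_bound (hζ : Amplitude K l₀ r₀ ζ ζ') (hK : 0 ≤ K) (hl : r₀ - l₀ ≤ K)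
    {p q : ℝ → ℝ} (hp : Measurable p) (hq : Measurable q) (hf : L2B f a) (hg : L2B g b) :
    L1B (bil p q ζ f g) (K * K * (a * b)) := by
  have := hf.meas
  have := hg.meas
  have := hζ.measurable
  have ha := hf.nonneg
  have hb := hg.nonneg
  exact L1B.integral (Φ := fun x t => f (x - p t) * g (x - q t)) (σ := fun t => (ζ t : ℂ))
    (by unfold uncurry; fun_prop) (by fun_prop) (by positivity) (by positivity)
    (hζ.lintegral_le hK hl) fun t _ => (hf.translate _).mul (hg.translate _)

/-- Decay of the bilinear average against functions oscillating at scales finer than that of the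
second translation. -/
def OscBound (K C : ℝ) : Prop :=
  ∀ {l₀ r₀ α β a b : ℝ} {q q₁ q₂ q₃ ζ ζ' : ℝ → ℝ} {f ψ : ℝ → ℂ} {n l : ℤ},
    SmoothingCurve K l₀ r₀ q q₁ q₂ q₃ → Measurable q → Amplitude K l₀ r₀ ζ ζ' → 0 < β →
    4 * K ^ 8 * β ≤ α → (2:ℝ) ^ (-n) ≤ β → n ≤ l → L2B f a → DyadicAvg.Piece l ψ b →
    L1B (bil (fun s => α * s) (fun s => β * q s) ζ f ψ)
      (C * (2 ^ (-(((l:ℝ) - n) / 64)) * (a * b)))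

lemma exists_oscBound : ∃ K₀, ∀ K, K₀ ≤ K → ∃ C, 0 < C ∧ OscBound K C := by
  obtain ⟨K₀, hK₀⟩ := Smoothing.exists_smoothing_bound
  refine ⟨max K₀ 2, fun K hK => ?_⟩
  obtain ⟨C, hC, h⟩ := hK₀ K ((le_max_left _ _).trans hK)
  have hK2 : 2 ≤ K := (le_max_right _ _).trans hK
  refine ⟨√C + K * K, by positivity, ?_⟩
  intro l₀ r₀ α β a b q q₁ q₂ q₃ ζ ζ' f ψ n l hq hqm hζ hβ hαβ hn hl hf hψ'
  have hψb := hψ'.l2.nrm_le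
  have hψ : DyadicAvg.Piece l ψ (nrm ψ) := ⟨hψ'.const, hψ'.mean, hψ'.l2.self⟩
  have ha := hf.nonneg
  have hb := nrm_nonneg ψ
  have hα : 0 < α := by
    refine lt_of_lt_of_le ?_ hαβ
    positivity
  set D : ℝ := 2 ^ (-(((l:ℝ) - n) / 64)) with hD
  have hln : (n:ℝ) ≤ l := by exact_mod_cast hl
  have hD0 : 0 < D := by positivity
  have hD1 : D ≤ 1 := rpow_le_one_of_one_le_of_nonpos (by norm_num) (by linarith)
  obtain ⟨w, W, hw, hW, hwb, hwψ, -, hWb⟩ :=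
    hψ.exists_smooth (η := (2:ℝ) ^ (-(l + 1)) * (D / 8) ^ 2) (by positivity)
  have e1 : 4 * nrm ψ * √((2:ℝ) ^ (l + 1) * ((2:ℝ) ^ (-(l + 1)) * (D / 8) ^ 2)) =
      nrm ψ * D / 2 := by
    rw [← mul_assoc, ← zpow_add₀ two_ne_zero, add_neg_cancel, zpow_zero, one_mul,
      sqrt_sq (by positivity)]
    ring
  rw [e1] at hwψ
  have hψw : nrm ψ ≤ 2 * nrm w := by
    have h1 := (hwb.self.sub hwψ).nrm_le
    simp only [sub_sub_cancel] at h1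
    have : nrm ψ * D ≤ nrm ψ := mul_le_of_le_one_right hb hD1
    change nrm ψ ≤ _ at h1
    linarith
  have hsmooth : L1B (bil (fun s => α * s) (fun s => β * q s) ζ f w)
      (√C * (D * (a * nrm ψ))) := by
    refine ⟨measurable_bil (by fun_prop) (by fun_prop) hζ.measurable hf.meas hwb.meas,
      by positivity, ENNReal.le_of_sq_le_sq ?_⟩
    have hν : ofReal (((2:ℝ) ^ l) ^ 2) * ∫⁻ x, ‖W x‖ₑ ^ 2 ≤
        ofReal (K ^ 2) * ∫⁻ x, ‖w x‖ₑ ^ 2 := by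
      have h1 : ofReal (nrm w ^ 2) = ∫⁻ x, ‖w x‖ₑ ^ 2 := by
        rw [nrm, ofReal_pow ENNReal.toReal_nonneg, ENNReal.ofReal_toReal hwb.memLp.2.ne,
          sq_eLpNorm_two]
      rw [← h1, ← ofReal_mul (by positivity)]
      calc _ ≤ ofReal (((2:ℝ) ^ l) ^ 2) * ofReal (((2:ℝ) ^ (-l) * nrm ψ) ^ 2) := by
            gcongr
            exact hWb.lintegral_le
        _ = ofReal (nrm ψ ^ 2) := by
            rw [← ofReal_mul (by positivity), ← mul_pow, ← mul_assoc,
              ← zpow_add₀ two_ne_zero, add_neg_cancel, zpow_zero, one_mul]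
        _ ≤ _ := by
            refine ofReal_le_ofReal ?_
            rw [← mul_pow]
            gcongr
            exact hψw.trans (by have := nrm_nonneg w; gcongr)
    have hνβ : (2:ℝ) ^ ((l:ℝ) - n) ≤ (2:ℝ) ^ l * β := by
      rw [rpow_sub two_pos, rpow_intCast, rpow_intCast, div_eq_mul_inv,
        ← zpow_neg]
      gcongr
    have h1 := h (ν := (2:ℝ) ^ l) hq hqm hζ hβ hαβ
      ((Real.one_le_rpow (by norm_num) (by linarith)).trans hνβ) hf.meas
      (hf.lintegral_le.trans_lt ofReal_lt_top)
      (hwb.lintegral_le.trans_lt ofReal_lt_top) hw hW hν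
    have e2 : ∀ x, bil (fun s => α * s) (fun s => β * q s) ζ f w x =
        ∫ s, (ζ s : ℂ) * (f (x - α * s) * w (x - β * q s)) := fun x => by
      simp only [bil, mul_comm _ ((ζ _ : ℝ) : ℂ)]
    simp only [e2]
    refine h1.trans ?_
    rw [← ofReal_pow (by positivity)]
    calc _ ≤ ofReal (C * D ^ 2) * ofReal (a ^ 2) *
          ofReal (nrm ψ ^ 2) := by
          gcongr
          · calc _ ≤ ((2:ℝ) ^ ((l:ℝ) - n)) ^ (-(1/32) : ℝ) :=
                  Real.rpow_le_rpow_of_nonpos (by positivity) hνβ (by norm_num)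
              _ = D ^ 2 := by
                  rw [hD, ← rpow_mul (by norm_num), ← rpow_natCast,
                    ← rpow_mul (by norm_num)]
                  congr 1; push_cast; ring
          · exact hf.lintegral_le
          · exact hwb.lintegral_le
      _ = _ := by
          rw [← ofReal_mul (by positivity), ← ofReal_mul (by positivity)]
          congr 1
          rw [mul_pow, sq_sqrt hC.le]
          ring
  have hrough := hζ.bil_bound (by linarith) hq.length (p := fun s => α * s)
    (q := fun s => β * q s) (by fun_prop) (by fun_prop) hf hwψ
  refine (hsmooth.sub hrough).congr (fun x => ?_) ?_
  · have hl1 : LocBdd w := .of_continuous hw.continuous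
    simp only [bil]
    rw [← integral_sub (hq.integrable hqm hζ hα hf hl1 x)
      (hq.integrable hqm hζ hα hf (hl1.sub hψ.locBdd) x)]
    congr 1
    ext s
    ring
  · have : a * nrm ψ ≤ a * b := by gcongr
    calc _ = (√C + K * K / 2) * (D * (a * nrm ψ)) := by ring
      _ ≤ _ := by
        gcongr
        nlinarith

end Oscillation

lemma Amplitude.of_indicator {K l r : ℝ} {φ φ' : ℝ → ℝ} {S : Set ℝ} (hK : 0 ≤ K)
    (hd : ∀ t ∈ Ioo l r, HasDerivAt φ (φ' t) t) (hc : ContinuousOn φ' (Ioo l r))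
    (h0 : ∀ t ∈ Ioo l r, |φ t| ≤ K) (h1 : ∀ t ∈ Ioo l r, |φ' t| ≤ K) (hS : IsCompact S)
    (hSI : S ⊆ Ioo l r) (hs : ∀ t ∈ Ioo l r, φ t ≠ 0 → t ∈ S) :
    Amplitude K l r ((Ioo l r).indicator φ) ((Ioo l r).indicator φ') := by
  have hsupp : Function.support ((Ioo l r).indicator φ) ⊆ S := fun t ht => by
    have hm : t ∈ Ioo l r := mem_of_indicator_ne_zero ht
    exact hs t hm (by rwa [Function.mem_support, indicator_of_mem hm] at ht)
  have hbd : ∀ {θ : ℝ → ℝ}, (∀ t ∈ Ioo l r, |θ t| ≤ K) → ∀ t, |(Ioo l r).indicator θ t| ≤ K := by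
    intro θ hθ t
    by_cases h : t ∈ Ioo l r
    · rw [indicator_of_mem h]; exact hθ t h
    · rw [indicator_of_notMem h]; simpa using hK
  have hin : ∀ (θ : ℝ → ℝ) t, t ∈ Ioo l r → (Ioo l r).indicator θ =ᶠ[nhds t] θ := by
    intro θ t ht
    filter_upwards [isOpen_Ioo.mem_nhds ht] with y hy
    rw [indicator_of_mem hy]
  have hout : ∀ t, t ∉ S → (Ioo l r).indicator φ =ᶠ[nhds t] fun _ => 0 := by
    intro t ht
    filter_upwards [hS.isClosed.isOpen_compl.mem_nhds ht] with y hy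
    by_contra h
    exact hy (hsupp h)
  have hder : ∀ t, HasDerivAt ((Ioo l r).indicator φ) ((Ioo l r).indicator φ' t) t := by
    intro t
    by_cases h : t ∈ Ioo l r
    · rw [indicator_of_mem h]
      exact (hd t h).congr_of_eventuallyEq (hin φ t h)
    · rw [indicator_of_notMem h]
      exact (hasDerivAt_const t 0).congr_of_eventuallyEq (hout t fun h' => h (hSI h'))
  refine ⟨hder, continuous_iff_continuousAt.2 fun t => ?_, hbd h0, hbd h1,
    .of_support_subset_isCompact hS hsupp, (closure_minimal hsupp hS.isClosed).trans hSI⟩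
  by_cases h : t ∈ S
  · exact (hc.continuousAt (isOpen_Ioo.mem_nhds (hSI h))).congr (hin φ' t (hSI h)).symm
  · have : (Ioo l r).indicator φ' =ᶠ[nhds t] fun _ => 0 := by
      filter_upwards [hS.isClosed.isOpen_compl.mem_nhds h] with y hy
      exact (hder y).unique ((hasDerivAt_const y 0).congr_of_eventuallyEq (hout y hy))
    exact continuousAt_const.congr this.symm

/-- Inversion of a strictly increasing differentiable function on an interval. -/
lemma exists_inverse_of_pos {Q Q₁ : ℝ → ℝ} {l r : ℝ} (hlr : l < r)
    (hd : ∀ t ∈ Icc l r, HasDerivAt Q (Q₁ t) t) (hpos : ∀ t ∈ Icc l r, 0 < Q₁ t) :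
    ∃ q : ℝ → ℝ, Continuous q ∧ Q '' Ioo l r = Ioo (Q l) (Q r) ∧
      (∀ t ∈ Ioo l r, q (Q t) = t) ∧ ∀ t ∈ Ioo l r, HasDerivAt q (Q₁ t)⁻¹ (Q t) := by
  have hmono : StrictMonoOn Q (Icc l r) := by
    refine strictMonoOn_of_deriv_pos (convex_Icc l r)
      (fun t ht => (hd t ht).continuousAt.continuousWithinAt) fun t ht => ?_
    have := interior_subset ht
    rw [(hd t this).deriv]
    exact hpos t this
  set c : ℝ → ℝ := fun t => max l (min t r) with hc
  have hcm : ∀ t, c t ∈ Icc l r := fun t => ⟨le_max_left _ _, max_le hlr.le (min_le_right _ _)⟩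
  have hci : ∀ t ∈ Icc l r, c t = t := fun t ht => by simp [hc, ht.1, ht.2]
  have hcmono : Monotone c := fun s t h => max_le_max le_rfl (min_le_min h le_rfl)
  have hsub : ∀ s t, s ≤ t → c t - c s ≤ t - s := by
    intro s t h
    simp only [hc]
    rcases le_total s r with h1 | h1 <;> rcases le_total t r with h2 | h2 <;>
      simp only [min_eq_left, min_eq_right, h1, h2] <;>
      rcases le_total l s with h3 | h3 <;> rcases le_total l t with h4 | h4 <;>
      simp only [max_eq_left, max_eq_right, h3, h4, hlr.le] <;> linarith
  set P : ℝ → ℝ := fun t => Q (c t) + (t - c t) with hP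
  have hPQ : ∀ t ∈ Icc l r, P t = Q t := fun t ht => by simp [hP, hci t ht]
  have hPmono : StrictMono P := by
    intro s t h
    have h1 := hsub s t h.le
    rcases (hcmono h.le).lt_or_eq with h2 | h2
    · have := hmono (hcm s) (hcm t) h2
      simp only [hP]; linarith
    · simp only [hP, h2]; linarith
  have hcc : Continuous c := by fun_prop
  have hPc : Continuous P := by
    refine .add (continuous_iff_continuousAt.2 fun t => ?_) (by fun_prop)
    exact ContinuousAt.comp (hd _ (hcm t)).continuousAt hcc.continuousAt
  have hPs : Function.Surjective P := by
    refine hPc.surjective ?_ ?_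
    · refine Filter.tendsto_atTop_mono (f := fun t => t + (Q l - r)) (fun t => ?_)
        (Filter.tendsto_atTop_add_const_right _ _ Filter.tendsto_id)
      have := hmono.monotoneOn ⟨le_rfl, hlr.le⟩ (hcm t) (hcm t).1
      simp only [hP]; linarith [(hcm t).2]
    · refine Filter.tendsto_atBot_mono (f := fun t => t + (Q r - l)) (fun t => ?_)
        (Filter.tendsto_atBot_add_const_right _ _ Filter.tendsto_id)
      have := hmono.monotoneOn (hcm t) ⟨hlr.le, le_rfl⟩ (hcm t).2
      simp only [hP]; linarith [(hcm t).1]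
  let e : ℝ ≃o ℝ := hPmono.orderIsoOfSurjective P hPs
  have he : ∀ t, e t = P t := fun t => rfl
  have hinv : ∀ t ∈ Icc l r, e.symm (Q t) = t := fun t ht => by
    rw [← hPQ t ht, ← he, e.symm_apply_apply]
  refine ⟨e.symm, e.symm.continuous, ?_, fun t ht => hinv t (Ioo_subset_Icc_self ht),
    fun t ht => ?_⟩
  · rw [← hPQ l ⟨le_rfl, hlr.le⟩, ← hPQ r ⟨hlr.le, le_rfl⟩, ← he, ← he, ← e.image_Ioo]
    exact image_congr fun t ht => (hPQ t (Ioo_subset_Icc_self ht)).symm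
  · have h1 := Ioo_subset_Icc_self ht
    have h2 : HasDerivAt e (Q₁ t) t := by
      refine (hd t h1).congr_of_eventuallyEq ?_
      filter_upwards [isOpen_Ioo.mem_nhds ht] with y hy
      exact hPQ y (Ioo_subset_Icc_self hy)
    refine HasDerivAt.of_local_left_inverse e.symm.continuous.continuousAt
      (by rwa [hinv t h1]) (hpos t h1).ne' (.of_forall e.apply_symm_apply)

/-- Inversion of a differentiable function with nonvanishing derivative on an interval. -/
lemma exists_inverse {Q Q₁ : ℝ → ℝ} {l r : ℝ} (hlr : l < r)
    (hd : ∀ t ∈ Icc l r, HasDerivAt Q (Q₁ t) t) (hne : ∀ t ∈ Icc l r, Q₁ t ≠ 0) :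
    ∃ (q : ℝ → ℝ) (l₁ r₁ σ : ℝ), Continuous q ∧ r₁ - l₁ ≤ |Q l| + |Q r| ∧
      (∀ t ∈ Icc l r, |Q₁ t| = σ * Q₁ t) ∧ |σ| = 1 ∧ Q '' Ioo l r = Ioo l₁ r₁ ∧
      (∀ t ∈ Ioo l r, q (Q t) = t) ∧ ∀ t ∈ Ioo l r, HasDerivAt q (Q₁ t)⁻¹ (Q t) := by
  rcases hasDerivWithinAt_forall_lt_or_forall_gt_of_forall_ne (convex_Icc l r)
    (fun t ht => (hd t ht).hasDerivWithinAt) hne with h | h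
  · obtain ⟨q, h1, h2, h3, h4⟩ := exists_inverse_of_pos (Q := fun t => -Q t)
      (Q₁ := fun t => -Q₁ t) hlr (fun t ht => (hd t ht).neg) fun t ht => neg_pos.2 (h t ht)
    refine ⟨fun s => q (-s), Q r, Q l, -1, by fun_prop, ?_, fun t ht => ?_, by simp, ?_, ?_, ?_⟩
    · linarith [le_abs_self (Q l), neg_abs_le (Q r)]
    · rw [abs_of_neg (h t ht)]; ring
    · have e : Q '' Ioo l r = Neg.neg '' ((fun t => -Q t) '' Ioo l r) := by
        rw [image_image]; simp
      rw [e, h2]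
      simp
    · exact h3
    · intro t ht
      have := (h4 t ht).comp (Q t) (hasDerivAt_neg _)
      refine this.congr_deriv ?_
      rw [inv_neg]; ring
  · obtain ⟨q, h1, h2, h3, h4⟩ := exists_inverse_of_pos hlr hd h
    refine ⟨q, Q l, Q r, 1, h1, ?_, fun t ht => ?_, by simp, h2, h3, h4⟩
    · linarith [le_abs_self (Q r), neg_abs_le (Q l)]
    · rw [abs_of_pos (h t ht), one_mul]

/-- The points of size comparable to one. -/
def shell : Set ℝ := {t | 1/4 < |t| ∧ |t| < 4}

lemma isOpen_shell : IsOpen shell :=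
  (isOpen_lt continuous_const continuous_abs).inter (isOpen_lt continuous_abs continuous_const)

/-- The intervals `(1/3, 3)` and `(-3, -1/3)`. -/
def IsSide (l r : ℝ) : Prop := (l = 1/3 ∧ r = 3) ∨ (l = -3 ∧ r = -(1/3))

namespace IsSide

variable {l r t : ℝ}

lemma lt (h : IsSide l r) : l < r := by
  rcases h with ⟨rfl, rfl⟩ | ⟨rfl, rfl⟩ <;> norm_num

lemma length (h : IsSide l r) : r - l ≤ 3 := by
  rcases h with ⟨rfl, rfl⟩ | ⟨rfl, rfl⟩ <;> norm_num

lemma mem_shell (h : IsSide l r) (ht : t ∈ Icc l r) : t ∈ shell := by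
  rcases h with ⟨rfl, rfl⟩ | ⟨rfl, rfl⟩
  · rw [shell, mem_ofPred_eq, abs_of_pos (by linarith [ht.1])]
    exact ⟨by linarith [ht.1], by linarith [ht.2]⟩
  · rw [shell, mem_ofPred_eq, abs_of_neg (by linarith [ht.2])]
    exact ⟨by linarith [ht.2], by linarith [ht.1]⟩

lemma exists_compact (h : IsSide l r) :
    ∃ S, IsCompact S ∧ S ⊆ Ioo l r ∧ ∀ t ∈ Ioo l r, 1/2 ≤ |t| ∧ |t| ≤ 2 → t ∈ S := by
  rcases h with ⟨rfl, rfl⟩ | ⟨rfl, rfl⟩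
  · refine ⟨Icc (1/2) 2, isCompact_Icc, fun t ht => ⟨by linarith [ht.1], by linarith [ht.2]⟩,
      fun t ht => ?_⟩
    rw [abs_of_pos (by linarith [ht.1])]
    exact id
  · refine ⟨Icc (-2) (-(1/2)), isCompact_Icc,
      fun t ht => ⟨by linarith [ht.1], by linarith [ht.2]⟩, fun t ht => ?_⟩
    rw [abs_of_neg (by linarith [ht.2])]
    exact fun h => ⟨by linarith [h.2], by linarith [h.1]⟩

lemma integral_eq {h : ℝ → ℂ} (hs : ∀ t, h t ≠ 0 → 1/2 ≤ |t| ∧ |t| ≤ 2)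
    (hi : ∀ l r, IsSide l r → IntegrableOn h (Ioo l r)) :
    ∫ t, h t = (∫ t in Ioo (1/3) 3, h t) + ∫ t in Ioo (-3) (-(1/3)), h t := by
  rw [← setIntegral_union _ measurableSet_Ioo (hi _ _ (.inl ⟨rfl, rfl⟩))
    (hi _ _ (.inr ⟨rfl, rfl⟩)), setIntegral_eq_integral_of_forall_compl_eq_zero]
  · intro t ht
    by_contra h'
    obtain ⟨h1, h2⟩ := hs t h'
    refine ht ?_
    rcases abs_cases t with ⟨h3, h4⟩ | ⟨h3, h4⟩
    · exact .inl ⟨by linarith, by linarith⟩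
    · exact .inr ⟨by linarith, by linarith⟩
  · rw [Set.disjoint_left]
    intro t h1 h2
    linarith [h1.1, h2.2]

lemma bil_bound {K c : ℝ} {ρ p q : ℝ → ℝ} {f g : ℝ → ℂ} (hρ : Weight K ρ)
    (h : ∀ l r, IsSide l r →
      (∀ x, IntegrableOn (fun t => (f (x - p t) * g (x - q t)) * (ρ t : ℂ)) (Ioo l r)) ∧
      L1B (fun x => ∫ t in Ioo l r, (f (x - p t) * g (x - q t)) * (ρ t : ℂ)) c) :
    L1B (bil p q ρ f g) (2 * c) := by
  refine ((h _ _ (.inl ⟨rfl, rfl⟩)).2.add (h _ _ (.inr ⟨rfl, rfl⟩)).2).congr (fun x => ?_)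
    (by linarith)
  exact integral_eq (fun t ht => hρ.supp t fun h0 => ht (by simp [h0]))
    fun l r hs => (h l r hs).1 x

end IsSide

/-- A normalized curve with nonvanishing speed. -/
structure Curve (K : ℝ) (Q Q₁ Q₂ Q₃ : ℝ → ℝ) : Prop where
  four_le : 4 ≤ K
  meas : Measurable Q
  deriv0 : ∀ t ∈ shell, HasDerivAt Q (Q₁ t) t
  deriv1 : ∀ t ∈ shell, HasDerivAt Q₁ (Q₂ t) t
  deriv2 : ∀ t ∈ shell, HasDerivAt Q₂ (Q₃ t) t
  bound0 : ∀ t ∈ shell, |Q t| ≤ K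
  bound1 : ∀ t ∈ shell, |Q₁ t| ≤ K
  bound2 : ∀ t ∈ shell, |Q₂ t| ≤ K
  lower : ∀ t ∈ shell, K⁻¹ ≤ |Q₁ t|

namespace Curve

variable {K K' C α β : ℝ} {Q Q₁ Q₂ Q₃ ρ : ℝ → ℝ} {m n : ℤ}

lemma linear (hK : 4 ≤ K) : Curve K (fun t => t) (fun _ => 1) (fun _ => 0) (fun _ => 0) where
  four_le := hK
  meas := measurable_id
  deriv0 t _ := hasDerivAt_id t
  deriv1 t _ := hasDerivAt_const t 1
  deriv2 t _ := hasDerivAt_const t 0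
  bound0 t h := by linarith [h.2]
  bound1 t _ := by simp; linarith
  bound2 t _ := by simp; linarith
  lower t _ := by rw [abs_one]; exact inv_le_one_of_one_le₀ (by linarith)

lemma shift (hQ : Curve K Q Q₁ Q₂ Q₃) (h1 : (2:ℝ) ^ (-n) ≤ β) (h2 : β ≤ 2 * 2 ^ (-n))
    (hK : 2 * K ≤ K') : Shift K' n fun t => β * Q t := by
  have hK4 := hQ.four_le
  have h2n : (0:ℝ) < 2 ^ (-n) := by positivity
  have hβ : 0 < β := by linarith
  have hd0 : ∀ t ∈ shell, HasDerivAt (fun t => β * Q t) (β * Q₁ t) t :=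
    fun t ht => (hQ.deriv0 t ht).const_mul β
  have hd1 : ∀ t ∈ shell, HasDerivAt (deriv fun t => β * Q t) (β * Q₂ t) t := fun t ht => by
    refine ((hQ.deriv1 t ht).const_mul β).congr_of_eventuallyEq ?_
    filter_upwards [isOpen_shell.mem_nhds ht] with y hy
    exact (hd0 y hy).deriv
  have hb : ∀ u : ℝ, |u| ≤ K → |β * u| ≤ K' * 2 ^ (-n) := by
    intro u hu
    rw [abs_mul, abs_of_pos hβ]
    calc β * |u| ≤ (2 * 2 ^ (-n)) * K := by gcongr
      _ = 2 * K * 2 ^ (-n) := by ring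
      _ ≤ _ := by gcongr
  refine ⟨hQ.meas.const_mul β, fun t h3 h4 => (hd0 t ⟨h3, h4⟩).differentiableAt,
    fun t h3 h4 => (hd1 t ⟨h3, h4⟩).differentiableAt, fun t h3 h4 => hb _ (hQ.bound0 t ⟨h3, h4⟩),
    fun t h3 h4 => ?_, fun t h3 h4 => ?_, fun t h3 h4 => ?_⟩
  · rw [(hd0 t ⟨h3, h4⟩).deriv]; exact hb _ (hQ.bound1 t ⟨h3, h4⟩)
  · rw [(hd1 t ⟨h3, h4⟩).deriv]; exact hb _ (hQ.bound2 t ⟨h3, h4⟩)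
  · rw [(hd0 t ⟨h3, h4⟩).deriv, abs_mul, abs_of_pos hβ]
    have h5 : 1 ≤ K * |Q₁ t| := by
      rw [← inv_le_iff_one_le_mul₀' (by linarith)]; exact hQ.lower t ⟨h3, h4⟩
    calc (2:ℝ) ^ (-n) ≤ β * 1 := by linarith
      _ ≤ β * (K * |Q₁ t|) := by gcongr
      _ = K * (β * |Q₁ t|) := by ring
      _ ≤ _ := by gcongr; linarith

/-- A single scale whose fine translation runs along a curve. -/
lemma scaleData_right (hQ : Curve K Q Q₁ Q₂ Q₃)
    (hlow : ∀ t ∈ shell, K⁻¹ ≤ |Q₂ t ^ 2 - Q₁ t * Q₃ t|) (hρ : Weight K ρ)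
    (hC : OscBound K C) (h1 : (2:ℝ) ^ (-n) ≤ β) (h2 : β ≤ 2 * 2 ^ (-n))
    (h3 : 4 * K ^ 8 * β ≤ 2 ^ (-m)) (hK : 2 * K ≤ K') (hCK : 2 * C ≤ K') :
    ScaleData K' ρ m n (fun t => 2 ^ (-m) * t) fun t => β * Q t := by
  have hK4 := hQ.four_le
  have h2n : (0:ℝ) < 2 ^ (-n) := by positivity
  refine ⟨(linear hK4).shift le_rfl (by linarith [show (0:ℝ) < 2 ^ (-m) by positivity]) hK,
    hQ.shift h1 h2 hK, ?_⟩
  intro f ψ a b l hl hf hψ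
  have ha := hf.nonneg
  have hb := hψ.l2.nonneg
  refine (IsSide.bil_bound (c := C * (2 ^ (-(((l:ℝ) - n) / 64)) * (a * b))) hρ
    fun l₀ r₀ hs => ?_).mono ?_
  · have hr := fun t (ht : t ∈ Ioo l₀ r₀) => hs.mem_shell (Ioo_subset_Icc_self ht)
    obtain ⟨S, hS, hSI, hSm⟩ := hs.exists_compact
    have hq : SmoothingCurve K l₀ r₀ Q Q₁ Q₂ Q₃ :=
      ⟨by linarith, by linarith [hs.length],
        fun t ht => hQ.deriv0 t (hr t ht), fun t ht => hQ.deriv1 t (hr t ht),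
        fun t ht => hQ.deriv2 t (hr t ht), fun t ht => hQ.bound0 t (hr t ht),
        fun t ht => hQ.bound1 t (hr t ht), fun t ht => hQ.bound2 t (hr t ht),
        fun t ht => hQ.lower t (hr t ht), fun t ht => hlow t (hr t ht)⟩
    have hζ : Amplitude K l₀ r₀ ((Ioo l₀ r₀).indicator ρ) ((Ioo l₀ r₀).indicator (deriv ρ)) :=
      .of_indicator (by linarith)
        (fun t _ => (hρ.smooth.differentiable one_ne_zero t).hasDerivAt)
        (hρ.smooth.continuous_deriv le_rfl).continuousOn (fun t _ => hρ.bound t)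
        (fun t _ => hρ.bound' t) hS hSI fun t ht h => hSm t ht (hρ.supp t h)
    have e : ∀ x, (fun s => (f (x - 2 ^ (-m) * s) * ψ (x - β * Q s)) *
        (((Ioo l₀ r₀).indicator ρ s : ℝ) : ℂ)) =
        (Ioo l₀ r₀).indicator
          fun s => (f (x - 2 ^ (-m) * s) * ψ (x - β * Q s)) * (ρ s : ℂ) := by
      intro x
      ext s
      by_cases h : s ∈ Ioo l₀ r₀ <;> simp [h]
    refine ⟨fun x => ?_, ?_⟩
    · rw [← integrable_indicator_iff measurableSet_Ioo, ← e]
      exact hq.integrable hQ.meas hζ (by positivity) hf hψ.locBdd x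
    · refine (hC hq hQ.meas hζ (by linarith) h3 h1 hl hf hψ).congr (fun x => ?_) le_rfl
      rw [bil, e, integral_indicator measurableSet_Ioo]
  · rw [← mul_assoc]
    gcongr

variable {l r : ℝ}

/-- Reparametrization of a side of a curve by its second coordinate. -/
lemma exists_inverse_curve (hQ : Curve K Q Q₁ Q₂ Q₃)
    (hlow : ∀ t ∈ shell, K⁻¹ ≤ |2 * Q₂ t ^ 2 - Q₁ t * Q₃ t|) (hρ : Weight K ρ)
    (hs : IsSide l r) :
    ∃ (q q₁ q₂ q₃ ζ ζ' : ℝ → ℝ) (l₁ r₁ : ℝ), SmoothingCurve (4 * K ^ 7) l₁ r₁ q q₁ q₂ q₃ ∧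
      Measurable q ∧ Amplitude (4 * K ^ 7) l₁ r₁ ζ ζ' ∧ ∀ h : ℝ → ℝ → ℂ,
        (IntegrableOn (fun t => h (Q t) t * (ρ t : ℂ)) (Ioo l r) ↔
          Integrable fun s => h s (q s) * (ζ s : ℂ)) ∧
        ∫ t in Ioo l r, h (Q t) t * (ρ t : ℂ) = ∫ s, h s (q s) * (ζ s : ℂ) := by
  have hK := hQ.four_le
  have hne : ∀ t ∈ Icc l r, Q₁ t ≠ 0 := fun t ht h0 => by
    have := hQ.lower t (hs.mem_shell ht)
    rw [h0, abs_zero] at this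
    have : 0 < K⁻¹ := by positivity
    linarith
  obtain ⟨q, l₁, r₁, σ, hqc, hlen, hσ, hσ1, himg, hinv, hdq⟩ := exists_inverse hs.lt
    (fun t ht => hQ.deriv0 t (hs.mem_shell ht)) hne
  have hsurj : ∀ s ∈ Ioo l₁ r₁, q s ∈ Ioo l r ∧ Q (q s) = s := by
    intro s hs'
    rw [← himg] at hs'
    obtain ⟨t, ht, rfl⟩ := hs'
    rw [hinv t ht]
    exact ⟨ht, rfl⟩
  have hr := fun s (hs' : s ∈ Ioo l₁ r₁) => hs.mem_shell (Ioo_subset_Icc_self (hsurj s hs').1)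
  set q₁ : ℝ → ℝ := fun s => (Q₁ (q s))⁻¹ with hq₁
  set q₂ : ℝ → ℝ := fun s => -Q₂ (q s) / Q₁ (q s) ^ 3 with hq₂
  set q₃ : ℝ → ℝ := fun s => (3 * Q₂ (q s) ^ 2 - Q₁ (q s) * Q₃ (q s)) / Q₁ (q s) ^ 5 with hq₃
  have hd0 : ∀ s ∈ Ioo l₁ r₁, HasDerivAt q (q₁ s) s := fun s hs' => by
    obtain ⟨h1, h2⟩ := hsurj s hs'
    have := hdq _ h1
    rwa [h2] at this
  have hne' : ∀ s ∈ Ioo l₁ r₁, Q₁ (q s) ≠ 0 := fun s hs' =>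
    hne _ (Ioo_subset_Icc_self (hsurj s hs').1)
  have hc1 : ∀ s ∈ Ioo l₁ r₁, HasDerivAt (fun s => Q₁ (q s)) (Q₂ (q s) * q₁ s) s := fun s hs' =>
    (hQ.deriv1 _ (hr s hs')).comp s (hd0 s hs')
  have hc2 : ∀ s ∈ Ioo l₁ r₁, HasDerivAt (fun s => Q₂ (q s)) (Q₃ (q s) * q₁ s) s := fun s hs' =>
    (hQ.deriv2 _ (hr s hs')).comp s (hd0 s hs')
  have hd1 : ∀ s ∈ Ioo l₁ r₁, HasDerivAt q₁ (q₂ s) s := fun s hs' => by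
    have h0 := hne' s hs'
    refine ((hc1 s hs').fun_inv h0).congr_deriv ?_
    simp only [hq₁, hq₂]
    field_simp
  have hd2 : ∀ s ∈ Ioo l₁ r₁, HasDerivAt q₂ (q₃ s) s := fun s hs' => by
    have h0 := hne' s hs'
    refine ((hc2 s hs').fun_neg.fun_div ((hc1 s hs').fun_pow 3) (pow_ne_zero 3 h0)).congr_deriv ?_
    simp only [hq₁, hq₃]
    field_simp
    push_cast
    ring
  have hb1 : ∀ s ∈ Ioo l₁ r₁, |q₁ s| ≤ K := fun s hs' => by
    rw [hq₁, abs_inv]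
    exact inv_le_of_inv_le₀ (by linarith) (hQ.lower _ (hr s hs'))
  have hb2 : ∀ s ∈ Ioo l₁ r₁, |q₂ s| ≤ K ^ 4 := fun s hs' => by
    have h1 := hQ.bound2 _ (hr s hs')
    have h2 := hb1 s hs'
    have e : q₂ s = -Q₂ (q s) * q₁ s ^ 3 := by simp only [hq₁, hq₂]; field_simp
    rw [e, abs_mul, abs_neg, abs_pow]
    calc _ ≤ K * K ^ 3 := by gcongr
      _ = _ := by ring
  have hpow : ∀ k ≤ 7, K ^ k ≤ K ^ 7 := fun k hk => pow_le_pow_right₀ (by linarith) hk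
  have hK7 : 1 ≤ K ^ 7 := one_le_pow₀ (by linarith)
  have hK1 : K ≤ K ^ 7 := by simpa using hpow 1 (by norm_num)
  have hcurve : SmoothingCurve (4 * K ^ 7) l₁ r₁ q q₁ q₂ q₃ := by
    refine ⟨by linarith, ?_, hd0, hd1, hd2, fun s hs' => ?_, fun s hs' => ?_, fun s hs' => ?_,
      fun s hs' => ?_, fun s hs' => ?_⟩
    · linarith [hQ.bound0 l (hs.mem_shell ⟨le_rfl, hs.lt.le⟩),
        hQ.bound0 r (hs.mem_shell ⟨hs.lt.le, le_rfl⟩)]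
    · linarith [(hr s hs').2]
    · linarith [hb1 s hs']
    · linarith [hb2 s hs', hpow 4 (by norm_num)]
    · rw [hq₁, abs_inv]
      have h0 : 0 < |Q₁ (q s)| := abs_pos.2 (hne' s hs')
      gcongr
      linarith [hQ.bound1 _ (hr s hs')]
    · have h0 : 0 < |Q₁ (q s)| := abs_pos.2 (hne' s hs')
      have h1 := hQ.bound1 _ (hr s hs')
      have h0' := hne' s hs'
      have e : q₂ s ^ 2 - q₁ s * q₃ s =
          -(2 * Q₂ (q s) ^ 2 - Q₁ (q s) * Q₃ (q s)) / Q₁ (q s) ^ 6 := by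
        simp only [hq₁, hq₂, hq₃]
        field_simp
        ring
      rw [e, abs_div, abs_neg, abs_pow]
      calc (4 * K ^ 7)⁻¹ ≤ (K ^ 7)⁻¹ := by gcongr; linarith
        _ = K⁻¹ / K ^ 6 := by field_simp
        _ ≤ _ := by
          gcongr
          exact hlow _ (hr s hs')
  obtain ⟨S, hS, hSI, hSm⟩ := hs.exists_compact
  have hρd : ∀ t, HasDerivAt ρ (deriv ρ t) t := fun t =>
    (hρ.smooth.differentiable one_ne_zero t).hasDerivAt
  have hamp : Amplitude (4 * K ^ 7) l₁ r₁
      ((Ioo l₁ r₁).indicator fun s => σ * (ρ (q s) * q₁ s))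
      ((Ioo l₁ r₁).indicator fun s => σ * (deriv ρ (q s) * q₁ s * q₁ s + ρ (q s) * q₂ s)) := by
    refine .of_indicator (S := Q '' S) (by linarith) (fun s hs' => ?_) ?_ (fun s hs' => ?_)
      (fun s hs' => ?_) (hS.image_of_continuousOn fun t ht => ?_) ?_ (fun s hs' h => ?_)
    · exact ((((hρd (q s)).comp s (hd0 s hs')).fun_mul (hd1 s hs')).const_mul σ)
    · have c1 : ContinuousOn q₁ (Ioo l₁ r₁) := fun s hs' =>
        (hd1 s hs').continuousAt.continuousWithinAt
      have c2 : ContinuousOn q₂ (Ioo l₁ r₁) := fun s hs' =>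
        (hd2 s hs').continuousAt.continuousWithinAt
      have c3 : Continuous (deriv ρ) := hρ.smooth.continuous_deriv le_rfl
      have c4 := hρ.smooth.continuous
      fun_prop
    · rw [abs_mul, hσ1, one_mul, abs_mul]
      calc _ ≤ K * K := mul_le_mul (hρ.bound _) (hb1 s hs') (abs_nonneg _) (by linarith)
        _ ≤ _ := by nlinarith [hpow 2 (by norm_num)]
    · rw [abs_mul, hσ1, one_mul]
      have h1 : |deriv ρ (q s) * q₁ s * q₁ s| ≤ K * K * K := by
        rw [abs_mul, abs_mul]
        gcongr
        exacts [hρ.bound' _, hb1 s hs', hb1 s hs']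
      have h2 : |ρ (q s) * q₂ s| ≤ K * K ^ 4 := by
        rw [abs_mul]
        gcongr
        exacts [hρ.bound _, hb2 s hs']
      refine (abs_add_le _ _).trans ?_
      nlinarith [hpow 3 (by norm_num), hpow 5 (by norm_num)]
    · exact (hQ.deriv0 t
        (hs.mem_shell (Ioo_subset_Icc_self (hSI ht)))).continuousAt.continuousWithinAt
    · rw [← himg]; exact image_mono hSI
    · refine ⟨q s, hSm _ (hsurj s hs').1 (hρ.supp _ fun h0 => h ?_), (hsurj s hs').2⟩
      simp [h0]
  refine ⟨q, q₁, q₂, q₃, _, _, l₁, r₁, hcurve, hqc.measurable, hamp, fun h => ?_⟩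
  have hqimg : q '' Ioo l₁ r₁ = Ioo l r := by
    rw [← himg, image_image]
    exact (image_congr hinv).trans (image_id _)
  have hqinj : InjOn q (Ioo l₁ r₁) := fun s hs' s' hs'' heq => by
    rw [← (hsurj s hs').2, heq, (hsurj s' hs'').2]
  have e : (fun s => h s (q s) *
      (((Ioo l₁ r₁).indicator (fun s => σ * (ρ (q s) * q₁ s)) s : ℝ) : ℂ)) =
      (Ioo l₁ r₁).indicator fun s => |q₁ s| • (h (Q (q s)) (q s) * (ρ (q s) : ℂ)) := by
    ext s
    by_cases hs' : s ∈ Ioo l₁ r₁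
    · rw [indicator_of_mem hs', indicator_of_mem hs', (hsurj s hs').2, real_smul]
      have h1 : |q₁ s| = σ * q₁ s := by
        have h2 := hσ _ (Ioo_subset_Icc_self (hsurj s hs').1)
        have h3 : σ * σ = 1 := by rw [← abs_mul_abs_self, hσ1, one_mul]
        rw [hq₁, abs_inv, h2, mul_inv, inv_eq_of_mul_eq_one_right h3]
      rw [h1]
      push_cast
      ring
    · rw [indicator_of_notMem hs', indicator_of_notMem hs']; simp
  have hdw : ∀ s ∈ Ioo l₁ r₁, HasDerivWithinAt q (q₁ s) (Ioo l₁ r₁) s := fun s hs' =>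
    (hd0 s hs').hasDerivWithinAt
  rw [e, integrable_indicator_iff measurableSet_Ioo, integral_indicator measurableSet_Ioo,
    ← hqimg]
  exact ⟨integrableOn_image_iff_integrableOn_abs_deriv_smul measurableSet_Ioo hdw hqinj
      (fun t => h (Q t) t * (ρ t : ℂ)),
    integral_image_eq_integral_abs_deriv_smul measurableSet_Ioo hdw hqinj
      (fun t => h (Q t) t * (ρ t : ℂ))⟩

/-- A single scale whose coarse translation runs along a curve. -/
lemma scaleData_left (hQ : Curve K Q Q₁ Q₂ Q₃)
    (hlow : ∀ t ∈ shell, K⁻¹ ≤ |2 * Q₂ t ^ 2 - Q₁ t * Q₃ t|) (hρ : Weight K ρ)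
    (hC : OscBound (4 * K ^ 7) C) (h1 : (2:ℝ) ^ (-m) ≤ α) (h2 : α ≤ 2 * 2 ^ (-m))
    (h3 : 4 * (4 * K ^ 7) ^ 8 * 2 ^ (-n) ≤ α) (hK : 2 * K ≤ K') (hCK : 2 * C ≤ K') :
    ScaleData K' ρ m n (fun t => α * Q t) fun t => 2 ^ (-n) * t := by
  have hK4 := hQ.four_le
  have h2m : (0:ℝ) < 2 ^ (-m) := by positivity
  refine ⟨hQ.shift h1 h2 hK,
    (linear hK4).shift le_rfl (by linarith [show (0:ℝ) < 2 ^ (-n) by positivity]) hK, ?_⟩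
  intro f ψ a b l hl hf hψ
  have ha := hf.nonneg
  have hb := hψ.l2.nonneg
  refine (IsSide.bil_bound (c := C * (2 ^ (-(((l:ℝ) - n) / 64)) * (a * b))) hρ
    fun l₀ r₀ hs => ?_).mono ?_
  · obtain ⟨q, q₁, q₂, q₃, ζ, ζ', l₁, r₁, hq, hqm, hζ, hcv⟩ := hQ.exists_inverse_curve hlow hρ hs
    refine ⟨fun x => ?_, ?_⟩
    · rw [(hcv fun s t => f (x - α * s) * ψ (x - 2 ^ (-n) * t)).1]
      exact hq.integrable hqm hζ (by linarith) hf hψ.locBdd x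
    · refine (hC hq hqm hζ (by positivity) h3 le_rfl hl hf hψ).congr (fun x => ?_) le_rfl
      exact (hcv fun s t => f (x - α * s) * ψ (x - 2 ^ (-n) * t)).2
  · rw [← mul_assoc]
    gcongr

end Curve

lemma ContDiffAt.hasDerivAt_iteratedDeriv {f : ℝ → ℝ} {t : ℝ} {N k : ℕ} (h : ContDiffAt ℝ N f t)
    (hk : k < N) : HasDerivAt (iteratedDeriv k f) (iteratedDeriv (k + 1) f t) t := by
  rw [iteratedDeriv_succ]
  refine DifferentiableAt.hasDerivAt ?_
  rw [iteratedDeriv_eq_equiv_comp]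
  exact (LinearIsometryEquiv.differentiable _).differentiableAt.comp t
    (h.differentiableAt_iteratedFDeriv (by exact_mod_cast hk))

lemma ContinuousOn.measurable_indicator_zero {f : ℝ → ℝ} {s : Set ℝ} (hf : ContinuousOn f s)
    (hs : MeasurableSet s) : Measurable (s.indicator f) := by
  classical
  rw [← piecewise_eq_indicator]
  exact hf.measurable_piecewise continuousOn_const hs

lemma exists_mul_rpow_le {K c η : ℝ} (hK : 0 < K) (hc : 0 < c) (hη : 0 < η) :
    ∃ δ : ℝ, 0 < δ ∧ ∀ ε, 0 < ε → ε < δ → K * ε ^ c ≤ η := by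
  refine ⟨(η / K) ^ c⁻¹, by positivity, fun ε h0 h1 => ?_⟩
  have h2 : ε ^ c ≤ ((η / K) ^ c⁻¹) ^ c := by gcongr
  rw [← rpow_mul (by positivity), inv_mul_cancel₀ hc.ne', rpow_one] at h2
  calc K * ε ^ c ≤ K * (η / K) := by gcongr
    _ = η := by field_simp

lemma Finset.sum_range_mul_eq {M : Type*} [AddCommMonoid M] (F : ℕ → M) (k n : ℕ) :
    ∑ i ∈ Finset.range (k * n), F i =
      ∑ s ∈ Finset.range k, ∑ i ∈ Finset.range n, F (k * i + s) := by
  induction n with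
  | zero => simp
  | succ n ih =>
    rw [Nat.mul_succ, Finset.sum_range_add, ih, ← sum_add_distrib]
    exact sum_congr rfl fun s _ => (sum_range_succ _ _).symm

/-- The dyadic scale of a positive number: `2 ^ (-scaleExp b) ≤ b < 2 * 2 ^ (-scaleExp b)`. -/
def scaleExp (b : ℝ) : ℤ := -Int.log 2 b

lemma zpow_scaleExp_le {b : ℝ} (hb : 0 < b) : (2:ℝ) ^ (-scaleExp b) ≤ b := by
  rw [scaleExp, neg_neg]
  exact_mod_cast Int.zpow_log_le_self (b := 2) (by norm_num) hb

lemma le_zpow_scaleExp (b : ℝ) : b ≤ 2 * (2:ℝ) ^ (-scaleExp b) := by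
  have h := (Int.lt_zpow_succ_log_self (b := 2) (by norm_num) b).le
  rw [scaleExp, neg_neg, mul_comm, ← zpow_add_one₀ two_ne_zero]
  exact_mod_cast h

lemma scaleExp_lt {a b : ℝ} (ha : 0 < a) (hab : 2 * a ≤ b) : scaleExp b < scaleExp a := by
  have h1 := zpow_scaleExp_le ha
  have h3 := Int.lt_zpow_succ_log_self (b := 2) (by norm_num) b
  have h4 : (2:ℝ) ^ (-scaleExp a + 1) < 2 ^ (-scaleExp b + 1) := by
    rw [zpow_add_one₀ two_ne_zero]
    refine lt_of_le_of_lt (by linarith) (lt_of_lt_of_eq h3 ?_)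
    rw [scaleExp, neg_neg]
    norm_cast
  have := (zpow_lt_zpow_iff_right₀ one_lt_two).1 h4
  omega

lemma exists_forall_zpow_lt {δ : ℝ} (hδ : 0 < δ) :
    ∃ j₀ : ℕ, ∀ j : ℤ, (j₀ : ℤ) ≤ j → 4 * (2:ℝ) ^ (-j) < δ := by
  obtain ⟨n, hn⟩ := exists_pow_lt_of_lt_one (show 0 < δ / 4 by positivity)
    (show (1/2:ℝ) < 1 by norm_num)
  refine ⟨n, fun j hj => ?_⟩
  have h1 : (2:ℝ) ^ (-j) ≤ 2 ^ (-(n:ℤ)) := zpow_le_zpow_right₀ (by norm_num) (by omega)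
  have h2 : (2:ℝ) ^ (-(n:ℤ)) = (1/2) ^ n := by rw [zpow_neg, zpow_natCast]; simp
  linarith

/-- One half of Tonelli's theorem for functions which are uniformly Lipschitz in the first variable,
without any measurability in the second one. -/
lemma lintegral_lintegral_le_of_lipschitz {μ : Measure ℝ} [IsFiniteMeasure μ]
    {H : ℝ → ℝ → ENNReal} {L : ℝ} (hL : 0 ≤ L)
    (hH : ∀ x y t, H x t ≤ H y t + ofReal (L * |x - y|)) :
    ∫⁻ x, ∫⁻ t, H x t ∂μ ≤ ∫⁻ t, (∫⁻ x, H x t) ∂μ := by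
  choose φ hφm hφle hφ using fun n =>
    exists_measurable_le_lintegral_eq μ (H (TopologicalSpace.denseSeq ℝ n))
  let e (x : ℝ) (n : ℕ) : ENNReal := ofReal (L * |x - TopologicalSpace.denseSeq ℝ n|)
  let G (x t : ℝ) : ENNReal := ⨆ n, φ n t - e x n
  have hGH : ∀ x t, G x t ≤ H x t := fun x t => iSup_le fun n => tsub_le_iff_right.2
    ((hφle n t).trans (by simpa only [abs_sub_comm] using hH (TopologicalSpace.denseSeq ℝ n) x t))
  have hG : Measurable (uncurry G) := by
    refine Measurable.iSup fun n => ?_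
    have := hφm n
    dsimp only [e]
    fun_prop
  have hHG : ∀ x, ∫⁻ t, H x t ∂μ ≤ ∫⁻ t, G x t ∂μ := fun x => by
    refine ENNReal.le_of_forall_pos_le_add fun η hη _ => ?_
    obtain ⟨n, hn⟩ := (TopologicalSpace.denseRange_denseSeq ℝ).exists_dist_lt x
      (show 0 < (η:ℝ) / (2 * (L * μ.real univ + 1)) by positivity)
    rw [Real.dist_eq, lt_div_iff₀ (by positivity)] at hn
    have he : e x n * μ univ + e x n * μ univ ≤ η := by
      rw [← ofReal_measureReal, ← ofReal_mul (by positivity),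
        ← ofReal_add (by positivity) (by positivity)]
      refine ENNReal.ofReal_le_of_le_toReal ?_
      rw [ENNReal.coe_toReal]
      nlinarith [abs_nonneg (x - TopologicalSpace.denseSeq ℝ n)]
    calc ∫⁻ t, H x t ∂μ ≤ ∫⁻ t, (H (TopologicalSpace.denseSeq ℝ n) t + e x n) ∂μ :=
          lintegral_mono fun t => hH _ _ t
      _ = ∫⁻ t, φ n t ∂μ + e x n * μ univ := by
          rw [lintegral_add_right _ measurable_const, hφ, lintegral_const]
      _ ≤ ∫⁻ t, (G x t + e x n) ∂μ + e x n * μ univ := by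
          gcongr with t
          exact tsub_le_iff_right.1 (le_iSup (fun n => φ n t - e x n) n)
      _ ≤ ∫⁻ t, G x t ∂μ + η := by
          rw [lintegral_add_right _ measurable_const, lintegral_const, add_assoc]
          gcongr
  calc ∫⁻ x, ∫⁻ t, H x t ∂μ ≤ ∫⁻ x, ∫⁻ t, G x t ∂μ := lintegral_mono hHG
    _ = ∫⁻ t, (∫⁻ x, G x t) ∂μ := lintegral_lintegral_swap hG.aemeasurable
    _ ≤ _ := lintegral_mono fun t => lintegral_mono fun x => hGH x t

namespace SchwartzMap

lemma exists_norm_le (f : SchwartzMap ℝ ℂ) : ∃ c, 0 ≤ c ∧ ∀ x, ‖f x‖ ≤ c :=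
  ⟨_, norm_nonneg _, f.toBoundedContinuousFunction.norm_coe_le_norm⟩

lemma exists_lipschitz (f : SchwartzMap ℝ ℂ) : ∃ c, 0 ≤ c ∧ ∀ x y, ‖f x - f y‖ ≤ c * |x - y| := by
  obtain ⟨c, hc0, hc⟩ := exists_norm_le (derivCLM ℝ ℂ f)
  exact ⟨c, hc0, fun x y => Convex.norm_image_sub_le_of_norm_deriv_le (s := univ)
    (fun _ _ => f.differentiableAt) (fun x _ => hc x) convex_univ trivial trivial⟩

/-- The single averages of `f (x - t) * g (x - γ t)` are bounded for every function `γ`. -/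
lemma lintegral_enorm_mul_le (f g : SchwartzMap ℝ ℂ) (γ : ℝ → ℝ) (μ : Measure ℝ)
    [IsFiniteMeasure μ] : ∫⁻ x, ∫⁻ t, ‖f (x - t) * g (x - γ t)‖ₑ ∂μ ≤
      μ univ * (eLpNorm f 2 volume * eLpNorm g 2 volume) := by
  obtain ⟨a, ha0, ha⟩ := f.exists_norm_le
  obtain ⟨b, hb0, hb⟩ := g.exists_norm_le
  obtain ⟨a', ha0', ha'⟩ := f.exists_lipschitz
  obtain ⟨b', hb0', hb'⟩ := g.exists_lipschitz
  refine (lintegral_lintegral_le_of_lipschitz (L := a * b' + a' * b) (by positivity)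
    fun x y t => ?_).trans ?_
  · rw [← ofReal_norm, ← ofReal_norm, ← ofReal_add (by positivity) (by positivity)]
    refine ofReal_le_ofReal (le_trans (norm_le_norm_add_norm_sub' _ _)
      (add_le_add_right ?_ _))
    rw [show f (x - t) * g (x - γ t) - f (y - t) * g (y - γ t) =
      f (x - t) * (g (x - γ t) - g (y - γ t)) + (f (x - t) - f (y - t)) * g (y - γ t) by ring]
    refine (norm_add_le _ _).trans ?_
    rw [norm_mul, norm_mul]
    have h1 := hb' (x - γ t) (y - γ t)
    have h2 := ha' (x - t) (y - t)
    rw [sub_sub_sub_cancel_right] at h1 h2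
    calc _ ≤ a * (b' * |x - y|) + a' * |x - y| * b := by gcongr; exacts [ha _, hb _]
      _ = _ := by ring
  · rw [mul_comm, ← lintegral_const]
    refine lintegral_mono fun t => ENNReal.le_of_sq_le_sq ?_
    rw [mul_pow, sq_eLpNorm_two, sq_eLpNorm_two]
    simp only [enorm_mul]
    exact lintegral_translate_mul_le (g := fun x => ‖f x‖ₑ) (h := fun x => ‖g x‖ₑ)
      f.continuous.measurable.enorm g.continuous.measurable.enorm t (γ t)

end SchwartzMap

/-- The difference between the truncated kernel and a smooth dyadic sum. -/
def kernelError (ε : ℝ) (j₀ n : ℕ) (t : ℝ) : ℝ :=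
  {t : ℝ | ε < |t| ∧ |t| < 1}.indicator (fun t => t⁻¹) t -
    (stdBump (2 ^ (j₀ : ℤ) * t) - stdBump (2 ^ ((j₀ : ℤ) + n) * t)) / t

lemma kernelError_eq {ε : ℝ} {j₀ n : ℕ} {t : ℝ} : ∃ c : ℝ, (c = 0 ∨ c = 1) ∧
    (c = 1 ↔ ε < |t| ∧ |t| < 1) ∧ kernelError ε j₀ n t = (c -
      (stdBump (2 ^ (j₀ : ℤ) * t) - stdBump (2 ^ ((j₀ : ℤ) + n) * t))) / t := by
  by_cases h : ε < |t| ∧ |t| < 1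
  · refine ⟨1, .inr rfl, by simpa using h, ?_⟩
    rw [kernelError, indicator_of_mem (show t ∈ {t : ℝ | ε < |t| ∧ |t| < 1} from h)]
    ring
  · refine ⟨0, .inl rfl, by simpa using h, ?_⟩
    rw [kernelError, indicator_of_notMem (show t ∉ {t : ℝ | ε < |t| ∧ |t| < 1} from h)]
    ring

lemma exists_kernelError_le {ε : ℝ} (hε : 0 < ε) (j₀ : ℕ) {k : ℕ} (hk : 0 < k) :
    ∃ (M : ℕ) (r : ℝ), 0 < r ∧ ∀ t, (|t| ≤ 2 * r → |kernelError ε j₀ (k * M) t| ≤ 2 * 2 ^ k / r) ∧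
      (2 * r < |t| → |kernelError ε j₀ (k * M) t| ≤ 2 ^ j₀) ∧
      (2 < |t| → kernelError ε j₀ (k * M) t = 0) := by
  have hj1 : (1:ℝ) ≤ 2 ^ j₀ := one_le_pow₀ one_le_two
  have hk1 : (1:ℝ) ≤ 2 ^ k := one_le_pow₀ one_le_two
  have hb0 := fun t => stdBump.nonneg (x := t)
  have hb1 := fun t => stdBump.le_one (x := t)
  rcases lt_or_ge ((2 ^ j₀ : ℝ)⁻¹) ε with h | h
  · have hD : ∀ t, |kernelError ε j₀ (k * 0) t| ≤ 2 ^ j₀ := fun t => by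
      obtain ⟨c, hc, hc', h1⟩ := kernelError_eq (ε := ε) (j₀ := j₀) (n := k * 0) (t := t)
      simp only [mul_zero, Nat.cast_zero, add_zero, sub_self, sub_zero] at h1 ⊢
      rw [h1]
      rcases hc with rfl | rfl
      · simp
      · rw [one_div, abs_inv]
        exact inv_le_of_inv_le₀ (by positivity) (h.trans (hc'.1 rfl).1).le
    refine ⟨0, (2 ^ j₀)⁻¹, by positivity, fun t => ⟨fun _ => (hD t).trans ?_, fun _ => hD t,
      fun h2 => ?_⟩⟩
    · rw [div_inv_eq_mul]
      nlinarith
    · obtain ⟨c, hc, hc', h1⟩ := kernelError_eq (ε := ε) (j₀ := j₀) (n := k * 0) (t := t)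
      simp only [mul_zero, Nat.cast_zero, add_zero, sub_self, sub_zero] at h1 ⊢
      rw [h1]
      rcases hc with rfl | rfl
      · simp
      · linarith [(hc'.1 rfl).2]
  obtain ⟨M, hM, hM'⟩ : ∃ M : ℕ, ε ≤ (2 ^ (j₀ + k * M) : ℝ)⁻¹ ∧
      (2 ^ (j₀ + k * (M + 1)) : ℝ)⁻¹ < ε := by
    have hex : ∃ M : ℕ, (2 ^ (j₀ + k * M) : ℝ)⁻¹ < ε := by
      obtain ⟨n, hn⟩ := exists_pow_lt_of_lt_one hε (show (1/2:ℝ) < 1 by norm_num)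
      refine ⟨n, lt_of_le_of_lt ?_ hn⟩
      rw [one_div, inv_pow]
      gcongr
      · norm_num
      · nlinarith
    refine ⟨Nat.find hex - 1, ?_, ?_⟩
    · rcases Nat.eq_zero_or_pos (Nat.find hex) with h0 | h0
      · simpa [h0] using h
      · exact not_lt.1 (Nat.find_min hex (by omega))
    · have h0 : Nat.find hex ≠ 0 := fun h0 => by
        have := Nat.find_spec hex
        rw [h0, mul_zero, add_zero] at this
        linarith
      rw [Nat.sub_add_cancel (by omega)]
      exact Nat.find_spec hex
  have hr : (0:ℝ) < 2 ^ (j₀ + k * M) := by positivity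
  have hr' : (2:ℝ) ^ (j₀ + k * (M + 1)) = 2 ^ (j₀ + k * M) * 2 ^ k := by rw [← pow_add]; ring_nf
  have hjr : (2:ℝ) ^ j₀ ≤ 2 ^ (j₀ + k * M) := pow_le_pow_right₀ one_le_two (by omega)
  have hz : (2:ℝ) ^ ((j₀ : ℤ) + (k * M : ℕ)) = 2 ^ (j₀ + k * M) := by norm_cast
  refine ⟨M, (2 ^ (j₀ + k * M))⁻¹, by positivity, fun t => ?_⟩
  obtain ⟨c, hc, hc', h1⟩ := kernelError_eq (ε := ε) (j₀ := j₀) (n := k * M) (t := t)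
  have hc01 : 0 ≤ c ∧ c ≤ 1 := by rcases hc with rfl | rfl <;> norm_num
  rw [h1, hz, zpow_natCast]
  generalize (2:ℝ) ^ (j₀ + k * M) = R at hM hM' hr hr' hjr ⊢
  have hj := hb0 (2 ^ j₀ * t)
  have hj' := hb1 (2 ^ j₀ * t)
  have hR := hb0 (R * t)
  have hR' := hb1 (R * t)
  have ht0 := abs_nonneg t
  rw [hr'] at hM'
  refine ⟨fun ht => ?_, fun ht => ?_, fun ht => ?_⟩
  · rw [abs_div]
    rcases lt_or_ge |t| ((R * 2 ^ k)⁻¹) with h2 | h2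
    · have h3 : c = 0 := hc.resolve_right fun h => by linarith [(hc'.1 h).1]
      have h4 : R * |t| ≤ 1 := by
        have := mul_lt_mul_of_pos_left h2 (show 0 < R * 2 ^ k by positivity)
        rw [mul_inv_cancel₀ (by positivity)] at this
        nlinarith [mul_nonneg hr.le ht0]
      rw [h3, kernelBump.one_of_le (t := R * t) (by rwa [abs_mul, abs_of_pos hr]),
        kernelBump.one_of_le (by rw [abs_mul, abs_of_pos (by positivity)]; nlinarith)]
      simp
      positivity
    · have h3 : 0 < |t| := lt_of_lt_of_le (by positivity) h2
      rw [div_inv_eq_mul, div_le_iff₀ h3]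
      have h4 : 1 ≤ R * 2 ^ k * |t| := (inv_le_iff_one_le_mul₀' (by positivity)).1 h2
      have h5 : |c - (stdBump (2 ^ j₀ * t) - stdBump (R * t))| ≤ 2 :=
        abs_le.2 ⟨by linarith, by linarith⟩
      linarith
  · have h2 : 2 ≤ R * |t| := by
      rw [← div_eq_mul_inv, div_lt_iff₀ hr] at ht
      linarith
    rw [kernelBump.zero_of_le (t := R * t) (by rwa [abs_mul, abs_of_pos hr]), abs_div]
    rcases lt_or_ge (2 ^ j₀ * |t|) 1 with h3 | h3
    · rw [hc'.2 ⟨by linarith, by nlinarith⟩, kernelBump.one_of_le (by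
        rw [abs_mul, abs_of_pos (by positivity)]; exact h3.le)]
      simp
    · rw [div_le_iff₀ (by nlinarith)]
      exact (abs_le.2 ⟨by linarith, by linarith⟩ : |_| ≤ (1:ℝ)).trans h3
  · have h2 : c = 0 := hc.resolve_right fun h => by linarith [(hc'.1 h).2]
    rw [h2, kernelBump.zero_of_le (t := R * t) (by rw [abs_mul, abs_of_pos hr]; nlinarith),
      kernelBump.zero_of_le (by rw [abs_mul, abs_of_pos (by positivity)]; nlinarith)]
    simp

namespace MemF

variable {γ : ℝ → ℝ} {A₁ c₀ c₁ c₂ c₃ C₁ K₁ K₂ : ℝ} {N : ℕ}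

local notation "𝓕γ" => MemF γ A₁ c₀ c₁ c₂ c₃ C₁ K₁ K₂ N

lemma contDiffAt (h : 𝓕γ) {t : ℝ} (h0 : t ≠ 0) (ht : |t| < A₁) :
    ContDiffAt ℝ N γ t :=
  h.smooth.contDiffAt ((isOpen_Ioo.sdiff isClosed_singleton).mem_nhds ⟨abs_lt.1 ht, h0⟩)

lemma deriv_ne_zero (h : 𝓕γ) {t : ℝ} (h0 : t ≠ 0) (ht : |t| < c₀) : deriv γ t ≠ 0 :=
  h.deriv_ne t ⟨abs_lt.1 (by linarith [h.hc₀, h.hA₁0]), h0⟩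

lemma lt_A₁ (h : 𝓕γ) {ε t : ℝ} (hε : |ε| < c₀) (ht : |t| ≤ 4) :
    |ε * t| < A₁ := by
  have := h.hc₀
  have := h.hc₀0
  rw [abs_mul]
  nlinarith [abs_nonneg ε, abs_nonneg t]

lemma contDiffAt_Qc (h : 𝓕γ) {ε t : ℝ} (h0 : ε ≠ 0) (hε : |ε| < c₀)
    (ht0 : t ≠ 0) (ht : |t| ≤ 4) : ContDiffAt ℝ N (Qc γ ε) t := by
  have h1 := h.contDiffAt (mul_ne_zero h0 ht0) (h.lt_A₁ hε ht)
  exact (h1.comp t (contDiff_const.mul contDiff_id).contDiffAt).div_const _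

lemma deriv_Qc (h : 𝓕γ) {ε t : ℝ} (h0 : ε ≠ 0) (hε : |ε| < c₀)
    (ht0 : t ≠ 0) (ht : |t| ≤ 4) : deriv (Qc γ ε) t = deriv γ (ε * t) / deriv γ ε := by
  have h1 := (h.contDiffAt (mul_ne_zero h0 ht0) (h.lt_A₁ hε ht)).differentiableAt
    (by have := h.hN; norm_cast; omega)
  have h2 := (h1.hasDerivAt.comp t ((hasDerivAt_id t).const_mul ε)).div_const (ε * deriv γ ε)
  refine h2.deriv.trans ?_
  have h3 := h.deriv_ne_zero h0 hε
  simp only [mul_one]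
  field_simp

lemma le_deriv_Qc (h : 𝓕γ) {ε t : ℝ} (h0 : ε ≠ 0)
    (hε : 4 * |ε| < c₀) (ht0 : 1/4 ≤ |t|) (ht : |t| ≤ 4) : C₁⁻¹ ≤ |deriv (Qc γ ε) t| := by
  have ht' : t ≠ 0 := fun h => by norm_num [h] at ht0
  have hε' : |ε * t| < c₀ := by
    rw [abs_mul]
    nlinarith [abs_nonneg ε]
  have ht'' : |t⁻¹| ≤ 4 := by
    rw [abs_inv]
    exact inv_le_of_inv_le₀ (by norm_num) (by linarith)
  have h1 := h.derivBound (ε * t) t⁻¹ (abs_pos.2 (mul_ne_zero h0 ht')) hε'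
    (by rw [abs_inv, one_div]; gcongr) ht'' 1 (by have := h.hN; omega)
  have hεc : |ε| < c₀ := by linarith [abs_nonneg ε]
  rw [iteratedDeriv_one, h.deriv_Qc (mul_ne_zero h0 ht') hε' (inv_ne_zero ht') ht'',
    mul_assoc, mul_inv_cancel₀ ht', mul_one] at h1
  rw [h.deriv_Qc h0 hεc ht' ht, ← inv_div, abs_inv]
  have h3 := h.deriv_ne_zero h0 hεc
  have h4 := h.deriv_ne_zero (mul_ne_zero h0 ht') hε'
  gcongr

/-- The normalized restriction of `γ` to the scale `ε`. -/
def normCurve (γ : ℝ → ℝ) (ε : ℝ) : ℝ → ℝ :=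
  shell.indicator fun t => γ (ε * t) / |ε * deriv γ ε|

lemma curve (h : 𝓕γ) {ε K : ℝ} (h0 : ε ≠ 0) (hε : 4 * |ε| < c₀)
    (hK : 4 ≤ K) (hC : C₁ ≤ K) : ∃ σ : ℝ, σ ^ 2 = 1 ∧
      Curve K (normCurve γ ε) (fun t => σ * iteratedDeriv 1 (Qc γ ε) t)
        (fun t => σ * iteratedDeriv 2 (Qc γ ε) t) fun t => σ * iteratedDeriv 3 (Qc γ ε) t := by
  have hεc : |ε| < c₀ := by linarith [abs_nonneg ε]
  obtain ⟨σ, hσ, hσe⟩ : ∃ σ : ℝ, σ ^ 2 = 1 ∧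
      ∀ t, γ (ε * t) / |ε * deriv γ ε| = σ * iteratedDeriv 0 (Qc γ ε) t := by
    rcases abs_cases (ε * deriv γ ε) with ⟨h1, -⟩ | ⟨h1, -⟩
    · exact ⟨1, by norm_num, fun t => by rw [h1, iteratedDeriv_zero, Qc, one_mul]⟩
    · exact ⟨-1, by norm_num, fun t => by rw [h1, iteratedDeriv_zero, Qc, div_neg]; ring⟩
  have hσa : |σ| = 1 := (pow_eq_one_iff_of_nonneg (abs_nonneg σ) two_ne_zero).1 (by rw [sq_abs, hσ])
  have hN := h.hN
  have hder : ∀ k < N, ∀ t ∈ shell, HasDerivAt (fun t => σ * iteratedDeriv k (Qc γ ε) t)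
      (σ * iteratedDeriv (k + 1) (Qc γ ε) t) t := fun k hk t ht =>
    ((h.contDiffAt_Qc h0 hεc (abs_pos.1 (by linarith [ht.1])) ht.2.le).hasDerivAt_iteratedDeriv
      hk).const_mul σ
  have hb : ∀ k ≤ N, ∀ t ∈ shell, |σ * iteratedDeriv k (Qc γ ε) t| ≤ K := fun k hk t ht => by
    rw [abs_mul, hσa, one_mul]
    exact (h.derivBound ε t (abs_pos.2 h0) hεc ht.1.le ht.2.le k hk).trans hC
  have hn : ∀ t ∈ shell, normCurve γ ε t = σ * iteratedDeriv 0 (Qc γ ε) t :=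
    fun t ht => by rw [normCurve, indicator_of_mem ht, hσe]
  refine ⟨σ, hσ, hK, ?_, fun t ht => ?_, hder 1 (by omega), hder 2 (by omega),
    fun t ht => ?_, hb 1 (by omega), hb 2 (by omega), fun t ht => ?_⟩
  · refine ContinuousOn.measurable_indicator_zero (fun t ht => ?_) isOpen_shell.measurableSet
    simp only [hσe]
    exact (hder 0 (by omega) t ht).continuousAt.continuousWithinAt
  · refine (hder 0 (by omega) t ht).congr_of_eventuallyEq ?_
    filter_upwards [isOpen_shell.mem_nhds ht] with y hy using hn y hy
  · rw [hn t ht]; exact hb 0 (by omega) t ht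
  · rw [abs_mul, hσa, one_mul, iteratedDeriv_one]
    refine le_trans ?_ (h.le_deriv_Qc h0 hε ht.1.le ht.2.le)
    have := h.hC₁
    gcongr

lemma deriv_deriv_ne_zero (h : 𝓕γ) {ε : ℝ} (h0 : 0 < ε)
    (hε : ε < c₀) : deriv (deriv γ) ε ≠ 0 := fun hd => by
  have hεc : |ε| < c₀ := by rwa [abs_of_pos h0]
  have h1 := h.secondDeriv ε 1 (abs_pos.2 h0.ne') hεc (by norm_num) (by norm_num)
  have h2 : deriv (Qc γ ε) =ᶠ[nhds 1] fun t => deriv γ (ε * t) / deriv γ ε := by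
    filter_upwards [Ioo_mem_nhds one_pos (show (1:ℝ) < 4 by norm_num)] with t ht
    exact h.deriv_Qc h0.ne' hεc ht.1.ne' (by rw [abs_of_pos ht.1]; exact ht.2.le)
  rw [iteratedDeriv_succ, iteratedDeriv_one, h2.deriv_eq, deriv_div_const,
    deriv_comp_mul_left, mul_one, hd] at h1
  simp only [smul_zero, zero_div, abs_zero] at h1
  linarith [h.hc₁]

lemma hasDerivAt_sq_deriv (h : 𝓕γ) {ε : ℝ} (h0 : 0 < ε)
    (hε : ε < c₀) :
    HasDerivAt (fun t => deriv γ t ^ 2) (2 * (deriv (deriv γ) ε * deriv γ ε)) ε := by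
  have h1 := h.contDiffAt h0.ne' (by rw [abs_of_pos h0]; linarith [h.hc₀, h.hA₁0])
  have h2 := h1.hasDerivAt_iteratedDeriv (k := 1) (by have := h.hN; omega)
  simp only [iteratedDeriv_succ, iteratedDeriv_zero] at h2
  exact (h2.fun_pow 2).congr_deriv (by push_cast; ring)

lemma sign (h : 𝓕γ) :
    (∀ ε, 0 < ε → ε < c₀ → deriv (deriv γ) ε * deriv γ ε < 0) ∨
      ∀ ε, 0 < ε → ε < c₀ → 0 < deriv (deriv γ) ε * deriv γ ε := by
  rcases hasDerivWithinAt_forall_lt_or_forall_gt_of_forall_ne (m := 0) (convex_Ioo 0 c₀)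
    (fun ε hε => (h.hasDerivAt_sq_deriv hε.1 hε.2).hasDerivWithinAt) (fun ε hε =>
      mul_ne_zero two_ne_zero (mul_ne_zero (h.deriv_deriv_ne_zero hε.1 hε.2)
        (h.deriv_ne_zero hε.1.ne' (by rw [abs_of_pos hε.1]; exact hε.2)))) with H | H
  · exact .inl fun ε h0 h1 => by linarith [H ε ⟨h0, h1⟩]
  · exact .inr fun ε h0 h1 => by linarith [H ε ⟨h0, h1⟩]

lemma abs_deriv_mono (h : 𝓕γ)
    (hs : ∀ ε, 0 < ε → ε < c₀ → 0 < deriv (deriv γ) ε * deriv γ ε) {a b : ℝ} (ha : 0 < a)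
    (hab : a ≤ b) (hb : b < c₀) : |deriv γ a| ≤ |deriv γ b| := by
  have hd := fun ε (hε : ε ∈ Ioo 0 c₀) => h.hasDerivAt_sq_deriv hε.1 hε.2
  refine sq_le_sq.1 (monotoneOn_of_hasDerivWithinAt_nonneg (convex_Ioo 0 c₀)
    (fun ε hε => (hd ε hε).continuousAt.continuousWithinAt)
    (fun ε hε => (hd ε (interior_subset hε)).hasDerivWithinAt) (fun ε hε => ?_)
    ⟨ha, by linarith⟩ ⟨by linarith, hb⟩ hab)
  linarith [hs ε (interior_subset hε).1 (interior_subset hε).2]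

lemma abs_deriv_anti (h : 𝓕γ)
    (hs : ∀ ε, 0 < ε → ε < c₀ → deriv (deriv γ) ε * deriv γ ε < 0) {a b : ℝ} (ha : 0 < a)
    (hab : a ≤ b) (hb : b < c₀) : |deriv γ b| ≤ |deriv γ a| := by
  have hd := fun ε (hε : ε ∈ Ioo 0 c₀) => h.hasDerivAt_sq_deriv hε.1 hε.2
  refine sq_le_sq.1 (antitoneOn_of_hasDerivWithinAt_nonpos (convex_Ioo 0 c₀)
    (fun ε hε => (hd ε hε).continuousAt.continuousWithinAt)
    (fun ε hε => (hd ε (interior_subset hε)).hasDerivWithinAt) (fun ε hε => ?_)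
    ⟨ha, by linarith⟩ ⟨by linarith, hb⟩ hab)
  linarith [hs ε (interior_subset hε).1 (interior_subset hε).2]

lemma exists_abs_deriv_le (h : 𝓕γ) (hB : BranchA γ c₀ c₁ c₂ K₁)
    {η : ℝ} (hη : 0 < η) : ∃ δ : ℝ, 0 < δ ∧ δ ≤ c₀ ∧ ∀ ε, 0 < ε → ε < δ → |deriv γ ε| ≤ η := by
  obtain ⟨δ, h0, h1⟩ := exists_mul_rpow_le h.hK₁ h.hc₁ hη
  refine ⟨min δ c₀, lt_min h0 h.hc₀0, min_le_right _ _, fun ε h2 h3 => ?_⟩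
  have h4 := hB.1 ε (abs_pos.2 h2.ne') (by rw [abs_of_pos h2]; exact h3.trans_le (min_le_right _ _))
  rw [abs_of_pos h2] at h4
  exact h4.trans (h1 ε h2 (h3.trans_le (min_le_left _ _)))

lemma exists_le_abs_deriv (h : 𝓕γ) (hB : BranchB γ c₀ c₁ c₃ K₂)
    {η : ℝ} (hη : 0 < η) : ∃ δ : ℝ, 0 < δ ∧ δ ≤ c₀ ∧ ∀ ε, 0 < ε → ε < δ → η ≤ |deriv γ ε| := by
  obtain ⟨δ, h0, h1⟩ := exists_mul_rpow_le (inv_pos.2 h.hK₂) h.hc₁ (inv_pos.2 hη)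
  refine ⟨min δ c₀, lt_min h0 h.hc₀0, min_le_right _ _, fun ε h2 h3 => ?_⟩
  have h4 := hB.1 ε (abs_pos.2 h2.ne') (by rw [abs_of_pos h2]; exact h3.trans_le (min_le_right _ _))
  rw [abs_of_pos h2, Real.rpow_neg h2.le] at h4
  refine le_trans ?_ h4
  have h5 := h1 ε h2 (h3.trans_le (min_le_left _ _))
  have := h.hK₂
  rw [← div_eq_mul_inv, le_div_iff₀ (by positivity)]
  rw [inv_mul_eq_div, div_le_iff₀ h.hK₂, inv_mul_eq_div, le_div_iff₀ hη] at h5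
  linarith

lemma sign_of_branchA (h : 𝓕γ) (hB : BranchA γ c₀ c₁ c₂ K₁) :
    ∀ ε, 0 < ε → ε < c₀ → 0 < deriv (deriv γ) ε * deriv γ ε := by
  refine h.sign.resolve_left fun hs => ?_
  have hc := h.hc₀0
  have h1 : 0 < |deriv γ (c₀ / 2)| := abs_pos.2 (h.deriv_ne_zero (by positivity) (by
    rw [abs_of_pos (by positivity)]; linarith))
  obtain ⟨δ, h2, h3, h4⟩ := h.exists_abs_deriv_le hB (half_pos h1)
  have h5 := h.abs_deriv_anti hs (half_pos h2) (by linarith : δ / 2 ≤ c₀ / 2) (by linarith)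
  linarith [h4 (δ / 2) (by positivity) (by linarith)]

lemma sign_of_branchB (h : 𝓕γ) (hB : BranchB γ c₀ c₁ c₃ K₂) :
    ∀ ε, 0 < ε → ε < c₀ → deriv (deriv γ) ε * deriv γ ε < 0 := by
  refine h.sign.resolve_right fun hs => ?_
  have hc := h.hc₀0
  obtain ⟨δ, h2, h3, h4⟩ := h.exists_le_abs_deriv hB (η := |deriv γ (c₀ / 2)| + 1) (by positivity)
  have h5 := h.abs_deriv_mono hs (half_pos h2) (by linarith : δ / 2 ≤ c₀ / 2) (by linarith)
  linarith [h4 (δ / 2) (by positivity) (by linarith)]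

/-- The size of the second translation at the dyadic scale `j`. -/
def size (γ : ℝ → ℝ) (j : ℤ) : ℝ := |2 ^ (-j) * deriv γ (2 ^ (-j))|

/-- The part of the bilinear Hilbert transform along `γ` living at the dyadic scale `j`. -/
def dyadicPiece (γ : ℝ → ℝ) (j : ℤ) : (ℝ → ℂ) → (ℝ → ℂ) → ℝ → ℂ :=
  bil (fun t => 2 ^ (-j) * t) (fun t => size γ j * normCurve γ (2 ^ (-j)) t) kernelBump

lemma size_eq (γ : ℝ → ℝ) (j : ℤ) : size γ j = 2 ^ (-j) * |deriv γ (2 ^ (-j))| := by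
  rw [size, abs_mul, abs_of_pos (by positivity)]

lemma size_pos (h : 𝓕γ) {j : ℤ} (hj : 4 * (2:ℝ) ^ (-j) < c₀) :
    0 < size γ j := by
  have h0 : (0:ℝ) < 2 ^ (-j) := by positivity
  exact abs_pos.2 (mul_ne_zero h0.ne' (h.deriv_ne_zero h0.ne' (by
    rw [abs_of_pos h0]; linarith)))

/-- The sum of finitely many consecutive dyadic pieces, in multiples of `k`, is bounded. -/
def SumBound (γ : ℝ → ℝ) (k j₀ : ℕ) (C : ℝ) : Prop :=
  ∀ (M : ℕ) (f g : SchwartzMap ℝ ℂ),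
    L1B (fun x => ∑ i ∈ Finset.range (k * M), dyadicPiece γ (j₀ + i) f g x) (C * (nrm f * nrm g))

lemma exists_constants (C₁ c : ℝ) : ∃ K, 4 ≤ K ∧ C₁ ≤ K ∧ c⁻¹ ≤ K ∧ Weight K kernelBump ∧
    ∀ K', K ≤ K' → ∃ C, 0 < C ∧ OscBound K' C := by
  obtain ⟨Kw, hw⟩ := kernelBump.exists_weight
  obtain ⟨K₀, hK₀⟩ := exists_oscBound
  exact ⟨max (max 4 C₁) (max c⁻¹ (max Kw K₀)), by simp, by simp, by simp, hw.mono (by simp),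
    fun K' hK => hK₀ K' (le_trans (by simp) hK)⟩

lemma exists_sumBound_of_branchA (h : 𝓕γ)
    (hB : BranchA γ c₀ c₁ c₂ K₁) : ∃ (j₀ : ℕ) (C : ℝ), 0 ≤ C ∧
      (∀ j : ℤ, (j₀ : ℤ) ≤ j → 4 * (2:ℝ) ^ (-j) < c₀) ∧ SumBound γ 1 j₀ C := by
  obtain ⟨K, hK4, hKC, hKc, hρ, hosc⟩ := exists_constants C₁ c₂
  obtain ⟨C, hC0, hC⟩ := hosc K le_rfl
  have hρ' : Weight (2 * K + 2 * C) kernelBump := hρ.mono (by linarith)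
  obtain ⟨δ, hδ0, hδc, hδ⟩ := h.exists_abs_deriv_le hB (η := (4 * K ^ 8)⁻¹) (by positivity)
  obtain ⟨j₀, hj₀⟩ := exists_forall_zpow_lt hδ0
  have hsmall : ∀ j : ℤ, (j₀ : ℤ) ≤ j → 4 * (2:ℝ) ^ (-j) < c₀ := fun j hj =>
    (hj₀ j hj).trans_le hδc
  have hd : ∀ j : ℤ, (j₀ : ℤ) ≤ j → 4 * K ^ 8 * size γ j ≤ 2 ^ (-j) := fun j hj => by
    have h0 : (0:ℝ) < 2 ^ (-j) := by positivity
    have h1 := hδ (2 ^ (-j)) h0 (by linarith [hj₀ j hj])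
    rw [size_eq]
    calc 4 * K ^ 8 * (2 ^ (-j) * |deriv γ (2 ^ (-j))|)
        ≤ 4 * K ^ 8 * (2 ^ (-j) * (4 * K ^ 8)⁻¹) := by gcongr
      _ = 2 ^ (-j) := by field_simp
  refine ⟨j₀, 4 * scalesConst (2 * K + 2 * C),
    mul_nonneg (by norm_num) (scalesConst_nonneg _), hsmall, fun M f g => ?_⟩
  rw [one_mul]
  refine sum_bil_bound hρ' (m := fun i => j₀ + i) (n := fun i => scaleExp (size γ (j₀ + i)))
    (fun i => ?_) (.inl fun i j hij => by dsimp only; omega)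
    (strictMono_nat_of_lt_succ fun i => ?_) (fun i => ?_) M f g
  · have hj : (j₀ : ℤ) ≤ j₀ + i := by omega
    have h0 : (0:ℝ) < 2 ^ (-((j₀ : ℤ) + i)) := by positivity
    have hs := hsmall _ hj
    obtain ⟨σ, hσ, hQ⟩ := h.curve h0.ne' (by rwa [abs_of_pos h0]) hK4 hKC
    refine hQ.scaleData_right (fun t ht => ?_) hρ hC (zpow_scaleExp_le (h.size_pos hs))
      (le_zpow_scaleExp _) (hd _ hj) (by linarith) (by linarith)
    refine (inv_le_of_inv_le₀ h.hc₂ hKc).trans ((hB.2 _ t (abs_pos.2 h0.ne')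
      (by rw [abs_of_pos h0]; linarith) ht.1.le ht.2.le).trans (le_of_eq (congrArg _ ?_)))
    linear_combination (-iteratedDeriv 2 (Qc γ (2 ^ (-((j₀:ℤ) + i)))) t ^ 2
      + iteratedDeriv 1 (Qc γ (2 ^ (-((j₀:ℤ) + i)))) t
        * iteratedDeriv 3 (Qc γ (2 ^ (-((j₀:ℤ) + i)))) t) * hσ
  · have h1 := hsmall (j₀ + (i + 1 : ℕ)) (by omega)
    refine scaleExp_lt (h.size_pos h1) ?_
    have h2 : 2 * (2:ℝ) ^ (-((j₀ : ℤ) + (i + 1 : ℕ))) = 2 ^ (-((j₀ : ℤ) + i)) := by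
      rw [mul_comm, ← zpow_add_one₀ two_ne_zero]
      congr 1
      push_cast
      ring
    have h0 : (0:ℝ) < 2 ^ (-((j₀ : ℤ) + (i + 1 : ℕ))) := by positivity
    have h3 := hsmall (j₀ + i) (by omega)
    rw [size_eq, size_eq, ← mul_assoc, h2]
    exact mul_le_mul_of_nonneg_left (h.abs_deriv_mono (h.sign_of_branchA hB) h0 (by linarith)
      (by linarith)) (by positivity)
  · have hj : (j₀ : ℤ) ≤ j₀ + i := by omega
    have h1 := zpow_scaleExp_le (h.size_pos (hsmall _ hj))
    have h2 : size γ (j₀ + i) ≤ 2 ^ (-((j₀ : ℤ) + i)) := by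
      refine le_trans ?_ (hd _ hj)
      have : (1:ℝ) ≤ K ^ 8 := one_le_pow₀ (by linarith)
      nlinarith [h.size_pos (hsmall _ hj)]
    have := (zpow_le_zpow_iff_right₀ one_lt_two).1 (h1.trans h2)
    omega

lemma exists_scaleExp_step (h : 𝓕γ)
    (hB : BranchB γ c₀ c₁ c₃ K₂) {j₁ : ℕ}
    (hj₁ : ∀ j : ℤ, (j₁ : ℤ) ≤ j → 4 * (2:ℝ) ^ (-j) < c₀) : ∃ k j₀ : ℕ, 0 < k ∧ j₁ ≤ j₀ ∧
      ((∀ j : ℤ, (j₀ : ℤ) ≤ j → scaleExp (size γ j) < scaleExp (size γ (j + k))) ∨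
        ∀ j : ℤ, (j₀ : ℤ) ≤ j → scaleExp (size γ (j + k)) < scaleExp (size γ j)) := by
  obtain ⟨K₃, K₄, hK⟩ := h.dyadic (h.sign_of_branchB hB)
  have hs : ∀ j : ℤ, (j₁ : ℤ) ≤ j → 0 < size γ j := fun j hj => h.size_pos (hj₁ j hj)
  have hK' : ∀ j : ℤ, (K₄ : ℤ) ≤ j → (j₁ : ℤ) ≤ j → (j₁ : ℤ) ≤ j + K₃ →
      2 * size γ (j + K₃) ≤ size γ j := fun j h1 h2 h3 => by
    have h4 : 2 * (size γ j)⁻¹ ≤ (size γ (j + K₃))⁻¹ := hK j h1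
    have h5 := hs j h2
    have h6 := hs _ h3
    field_simp at h4
    linarith
  rcases lt_trichotomy K₃ 0 with hneg | hzero | hpos
  · refine ⟨K₃.natAbs, max j₁ K₄, by omega, le_max_left _ _, .inr fun j hj => ?_⟩
    have h1 : j + (K₃.natAbs : ℤ) + K₃ = j := by omega
    have h2 := hK' (j + K₃.natAbs) (by omega) (by omega) (by omega)
    rw [h1] at h2
    exact scaleExp_lt (hs _ (by omega)) h2
  · have h1 := hK' (max j₁ K₄) (by omega) (by omega) (by omega)
    rw [hzero, add_zero] at h1
    linarith [hs (max j₁ K₄) (by omega)]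
  · refine ⟨K₃.natAbs, max j₁ K₄, by omega, le_max_left _ _, .inl fun j hj => ?_⟩
    have h1 : j + (K₃.natAbs : ℤ) = j + K₃ := by omega
    rw [h1]
    exact scaleExp_lt (hs _ (by omega)) (hK' j (by omega) (by omega) (by omega))

lemma exists_sumBound_of_branchB (h : 𝓕γ)
    (hB : BranchB γ c₀ c₁ c₃ K₂) : ∃ (k j₀ : ℕ) (C : ℝ), 0 < k ∧ 0 ≤ C ∧
      (∀ j : ℤ, (j₀ : ℤ) ≤ j → 4 * (2:ℝ) ^ (-j) < c₀) ∧ SumBound γ k j₀ C := by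
  obtain ⟨K, hK4, hKC, hKc, hρ, hosc⟩ := exists_constants C₁ c₃
  have hK7 : K ≤ 4 * K ^ 7 := by
    linarith [le_self_pow₀ (by linarith : 1 ≤ K) (by norm_num : 7 ≠ 0)]
  obtain ⟨C, hC0, hC⟩ := hosc _ hK7
  have hρ' : Weight (2 * K + 2 * C) kernelBump := hρ.mono (by linarith)
  have hη : 2 ≤ 4 * (4 * K ^ 7) ^ 8 := by
    linarith [one_le_pow₀ (n := 8) (by linarith : 1 ≤ 4 * K ^ 7)]
  obtain ⟨δ, hδ0, hδc, hδ⟩ := h.exists_le_abs_deriv hB (zero_lt_two.trans_le hη)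
  obtain ⟨j₁, hj₁⟩ := exists_forall_zpow_lt hδ0
  obtain ⟨k, j₀, hk, hj₀₁, hstep⟩ := h.exists_scaleExp_step hB (j₁ := j₁)
    fun j hj => (hj₁ j hj).trans_le hδc
  have hsmall : ∀ j : ℤ, (j₀ : ℤ) ≤ j → 4 * (2:ℝ) ^ (-j) < δ := fun j hj => hj₁ j (by omega)
  have hd : ∀ j : ℤ, (j₀ : ℤ) ≤ j → 4 * (4 * K ^ 7) ^ 8 * 2 ^ (-j) ≤ size γ j := fun j hj => by
    have h0 : (0:ℝ) < 2 ^ (-j) := by positivity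
    rw [size_eq, mul_comm]
    gcongr
    exact hδ (2 ^ (-j)) h0 (by linarith [hsmall j hj])
  have hC' := scalesConst_nonneg (2 * K + 2 * C)
  refine ⟨k, j₀, k * (4 * scalesConst (2 * K + 2 * C)), hk, by positivity,
    fun j hj => (hsmall j hj).trans_le hδc, fun M f g => ?_⟩
  refine (L1B.sum (Finset.range k) (a := fun _ => 4 * scalesConst (2 * K + 2 * C) * (nrm g * nrm f))
    (f := fun s x => ∑ i ∈ Finset.range M, dyadicPiece γ (j₀ + (k * i + s : ℕ)) f g x)
    fun s hs => ?_).congr (fun x => Finset.sum_range_mul_eq _ k M) (le_of_eq ?_)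
  · simp only [dyadicPiece, bil_comm _ _ _ (⇑f) (⇑g)]
    refine sum_bil_bound hρ' (m := fun i => scaleExp (size γ (j₀ + (k * i + s : ℕ))))
      (n := fun i => j₀ + (k * i + s : ℕ)) (fun i => ?_) (hstep.imp ?_ ?_)
      (strictMono_nat_of_lt_succ fun i => ?_) (fun i => ?_) M g f
    · have hj : (j₀ : ℤ) ≤ j₀ + (k * i + s : ℕ) := by omega
      generalize (j₀ : ℤ) + (k * i + s : ℕ) = j at hj
      have h0 : (0:ℝ) < 2 ^ (-j) := by positivity
      have hs := (hsmall _ hj).trans_le hδc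
      obtain ⟨σ, hσ, hQ⟩ := h.curve h0.ne' (by rwa [abs_of_pos h0]) hK4 hKC
      refine hQ.scaleData_left (fun t ht => ?_) hρ hC (zpow_scaleExp_le (h.size_pos hs))
        (le_zpow_scaleExp _) (hd _ hj) (by linarith) (by linarith)
      refine (inv_le_of_inv_le₀ h.hc₃ hKc).trans ((hB.2 _ t (abs_pos.2 h0.ne')
        (by rw [abs_of_pos h0]; linarith) ht.1.le ht.2.le).trans (le_of_eq (congrArg _ ?_)))
      linear_combination (-2 * iteratedDeriv 2 (Qc γ (2 ^ (-j))) t ^ 2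
        + iteratedDeriv 1 (Qc γ (2 ^ (-j))) t * iteratedDeriv 3 (Qc γ (2 ^ (-j))) t) * hσ
    · refine fun H => strictMono_nat_of_lt_succ fun i => ?_
      refine (H (j₀ + (k * i + s : ℕ)) (by omega)).trans_eq ?_
      congr 2
      push_cast
      ring
    · refine fun H => strictAnti_nat_of_succ_lt fun i => ?_
      refine Eq.trans_lt ?_ (H (j₀ + (k * i + s : ℕ)) (by omega))
      congr 2
      push_cast
      ring
    · have : k * (i + 1) = k * i + k := by ring
      omega
    · have hj : (j₀ : ℤ) ≤ j₀ + (k * i + s : ℕ) := by omega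
      generalize (j₀ : ℤ) + (k * i + s : ℕ) = j at hj
      have h0 : (0:ℝ) < 2 ^ (-j) := by positivity
      have h1 : (2:ℝ) ^ (-j) ≤ 2 ^ (-scaleExp (size γ j)) := by
        nlinarith [le_zpow_scaleExp (size γ j), hd j hj]
      have := (zpow_le_zpow_iff_right₀ one_lt_two).1 h1
      omega
  · rw [Finset.sum_const, Finset.card_range, nsmul_eq_mul]
    ring

lemma exists_sumBound (h : 𝓕γ) :
    ∃ (k j₀ : ℕ) (C : ℝ), 0 < k ∧ 0 ≤ C ∧
      (∀ j : ℤ, (j₀ : ℤ) ≤ j → 4 * (2:ℝ) ^ (-j) < c₀) ∧ SumBound γ k j₀ C := by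
  rcases h.branch with hB | hB
  · obtain ⟨j₀, C, h1⟩ := h.exists_sumBound_of_branchA hB
    exact ⟨1, j₀, C, one_pos, h1⟩
  · exact h.exists_sumBound_of_branchB hB

lemma size_mul_normCurve (h : 𝓕γ) {j : ℤ}
    (hj : 4 * (2:ℝ) ^ (-j) < c₀) {t : ℝ} (ht : kernelBump t ≠ 0) :
    size γ j * normCurve γ (2 ^ (-j)) t = γ (2 ^ (-j) * t) := by
  have h1 := kernelBump.supp ht
  rw [normCurve, indicator_of_mem (show t ∈ shell from ⟨by linarith, by linarith⟩),
    ← size, mul_div_cancel₀ _ (h.size_pos hj).ne']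

lemma integrable_dyadicPiece (h : 𝓕γ) {j : ℤ}
    (hj : 4 * (2:ℝ) ^ (-j) < c₀) (f g : SchwartzMap ℝ ℂ) (x : ℝ) :
    Integrable (fun t => f (x - t) * g (x - γ t) * ((2 ^ j * kernelBump (2 ^ j * t) : ℝ) : ℂ)) ∧
      dyadicPiece γ j f g x =
        ∫ t, f (x - t) * g (x - γ t) * ((2 ^ j * kernelBump (2 ^ j * t) : ℝ) : ℂ) := by
  have h0 : (0:ℝ) < 2 ^ (-j) := by positivity
  have hinv : (2:ℝ) ^ (-j) = (2 ^ j)⁻¹ := zpow_neg _ _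
  let F : ℝ → ℂ := fun t => f (x - t) * g (x - γ t) * (kernelBump (2 ^ j * t) : ℂ)
  have hF : ∀ t, (f (x - 2 ^ (-j) * t) * g (x - size γ j * normCurve γ (2 ^ (-j)) t)) *
      (kernelBump t : ℂ) = F (2 ^ (-j) * t) := fun t => by
    have h2 : (2:ℝ) ^ j * (2 ^ (-j) * t) = t := by rw [hinv]; field_simp
    simp only [F, h2]
    by_cases ht : kernelBump t = 0
    · simp [ht]
    · rw [h.size_mul_normCurve hj ht]
  obtain ⟨_, _, hQ⟩ := h.curve h0.ne' (by rwa [abs_of_pos h0]) (le_max_left 4 C₁)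
    (le_max_right 4 C₁)
  obtain ⟨a, ha0, ha⟩ := f.exists_norm_le
  obtain ⟨b, -, hb⟩ := g.exists_norm_le
  have hintg : Integrable F := by
    rw [← integrable_comp_mul_left_iff F h0.ne']
    refine Integrable.congr ?_ (.of_forall hF)
    have hm := hQ.meas
    have hf := f.continuous.measurable
    have hg := g.continuous.measurable
    refine Integrable.bdd_mul (c := a * b)
      ((kernelBump.contDiff.continuous.integrable_of_hasCompactSupport
      kernelBump.hasCompactSupport).ofReal) (Measurable.aestronglyMeasurable (by fun_prop))
      (.of_forall fun t => ?_)
    rw [norm_mul]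
    gcongr
    exacts [ha _, hb _]
  have hc : ∀ t, f (x - t) * g (x - γ t) * ((2 ^ j * kernelBump (2 ^ j * t) : ℝ) : ℂ) =
      ((2 ^ j : ℝ) : ℂ) * F t := fun t => by simp only [F]; push_cast; ring
  simp only [hc]
  refine ⟨hintg.const_mul _, ?_⟩
  rw [dyadicPiece, bil]
  simp only [hF]
  rw [Measure.integral_comp_mul_left, integral_const_mul, hinv, inv_inv,
    abs_of_pos (by positivity), real_smul]

end MemF

lemma enorm_truncated_le {ε r a b : ℝ} {j₀ n : ℕ} {P Φ : ℝ → ℂ}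
    (hΦ : Integrable fun t => P t * Φ t)
    (hD : ∀ t, {t : ℝ | ε < |t| ∧ |t| < 1}.indicator (fun t => (t:ℂ)⁻¹) t - Φ t =
      kernelError ε j₀ n t)
    (h : ∀ t, (|t| ≤ 2 * r → |kernelError ε j₀ n t| ≤ a) ∧
      (2 * r < |t| → |kernelError ε j₀ n t| ≤ b) ∧ (2 < |t| → kernelError ε j₀ n t = 0)) :
    ‖∫ t in {t : ℝ | ε < |t| ∧ |t| < 1}, P t / (t:ℂ)‖ₑ ≤ ‖∫ t, P t * Φ t‖ₑ +
      ∫⁻ t, ‖P t‖ₑ ∂(ofReal a • volume.restrict (Icc (-(2 * r)) (2 * r)) +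
        ofReal b • volume.restrict (Icc (-2) 2)) := by
  have hS : MeasurableSet {t : ℝ | ε < |t| ∧ |t| < 1} :=
    ((isOpen_lt continuous_const continuous_abs).inter
      (isOpen_lt continuous_abs continuous_const)).measurableSet
  by_cases hi : IntegrableOn (fun t => P t / (t:ℂ)) {t : ℝ | ε < |t| ∧ |t| < 1}
  swap
  · rw [integral_undef hi, enorm_zero]
    exact zero_le
  rw [← integral_indicator hS]
  have hdiff : (∫ t, {t : ℝ | ε < |t| ∧ |t| < 1}.indicator (fun t => P t / (t:ℂ)) t) =
      (∫ t, P t * Φ t) + ∫ t, P t * (kernelError ε j₀ n t : ℂ) := by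
    rw [← sub_eq_iff_eq_add', ← integral_sub (hi.integrable_indicator hS) hΦ]
    congr 1 with t
    rw [← hD, mul_sub]
    by_cases ht : t ∈ {t : ℝ | ε < |t| ∧ |t| < 1}
    · rw [indicator_of_mem ht, indicator_of_mem ht, div_eq_mul_inv]
    · rw [indicator_of_notMem ht, indicator_of_notMem ht, mul_zero]
  rw [hdiff]
  refine (enorm_add_le _ _).trans (add_le_add_right
    ((enorm_integral_le_lintegral_enorm _).trans ?_) _)
  rw [lintegral_add_measure, lintegral_smul_measure, lintegral_smul_measure,
    ← lintegral_add_compl _ (measurableSet_Icc (a := -(2 * r)) (b := 2 * r)),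
      smul_eq_mul, smul_eq_mul]
  have hE : ∀ {t c : ℝ}, |kernelError ε j₀ n t| ≤ c →
      ‖P t * (kernelError ε j₀ n t : ℂ)‖ₑ ≤ ofReal c * ‖P t‖ₑ := fun {t c} hc => by
    rw [enorm_mul, mul_comm, ← ofReal_norm (kernelError ε j₀ n t : ℂ), norm_real]
    gcongr
    exact hc
  rw [← lintegral_const_mul' _ _ ofReal_ne_top, ← lintegral_const_mul' _ _ ofReal_ne_top]
  refine add_le_add (setLIntegral_mono' measurableSet_Icc fun t ht =>
    hE ((h t).1 (abs_le.2 ht))) ?_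
  rw [← lintegral_indicator measurableSet_Icc.compl, ← lintegral_indicator measurableSet_Icc]
  refine lintegral_mono fun t => ?_
  by_cases ht : t ∈ (Icc (-(2 * r)) (2 * r))ᶜ
  swap
  · rw [indicator_of_notMem ht]
    exact zero_le
  rw [indicator_of_mem ht]
  rcases le_or_gt |t| 2 with h2 | h2
  · rw [indicator_of_mem (show t ∈ Icc (-2:ℝ) 2 from abs_le.1 h2)]
    exact hE ((h t).2.1 (not_le.1 fun h3 => ht (abs_le.1 h3)))
  · simp [(h t).2.2 h2]

/-- The truncated bilinear Hilbert transform along a curve in F(-1,1)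
is bounded from L² × L² to L¹, uniformly in the truncation. -/
theorem bilinear_hilbert_bounded
    (γ : ℝ → ℝ) (A₁ c₀ c₁ c₂ c₃ C₁ K₁ K₂ : ℝ) (N : ℕ)
    (hγ : MemF γ A₁ c₀ c₁ c₂ c₃ C₁ K₁ K₂ N) :
    ∃ C : ℝ, 0 < C ∧ ∀ (f g : SchwartzMap ℝ ℂ) (ε : ℝ), 0 < ε → ε < 1 →
      eLpNorm (fun x : ℝ =>
          ∫ t in {t : ℝ | ε < |t| ∧ |t| < 1}, f (x - t) * g (x - γ t) / (t : ℂ)) 1 volume ≤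
        ENNReal.ofReal C * eLpNorm (⇑f) 2 volume * eLpNorm (⇑g) 2 volume := by
  obtain ⟨k, j₀, C, hk, hC, hj₀, hsum⟩ := hγ.exists_sumBound
  refine ⟨C + (8 * 2 ^ k + 4 * 2 ^ j₀), by positivity, fun f g ε hε _ => ?_⟩
  obtain ⟨M, r, hr, hM⟩ := exists_kernelError_le hε j₀ hk
  have hd := fun (i : ℕ) => hγ.integrable_dyadicPiece (hj₀ (j₀ + i) (by omega)) f g
  let Φ : ℝ → ℂ := fun t =>
    ∑ i ∈ Finset.range (k * M), ((2 ^ ((j₀:ℤ) + i) * kernelBump (2 ^ ((j₀:ℤ) + i) * t) : ℝ) : ℂ)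
  have hD : ∀ t, {t : ℝ | ε < |t| ∧ |t| < 1}.indicator (fun t => (t:ℂ)⁻¹) t - Φ t =
      kernelError ε j₀ (k * M) t := fun t => by
    rw [kernelError, ← kernelBump.telescope]
    simp only [Φ]
    by_cases ht : t ∈ {t : ℝ | ε < |t| ∧ |t| < 1}
    · rw [indicator_of_mem ht, indicator_of_mem ht]
      push_cast
      rfl
    · rw [indicator_of_notMem ht, indicator_of_notMem ht]
      push_cast
      rfl
  have hΦ : ∀ x, Integrable fun t => f (x - t) * g (x - γ t) * Φ t := fun x => by
    simp only [Φ, mul_sum]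
    exact integrable_finsetSum _ fun i _ => (hd i x).1
  have hΦ' : ∀ x, ∫ t, f (x - t) * g (x - γ t) * Φ t =
      ∑ i ∈ Finset.range (k * M), MemF.dyadicPiece γ (j₀ + i) f g x := fun x => by
    simp only [Φ, mul_sum]
    rw [integral_finsetSum _ fun i _ => (hd i x).1]
    exact sum_congr rfl fun i _ => (hd i x).2.symm
  have hT := hsum M f g
  let μ : Measure ℝ := ofReal (2 * 2 ^ k / r) • volume.restrict (Icc (-(2 * r)) (2 * r)) +
    ofReal (2 ^ j₀) • volume.restrict (Icc (-2) 2)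
  have hμ : μ univ = ofReal (8 * 2 ^ k + 4 * 2 ^ j₀) := by
    simp only [μ, Measure.add_apply, Measure.smul_apply, Measure.restrict_apply_univ, volume_Icc,
      sub_neg_eq_add,
      smul_eq_mul]
    rw [← ofReal_mul (by positivity), ← ofReal_mul (by positivity),
      ← ofReal_add (by positivity) (by positivity)]
    congr 1
    field_simp
    ring
  have : IsFiniteMeasure μ := ⟨by rw [hμ]; exact ofReal_lt_top⟩
  rw [eLpNorm_one_eq_lintegral_enorm]
  calc _ ≤ ∫⁻ x, (‖∑ i ∈ Finset.range (k * M), MemF.dyadicPiece γ (j₀ + i) f g x‖ₑ +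
        ∫⁻ t, ‖f (x - t) * g (x - γ t)‖ₑ ∂μ) := lintegral_mono fun x =>
          hΦ' x ▸ enorm_truncated_le (hΦ x) hD hM
    _ ≤ ofReal (C * (nrm f * nrm g)) + ofReal (8 * 2 ^ k + 4 * 2 ^ j₀) *
        (eLpNorm f 2 volume * eLpNorm g 2 volume) := by
      rw [lintegral_add_left hT.meas.enorm]
      exact add_le_add hT.le (hμ ▸ f.lintegral_enorm_mul_le g γ μ)
    _ = _ := by
      rw [ofReal_mul hC, ofReal_mul (nrm_nonneg _), nrm, nrm,
        ENNReal.ofReal_toReal (f.memLp 2 volume).2.ne,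
          ENNReal.ofReal_toReal (g.memLp 2 volume).2.ne,
        ofReal_add hC (by positivity)]
      ring

end
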